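/- Let 1 < p < ∞, m ∈ ℝ and α < 2. Let A = [[Q, qᵗ],[q, γ]] be a real symmetric positive definite (N+1)×(N+1) matrix (Q ∈ ℝ^{N×N}, q ∈ ℝ^N, γ > 0), v = (d,c) ∈ ℝ^{N+1}, b ∈ ℝ, and assume D := b/γ + ((c/γ − 1)/2)² ≥ 0. With s₁ := (c/γ−1)/2 − √D and s₂ := (c/γ−1)/2 + √D, assume s₁ + max(−α,0) < (m+1)/p < s₂ + 2 − α. Set w := v − 2s₁(q,γ) = (d − 2s₁q, c − 2s₁γ). Then there exists C > 0 such that for every φ ∈ 𝒞_w, setting u(x,y) := y^{−s₁} φ(x,y) and ℒu := y^{α} Tr(A D²u) + y^{α−1} v·∇u − b y^{α−2} u, one has Σ_{i,j=1}^{N} ‖y^{α} ∂²u/∂x_i∂x_j‖_{L^p_m} ≤ C ‖ℒu‖_{L^p_m}. -/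

import Mathlib

open MeasureTheory Real

noncomputable section

/-- Points of `ℝ^{N+1} = ℝ^N × ℝ`; we write `z = (x, y)` with `x : Fin N → ℝ` and `y : ℝ`. -/
abbrev Pt (N : ℕ) := (Fin N → ℝ) × ℝ

/-- Directional (partial) derivative of `u` at `z` in the direction `v`. -/
def pd {N : ℕ} (v : Pt N) (u : Pt N → ℝ) (z : Pt N) : ℝ := fderiv ℝ u z v

/-- The unit vector in the `i`-th `x`-direction. -/
def ex {N : ℕ} (i : Fin N) : Pt N := (Pi.single i 1, 0)

/-- The unit vector in the `y`-direction. -/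
def ey {N : ℕ} : Pt N := (0, 1)

/-- The `i`-th coordinate direction of `ℝ^{N+1}`, `(x_1, …, x_N, y)`. -/
def bvec {N : ℕ} (i : Fin (N + 1)) : Pt N :=
  if h : (i : ℕ) < N then ex ⟨i, h⟩ else ey

/-- The block matrix `[[Q, qᵗ], [q, γ]]`. -/
def blockA {N : ℕ} (Q : Matrix (Fin N) (Fin N) ℝ) (q : Fin N → ℝ) (γ : ℝ) :
    Matrix (Fin (N + 1)) (Fin (N + 1)) ℝ := Matrix.of fun i j =>
  if hi : (i : ℕ) < N then
    if hj : (j : ℕ) < N then Q ⟨i, hi⟩ ⟨j, hj⟩ else q ⟨i, hi⟩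
  else if hj : (j : ℕ) < N then q ⟨j, hj⟩ else γ

/-- `Tr (A D² u)` at the point `z`: `∑_{i,j} a_{ij} ∂²u/∂z_i∂z_j`. -/
def trHess {N : ℕ} (A : Matrix (Fin (N + 1)) (Fin (N + 1)) ℝ) (u : Pt N → ℝ) (z : Pt N) : ℝ :=
  ∑ i, ∑ j, A i j * pd (bvec i) (pd (bvec j) u) z

/-- The norm of `L^p_m(ℝ^{N+1}_+) = L^p(ℝ^{N+1}_+ ; y^m dx dy)`. -/
def LpmNorm (N : ℕ) (p m : ℝ) (f : Pt N → ℝ) : ℝ :=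
  (∫ z in {z : Pt N | 0 < z.2}, |f z| ^ p * z.2 ^ m) ^ (1 / p)

variable {N : ℕ}

lemma pd_add {v : Pt N} {f g : Pt N → ℝ} (hf : Differentiable ℝ f) (hg : Differentiable ℝ g) :
    pd v (fun z => f z + g z) = fun z => pd v f z + pd v g z := by
  funext z; simp only [pd]; rw [fderiv_fun_add (hf z) (hg z)]; rfl

lemma pd_sub {v : Pt N} {f g : Pt N → ℝ} (hf : Differentiable ℝ f) (hg : Differentiable ℝ g) :
    pd v (fun z => f z - g z) = fun z => pd v f z - pd v g z := by
  funext z; simp only [pd]; rw [fderiv_fun_sub (hf z) (hg z)]; rfl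

lemma pd_const_mul {v : Pt N} {f : Pt N → ℝ} (c : ℝ) (hf : Differentiable ℝ f) :
    pd v (fun z => c * f z) = fun z => c * pd v f z := by
  funext z; simp only [pd]; rw [fderiv_const_mul (hf z)]; rfl

lemma pd_mul {v : Pt N} {f g : Pt N → ℝ} (hf : Differentiable ℝ f) (hg : Differentiable ℝ g) :
    pd v (fun z => f z * g z) = fun z => pd v f z * g z + f z * pd v g z := by
  funext z; simp only [pd]; rw [fderiv_fun_mul (hf z) (hg z)]
  simp; ring

lemma pd_sum {ι : Type*} (s : Finset ι) {v : Pt N} {f : ι → Pt N → ℝ}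
    (hf : ∀ i, Differentiable ℝ (f i)) :
    pd v (fun z => ∑ i ∈ s, f i z) = fun z => ∑ i ∈ s, pd v (f i) z := by
  funext z; simp only [pd]; rw [fderiv_fun_sum (fun i _ => hf i z)]; simp

lemma pd_smul_dir (c : ℝ) (v : Pt N) (f : Pt N → ℝ) : pd (c • v) f = fun z => c * pd v f z := by
  funext z; simp [pd]

lemma pd_add_dir (v w : Pt N) (f : Pt N → ℝ) : pd (v + w) f = fun z => pd v f z + pd w f z := by
  funext z; simp [pd]

lemma pd_sum_dir {ι : Type*} (s : Finset ι) (v : ι → Pt N) (f : Pt N → ℝ) :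
    pd (∑ i ∈ s, v i) f = fun z => ∑ i ∈ s, pd (v i) f z := by
  funext z; simp [pd]

/-- Smooth up to order `k` with bounded derivatives. -/
def Bd : ℕ → (Pt N → ℝ) → Prop
  | 0, f => Continuous f ∧ ∃ C, ∀ z, |f z| ≤ C
  | k + 1, f => (Continuous f ∧ ∃ C, ∀ z, |f z| ≤ C) ∧ Differentiable ℝ f ∧ ∀ v, Bd k (pd v f)

/-- Smooth up to order `k` with bounded and integrable derivatives. -/
def Nice : ℕ → (Pt N → ℝ) → Prop
  | 0, f => Continuous f ∧ (∃ C, ∀ z, |f z| ≤ C) ∧ Integrable f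
  | k + 1, f => (Continuous f ∧ (∃ C, ∀ z, |f z| ≤ C) ∧ Integrable f) ∧
      Differentiable ℝ f ∧ ∀ v, Nice k (pd v f)

lemma Nice.zero {k : ℕ} {f : Pt N → ℝ} (h : Nice k f) : Nice 0 f := by
  cases k with
  | zero => exact h
  | succ k => exact h.1

lemma Nice.cont {k : ℕ} {f : Pt N → ℝ} (h : Nice k f) : Continuous f := h.zero.1
lemma Nice.bdd {k : ℕ} {f : Pt N → ℝ} (h : Nice k f) : ∃ C, ∀ z, |f z| ≤ C := h.zero.2.1
lemma Nice.int {k : ℕ} {f : Pt N → ℝ} (h : Nice k f) : Integrable f := h.zero.2.2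
lemma Nice.diff {k : ℕ} {f : Pt N → ℝ} (h : Nice (k + 1) f) : Differentiable ℝ f := h.2.1
lemma Nice.pd {k : ℕ} {f : Pt N → ℝ} (h : Nice (k + 1) f) (v : Pt N) : Nice k (pd v f) := h.2.2 v

lemma Nice.mono {k l : ℕ} (hkl : k ≤ l) {f : Pt N → ℝ} (h : Nice l f) : Nice k f := by
  induction k generalizing l f with
  | zero => exact h.zero
  | succ k ih =>
    obtain ⟨l, rfl⟩ : ∃ m, l = m + 1 := ⟨l - 1, by omega⟩
    exact ⟨h.1, h.2.1, fun v => ih (by omega) (h.2.2 v)⟩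

lemma Bd.zero {k : ℕ} {f : Pt N → ℝ} (h : Bd k f) : Bd 0 f := by
  cases k with
  | zero => exact h
  | succ k => exact h.1

lemma Bd.mono {k l : ℕ} (hkl : k ≤ l) {f : Pt N → ℝ} (h : Bd l f) : Bd k f := by
  induction k generalizing l f with
  | zero => exact h.zero
  | succ k ih =>
    obtain ⟨l, rfl⟩ : ∃ m, l = m + 1 := ⟨l - 1, by omega⟩
    exact ⟨h.1, h.2.1, fun v => ih (by omega) (h.2.2 v)⟩

lemma Nice.add {k : ℕ} {f g : Pt N → ℝ} (hf : Nice k f) (hg : Nice k g) :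
    Nice k (fun z => f z + g z) := by
  induction k generalizing f g with
  | zero =>
    obtain ⟨hf, ⟨C, hC⟩, hfi⟩ := hf
    obtain ⟨hg, ⟨D, hD⟩, hgi⟩ := hg
    exact ⟨hf.add hg, ⟨C + D, fun z => (abs_add_le _ _).trans (add_le_add (hC z) (hD z))⟩,
      hfi.add hgi⟩
  | succ k ih =>
    have h0 : Nice 0 (fun z => f z + g z) := by
      obtain ⟨hf, ⟨C, hC⟩, hfi⟩ := hf.zero
      obtain ⟨hg, ⟨D, hD⟩, hgi⟩ := hg.zero
      exact ⟨hf.add hg, ⟨C + D, fun z => (abs_add_le _ _).trans (add_le_add (hC z) (hD z))⟩,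
        hfi.add hgi⟩
    refine ⟨h0, hf.diff.add hg.diff, fun v => ?_⟩
    rw [pd_add hf.diff hg.diff]; exact ih (hf.pd v) (hg.pd v)

lemma Nice.mul {k : ℕ} {f g : Pt N → ℝ} (hf : Bd k f) (hg : Nice k g) :
    Nice k (fun z => f z * g z) := by
  induction k generalizing f g with
  | zero =>
    obtain ⟨hf, C, hC⟩ := hf
    obtain ⟨hg, ⟨D, hD⟩, hgi⟩ := hg
    refine ⟨hf.mul hg, ⟨C * D, fun z => ?_⟩, ?_⟩
    · rw [abs_mul]; exact mul_le_mul (hC z) (hD z) (abs_nonneg _) ((abs_nonneg _).trans (hC z))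
    · exact hgi.bdd_mul (c := C) hf.aestronglyMeasurable (Filter.Eventually.of_forall fun z => hC z)
  | succ k ih =>
    have h0 : Nice 0 (fun z => f z * g z) := by
      obtain ⟨hf, C, hC⟩ := hf.zero
      obtain ⟨hg, ⟨D, hD⟩, hgi⟩ := hg.zero
      refine ⟨hf.mul hg, ⟨C * D, fun z => ?_⟩, ?_⟩
      · rw [abs_mul]; exact mul_le_mul (hC z) (hD z) (abs_nonneg _) ((abs_nonneg _).trans (hC z))
      · exact hgi.bdd_mul (c := C) hf.aestronglyMeasurable
          (Filter.Eventually.of_forall fun z => hC z)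
    refine ⟨h0, hf.2.1.mul hg.diff, fun v => ?_⟩
    rw [pd_mul hf.2.1 hg.diff]
    exact (ih (hf.2.2 v) (hg.mono (Nat.le_succ _))).add (ih (hf.mono (Nat.le_succ _)) (hg.pd v))

lemma Bd.const (k : ℕ) (c : ℝ) : Bd k (fun _ : Pt N => c) := by
  induction k generalizing c with
  | zero => exact ⟨continuous_const, |c|, fun _ => le_rfl⟩
  | succ k ih =>
    refine ⟨⟨continuous_const, |c|, fun _ => le_rfl⟩, differentiable_const c, fun v => ?_⟩
    have : pd v (fun _ : Pt N => c) = fun _ => 0 := by funext z; simp [pd]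
    rw [this]; exact ih 0

lemma Nice.const_mul {k : ℕ} {f : Pt N → ℝ} (c : ℝ) (hf : Nice k f) :
    Nice k (fun z => c * f z) := Nice.mul (Bd.const k c) hf

lemma Nice.sub {k : ℕ} {f g : Pt N → ℝ} (hf : Nice k f) (hg : Nice k g) :
    Nice k (fun z => f z - g z) := by
  have := hf.add (hg.const_mul (-1))
  convert this using 2; ring

lemma Nice.zero_fun (k : ℕ) : Nice k (fun _ : Pt N => (0 : ℝ)) := by
  induction k with
  | zero => exact ⟨continuous_const, ⟨0, by simp⟩, by simp⟩
  | succ k ih =>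
    refine ⟨⟨continuous_const, ⟨0, by simp⟩, by simp⟩, differentiable_const _, fun v => ?_⟩
    have : _root_.pd v (fun _ : Pt N => (0 : ℝ)) = fun _ => 0 := by funext z; simp [_root_.pd]
    rw [this]; exact ih

lemma Nice.sum {ι : Type*} (s : Finset ι) {k : ℕ} {f : ι → Pt N → ℝ} (hf : ∀ i, Nice k (f i)) :
    Nice k (fun z => ∑ i ∈ s, f i z) := by
  classical
  induction s using Finset.induction_on with
  | empty => simpa using Nice.zero_fun k
  | insert a s ha ih => simpa [Finset.sum_insert ha] using (hf a).add ih

lemma pd_contDiff {f : Pt N → ℝ} (hf : ContDiff ℝ (⊤ : ℕ∞) f) (v : Pt N) :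
    ContDiff ℝ (⊤ : ℕ∞) (pd v f) := by
  have : ContDiff ℝ (⊤ : ℕ∞) (fderiv ℝ f) := hf.fderiv_right (by simp)
  exact this.clm_apply contDiff_const

lemma pd_hcs {f : Pt N → ℝ} (hf : HasCompactSupport f) (v : Pt N) :
    HasCompactSupport (pd v f) := by
  exact hf.fderiv_apply (𝕜 := ℝ) v

lemma Nice.of_cs (k : ℕ) {f : Pt N → ℝ} (hf : ContDiff ℝ (⊤ : ℕ∞) f) (hs : HasCompactSupport f) :
    Nice k f := by
  have key : ∀ f : Pt N → ℝ, ContDiff ℝ (⊤ : ℕ∞) f → HasCompactSupport f → Nice 0 f := by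
    intro f hf hs
    obtain ⟨C, hC⟩ := hs.exists_bound_of_continuous hf.continuous
    exact ⟨hf.continuous, ⟨C, hC⟩, hf.continuous.integrable_of_hasCompactSupport hs⟩
  induction k generalizing f with
  | zero => exact key f hf hs
  | succ k ih =>
    exact ⟨key f hf hs, hf.differentiable (by simp), fun v => ih (pd_contDiff hf v) (pd_hcs hs v)⟩

lemma Nice.contDiff {k : ℕ} {f : Pt N → ℝ} (h : Nice k f) : ContDiff ℝ k f := by
  induction k generalizing f with
  | zero => exact contDiff_zero.2 h.cont
  | succ k ih =>
    rw [Nat.cast_succ, contDiff_succ_iff_fderiv_apply]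
    exact ⟨h.diff, by simp, fun v => ih (h.pd v)⟩

lemma pd_comm {f : Pt N → ℝ} (hf : ContDiff ℝ 2 f) (v w : Pt N) :
    pd v (pd w f) = pd w (pd v f) := by
  have hd : Differentiable ℝ (fderiv ℝ f) :=
    (hf.fderiv_right (m := 1) (by norm_num)).differentiable (by norm_num)
  have e : ∀ a b : Pt N, ∀ z, pd a (pd b f) z = fderiv ℝ (fderiv ℝ f) z a b := by
    intro a b z
    show fderiv ℝ (fun y => fderiv ℝ f y b) z a = _
    rw [fderiv_clm_apply (hd z) (differentiableAt_const _)]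
    simp
  funext z
  rw [e, e]
  have := (hf.contDiffAt (x := z)).isSymmSndFDerivAt (by simp)
  exact this v w

lemma Nice.pd_comm {k : ℕ} {f : Pt N → ℝ} (hf : Nice (k + 2) f) (v w : Pt N) :
    _root_.pd v (_root_.pd w f) = _root_.pd w (_root_.pd v f) :=
  _root_.pd_comm ((hf.mono (k := 2) (by omega)).contDiff) v w

lemma Bd.of_snd (k : ℕ) {η : ℝ → ℝ} (hη : ContDiff ℝ (⊤ : ℕ∞) η) (hs : HasCompactSupport η) :
    Bd k (fun z : Pt N => η z.2) := by
  have key : ∀ η : ℝ → ℝ, ContDiff ℝ (⊤ : ℕ∞) η → HasCompactSupport η →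
      Bd 0 (fun z : Pt N => η z.2) := by
    intro f hf hs
    obtain ⟨C, hC⟩ := hs.exists_bound_of_continuous hf.continuous
    exact ⟨hf.continuous.comp continuous_snd, C, fun z => hC z.2⟩
  induction k generalizing η with
  | zero => exact key η hη hs
  | succ k ih =>
    refine ⟨key η hη hs, (hη.differentiable (by simp)).comp differentiable_snd, fun v => ?_⟩
    have h1 : pd v (fun z : Pt N => η z.2) = fun z => (fun y => v.2 * deriv η y) z.2 := by
      funext z
      have h := ((hη.differentiable (by simp)) z.2).hasDerivAt.comp_hasFDerivAt z
        (hasFDerivAt_snd (𝕜 := ℝ) (p := z))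
      simp only [pd]
      rw [show (fun z : Pt N => η z.2) = η ∘ Prod.snd from rfl, h.fderiv]
      simp [mul_comm]
    rw [h1]
    refine ih (η := fun y => v.2 * deriv η y) ?_ ?_
    · exact contDiff_const.mul (hη.iterate_deriv 1)
    · exact (hs.deriv).mul_left

lemma pd_snd {η : ℝ → ℝ} (hη : Differentiable ℝ η) (v : Pt N) :
    pd v (fun z : Pt N => η z.2) = fun z => v.2 * deriv η z.2 := by
  funext z
  have h := (hη z.2).hasDerivAt.comp_hasFDerivAt z (hasFDerivAt_snd (𝕜 := ℝ) (p := z))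
  simp only [pd]
  rw [show (fun z : Pt N => η z.2) = η ∘ Prod.snd from rfl, h.fderiv]
  simp [mul_comm]

section gauss
variable {ι : Type} [Fintype ι]

/-- unnormalized gaussian density -/
def gd (ζ : ι → ℝ) : ℝ := Real.exp (-(∑ k, ζ k ^ 2) / 2)

variable (ι) in
def gZ : ℝ := ∫ ζ : ι → ℝ, gd ζ

variable (ι) in
/-- standard gaussian measure -/
def gν : Measure (ι → ℝ) := volume.withDensity (fun ζ => ENNReal.ofReal (gd ζ / gZ ι))

lemma gd_pos (ζ : ι → ℝ) : 0 < gd ζ := Real.exp_pos _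

lemma gd_cont : Continuous (gd : (ι → ℝ) → ℝ) := by
  unfold gd; fun_prop

lemma int_exp_sq (b : ℝ) (hb : 0 < b) :
    Integrable (fun ζ : ι → ℝ => Real.exp (-b * ∑ k, ζ k ^ 2)) := by
  have := Integrable.fintype_prod (𝕜 := ℝ) (ι := ι) (μ := fun _ => (volume : Measure ℝ))
    (f := fun _ x => Real.exp (-b * x ^ 2)) (fun _ => integrable_exp_neg_mul_sq hb)
  refine (this.congr (Filter.Eventually.of_forall fun ζ => ?_))
  simp only [← Real.exp_sum, Finset.mul_sum]

lemma gd_int : Integrable (gd : (ι → ℝ) → ℝ) := by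
  refine (int_exp_sq (ι := ι) (1/2) (by norm_num)).congr (Filter.Eventually.of_forall fun ζ => ?_)
  simp only [gd]; congr 1; ring

lemma gZ_pos : 0 < gZ ι := by
  unfold gZ
  rw [integral_pos_iff_support_of_nonneg (fun ζ => (gd_pos ζ).le) gd_int]
  have : Function.support (gd : (ι → ℝ) → ℝ) = Set.univ := by
    ext ζ; simp [(gd_pos ζ).ne']
  rw [this]; exact (isOpen_univ.measure_pos volume Set.univ_nonempty)

lemma norm_sq_le_sum (ζ : ι → ℝ) : ‖ζ‖ ^ 2 ≤ ∑ k, ζ k ^ 2 := by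
  have h : ‖ζ‖ ≤ Real.sqrt (∑ k, ζ k ^ 2) := by
    rw [pi_norm_le_iff_of_nonneg (Real.sqrt_nonneg _)]
    intro i
    rw [Real.norm_eq_abs]
    apply Real.abs_le_sqrt
    exact Finset.single_le_sum (f := fun k => ζ k ^ 2) (fun k _ => sq_nonneg _) (Finset.mem_univ i)
  calc ‖ζ‖ ^ 2 ≤ Real.sqrt (∑ k, ζ k ^ 2) ^ 2 := by gcongr
    _ = _ := Real.sq_sqrt (Finset.sum_nonneg fun k _ => sq_nonneg _)

lemma gd_moment (n : ℕ) : Integrable (fun ζ : ι → ℝ => ‖ζ‖ ^ n * gd ζ) := by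
  refine ((int_exp_sq (ι := ι) (1/4) (by norm_num)).const_mul (n.factorial * Real.exp 1)).mono'
    ((continuous_norm.pow n).mul gd_cont).aestronglyMeasurable
    (Filter.Eventually.of_forall fun ζ => ?_)
  have h1 : ‖ζ‖ ^ n ≤ n.factorial * Real.exp ‖ζ‖ := by
    have := Real.pow_div_factorial_le_exp (x := ‖ζ‖) (norm_nonneg _) n
    rwa [div_le_iff₀' (by positivity)] at this
  have h2 := norm_sq_le_sum ζ
  rw [Real.norm_of_nonneg (mul_nonneg (by positivity) (gd_pos ζ).le)]
  calc ‖ζ‖ ^ n * gd ζ ≤ (n.factorial * Real.exp ‖ζ‖) * gd ζ := by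
        gcongr; exact (gd_pos ζ).le
    _ = n.factorial * Real.exp (‖ζ‖ + -(∑ k, ζ k ^ 2) / 2) := by
        rw [Real.exp_add, gd]; ring
    _ ≤ n.factorial * Real.exp (1 + -(1/4) * ∑ k, ζ k ^ 2) := by
        have : ‖ζ‖ + -(∑ k, ζ k ^ 2) / 2 ≤ 1 + -(1/4) * ∑ k, ζ k ^ 2 := by
          nlinarith [sq_nonneg (‖ζ‖ - 2)]
        gcongr
    _ = _ := by rw [Real.exp_add]; ring

lemma gint (f : (ι → ℝ) → ℝ) : ∫ ζ, f ζ ∂(gν ι) = ∫ ζ, (gd ζ / gZ ι) * f ζ := by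
  rw [gν, integral_withDensity_eq_integral_toReal_smul]
  · refine integral_congr_ae (Filter.Eventually.of_forall fun ζ => ?_)
    simp only [smul_eq_mul]
    rw [ENNReal.toReal_ofReal (div_nonneg (gd_pos ζ).le gZ_pos.le)]
  · exact (gd_cont.div_const _).measurable.ennreal_ofReal
  · exact Filter.Eventually.of_forall fun ζ => ENNReal.ofReal_lt_top

lemma gintble (f : (ι → ℝ) → ℝ) :
    Integrable f (gν ι) ↔ Integrable (fun ζ => (gd ζ / gZ ι) * f ζ) := by
  rw [gν, integrable_withDensity_iff_integrable_smul']
  · refine integrable_congr (Filter.Eventually.of_forall fun ζ => ?_)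
    simp only [smul_eq_mul]
    rw [ENNReal.toReal_ofReal (div_nonneg (gd_pos ζ).le gZ_pos.le)]
  · exact (gd_cont.div_const _).measurable.ennreal_ofReal
  · exact Filter.Eventually.of_forall fun ζ => ENNReal.ofReal_lt_top

instance : IsProbabilityMeasure (gν ι) := by
  constructor
  rw [gν, withDensity_apply _ MeasurableSet.univ, Measure.restrict_univ,
    ← ofReal_integral_eq_lintegral_ofReal (gd_int.div_const _)
      (Filter.Eventually.of_forall fun ζ => div_nonneg (gd_pos ζ).le gZ_pos.le),
    integral_div]
  rw [show (∫ ζ : ι → ℝ, gd ζ) = gZ ι from rfl, div_self gZ_pos.ne']; simp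

lemma gmoment (n : ℕ) : Integrable (fun ζ : ι → ℝ => ‖ζ‖ ^ n) (gν ι) := by
  rw [gintble]
  refine ((gd_moment (ι := ι) n).div_const (gZ ι)).congr (Filter.Eventually.of_forall fun ζ => ?_)
  simp only; ring

/-- polynomial growth functions are integrable -/
lemma gint_poly {f : (ι → ℝ) → ℝ} (hf : Continuous f) (C : ℝ) (n : ℕ)
    (h : ∀ ζ, |f ζ| ≤ C * ‖ζ‖ ^ n) : Integrable f (gν ι) :=
  ((gmoment n).const_mul C).mono' hf.aestronglyMeasurable
    (Filter.Eventually.of_forall fun ζ => h ζ)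

lemma gint_bdd {f : (ι → ℝ) → ℝ} (hf : Continuous f) (C : ℝ)
    (h : ∀ ζ, |f ζ| ≤ C) : Integrable f (gν ι) :=
  gint_poly hf C 0 (by simpa using h)

variable [DecidableEq ι]

lemma gd_hasFDeriv (ζ : ι → ℝ) (k : ι) :
    DifferentiableAt ℝ gd ζ ∧ fderiv ℝ gd ζ (Pi.single k 1) = - ζ k * gd ζ := by
  have h0 : HasFDerivAt (fun ζ : ι → ℝ => -(∑ k, ζ k ^ 2) / 2)
      (-(∑ k, (ζ k) • ContinuousLinearMap.proj (R := ℝ) (φ := fun _ : ι => ℝ) k)) ζ := by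
    have : HasFDerivAt (fun ζ : ι → ℝ => ∑ k, ζ k ^ 2)
      (∑ k, (2 * ζ k) • ContinuousLinearMap.proj (R := ℝ) (φ := fun _ : ι => ℝ) k) ζ := by
      refine HasFDerivAt.fun_sum fun k _ => ?_
      have := (hasFDerivAt_apply (𝕜 := ℝ) k ζ).pow 2
      simpa using this
    have h := (this.neg).mul_const (1/2 : ℝ)
    refine (h.congr_fderiv ?_).congr_of_eventuallyEq
      (Filter.Eventually.of_forall fun ζ => by simp; ring)
    ext v; simp [Finset.mul_sum, mul_assoc]
  have h1 := h0.exp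
  refine ⟨h1.differentiableAt, ?_⟩
  have : fderiv ℝ gd ζ = _ := h1.fderiv
  rw [this]
  simp [Pi.single_apply, gd]; ring

/-- Stein lemma -/
lemma stein {G : (ι → ℝ) → ℝ} (k : ι) (hd : Differentiable ℝ G)
    (hc : Continuous fun ζ => fderiv ℝ G ζ (Pi.single k 1)) (C : ℝ) (n : ℕ)
    (hG : ∀ ζ, |G ζ| ≤ C * (1 + ‖ζ‖) ^ n) (hG' : ∀ ζ, |fderiv ℝ G ζ (Pi.single k 1)| ≤ C * (1 + ‖ζ‖) ^ n) :
    ∫ ζ, ζ k * G ζ ∂(gν ι) = ∫ ζ, fderiv ℝ G ζ (Pi.single k 1) ∂(gν ι) := by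
  have poly : ∀ n : ℕ, Integrable (fun ζ : ι → ℝ => (1 + ‖ζ‖) ^ n * gd ζ) := by
    intro n
    have e : (fun ζ : ι → ℝ => (1 + ‖ζ‖) ^ n * gd ζ) =
      fun ζ => ∑ m ∈ Finset.range (n+1), (n.choose m : ℝ) * (‖ζ‖ ^ (n - m) * gd ζ) := by
      funext ζ
      rw [add_pow, Finset.sum_mul]
      refine Finset.sum_congr rfl fun m _ => ?_
      simp; ring
    rw [e]
    exact integrable_finsetSum _ fun m _ => (gd_moment (n - m)).const_mul _
  have hC : 0 ≤ C := by
    have := (abs_nonneg _).trans (hG 0); simpa using this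
  have b1 : Integrable (fun ζ => fderiv ℝ G ζ (Pi.single k 1) * gd ζ) := by
    refine ((poly n).const_mul C).mono' (hc.mul gd_cont).aestronglyMeasurable
      (Filter.Eventually.of_forall fun ζ => ?_)
    rw [norm_mul, Real.norm_of_nonneg (gd_pos ζ).le, Real.norm_eq_abs, ← mul_assoc]
    exact mul_le_mul_of_nonneg_right (hG' ζ) (gd_pos ζ).le
  have b2 : Integrable (fun ζ => G ζ * fderiv ℝ gd ζ (Pi.single k 1)) := by
    simp only [fun ζ => (gd_hasFDeriv (ι := ι) ζ k).2]
    refine ((poly (n+1)).const_mul C).mono'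
      (hd.continuous.mul ((continuous_apply k).neg.mul gd_cont)).aestronglyMeasurable
      (Filter.Eventually.of_forall fun ζ => ?_)
    rw [norm_mul, norm_mul, norm_neg, Real.norm_of_nonneg (gd_pos ζ).le, Real.norm_eq_abs (G ζ)]
    have h1 : ‖ζ k‖ ≤ 1 + ‖ζ‖ := (norm_le_pi_norm ζ k).trans (by linarith)
    calc |G ζ| * (‖ζ k‖ * gd ζ) ≤ (C * (1 + ‖ζ‖) ^ n) * ((1 + ‖ζ‖) * gd ζ) := by
          gcongr
          · exact mul_nonneg (norm_nonneg _) (gd_pos ζ).le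
          · exact hG ζ
          · exact (gd_pos ζ).le
      _ = _ := by ring
  have b3 : Integrable (fun ζ => G ζ * gd ζ) := by
    refine ((poly n).const_mul C).mono' (hd.continuous.mul gd_cont).aestronglyMeasurable
      (Filter.Eventually.of_forall fun ζ => ?_)
    rw [norm_mul, Real.norm_of_nonneg (gd_pos ζ).le, Real.norm_eq_abs, ← mul_assoc]
    exact mul_le_mul_of_nonneg_right (hG ζ) (gd_pos ζ).le
  have := integral_mul_fderiv_eq_neg_fderiv_mul_of_integrable (μ := volume) b1 b2 b3
    (fun x _ => hd x) (fun x _ => (gd_hasFDeriv (ι := ι) x k).1)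
  rw [gint, gint]
  simp only [fun ζ => (gd_hasFDeriv (ι := ι) ζ k).2] at this
  have e1 : (∫ ζ : ι → ℝ, gd ζ / gZ ι * (ζ k * G ζ)) = - (∫ x, G x * (-x k * gd x)) / gZ ι := by
    rw [← integral_neg, ← integral_div]
    congr 1; funext ζ; ring
  have e2 : (∫ ζ : ι → ℝ, gd ζ / gZ ι * fderiv ℝ G ζ (Pi.single k 1)) =
      (∫ x, fderiv ℝ G x (Pi.single k 1) * gd x) / gZ ι := by
    rw [← integral_div]
    congr 1; funext ζ; ring
  rw [e1, e2, this, neg_neg]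

end gauss

section heat
variable {N : ℕ} {ι : Type} [Fintype ι]

instance ptHaar : (volume : Measure (Pt N)).IsAddHaarMeasure :=
  inferInstanceAs (Measure.prod (volume : Measure (Fin N → ℝ)) (volume : Measure ℝ)).IsAddHaarMeasure

lemma pt_decomp (v : Pt N) : v = (∑ i, v.1 i • (ex i : Pt N)) + v.2 • ey := by
  ext i
  · simp [ex, ey, Prod.fst_sum, Finset.sum_apply, Pi.single_apply]
  · simp [ex, ey, Prod.snd_sum]

lemma Nice.fderiv_bdd {f : Pt N → ℝ} (hf : Nice 1 f) : ∃ C, 0 ≤ C ∧ ∀ z, ‖fderiv ℝ f z‖ ≤ C := by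
  choose C hC using fun i : Fin N => (hf.pd (ex i)).bdd
  obtain ⟨D, hD⟩ := (hf.pd ey).bdd
  have hC0 : ∀ i, 0 ≤ C i := fun i => (abs_nonneg _).trans (hC i 0)
  have hD0 : 0 ≤ D := (abs_nonneg _).trans (hD 0)
  have h0 : 0 ≤ (∑ i, C i) + D := add_nonneg (Finset.sum_nonneg fun i _ => hC0 i) hD0
  refine ⟨(∑ i, C i) + D, h0, fun z => ?_⟩
  refine ContinuousLinearMap.opNorm_le_bound _ h0 fun v => ?_
  have e : fderiv ℝ f z v = (∑ i, v.1 i * _root_.pd (ex i) f z) + v.2 * _root_.pd ey f z := by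
    conv_lhs => rw [pt_decomp v]
    simp [_root_.pd]
  rw [e, add_mul, Finset.sum_mul]
  refine (norm_add_le _ _).trans (add_le_add ((norm_sum_le _ _).trans ?_) ?_)
  · refine Finset.sum_le_sum fun i _ => ?_
    rw [norm_mul, mul_comm]
    exact mul_le_mul (hC i z) ((norm_le_pi_norm v.1 i).trans (norm_fst_le v)) (norm_nonneg _) (hC0 i)
  · rw [norm_mul, mul_comm]
    exact mul_le_mul (hD z) (norm_snd_le v) (norm_nonneg _) hD0

lemma Nice.fderiv_cont {f : Pt N → ℝ} (hf : Nice 1 f) : Continuous (fderiv ℝ f) := by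
  rw [continuous_clm_apply]
  exact fun v => (hf.pd v).cont

/-- the linear map `ζ ↦ ∑ ζ_k s_k` -/
def hl (s : ι → Pt N) (ζ : ι → ℝ) : Pt N := ∑ k, ζ k • s k

lemma hl_cont (s : ι → Pt N) : Continuous (hl s) := by unfold hl; fun_prop

lemma hl_bound (s : ι → Pt N) (ζ : ι → ℝ) : ‖hl s ζ‖ ≤ (∑ k, ‖s k‖) * ‖ζ‖ := by
  rw [hl, Finset.sum_mul]
  refine (norm_sum_le _ _).trans (Finset.sum_le_sum fun k _ => ?_)
  rw [norm_smul, mul_comm]; gcongr; exact norm_le_pi_norm ζ k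

/-- the heat operator -/
def heat (s : ι → Pt N) (t : ℝ) (f : Pt N → ℝ) (z : Pt N) : ℝ :=
  ∫ ζ, f (z + t • hl s ζ) ∂(gν ι)

variable (s : ι → Pt N)

lemma heat_arg_cont (t : ℝ) (z : Pt N) : Continuous fun ζ => z + t • hl s ζ :=
  continuous_const.add ((hl_cont s).const_smul t)

lemma Nice.heat_intble {k : ℕ} {f : Pt N → ℝ} (hf : Nice k f) (t : ℝ) (z : Pt N) :
    Integrable (fun ζ => f (z + t • hl s ζ)) (gν ι) := by
  obtain ⟨C, hC⟩ := hf.bdd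
  exact gint_bdd (hf.cont.comp (heat_arg_cont s t z)) C fun ζ => hC _

lemma heat_add {k : ℕ} {f g : Pt N → ℝ} (hf : Nice k f) (hg : Nice k g) (t : ℝ) :
    heat s t (fun z => f z + g z) = fun z => heat s t f z + heat s t g z := by
  funext z; exact integral_add (hf.heat_intble s t z) (hg.heat_intble s t z)

lemma heat_sub {k : ℕ} {f g : Pt N → ℝ} (hf : Nice k f) (hg : Nice k g) (t : ℝ) :
    heat s t (fun z => f z - g z) = fun z => heat s t f z - heat s t g z := by
  funext z; exact integral_sub (hf.heat_intble s t z) (hg.heat_intble s t z)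

lemma heat_const_mul (c : ℝ) (f : Pt N → ℝ) (t : ℝ) :
    heat s t (fun z => c * f z) = fun z => c * heat s t f z := by
  funext z; exact integral_const_mul _ _

lemma heat_sum {κ : Type*} (S : Finset κ) {k : ℕ} {f : κ → Pt N → ℝ} (hf : ∀ i, Nice k (f i))
    (t : ℝ) : heat s t (fun z => ∑ i ∈ S, f i z) = fun z => ∑ i ∈ S, heat s t (f i) z := by
  funext z; exact integral_finsetSum _ fun i _ => (hf i).heat_intble s t z

lemma heat_zero (f : Pt N → ℝ) : heat s 0 f = f := by
  funext z; simp [heat]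

lemma heat_cont_joint {f : Pt N → ℝ} (hf : Continuous f) (hb : ∃ C, ∀ z, |f z| ≤ C) :
    Continuous fun q : ℝ × Pt N => heat s q.1 f q.2 := by
  obtain ⟨C, hC⟩ := hb
  refine continuous_of_dominated (bound := fun _ => C) (fun q => ?_) (fun q => ?_) ?_ ?_
  · exact (hf.comp (heat_arg_cont s q.1 q.2)).aestronglyMeasurable
  · exact Filter.Eventually.of_forall fun ζ => hC _
  · exact integrable_const _
  · exact Filter.Eventually.of_forall fun ζ => by fun_prop

lemma heat_cont {f : Pt N → ℝ} (hf : Continuous f) (hb : ∃ C, ∀ z, |f z| ≤ C) (t : ℝ) :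
    Continuous (heat s t f) :=
  (heat_cont_joint s hf hb).comp (Continuous.prodMk_right t)

lemma heat_bound {f : Pt N → ℝ} {C : ℝ} (hC : ∀ z, |f z| ≤ C) (t : ℝ) (z : Pt N) :
    |heat s t f z| ≤ C := by
  have := norm_integral_le_of_norm_le_const (μ := gν ι) (f := fun ζ => f (z + t • hl s ζ)) (C := C)
    (Filter.Eventually.of_forall fun ζ => hC _)
  simpa [heat] using this

lemma Nice.heat_prod_int {f : Pt N → ℝ} (hf : Nice 0 f) (t : ℝ) :
    Integrable (fun q : Pt N × (ι → ℝ) => f (q.1 + t • hl s q.2)) (volume.prod (gν ι)) := by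
  have hm : AEStronglyMeasurable (fun q : Pt N × (ι → ℝ) => f (q.1 + t • hl s q.2))
      (volume.prod (gν ι)) := by
    refine Continuous.aestronglyMeasurable ?_
    have := hf.cont; have := hl_cont s; fun_prop
  rw [integrable_prod_iff' hm]
  constructor
  · exact Filter.Eventually.of_forall fun ζ => hf.int.comp_add_right (t • hl s ζ)
  · have : (fun ζ => ∫ z : Pt N, ‖f (z + t • hl s ζ)‖) = fun _ => ∫ z, ‖f z‖ := by
      funext ζ; exact integral_add_right_eq_self (fun z => ‖f z‖) _
    simp only [this]; exact integrable_const _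

lemma Nice.heat_int {f : Pt N → ℝ} (hf : Nice 0 f) (t : ℝ) : Integrable (heat s t f) :=
  (hf.heat_prod_int s t).integral_prod_left

lemma heat_norm_int_le {f : Pt N → ℝ} (hf : Nice 0 f) (t : ℝ) :
    ∫ z, |heat s t f z| ≤ ∫ z, |f z| := by
  calc ∫ z, |heat s t f z| ≤ ∫ z, (∫ ζ, |f (z + t • hl s ζ)| ∂(gν ι)) := by
        refine integral_mono (hf.heat_int s t).abs (hf.heat_prod_int s t).norm.integral_prod_left
          fun z => ?_
        exact norm_integral_le_integral_norm (fun ζ => f (z + t • hl s ζ))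
    _ = ∫ ζ, (∫ z : Pt N, |f (z + t • hl s ζ)|) ∂(gν ι) :=
        integral_integral_swap (hf.heat_prod_int s t).norm
    _ = ∫ ζ : ι → ℝ, (∫ z, |f z|) ∂(gν ι) := by
        congr 1; funext ζ; exact integral_add_right_eq_self (fun z => |f z|) _
    _ = _ := by simp

lemma Nice.heat_hasFDeriv {f : Pt N → ℝ} (hf : Nice 1 f) (t : ℝ) (z : Pt N) :
    HasFDerivAt (heat s t f) (∫ ζ, fderiv ℝ f (z + t • hl s ζ) ∂(gν ι)) z := by
  obtain ⟨C, _, hC⟩ := hf.fderiv_bdd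
  refine hasFDerivAt_integral_of_dominated_of_fderiv_le (bound := fun _ => C)
    (F' := fun z ζ => fderiv ℝ f (z + t • hl s ζ)) Filter.univ_mem ?_ ?_ ?_ ?_ ?_ ?_
  · exact Filter.Eventually.of_forall fun z =>
      (hf.cont.comp (heat_arg_cont s t z)).aestronglyMeasurable
  · exact hf.heat_intble s t z
  · exact (hf.fderiv_cont.comp (heat_arg_cont s t z)).aestronglyMeasurable
  · exact Filter.Eventually.of_forall fun ζ z _ => hC _
  · exact integrable_const _
  · exact Filter.Eventually.of_forall fun ζ z _ =>
      (hasFDerivAt_comp_add_right (t • hl s ζ)).2 (hf.diff _).hasFDerivAt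

lemma Nice.heat_pd {f : Pt N → ℝ} (hf : Nice 1 f) (t : ℝ) (v : Pt N) :
    _root_.pd v (heat s t f) = heat s t (_root_.pd v f) := by
  obtain ⟨C, _, hC⟩ := hf.fderiv_bdd
  funext z
  simp only [_root_.pd, (hf.heat_hasFDeriv s t z).fderiv, heat]
  rw [ContinuousLinearMap.integral_apply]
  exact (integrable_const C).mono'
    (hf.fderiv_cont.comp (heat_arg_cont s t z)).aestronglyMeasurable
    (Filter.Eventually.of_forall fun ζ => hC _)

lemma Nice.heat {k : ℕ} {f : Pt N → ℝ} (hf : Nice k f) (t : ℝ) : Nice k (heat s t f) := by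
  have key : ∀ f : Pt N → ℝ, Nice 0 f → Nice 0 (_root_.heat s t f) := by
    intro f hf
    obtain ⟨C, hC⟩ := hf.bdd
    exact ⟨heat_cont s hf.cont hf.bdd t, ⟨C, heat_bound s hC t⟩, hf.heat_int s t⟩
  induction k generalizing f with
  | zero => exact key f hf
  | succ k ih =>
    refine ⟨key f hf.zero, fun z =>
      ((hf.mono (by omega)).heat_hasFDeriv s t z).differentiableAt, fun v => ?_⟩
    rw [Nice.heat_pd s (hf.mono (by omega)) t v]; exact ih (hf.pd v)

/-- Laplace type operator -/
def op (f : Pt N → ℝ) (z : Pt N) : ℝ := ∑ k, pd (s k) (pd (s k) f) z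

lemma Nice.op {k : ℕ} {f : Pt N → ℝ} (hf : Nice (k + 2) f) : Nice k (op s f) :=
  Nice.sum _ fun i => (hf.pd (s i)).pd (s i)

lemma Nice.heat_op {f : Pt N → ℝ} (hf : Nice 2 f) (t : ℝ) :
    _root_.op s (_root_.heat s t f) = _root_.heat s t (_root_.op s f) := by
  unfold _root_.op
  rw [heat_sum s _ (fun i => (hf.pd (s i)).pd (s i)) t]
  funext z
  refine Finset.sum_congr rfl fun i _ => ?_
  rw [Nice.heat_pd s (hf.mono (by omega)) t, Nice.heat_pd s (hf.pd _) t]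

lemma hl_hasFDeriv (t : ℝ) (z : Pt N) (ζ v : ι → ℝ) {f : Pt N → ℝ} (hf : Differentiable ℝ f) :
    DifferentiableAt ℝ (fun ζ => f (z + t • hl s ζ)) ζ ∧
    fderiv ℝ (fun ζ => f (z + t • hl s ζ)) ζ v = t * fderiv ℝ f (z + t • hl s ζ) (hl s v) := by
  let L : (ι → ℝ) →ₗ[ℝ] Pt N :=
    { toFun := hl s
      map_add' := fun a b => by simp [hl, add_smul, Finset.sum_add_distrib]
      map_smul' := fun c a => by simp [hl, Finset.smul_sum, smul_smul] }
  have hL : HasFDerivAt (fun ζ => z + t • hl s ζ) (t • LinearMap.toContinuousLinearMap L) ζ :=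
    ((LinearMap.toContinuousLinearMap L).hasFDerivAt.const_smul t).const_add z
  have h := (hf (z + t • hl s ζ)).hasFDerivAt.comp ζ hL
  refine ⟨h.differentiableAt, ?_⟩
  have e : fderiv ℝ (fun ζ => f (z + t • hl s ζ)) ζ = _ := h.fderiv
  rw [e]; simp; left; rfl

lemma hl_single [DecidableEq ι] (k : ι) : hl s (Pi.single k 1) = s k := by
  simp [hl, Pi.single_apply]

/-- Stein for heat averages. -/
lemma Nice.heat_stein {f : Pt N → ℝ} (hf : Nice 1 f) (t : ℝ) (z : Pt N) (k : ι) :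
    ∫ ζ, ζ k * f (z + t • hl s ζ) ∂(gν ι) = t * _root_.heat s t (_root_.pd (s k) f) z := by
  classical
  obtain ⟨C, hC⟩ := hf.bdd
  obtain ⟨D, hD⟩ := (hf.pd (s k)).bdd
  have e : ∀ ζ, fderiv ℝ (fun ζ => f (z + t • hl s ζ)) ζ (Pi.single k 1) =
      t * _root_.pd (s k) f (z + t • hl s ζ) := by
    intro ζ; rw [(hl_hasFDeriv s t z ζ _ hf.diff).2, hl_single]; rfl
  rw [stein k (fun ζ => (hl_hasFDeriv s t z ζ 0 hf.diff).1) (C := max C (|t| * D)) (n := 0)]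
  · simp only [e]; rw [integral_const_mul]; rfl
  · simp only [e]
    exact continuous_const.mul ((hf.pd (s k)).cont.comp (heat_arg_cont s t z))
  · intro ζ; simp only [pow_zero, mul_one]; exact (hC _).trans (le_max_left _ _)
  · intro ζ; rw [e, abs_mul]; simp only [pow_zero, mul_one]
    exact (mul_le_mul_of_nonneg_left (hD _) (abs_nonneg t)).trans (le_max_right _ _)

lemma Nice.heat_deriv {f : Pt N → ℝ} (hf : Nice 2 f) (t : ℝ) (z : Pt N) :
    HasDerivAt (fun t => _root_.heat s t f z) (t * _root_.heat s t (_root_.op s f) z) t := by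
  have hf1 : Nice 1 f := hf.mono (by omega)
  obtain ⟨C, hC0, hC⟩ := hf1.fderiv_bdd
  have hd : ∀ ζ : ι → ℝ, ∀ t : ℝ, HasDerivAt (fun t => f (z + t • hl s ζ))
      (fderiv ℝ f (z + t • hl s ζ) (hl s ζ)) t := by
    intro ζ t
    have h1 : HasDerivAt (fun t : ℝ => z + t • hl s ζ) (hl s ζ) t := by
      simpa using ((hasDerivAt_id t).smul_const (hl s ζ)).const_add z
    exact (hf1.diff _).hasFDerivAt.comp_hasDerivAt t h1
  have h := (hasDerivAt_integral_of_dominated_loc_of_deriv_le (μ := gν ι)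
    (F := fun t ζ => f (z + t • hl s ζ)) (x₀ := t)
    (F' := fun t ζ => fderiv ℝ f (z + t • hl s ζ) (hl s ζ))
    (bound := fun ζ => (C * ∑ k, ‖s k‖) * ‖ζ‖ ^ 1) Filter.univ_mem
    (Filter.Eventually.of_forall fun t =>
      (hf.cont.comp (heat_arg_cont s t z)).aestronglyMeasurable)
    (hf.heat_intble s t z)
    ((hf1.fderiv_cont.comp (heat_arg_cont s t z)).clm_apply (hl_cont s)).aestronglyMeasurable
    (Filter.Eventually.of_forall fun ζ t _ => by
      refine (ContinuousLinearMap.le_opNorm _ _).trans ?_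
      rw [mul_assoc, pow_one]
      exact mul_le_mul (hC _) (hl_bound s ζ) (norm_nonneg _) hC0)
    ((gmoment 1).const_mul _)
    (Filter.Eventually.of_forall fun ζ t _ => hd ζ t)).2
  have e : ∫ ζ, fderiv ℝ f (z + t • hl s ζ) (hl s ζ) ∂(gν ι) =
      t * _root_.heat s t (_root_.op s f) z := by
    have e1 : ∀ ζ : ι → ℝ, fderiv ℝ f (z + t • hl s ζ) (hl s ζ) =
        ∑ k, ζ k * _root_.pd (s k) f (z + t • hl s ζ) := by
      intro ζ
      conv_lhs => rw [hl.eq_1 s ζ]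
      simp only [map_sum, map_smul, smul_eq_mul, _root_.pd, hl]
    simp only [e1]
    rw [integral_finsetSum]
    · unfold _root_.op
      rw [heat_sum s _ (fun i => (hf.pd (s i)).pd (s i)) t, Finset.mul_sum]
      refine Finset.sum_congr rfl fun k _ => ?_
      exact (hf.pd (s k)).heat_stein s t z k
    · intro k _
      obtain ⟨D, hD⟩ := (hf.pd (s k)).bdd
      refine gint_poly ((continuous_apply k).mul
        ((hf.pd (s k)).cont.comp (heat_arg_cont s t z))) D 1 fun ζ => ?_
      rw [abs_mul, pow_one, mul_comm]
      exact mul_le_mul (hD _) (norm_le_pi_norm ζ k) (abs_nonneg _) ((abs_nonneg _).trans (hD 0))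
  rw [e] at h
  exact h

end heat

/-- A twice differentiable function of two real variables with explicit partial derivatives. -/
structure C2fn (Ψ Ψ1 Ψ2 Ψ11 Ψ12 Ψ22 : ℝ → ℝ → ℝ) : Prop where
  c0 : Continuous fun q : ℝ × ℝ => Ψ q.1 q.2
  c1 : Continuous fun q : ℝ × ℝ => Ψ1 q.1 q.2
  c2 : Continuous fun q : ℝ × ℝ => Ψ2 q.1 q.2
  c11 : Continuous fun q : ℝ × ℝ => Ψ11 q.1 q.2
  c12 : Continuous fun q : ℝ × ℝ => Ψ12 q.1 q.2
  c22 : Continuous fun q : ℝ × ℝ => Ψ22 q.1 q.2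
  d0 : ∀ (a b : ℝ → ℝ) (a' b' t : ℝ), HasDerivAt a a' t → HasDerivAt b b' t →
    HasDerivAt (fun t => Ψ (a t) (b t)) (Ψ1 (a t) (b t) * a' + Ψ2 (a t) (b t) * b') t
  d1 : ∀ (a b : ℝ → ℝ) (a' b' t : ℝ), HasDerivAt a a' t → HasDerivAt b b' t →
    HasDerivAt (fun t => Ψ1 (a t) (b t)) (Ψ11 (a t) (b t) * a' + Ψ12 (a t) (b t) * b') t
  d2 : ∀ (a b : ℝ → ℝ) (a' b' t : ℝ), HasDerivAt a a' t → HasDerivAt b b' t →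
    HasDerivAt (fun t => Ψ2 (a t) (b t)) (Ψ12 (a t) (b t) * a' + Ψ22 (a t) (b t) * b') t
  z : Ψ 0 0 = 0

lemma bdd_on_sq {F : ℝ → ℝ → ℝ} (hF : Continuous fun q : ℝ × ℝ => F q.1 q.2) (M : ℝ) :
    ∃ C, 0 ≤ C ∧ ∀ a b, |a| ≤ M → |b| ≤ M → |F a b| ≤ C := by
  have hc : IsCompact (Set.Icc (-M) M ×ˢ Set.Icc (-M) M) := isCompact_Icc.prod isCompact_Icc
  obtain ⟨C, hC⟩ := hc.exists_bound_of_continuousOn hF.continuousOn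
  exact ⟨max C 0, le_max_right _ _, fun a b ha hb =>
    (hC (a, b) ⟨abs_le.1 ha, abs_le.1 hb⟩).trans (le_max_left _ _)⟩

section flow
variable {N : ℕ} {ι : Type} [Fintype ι]
variable {Ψ Ψ1 Ψ2 Ψ11 Ψ12 Ψ22 : ℝ → ℝ → ℝ}

lemma hasDerivAt_line {u : Pt N → ℝ} (hu : Differentiable ℝ u) (z v : Pt N) :
    HasDerivAt (fun t : ℝ => u (z + t • v)) (pd v u z) 0 := by
  have := (hu z).hasFDerivAt.hasLineDerivAt v
  exact this

lemma Nice.common_bound {k l : ℕ} {u v : Pt N → ℝ} (hu : Nice k u) (hv : Nice l v) :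
    ∃ M, (∀ z, |u z| ≤ M) ∧ ∀ z, |v z| ≤ M := by
  obtain ⟨C, hC⟩ := hu.bdd
  obtain ⟨D, hD⟩ := hv.bdd
  exact ⟨max C D, fun z => (hC z).trans (le_max_left _ _), fun z => (hD z).trans (le_max_right _ _)⟩

lemma comp_int {F : ℝ → ℝ → ℝ} (hF : Continuous fun q : ℝ × ℝ => F q.1 q.2) {k l : ℕ}
    {u v w : Pt N → ℝ} (hu : Nice k u) (hv : Nice l v) (hw : Integrable w) :
    Integrable fun z => F (u z) (v z) * w z := by
  obtain ⟨M, h1, h2⟩ := hu.common_bound hv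
  obtain ⟨C, -, hC⟩ := bdd_on_sq hF M
  refine hw.bdd_mul (c := C) ?_ (Filter.Eventually.of_forall fun z => hC _ _ (h1 z) (h2 z))
  exact (hF.comp (hu.cont.prodMk hv.cont)).aestronglyMeasurable

lemma Nice.mul_int {k l : ℕ} {u v : Pt N → ℝ} (hu : Nice k u) (hv : Nice l v) :
    Integrable fun z => u z * v z := by
  obtain ⟨C, hC⟩ := hu.bdd
  exact hv.int.bdd_mul (c := C) hu.cont.aestronglyMeasurable (Filter.Eventually.of_forall hC)

lemma ibp_dir {F F1 F2 : ℝ → ℝ → ℝ} (hF : Continuous fun q : ℝ × ℝ => F q.1 q.2)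
    (hF1 : Continuous fun q : ℝ × ℝ => F1 q.1 q.2) (hF2 : Continuous fun q : ℝ × ℝ => F2 q.1 q.2)
    (hd : ∀ (a b : ℝ → ℝ) (a' b' t : ℝ), HasDerivAt a a' t → HasDerivAt b b' t →
      HasDerivAt (fun t => F (a t) (b t)) (F1 (a t) (b t) * a' + F2 (a t) (b t) * b') t)
    {u v w : Pt N → ℝ} (hu : Nice 1 u) (hv : Nice 1 v) (hw : Nice 1 w) (e : Pt N) :
    ∫ z, F (u z) (v z) * pd e w z =
      - ∫ z, (F1 (u z) (v z) * pd e u z + F2 (u z) (v z) * pd e v z) * w z := by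
  refine integral_bilinear_hasLineDerivAt_right_eq_neg_left_of_integrable
    (B := ContinuousLinearMap.mul ℝ ℝ) (v := e) (μ := volume)
    (f := fun z => F (u z) (v z)) (g := w) (g' := fun z => pd e w z)
    (f' := fun z => F1 (u z) (v z) * pd e u z + F2 (u z) (v z) * pd e v z) ?_ ?_ ?_ ?_ ?_
  · have h1 := comp_int hF1 hu hv ((hu.pd e).mul_int hw)
    have h2 := comp_int hF2 hu hv ((hv.pd e).mul_int hw)
    refine (h1.add h2).congr (Filter.Eventually.of_forall fun z => ?_)
    simp; ring
  · exact comp_int hF hu hv (hw.pd e).int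
  · exact comp_int hF hu hv hw.int
  · intro z _
    have := hd (fun t => u (z + t • e)) (fun t => v (z + t • e)) _ _ 0
      (hasDerivAt_line hu.diff z e) (hasDerivAt_line hv.diff z e)
    simpa [HasLineDerivAt] using this
  · intro z _
    exact hasDerivAt_line hw.diff z e

variable (s : ι → Pt N)

/-- the Hessian energy density -/
def Hd (Ψ11 Ψ12 Ψ22 : ℝ → ℝ → ℝ) (u v : Pt N → ℝ) (z : Pt N) : ℝ :=
  ∑ k, (Ψ11 (u z) (v z) * pd (s k) u z ^ 2 + 2 * Ψ12 (u z) (v z) * (pd (s k) u z * pd (s k) v z)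
    + Ψ22 (u z) (v z) * pd (s k) v z ^ 2)

lemma Hd_int (h : C2fn Ψ Ψ1 Ψ2 Ψ11 Ψ12 Ψ22) {u v : Pt N → ℝ} (hu : Nice 1 u) (hv : Nice 1 v) :
    Integrable (Hd s Ψ11 Ψ12 Ψ22 u v) := by
  refine integrable_finsetSum _ fun k _ => ?_
  have h1 := comp_int h.c11 hu hv ((hu.pd (s k)).mul_int (hu.pd (s k)))
  have h2 := (comp_int h.c12 hu hv ((hu.pd (s k)).mul_int (hv.pd (s k)))).const_mul 2
  have h3 := comp_int h.c22 hu hv ((hv.pd (s k)).mul_int (hv.pd (s k)))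
  refine ((h1.add h2).add h3).congr (Filter.Eventually.of_forall fun z => ?_)
  simp; ring

lemma flow_ibp (h : C2fn Ψ Ψ1 Ψ2 Ψ11 Ψ12 Ψ22) {u v : Pt N → ℝ} (hu : Nice 2 u) (hv : Nice 2 v) :
    ∫ z, (Ψ1 (u z) (v z) * op s u z + Ψ2 (u z) (v z) * op s v z) =
      - ∫ z, Hd s Ψ11 Ψ12 Ψ22 u v z := by
  have hu1 : Nice 1 u := hu.mono (by omega)
  have hv1 : Nice 1 v := hv.mono (by omega)
  have e1 : ∀ z, Ψ1 (u z) (v z) * op s u z + Ψ2 (u z) (v z) * op s v z =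
      ∑ k, (Ψ1 (u z) (v z) * pd (s k) (pd (s k) u) z + Ψ2 (u z) (v z) * pd (s k) (pd (s k) v) z) := by
    intro z; rw [op, op, Finset.mul_sum, Finset.mul_sum, Finset.sum_add_distrib]
  simp only [e1]
  have i1 := fun k => comp_int h.c1 hu hv ((hu.pd (s k)).pd (s k)).int
  have i2 := fun k => comp_int h.c2 hu hv ((hv.pd (s k)).pd (s k)).int
  have i12 : ∀ k, Integrable fun z => Ψ1 (u z) (v z) * pd (s k) (pd (s k) u) z +
      Ψ2 (u z) (v z) * pd (s k) (pd (s k) v) z := fun k => (i1 k).add (i2 k)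
  rw [integral_finsetSum _ fun k _ => i12 k]
  unfold Hd
  have j1 := fun k => comp_int h.c11 hu hv ((hu.pd (s k)).mul_int (hu.pd (s k)))
  have j2 := fun k => (comp_int h.c12 hu hv ((hu.pd (s k)).mul_int (hv.pd (s k))))
  have j3 := fun k => comp_int h.c22 hu hv ((hv.pd (s k)).mul_int (hv.pd (s k)))
  rw [integral_finsetSum, ← Finset.sum_neg_distrib]
  · refine Finset.sum_congr rfl fun k _ => ?_
    rw [integral_add (i1 k) (i2 k), ibp_dir h.c1 h.c11 h.c12 h.d1 hu1 hv1 (hu.pd (s k)) (s k),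
      ibp_dir h.c2 h.c12 h.c22 h.d2 hu1 hv1 (hv.pd (s k)) (s k), ← neg_add, ← integral_add]
    · congr 2; funext z; ring
    · refine ((j1 k).add (j2 k)).congr (Filter.Eventually.of_forall fun z => ?_)
      simp; ring
    · refine ((j2 k).add (j3 k)).congr (Filter.Eventually.of_forall fun z => ?_)
      simp; ring
  · intro k _
    refine (((j1 k).add ((j2 k).const_mul 2)).add (j3 k)).congr
      (Filter.Eventually.of_forall fun z => ?_)
    simp; ring

lemma psi_lin (h : C2fn Ψ Ψ1 Ψ2 Ψ11 Ψ12 Ψ22) (M : ℝ) :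
    ∃ C, ∀ a b, |a| ≤ M → |b| ≤ M → |Ψ a b| ≤ C * (|a| + |b|) := by
  obtain ⟨C, hC0, hC⟩ := bdd_on_sq h.c1 M
  obtain ⟨D, hD0, hD⟩ := bdd_on_sq h.c2 M
  refine ⟨C + D, fun a b ha hb => ?_⟩
  have key := norm_image_sub_le_of_norm_deriv_le_segment_01' (f := fun t : ℝ => Ψ (t * a) (t * b))
    (f' := fun t => Ψ1 (t * a) (t * b) * a + Ψ2 (t * a) (t * b) * b)
    (C := C * |a| + D * |b|) ?_ ?_
  · simp only [one_mul, zero_mul, h.z, sub_zero] at key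
    refine key.trans ?_
    nlinarith [abs_nonneg a, abs_nonneg b]
  · intro t _
    have := h.d0 (fun t => t * a) (fun t => t * b) a b t (by simpa using (hasDerivAt_id t).mul_const a)
      (by simpa using (hasDerivAt_id t).mul_const b)
    exact this.hasDerivWithinAt
  · intro t ht
    have hta : ∀ x : ℝ, |x| ≤ M → |t * x| ≤ M := by
      intro x hx
      rw [abs_mul, abs_of_nonneg ht.1]
      nlinarith [abs_nonneg x, ht.2]
    refine (norm_add_le _ _).trans ?_
    rw [norm_mul, norm_mul]
    exact add_le_add
      (mul_le_mul_of_nonneg_right (hC _ _ (hta a ha) (hta b hb)) (norm_nonneg _))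
      (mul_le_mul_of_nonneg_right (hD _ _ (hta a ha) (hta b hb)) (norm_nonneg _))

lemma psi_int (h : C2fn Ψ Ψ1 Ψ2 Ψ11 Ψ12 Ψ22) {u v : Pt N → ℝ} (hu : Nice 0 u) (hv : Nice 0 v) :
    Integrable fun z => Ψ (u z) (v z) := by
  obtain ⟨M, h1, h2⟩ := hu.common_bound hv
  obtain ⟨C, hC⟩ := psi_lin h M
  refine ((hu.int.abs.add hv.int.abs).const_mul C).mono'
    (h.c0.comp (hu.cont.prodMk hv.cont)).aestronglyMeasurable
    (Filter.Eventually.of_forall fun z => hC _ _ (h1 z) (h2 z))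

/-- The flow lemma. -/
theorem flow (h : C2fn Ψ Ψ1 Ψ2 Ψ11 Ψ12 Ψ22) {f g : Pt N → ℝ} (hf : Nice 2 f) (hg : Nice 2 g)
    {T : ℝ} (hT : 0 ≤ T) :
    IntervalIntegrable (fun t => t * ∫ z, Hd s Ψ11 Ψ12 Ψ22 (heat s t f) (heat s t g) z) volume 0 T ∧
    ∫ t in (0:ℝ)..T, t * ∫ z, Hd s Ψ11 Ψ12 Ψ22 (heat s t f) (heat s t g) z =
      (∫ z, Ψ (f z) (g z)) - ∫ z, Ψ (heat s T f z) (heat s T g z) := by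
  have hf0 := hf.zero
  have hg0 := hg.zero
  have hof := hf.op (k := 0) s
  have hog := hg.op (k := 0) s
  set G : ℝ → Pt N → ℝ := fun t z =>
    Ψ1 (heat s t f z) (heat s t g z) * (t * heat s t (op s f) z) +
    Ψ2 (heat s t f z) (heat s t g z) * (t * heat s t (op s g) z) with hGdef
  have hcf := heat_cont_joint s hf.cont hf.bdd
  have hcg := heat_cont_joint s hg.cont hg.bdd
  have hcof := heat_cont_joint s hof.cont hof.bdd
  have hcog := heat_cont_joint s hog.cont hog.bdd
  have hGc : Continuous fun q : ℝ × Pt N => G q.1 q.2 := by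
    have a1 : Continuous fun q : ℝ × Pt N => Ψ1 (heat s q.1 f q.2) (heat s q.1 g q.2) :=
      h.c1.comp (hcf.prodMk hcg)
    have a2 : Continuous fun q : ℝ × Pt N => Ψ2 (heat s q.1 f q.2) (heat s q.1 g q.2) :=
      h.c2.comp (hcf.prodMk hcg)
    exact (a1.mul (continuous_fst.mul hcof)).add (a2.mul (continuous_fst.mul hcog))
  have hGt : ∀ t, (∫ z, G t z) = - (t * ∫ z, Hd s Ψ11 Ψ12 Ψ22 (heat s t f) (heat s t g) z) := by
    intro t
    have := flow_ibp s h (hf.heat s t) (hg.heat s t)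
    rw [hf.heat_op s t, hg.heat_op s t] at this
    rw [← mul_neg, ← this, ← integral_const_mul]
    congr 1; funext z; simp only [hGdef]; ring
  have hGz : ∀ t, Integrable (G t) := by
    intro t
    have i1 := (comp_int h.c1 (hf.heat s t) (hg.heat s t) (hof.heat s t).int).const_mul t
    have i2 := (comp_int h.c2 (hf.heat s t) (hg.heat s t) (hog.heat s t).int).const_mul t
    refine (i1.add i2).congr (Filter.Eventually.of_forall fun z => ?_)
    simp [hGdef]; ring
  have hintg : Integrable (fun q : ℝ × Pt N => G q.1 q.2)
      ((volume.restrict (Set.Ioc 0 T)).prod volume) := by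
    rw [integrable_prod_iff hGc.aestronglyMeasurable]
    refine ⟨Filter.Eventually.of_forall fun t => hGz t, ?_⟩
    obtain ⟨M, h1, h2⟩ := hf.common_bound hg
    obtain ⟨C, hC0, hC⟩ := bdd_on_sq h.c1 M
    obtain ⟨D, hD0, hD⟩ := bdd_on_sq h.c2 M
    refine (integrable_const (T * (C * (∫ z, |op s f z|) + D * ∫ z, |op s g z|))).mono'
      hGc.aestronglyMeasurable.norm.integral_prod_right' ?_
    rw [ae_restrict_iff' measurableSet_Ioc]
    refine Filter.Eventually.of_forall fun t ht => ?_
    rw [Real.norm_of_nonneg (integral_nonneg fun z => norm_nonneg _)]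
    calc ∫ z, ‖G t z‖ ≤ ∫ z, T * (C * |heat s t (op s f) z| + D * |heat s t (op s g) z|) := by
          refine integral_mono (hGz t).norm
            ((((hof.heat s t).int.abs.const_mul C).add ((hog.heat s t).int.abs.const_mul D)).const_mul T)
            fun z => ?_
          have b1 := hC _ _ (heat_bound s h1 t z) (heat_bound s h2 t z)
          have b2 := hD _ _ (heat_bound s h1 t z) (heat_bound s h2 t z)
          simp only [hGdef]
          refine (norm_add_le _ _).trans ?_
          rw [norm_mul, norm_mul, norm_mul, norm_mul, Real.norm_of_nonneg ht.1.le, mul_add]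
          refine add_le_add ?_ ?_
          · calc _ ≤ C * (T * |heat s t (op s f) z|) := by
                  refine mul_le_mul b1 ?_ (mul_nonneg ht.1.le (norm_nonneg _)) hC0
                  exact mul_le_mul_of_nonneg_right ht.2 (norm_nonneg _)
              _ = _ := by ring
          · calc _ ≤ D * (T * |heat s t (op s g) z|) := by
                  refine mul_le_mul b2 ?_ (mul_nonneg ht.1.le (norm_nonneg _)) hD0
                  exact mul_le_mul_of_nonneg_right ht.2 (norm_nonneg _)
              _ = _ := by ring
      _ = T * (C * (∫ z, |heat s t (op s f) z|) + D * ∫ z, |heat s t (op s g) z|) := by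
          rw [integral_const_mul, integral_add ((hof.heat s t).int.abs.const_mul C)
            ((hog.heat s t).int.abs.const_mul D), integral_const_mul, integral_const_mul]
      _ ≤ _ := by
          have := heat_norm_int_le s hof t
          have := heat_norm_int_le s hog t
          gcongr
  have ftc : ∀ z, ∫ t in (0:ℝ)..T, G t z =
      Ψ (heat s T f z) (heat s T g z) - Ψ (f z) (g z) := by
    intro z
    have := intervalIntegral.integral_eq_sub_of_hasDerivAt (a := 0) (b := T)
      (f := fun t => Ψ (heat s t f z) (heat s t g z)) (f' := fun t => G t z)
      (fun t _ => h.d0 _ _ _ _ t (hf.heat_deriv s t z) (hg.heat_deriv s t z))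
      ((hGc.comp (Continuous.prodMk_left z)).intervalIntegrable _ _)
    rw [this, heat_zero, heat_zero]
  have hswap := integral_integral_swap (f := G) hintg
  have hI : IntegrableOn (fun t => ∫ z, G t z) (Set.Ioc 0 T) := hintg.integral_prod_left
  simp only [hGt] at hI
  constructor
  · rw [intervalIntegrable_iff_integrableOn_Ioc_of_le hT]
    simpa using hI.neg
  · have e1 : ∫ t in (0:ℝ)..T, t * ∫ z, Hd s Ψ11 Ψ12 Ψ22 (heat s t f) (heat s t g) z =
        - ∫ t in Set.Ioc 0 T, ∫ z, G t z := by
      rw [intervalIntegral.integral_of_le hT, ← integral_neg]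
      congr 1; funext t; rw [hGt, neg_neg]
    rw [e1, hswap]
    have e2 : ∀ z, ∫ t in Set.Ioc 0 T, G t z =
        Ψ (heat s T f z) (heat s T g z) - Ψ (f z) (g z) := by
      intro z; rw [← ftc z, intervalIntegral.integral_of_le hT]
    simp only [e2]
    rw [integral_sub (psi_int h (hf0.heat s T) (hg0.heat s T)) (psi_int h hf0 hg0)]
    ring

end flow

lemma C2fn.add {F F1 F2 F11 F12 F22 G G1 G2 G11 G12 G22 : ℝ → ℝ → ℝ}
    (hF : C2fn F F1 F2 F11 F12 F22) (hG : C2fn G G1 G2 G11 G12 G22) :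
    C2fn (fun a b => F a b + G a b) (fun a b => F1 a b + G1 a b) (fun a b => F2 a b + G2 a b)
      (fun a b => F11 a b + G11 a b) (fun a b => F12 a b + G12 a b)
      (fun a b => F22 a b + G22 a b) where
  c0 := hF.c0.add hG.c0
  c1 := hF.c1.add hG.c1
  c2 := hF.c2.add hG.c2
  c11 := hF.c11.add hG.c11
  c12 := hF.c12.add hG.c12
  c22 := hF.c22.add hG.c22
  d0 := fun a b a' b' t ha hb => by
    exact HasDerivAt.congr_deriv ((hF.d0 a b a' b' t ha hb).add (hG.d0 a b a' b' t ha hb)) (by ring)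
  d1 := fun a b a' b' t ha hb => by
    exact HasDerivAt.congr_deriv ((hF.d1 a b a' b' t ha hb).add (hG.d1 a b a' b' t ha hb)) (by ring)
  d2 := fun a b a' b' t ha hb => by
    exact HasDerivAt.congr_deriv ((hF.d2 a b a' b' t ha hb).add (hG.d2 a b a' b' t ha hb)) (by ring)
  z := by simp [hF.z, hG.z]

lemma C2fn.swap {F F1 F2 F11 F12 F22 : ℝ → ℝ → ℝ}
    (hF : C2fn F F1 F2 F11 F12 F22) :
    C2fn (fun a b => F b a) (fun a b => F2 b a) (fun a b => F1 b a)
      (fun a b => F22 b a) (fun a b => F12 b a) (fun a b => F11 b a) where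
  c0 := hF.c0.comp continuous_swap
  c1 := hF.c2.comp continuous_swap
  c2 := hF.c1.comp continuous_swap
  c11 := hF.c22.comp continuous_swap
  c12 := hF.c12.comp continuous_swap
  c22 := hF.c11.comp continuous_swap
  d0 := fun a b a' b' t ha hb => by
    exact HasDerivAt.congr_deriv ((hF.d0 b a b' a' t hb ha)) (by ring)
  d1 := fun a b a' b' t ha hb => by
    exact HasDerivAt.congr_deriv ((hF.d2 b a b' a' t hb ha)) (by ring)
  d2 := fun a b a' b' t ha hb => by
    exact HasDerivAt.congr_deriv ((hF.d1 b a b' a' t hb ha)) (by ring)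
  z := hF.z

lemma C2fn.const_mul {F F1 F2 F11 F12 F22 : ℝ → ℝ → ℝ} (c : ℝ)
    (hF : C2fn F F1 F2 F11 F12 F22) :
    C2fn (fun a b => c * F a b) (fun a b => c * F1 a b) (fun a b => c * F2 a b)
      (fun a b => c * F11 a b) (fun a b => c * F12 a b) (fun a b => c * F22 a b) where
  c0 := hF.c0.const_mul c
  c1 := hF.c1.const_mul c
  c2 := hF.c2.const_mul c
  c11 := hF.c11.const_mul c
  c12 := hF.c12.const_mul c
  c22 := hF.c22.const_mul c
  d0 := fun a b a' b' t ha hb => by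
    exact HasDerivAt.congr_deriv ((hF.d0 a b a' b' t ha hb).const_mul c) (by ring)
  d1 := fun a b a' b' t ha hb => by
    exact HasDerivAt.congr_deriv ((hF.d1 a b a' b' t ha hb).const_mul c) (by ring)
  d2 := fun a b a' b' t ha hb => by
    exact HasDerivAt.congr_deriv ((hF.d2 a b a' b' t ha hb).const_mul c) (by ring)
  z := by simp [hF.z]

lemma C2fn_mul : C2fn (fun a b => a * b) (fun _ b => b) (fun a _ => a)
    (fun _ _ => 0) (fun _ _ => 1) (fun _ _ => 0) where
  c0 := continuous_fst.mul continuous_snd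
  c1 := continuous_snd
  c2 := continuous_fst
  c11 := continuous_const
  c12 := continuous_const
  c22 := continuous_const
  d0 := fun a b a' b' t ha hb => by exact HasDerivAt.congr_deriv (ha.mul hb) (by ring)
  d1 := fun a b a' b' t ha hb => by exact HasDerivAt.congr_deriv (hb) (by ring)
  d2 := fun a b a' b' t ha hb => by exact HasDerivAt.congr_deriv (ha) (by ring)
  z := by simp

section bell
variable {κ : ℝ}

lemma sq_cont (κ r : ℝ) (hκ : 0 < κ) : Continuous fun a : ℝ => (a ^ 2 + κ ^ 2) ^ r :=
  Continuous.rpow_const (by fun_prop) fun a => Or.inl (by positivity)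

lemma sq_deriv (hκ : 0 < κ) (r : ℝ) {a : ℝ → ℝ} {a' t : ℝ} (ha : HasDerivAt a a' t) :
    HasDerivAt (fun t => (a t ^ 2 + κ ^ 2) ^ r)
      (2 * r * a t * (a t ^ 2 + κ ^ 2) ^ (r - 1) * a') t := by
  have h1 : HasDerivAt (fun t => a t ^ 2 + κ ^ 2) (2 * a t * a') t := by
    simpa using (ha.pow 2).add_const (κ ^ 2)
  exact HasDerivAt.congr_deriv (h1.rpow_const (p := r) (Or.inl (by positivity))) (by ring)

lemma C2fn_sq (hκ : 0 < κ) (r : ℝ) : C2fn (fun a _ => (a ^ 2 + κ ^ 2) ^ r - (κ ^ 2) ^ r)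
    (fun a _ => 2 * r * a * (a ^ 2 + κ ^ 2) ^ (r - 1)) (fun _ _ => 0)
    (fun a _ => 2 * r * (a ^ 2 + κ ^ 2) ^ (r - 1) +
      4 * r * (r - 1) * a ^ 2 * (a ^ 2 + κ ^ 2) ^ (r - 1 - 1))
    (fun _ _ => 0) (fun _ _ => 0) where
  c0 := ((sq_cont κ r hκ).comp continuous_fst).sub continuous_const
  c1 := (continuous_const.mul continuous_fst).mul ((sq_cont κ (r-1) hκ).comp continuous_fst)
  c2 := continuous_const
  c11 := (continuous_const.mul ((sq_cont κ (r-1) hκ).comp continuous_fst)).add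
    ((continuous_const.mul (continuous_fst.pow 2)).mul
      ((sq_cont κ (r-1-1) hκ).comp continuous_fst))
  c12 := continuous_const
  c22 := continuous_const
  d0 := fun a b a' b' t ha hb => by
    exact HasDerivAt.congr_deriv ((sq_deriv hκ r ha).sub_const ((κ^2)^r)) (by ring)
  d1 := fun a b a' b' t ha hb => by
    exact HasDerivAt.congr_deriv ((ha.const_mul (2 * r)).mul (sq_deriv hκ (r - 1) ha)) (by ring)
  d2 := fun a b a' b' t ha hb => by simpa using hasDerivAt_const t (0 : ℝ)
  z := by simp

/-- auxiliary functions of Bellman type -/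
def bS (κ v : ℝ) : ℝ := v ^ 2 + κ ^ 2
def bM (κ q u v : ℝ) : ℝ := bS κ v ^ q + bS κ v * u ^ 2
def bMv (κ q u v : ℝ) : ℝ := 2 * v * (q * bS κ v ^ (q - 1) + u ^ 2)
def bMvv (κ q u v : ℝ) : ℝ := 2 * (q * bS κ v ^ (q - 1) + u ^ 2) +
  4 * v ^ 2 * q * (q - 1) * bS κ v ^ (q - 1 - 1)
def bR (κ q u v : ℝ) : ℝ := √(bM κ q u v)

lemma bS_pos (hκ : 0 < κ) (v : ℝ) : 0 < bS κ v := by unfold bS; positivity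
lemma bM_pos (hκ : 0 < κ) (q u v : ℝ) : 0 < bM κ q u v := by
  have := bS_pos hκ v
  unfold bM; positivity
lemma bR_pos (hκ : 0 < κ) (q u v : ℝ) : 0 < bR κ q u v := Real.sqrt_pos.2 (bM_pos hκ q u v)
lemma bR_sq (hκ : 0 < κ) (q u v : ℝ) : bR κ q u v ^ 2 = bM κ q u v :=
  Real.sq_sqrt (bM_pos hκ q u v).le

lemma bSr_cont (hκ : 0 < κ) (r : ℝ) : Continuous fun z : ℝ × ℝ => bS κ z.2 ^ r :=
  (sq_cont κ r hκ).comp continuous_snd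
lemma bM_cont (hκ : 0 < κ) (q : ℝ) : Continuous fun z : ℝ × ℝ => bM κ q z.1 z.2 := by
  unfold bM
  have := bSr_cont hκ q
  refine this.add ?_
  unfold bS; fun_prop
lemma bR_cont (hκ : 0 < κ) (q : ℝ) : Continuous fun z : ℝ × ℝ => bR κ q z.1 z.2 :=
  (bM_cont hκ q).sqrt
lemma bMv_cont (hκ : 0 < κ) (q : ℝ) : Continuous fun z : ℝ × ℝ => bMv κ q z.1 z.2 := by
  unfold bMv
  have := bSr_cont hκ (q - 1)
  fun_prop
lemma bMvv_cont (hκ : 0 < κ) (q : ℝ) : Continuous fun z : ℝ × ℝ => bMvv κ q z.1 z.2 := by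
  unfold bMvv
  have := bSr_cont hκ (q - 1)
  have := bSr_cont hκ (q - 1 - 1)
  fun_prop

lemma bS_deriv {b : ℝ → ℝ} {b' t : ℝ} (hb : HasDerivAt b b' t) :
    HasDerivAt (fun t => bS κ (b t)) (2 * b t * b') t := by
  unfold bS
  simpa using (hb.pow 2).add_const (κ ^ 2)

lemma bM_deriv (hκ : 0 < κ) (q : ℝ) {a b : ℝ → ℝ} {a' b' t : ℝ} (ha : HasDerivAt a a' t)
    (hb : HasDerivAt b b' t) :
    HasDerivAt (fun t => bM κ q (a t) (b t))
      (2 * bS κ (b t) * a t * a' + bMv κ q (a t) (b t) * b') t := by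
  refine HasDerivAt.congr_deriv ((sq_deriv hκ q hb).add ((bS_deriv (κ := κ) hb).mul (ha.pow 2))) ?_
  simp [bMv, bS]; ring

lemma bR_deriv (hκ : 0 < κ) (q : ℝ) {a b : ℝ → ℝ} {a' b' t : ℝ} (ha : HasDerivAt a a' t)
    (hb : HasDerivAt b b' t) :
    HasDerivAt (fun t => bR κ q (a t) (b t))
      ((2 * bS κ (b t) * a t * a' + bMv κ q (a t) (b t) * b') / (2 * bR κ q (a t) (b t))) t :=
  (bM_deriv hκ q ha hb).sqrt (bM_pos hκ q _ _).ne'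

lemma bMv_deriv (hκ : 0 < κ) (q : ℝ) {a b : ℝ → ℝ} {a' b' t : ℝ} (ha : HasDerivAt a a' t)
    (hb : HasDerivAt b b' t) :
    HasDerivAt (fun t => bMv κ q (a t) (b t))
      (4 * b t * a t * a' + bMvv κ q (a t) (b t) * b') t := by
  refine HasDerivAt.congr_deriv ((hb.const_mul 2).mul (((sq_deriv hκ (q - 1) hb).const_mul q).add (ha.pow 2))) ?_
  simp [bMvv, bS]; ring

lemma C2fn_R (hκ : 0 < κ) (q : ℝ) : C2fn (fun u v => bR κ q u v - bR κ q 0 0)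
    (fun u v => bS κ v * u / bR κ q u v) (fun u v => bMv κ q u v / (2 * bR κ q u v))
    (fun u v => bS κ v * (bM κ q u v - bS κ v * u ^ 2) / bR κ q u v ^ 3)
    (fun u v => (4 * u * v * bM κ q u v - bS κ v * u * bMv κ q u v) / (2 * bR κ q u v ^ 3))
    (fun u v => (2 * bM κ q u v * bMvv κ q u v - bMv κ q u v ^ 2) / (4 * bR κ q u v ^ 3)) where
  c0 := (bR_cont hκ q).sub continuous_const
  c1 := by
    have := bR_cont hκ q
    refine Continuous.div ?_ this fun z => (bR_pos hκ _ _ _).ne'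
    unfold bS; fun_prop
  c2 := by
    have := bR_cont hκ q
    have := bMv_cont hκ q
    refine Continuous.div (by fun_prop) (by fun_prop) fun z =>
      (mul_pos two_pos (bR_pos hκ q _ _)).ne'
  c11 := by
    have := bR_cont hκ q
    have := bM_cont hκ q
    refine Continuous.div ?_ (by fun_prop) fun z => (pow_pos (bR_pos hκ q _ _) 3).ne'
    unfold bS; fun_prop
  c12 := by
    have := bR_cont hκ q
    have := bM_cont hκ q
    have := bMv_cont hκ q
    refine Continuous.div ?_ (by fun_prop) fun z =>
      (mul_pos two_pos (pow_pos (bR_pos hκ q _ _) 3)).ne'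
    unfold bS; fun_prop
  c22 := by
    have := bR_cont hκ q
    have := bM_cont hκ q
    have := bMv_cont hκ q
    have := bMvv_cont hκ q
    refine Continuous.div (by fun_prop) (by fun_prop) fun z =>
      (mul_pos four_pos (pow_pos (bR_pos hκ q _ _) 3)).ne'
  d0 := fun a b a' b' t ha hb => by
    refine HasDerivAt.congr_deriv ((bR_deriv hκ q ha hb).sub_const (bR κ q 0 0)) ?_
    have := bR_pos hκ q (a t) (b t)
    field_simp
  d1 := fun a b a' b' t ha hb => by
    have hp := bR_pos hκ q (a t) (b t)
    have h2 := bR_sq hκ q (a t) (b t)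
    refine HasDerivAt.congr_deriv (((bS_deriv (κ := κ) hb).mul ha).div (bR_deriv hκ q ha hb) hp.ne') ?_
    simp only [Pi.mul_apply]
    rw [← h2]
    field_simp
    ring
  d2 := fun a b a' b' t ha hb => by
    have hp := bR_pos hκ q (a t) (b t)
    have h2 := bR_sq hκ q (a t) (b t)
    refine HasDerivAt.congr_deriv ((bMv_deriv hκ q ha hb).div ((bR_deriv hκ q ha hb).const_mul 2)
      (mul_pos two_pos hp).ne') ?_
    rw [← h2]
    field_simp
    ring
  z := by simp

lemma bM_uu (q u v : ℝ) : bM κ q u v - bS κ v * u ^ 2 = bS κ v ^ q := by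
  unfold bM; ring

lemma bSq (hκ : 0 < κ) (q v : ℝ) : bS κ v ^ q = bS κ v * bS κ v ^ (q - 1) := by
  rw [Real.rpow_sub_one (bS_pos hκ v).ne']
  have := bS_pos hκ v
  field_simp

lemma v_le_bS (v : ℝ) : v ^ 2 ≤ bS κ v := by unfold bS; nlinarith [sq_nonneg κ]

lemma bR_uv_le (hκ : 0 < κ) {q : ℝ} (hq1 : 1 ≤ q) (hq2 : q ≤ 2) (u v : ℝ) :
    |(4 * u * v * bM κ q u v - bS κ v * u * bMv κ q u v) / (2 * bR κ q u v ^ 3)| ≤ 1 := by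
  have hp := bR_pos hκ q u v
  have h2 := bR_sq hκ q u v
  have hS := bS_pos hκ v
  have hX : 0 < bS κ v ^ (q - 1) := Real.rpow_pos_of_pos hS _
  have hv := v_le_bS (κ := κ) v
  have hM : bM κ q u v = bS κ v * (bS κ v ^ (q - 1) + u ^ 2) := by
    rw [bM, bSq hκ]; ring
  rw [abs_div, abs_of_pos (by positivity : 0 < 2 * bR κ q u v ^ 3), div_le_one (by positivity)]
  have e1 : 4 * u * v * bM κ q u v - bS κ v * u * bMv κ q u v =
      2 * ((u * v) * (bS κ v * ((2 - q) * bS κ v ^ (q - 1) + u ^ 2))) := by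
    rw [hM, bMv]; ring
  rw [e1, abs_mul, abs_mul, abs_of_pos (two_pos : (0:ℝ) < 2)]
  have huv : |u * v| ≤ bR κ q u v := by
    refine abs_le_of_sq_le_sq ?_ hp.le
    rw [h2, hM]
    nlinarith [mul_le_mul_of_nonneg_right hv (sq_nonneg u), mul_pos hS hX]
  have h3 : |bS κ v * ((2 - q) * bS κ v ^ (q - 1) + u ^ 2)| ≤ bR κ q u v ^ 2 := by
    rw [abs_of_nonneg (mul_nonneg hS.le (add_nonneg (mul_nonneg (by linarith) hX.le) (sq_nonneg u))), h2, hM]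
    refine mul_le_mul_of_nonneg_left ?_ hS.le
    nlinarith
  calc _ ≤ 2 * (bR κ q u v * bR κ q u v ^ 2) := by gcongr
    _ = _ := by ring

lemma bR_vv_nonneg (hκ : 0 < κ) {q : ℝ} (hq1 : 1 ≤ q) (u v : ℝ) :
    0 ≤ (2 * bM κ q u v * bMvv κ q u v - bMv κ q u v ^ 2) / (4 * bR κ q u v ^ 3) := by
  have hp := bR_pos hκ q u v
  have hS := bS_pos hκ v
  have hX : 0 < bS κ v ^ (q - 1) := Real.rpow_pos_of_pos hS _
  have hv := v_le_bS (κ := κ) v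
  refine div_nonneg ?_ (by positivity)
  have hM : bM κ q u v = bS κ v * (bS κ v ^ (q - 1) + u ^ 2) := by
    rw [bM, bSq hκ]; ring
  rw [hM, bMvv, bMv]
  have hb := bSq hκ (q - 1) v
  set X := bS κ v ^ (q - 1)
  set Z := bS κ v ^ (q - 1 - 1)
  set S := bS κ v
  have e : 2 * (S * (X + u ^ 2)) * (2 * (q * X + u ^ 2) + 4 * v ^ 2 * q * (q - 1) * Z) -
      (2 * v * (q * X + u ^ 2)) ^ 2 = 4 * (S - v ^ 2) * ((X + u ^ 2) * (q * X + u ^ 2)) +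
      4 * v ^ 2 * ((q - 1) * X * (q * X + (2 * q - 1) * u ^ 2)) := by
    have : S * (X + u^2) * (4 * v ^ 2 * q * (q - 1) * Z) =
        (X + u^2) * (4 * v ^ 2 * q * (q - 1) * X) := by rw [hb]; ring
    linear_combination 2 * this
  rw [e]
  have : 0 ≤ S - v ^ 2 := by linarith
  have : 0 ≤ q - 1 := by linarith
  have : 0 ≤ 2 * q - 1 := by linarith
  positivity

end bell

section bell2
variable {N : ℕ} {ι : Type} [Fintype ι]
variable {Ψ Ψ1 Ψ2 Ψ11 Ψ12 Ψ22 : ℝ → ℝ → ℝ}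

lemma hess_low {A B C α β x y : ℝ} (hA : α ≤ A) (hC : β ≤ C) (hB : |B| ≤ 1) (hα : 0 ≤ α)
    (hβ : 0 ≤ β) (hab : 4 ≤ α * β) : (α * x ^ 2 + β * y ^ 2) / 2 ≤
      A * x ^ 2 + 2 * B * (x * y) + C * y ^ 2 := by
  have h1 : α * x ^ 2 ≤ A * x ^ 2 := mul_le_mul_of_nonneg_right hA (sq_nonneg x)
  have h2 : β * y ^ 2 ≤ C * y ^ 2 := mul_le_mul_of_nonneg_right hC (sq_nonneg y)
  have h3 : |B * (x * y)| ≤ |x * y| := by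
    rw [abs_mul]; nlinarith [abs_nonneg (x * y), abs_nonneg B]
  have h4 : 4 * |x * y| ≤ α * x ^ 2 + β * y ^ 2 := by
    refine abs_le_of_sq_le_sq' ?_ (by positivity) |>.2
    have : (4 * |x * y|) ^ 2 = 16 * (x ^ 2 * y ^ 2) := by rw [mul_pow, sq_abs]; ring
    rw [this]
    nlinarith [sq_nonneg (α * x ^ 2 - β * y ^ 2), mul_nonneg (sq_nonneg x) (sq_nonneg y),
      mul_le_mul_of_nonneg_right hab (mul_nonneg (sq_nonneg x) (sq_nonneg y))]
  nlinarith [(abs_le.1 h3).1]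

lemma four_le {α β x y : ℝ} (hα : 0 ≤ α)
    (hβ : 0 ≤ β) (hab : 4 ≤ α * β) : 4 * (|x| * |y|) ≤ α * x ^ 2 + β * y ^ 2 := by
  rw [← abs_mul]
  refine abs_le_of_sq_le_sq' ?_ (by positivity) |>.2
  have : (4 * |x * y|) ^ 2 = 16 * (x ^ 2 * y ^ 2) := by rw [mul_pow, sq_abs]; ring
  rw [this]
  nlinarith [sq_nonneg (α * x ^ 2 - β * y ^ 2), mul_nonneg (sq_nonneg x) (sq_nonneg y),
    mul_le_mul_of_nonneg_right hab (mul_nonneg (sq_nonneg x) (sq_nonneg y))]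

variable (s : ι → Pt N)

lemma grad_prod_cont {f g : Pt N → ℝ} (hf : Nice 2 f) (hg : Nice 2 g) (a b : Pt N) :
    Continuous fun q : ℝ × Pt N => |pd a (heat s q.1 f) q.2| * |pd b (heat s q.1 g) q.2| := by
  have h1 := heat_cont_joint s (hf.pd a).cont (hf.pd a).bdd
  have h2 := heat_cont_joint s (hg.pd b).cont (hg.pd b).bdd
  have e1 : ∀ t, pd a (heat s t f) = heat s t (pd a f) := fun t => (hf.mono (by omega) : Nice 1 f).heat_pd s t a
  have e2 : ∀ t, pd b (heat s t g) = heat s t (pd b g) := fun t => (hg.mono (by omega) : Nice 1 g).heat_pd s t b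
  simp only [e1, e2]
  exact h1.abs.mul h2.abs

lemma grad_prod_int {f g : Pt N → ℝ} (hf : Nice 2 f) (hg : Nice 2 g) (a b : Pt N) (t : ℝ) :
    Integrable fun z => |pd a (heat s t f) z| * |pd b (heat s t g) z| := by
  have := (((hf.heat s t).pd a).mul_int ((hg.heat s t).pd b)).abs
  simpa only [abs_mul] using this

theorem bell_flow (h : C2fn Ψ Ψ1 Ψ2 Ψ11 Ψ12 Ψ22) (hpos : ∀ u v, 0 ≤ Ψ u v)
    (hh : ∀ u v, ∃ α β, 0 ≤ α ∧ 0 ≤ β ∧ 4 ≤ α * β ∧ α ≤ Ψ11 u v ∧ β ≤ Ψ22 u v ∧ |Ψ12 u v| ≤ 1)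
    {f g : Pt N → ℝ} (hf : Nice 2 f) (hg : Nice 2 g) {T : ℝ} (hT : 0 ≤ T) (a b : ι) :
    IntervalIntegrable (fun t => t * ∫ z, |pd (s a) (heat s t f) z| * |pd (s b) (heat s t g) z|)
      volume 0 T ∧
    ∫ t in (0:ℝ)..T, t * ∫ z, |pd (s a) (heat s t f) z| * |pd (s b) (heat s t g) z| ≤
      ∫ z, Ψ (f z) (g z) := by
  obtain ⟨hi, he⟩ := flow s h hf hg hT
  have hpt : ∀ t z, |pd (s a) (heat s t f) z| * |pd (s b) (heat s t g) z| ≤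
      Hd s Ψ11 Ψ12 Ψ22 (heat s t f) (heat s t g) z := by
    intro t z
    obtain ⟨α, β, hα, hβ, hab, h1, h2, h3⟩ := hh (heat s t f z) (heat s t g z)
    unfold Hd
    have : ∑ k, (α * pd (s k) (heat s t f) z ^ 2 + β * pd (s k) (heat s t g) z ^ 2) / 2 ≤ _ :=
      Finset.sum_le_sum fun k _ => hess_low h1 h2 h3 hα hβ hab
        (x := pd (s k) (heat s t f) z) (y := pd (s k) (heat s t g) z)
    refine le_trans ?_ this
    rw [← Finset.sum_div, Finset.sum_add_distrib]
    have h4 : α * pd (s a) (heat s t f) z ^ 2 ≤ ∑ k, α * pd (s k) (heat s t f) z ^ 2 :=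
      Finset.single_le_sum (f := fun k => α * pd (s k) (heat s t f) z ^ 2)
        (fun k _ => by positivity) (Finset.mem_univ a)
    have h5 : β * pd (s b) (heat s t g) z ^ 2 ≤ ∑ k, β * pd (s k) (heat s t g) z ^ 2 :=
      Finset.single_le_sum (f := fun k => β * pd (s k) (heat s t g) z ^ 2)
        (fun k _ => by positivity) (Finset.mem_univ b)
    have h6 := four_le hα hβ hab (x := pd (s a) (heat s t f) z) (y := pd (s b) (heat s t g) z)
    have : 0 ≤ |pd (s a) (heat s t f) z| * |pd (s b) (heat s t g) z| := by positivity
    linarith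
  have hintg : ∀ t, ∫ z, |pd (s a) (heat s t f) z| * |pd (s b) (heat s t g) z| ≤
      ∫ z, Hd s Ψ11 Ψ12 Ψ22 (heat s t f) (heat s t g) z := fun t =>
    integral_mono (grad_prod_int s hf hg _ _ t)
      (Hd_int s h ((hf.heat s t).mono (by omega)) ((hg.heat s t).mono (by omega))) (hpt t)
  have hi2 : IntervalIntegrable
      (fun t => t * ∫ z, |pd (s a) (heat s t f) z| * |pd (s b) (heat s t g) z|) volume 0 T := by
    rw [intervalIntegrable_iff_integrableOn_Ioc_of_le hT] at hi ⊢
    refine hi.mono' ?_ ?_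
    · refine continuous_id.aestronglyMeasurable.mul ?_
      exact (grad_prod_cont s hf hg (s a) (s b)).aestronglyMeasurable.integral_prod_right'
    · rw [ae_restrict_iff' measurableSet_Ioc]
      refine Filter.Eventually.of_forall fun t ht => ?_
      rw [Real.norm_of_nonneg (mul_nonneg ht.1.le (integral_nonneg fun z => by positivity))]
      exact mul_le_mul_of_nonneg_left (hintg t) ht.1.le
  refine ⟨hi2, ?_⟩
  calc _ ≤ ∫ t in (0:ℝ)..T, t * ∫ z, Hd s Ψ11 Ψ12 Ψ22 (heat s t f) (heat s t g) z :=
        intervalIntegral.integral_mono_on hT hi2 hi fun t ht =>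
          mul_le_mul_of_nonneg_left (hintg t) ht.1
    _ ≤ _ := by
        rw [he]
        linarith [integral_nonneg (μ := volume) (f := fun z => Ψ (heat s T f z) (heat s T g z)) fun z => hpos _ _]

end bell2

section numer

lemma sqpow_bound {p κ : ℝ} (hp : 2 ≤ p) (hκ : 0 < κ) (u : ℝ) :
    (u ^ 2 + κ ^ 2) ^ (p / 2) - (κ ^ 2) ^ (p / 2) ≤
      2 ^ (p / 2) * (|u| ^ p + κ ^ (p - 1) * |u|) := by
  have e1 : ∀ x : ℝ, 0 ≤ x → (x ^ 2) ^ (p / 2) = x ^ p := by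
    intro x hx
    rw [← Real.rpow_natCast x 2, ← Real.rpow_mul hx]; congr 1; push_cast; ring
  rcases le_total κ |u| with h | h
  · have : u ^ 2 + κ ^ 2 ≤ 2 * |u| ^ 2 := by rw [sq_abs]; nlinarith [sq_abs u, abs_nonneg u]
    have h1 : (u ^ 2 + κ ^ 2) ^ (p / 2) ≤ 2 ^ (p / 2) * |u| ^ p := by
      rw [← e1 _ (abs_nonneg u), ← Real.mul_rpow (by norm_num) (by positivity)]
      exact Real.rpow_le_rpow (by positivity) this (by linarith)
    have h2 : 0 ≤ (κ ^ 2) ^ (p / 2) := by positivity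
    have h3 : 0 ≤ κ ^ (p - 1) * |u| := by positivity
    have h4 : 0 < (2:ℝ) ^ (p / 2) := by positivity
    nlinarith
  · set x := (|u| / κ) ^ 2 with hx
    have hx0 : 0 ≤ x := by positivity
    have hu1 : |u| / κ ≤ 1 := by rw [div_le_one hκ]; exact h
    have hu0 : 0 ≤ |u| / κ := by positivity
    have hx1 : x ≤ |u| / κ := by rw [hx]; nlinarith
    have e2 : u ^ 2 + κ ^ 2 = (1 + x) * κ ^ 2 := by
      rw [hx]; field_simp; rw [sq_abs]; ring
    rw [e2, Real.mul_rpow (by positivity) (by positivity), e1 _ hκ.le]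
    have hc := (convexOn_rpow (p := p / 2) (by linarith)).2 (show (1:ℝ) ∈ Set.Ici 0 by simp)
      (show (2:ℝ) ∈ Set.Ici 0 by simp) (show 0 ≤ 1 - x by linarith) hx0 (by ring)
    simp only [smul_eq_mul, mul_one, Real.one_rpow] at hc
    have e3 : 1 - x + x * 2 = 1 + x := by ring
    rw [e3] at hc
    have hk : κ ^ p = κ ^ (p - 1) * κ := by rw [Real.rpow_sub_one hκ.ne']; field_simp
    have h4 : 0 < (2:ℝ) ^ (p / 2) := by positivity
    have h5 : 0 < κ ^ (p - 1) := by positivity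
    have h6 : (1 + x) ^ (p / 2) - 1 ≤ 2 ^ (p / 2) * (|u| / κ) := by nlinarith
    calc (1 + x) ^ (p / 2) * κ ^ p - κ ^ p = ((1 + x) ^ (p / 2) - 1) * κ ^ p := by ring
      _ ≤ (2 ^ (p / 2) * (|u| / κ)) * κ ^ p := by gcongr
      _ = 2 ^ (p / 2) * (κ ^ (p - 1) * |u|) := by rw [hk]; field_simp
      _ ≤ _ := by
        have : 0 ≤ |u| ^ p := by positivity
        nlinarith

lemma Sq_sub {q κ : ℝ} (hq1 : 0 < q) (hq2 : q ≤ 2) (hκ : 0 < κ) (v : ℝ) :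
    (v ^ 2 + κ ^ 2) ^ (q / 2) ≤ |v| ^ q + (κ ^ 2) ^ (q / 2) := by
  have := Real.rpow_add_le_add_rpow (a := v ^ 2) (b := κ ^ 2) (p := q / 2) (by positivity) (by positivity)
    (by linarith) (by linarith)
  refine this.trans (le_of_eq ?_)
  congr 1
  rw [← sq_abs, ← Real.rpow_natCast |v| 2, ← Real.rpow_mul (abs_nonneg v)]; congr 1; push_cast; ring

lemma bR_bound {p q κ : ℝ} (hpq : p.HolderConjugate q) (hq2 : q ≤ 2) (hκ : 0 < κ) (u v : ℝ) :
    bR κ q u v - bR κ q 0 0 ≤ |u| ^ p + 2 * |v| ^ q + κ * |u| := by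
  have hS := bS_pos hκ v
  have hq := hpq.symm.pos
  have h0 : bR κ q 0 0 = (κ ^ 2) ^ (q / 2) := by
    unfold bR bM bS
    rw [Real.sqrt_eq_rpow]; simp
    rw [← Real.rpow_mul (by positivity)]; congr 1
  have h1 : bR κ q u v ≤ bS κ v ^ (q / 2) + √(bS κ v) * |u| := by
    unfold bR
    rw [Real.sqrt_le_left (by positivity)]
    have e1 : (bS κ v ^ (q / 2)) ^ 2 = bS κ v ^ q := by
      rw [← Real.rpow_natCast, ← Real.rpow_mul hS.le]; congr 1; push_cast; ring
    have e2 : (√(bS κ v) * |u|) ^ 2 = bS κ v * u ^ 2 := by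
      rw [mul_pow, Real.sq_sqrt hS.le, sq_abs]
    have e3 : 0 ≤ bS κ v ^ (q / 2) * (√(bS κ v) * |u|) := by positivity
    unfold bM; nlinarith
  have h2 : √(bS κ v) ≤ |v| + κ := by
    rw [Real.sqrt_le_left (by positivity)]
    unfold bS; nlinarith [sq_abs v, abs_nonneg v]
  have h3 := Sq_sub hq hq2 hκ v
  have h4 : |u| * |v| ≤ |u| ^ p + |v| ^ q := by
    have := Real.young_inequality_of_nonneg (abs_nonneg u) (abs_nonneg v) hpq
    have h5 : |u| ^ p / p ≤ |u| ^ p := div_le_self (by positivity) hpq.lt.le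
    have h6 : |v| ^ q / q ≤ |v| ^ q := div_le_self (by positivity) hpq.symm.lt.le
    linarith
  have h5 : √(bS κ v) * |u| ≤ (|v| + κ) * |u| := by gcongr
  have h6 : bS κ v ^ (q / 2) ≤ |v| ^ q + (κ ^ 2) ^ (q / 2) := h3
  rw [h0]
  nlinarith

end numer

/-- lower bound for the `uu` second derivative -/
lemma uu_low {p q κ : ℝ} (hpq : p.HolderConjugate q) (hp : 2 ≤ p) (hκ : 0 < κ) (u v : ℝ) :
    (2:ℝ) ^ (-(3/2) : ℝ) * bS κ v ^ ((2 - q) / 2) ≤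
      2 * (p / 2) * (u ^ 2 + κ ^ 2) ^ (p / 2 - 1) +
      4 * (p / 2) * (p / 2 - 1) * u ^ 2 * (u ^ 2 + κ ^ 2) ^ (p / 2 - 1 - 1) +
      bS κ v * (bM κ q u v - bS κ v * u ^ 2) / bR κ q u v ^ 3 := by
  have hS := bS_pos hκ v
  have hR := bR_pos hκ q u v
  have hq1 := hpq.symm.lt
  rw [bM_uu]
  have hX : 0 < bS κ v ^ (q - 1) := Real.rpow_pos_of_pos hS _
  have n1 : 0 ≤ bS κ v * bS κ v ^ q / bR κ q u v ^ 3 := by positivity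
  have n2 : 0 ≤ 4 * (p / 2) * (p / 2 - 1) * u ^ 2 * (u ^ 2 + κ ^ 2) ^ (p / 2 - 1 - 1) := by
    have : 0 ≤ p / 2 - 1 := by linarith
    positivity
  have n3 : 0 ≤ 2 * (p / 2) * (u ^ 2 + κ ^ 2) ^ (p / 2 - 1) := by positivity
  rcases le_total (u ^ 2) (bS κ v ^ (q - 1)) with h | h
  · have hM : bM κ q u v ≤ 2 * bS κ v ^ q := by
      rw [bM, bSq hκ]; nlinarith
    have h3 : bR κ q u v ^ 3 ≤ (2:ℝ) ^ (3/2 : ℝ) * bS κ v ^ (q * (3/2)) := by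
      rw [Real.rpow_mul hS.le, ← Real.mul_rpow (by norm_num) (by positivity)]
      have : bR κ q u v ^ 3 = bM κ q u v ^ (3/2 : ℝ) := by
        unfold bR
        rw [Real.sqrt_eq_rpow, ← Real.rpow_natCast, ← Real.rpow_mul (bM_pos hκ q u v).le]
        norm_num
      rw [this]
      exact Real.rpow_le_rpow (bM_pos hκ q u v).le hM (by norm_num)
    have h4 : (2:ℝ) ^ (-(3/2) : ℝ) * bS κ v ^ ((2 - q) / 2) ≤
        bS κ v * bS κ v ^ q / bR κ q u v ^ 3 := by
      rw [le_div_iff₀ (by positivity)]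
      calc _ ≤ (2:ℝ) ^ (-(3/2) : ℝ) * bS κ v ^ ((2 - q) / 2) *
            ((2:ℝ) ^ (3/2 : ℝ) * bS κ v ^ (q * (3/2))) := by gcongr
        _ = ((2:ℝ) ^ (-(3/2) : ℝ) * (2:ℝ) ^ (3/2 : ℝ)) *
            (bS κ v ^ ((2 - q) / 2) * bS κ v ^ (q * (3/2))) := by ring
        _ = bS κ v ^ (1 + q) := by
            rw [← Real.rpow_add (by norm_num), ← Real.rpow_add hS]
            norm_num
            congr 1; ring
        _ = _ := by rw [Real.rpow_add hS, Real.rpow_one]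
    linarith
  · have h1 : bS κ v ^ ((2 - q) / 2) ≤ (u ^ 2 + κ ^ 2) ^ (p / 2 - 1) := by
      have e : (2 - q) / 2 = (q - 1) * (p / 2 - 1) := by
        have := hpq.mul_eq_add
        linarith
      rw [e, Real.rpow_mul hS.le]
      exact Real.rpow_le_rpow hX.le (h.trans (by nlinarith)) (by linarith)
    have h2 : (2:ℝ) ^ (-(3/2) : ℝ) ≤ 1 := Real.rpow_le_one_of_one_le_of_nonpos (by norm_num) (by norm_num)
    have h3 : 0 < bS κ v ^ ((2 - q) / 2) := Real.rpow_pos_of_pos hS _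
    have h4 : 0 < (u ^ 2 + κ ^ 2) ^ (p / 2 - 1) := by positivity
    nlinarith

lemma vv_low {q κ : ℝ} (hq1 : 1 < q) (hq2 : q ≤ 2) (hκ : 0 < κ) (v : ℝ) :
    q * (q - 1) * bS κ v ^ (- ((2 - q) / 2)) ≤
      2 * (q / 2) * (v ^ 2 + κ ^ 2) ^ (q / 2 - 1) +
      4 * (q / 2) * (q / 2 - 1) * v ^ 2 * (v ^ 2 + κ ^ 2) ^ (q / 2 - 1 - 1) := by
  have hS := bS_pos hκ v
  have e1 : - ((2 - q) / 2) = q / 2 - 1 := by ring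
  have e2 := bSq hκ (q / 2 - 1) v
  have hv := v_le_bS (κ := κ) v
  have h5 : 0 < bS κ v ^ (q / 2 - 1 - 1) := Real.rpow_pos_of_pos hS _
  change _ ≤ 2 * (q / 2) * bS κ v ^ (q / 2 - 1) + 4 * (q / 2) * (q / 2 - 1) * v ^ 2 * bS κ v ^ (q / 2 - 1 - 1)
  rw [e1, e2]
  have : 0 ≤ (bS κ v - v ^ 2) * bS κ v ^ (q / 2 - 1 - 1) * (q * (2 - q)) :=
    mul_nonneg (mul_nonneg (by linarith) h5.le) (mul_nonneg (by linarith) (by linarith))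
  nlinarith

section
variable {N : ℕ} {ι : Type} [Fintype ι] (s : ι → Pt N)

lemma Nice.rpow_int {k : ℕ} {f : Pt N → ℝ} (hf : Nice k f) {p : ℝ} (hp : 1 ≤ p) :
    Integrable fun z => |f z| ^ p := by
  obtain ⟨M, hM⟩ := hf.bdd
  refine (hf.int.abs.const_mul (M ^ (p - 1))).mono'
    (hf.cont.abs.rpow_const fun z => Or.inr (by linarith)).aestronglyMeasurable
    (Filter.Eventually.of_forall fun z => ?_)
  rw [Real.norm_of_nonneg (by positivity)]
  have : |f z| ^ p = |f z| ^ (p - 1) * |f z| := by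
    rcases eq_or_lt_of_le (abs_nonneg (f z)) with h | h
    · rw [← h, mul_zero, Real.zero_rpow (by linarith)]
    · rw [Real.rpow_sub_one h.ne']; field_simp
  rw [this]
  exact mul_le_mul_of_nonneg_right (Real.rpow_le_rpow (abs_nonneg _) (hM z) (by linarith)) (abs_nonneg _)

theorem bell_ge2 {p q : ℝ} (hpq : p.HolderConjugate q) (hp : 2 ≤ p) :
    ∃ C, 0 < C ∧ ∀ {f g : Pt N → ℝ}, Nice 2 f → Nice 2 g → ∀ {T : ℝ}, 0 ≤ T → ∀ a b : ι,
    IntervalIntegrable (fun t => t * ∫ z, |pd (s a) (heat s t f) z| * |pd (s b) (heat s t g) z|)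
      volume 0 T ∧
    ∫ t in (0:ℝ)..T, t * ∫ z, |pd (s a) (heat s t f) z| * |pd (s b) (heat s t g) z| ≤
      C * ((∫ z, |f z| ^ p) + ∫ z, |g z| ^ q) := by
  have hq1 := hpq.symm.lt
  have hq2 : q ≤ 2 := by nlinarith [hpq.mul_eq_add]
  set c1 : ℝ := (2:ℝ) ^ (-(3/2) : ℝ) with hc1
  have hc1p : 0 < c1 := by positivity
  set B : ℝ := 4 / (c1 * (q * (q - 1))) with hB
  have hqq : 0 < q * (q - 1) := mul_pos (by linarith) (by linarith)
  have hBp : 0 < B := by positivity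
  have hcon := fun (κ : ℝ) (hκ : 0 < κ) =>
    (C2fn_sq hκ (p / 2)).add (((C2fn_sq hκ (q / 2)).swap.const_mul B).add (C2fn_R hκ q))
  refine ⟨2 ^ (p / 2) + B + 2, by positivity, ?_⟩
  intro f g hf hg T hT a b
  have key : ∀ κ > 0, 
    IntervalIntegrable (fun t => t * ∫ z, |pd (s a) (heat s t f) z| * |pd (s b) (heat s t g) z|)
      volume 0 T ∧
    ∫ t in (0:ℝ)..T, t * ∫ z, |pd (s a) (heat s t f) z| * |pd (s b) (heat s t g) z| ≤
      (2 ^ (p / 2) + B + 2) * ((∫ z, |f z| ^ p) + ∫ z, |g z| ^ q) +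
        (2 ^ (p / 2) * κ ^ (p - 1) + κ) * ∫ z, |f z| := by
    intro κ hκ
    have h00 : ∀ v, (κ ^ 2) ^ (q / 2) ≤ (v ^ 2 + κ ^ 2) ^ (q / 2) := fun v =>
      Real.rpow_le_rpow (by positivity) (by nlinarith) (by linarith)
    have hR0 : ∀ u v, bR κ q 0 0 ≤ bR κ q u v := by
      intro u v
      refine Real.sqrt_le_sqrt ?_
      unfold bM bS
      have : ((0:ℝ) ^ 2 + κ ^ 2) ^ q ≤ (v ^ 2 + κ ^ 2) ^ q :=
        Real.rpow_le_rpow (by positivity) (by nlinarith) (by linarith)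
      have : 0 ≤ (v ^ 2 + κ ^ 2) * u ^ 2 := by positivity
      simp only [ne_eq, OfNat.ofNat_ne_zero, not_false_eq_true, zero_pow, mul_zero, add_zero] at *
      linarith
    have := bell_flow s (hcon κ hκ) ?_ ?_ hf hg hT a b
    · refine ⟨this.1, this.2.trans ?_⟩
      have i1 := hf.rpow_int hpq.lt.le
      have i2 := hg.rpow_int hq1.le
      have i3 := hf.int.abs
      have i12 : Integrable fun z => |f z| ^ p + |g z| ^ q := i1.add i2
      calc _ ≤ ∫ z, ((2 ^ (p / 2) + B + 2) * (|f z| ^ p + |g z| ^ q) +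
          (2 ^ (p / 2) * κ ^ (p - 1) + κ) * |f z|) := by
            refine integral_mono (psi_int (hcon κ hκ) hf.zero hg.zero)
              ((i12.const_mul _).add (i3.const_mul _)) fun z => ?_
            have b1 := sqpow_bound hp hκ (f z)
            have b2 := Sq_sub (by linarith) hq2 hκ (g z)
            have b3 := bR_bound hpq hq2 hκ (f z) (g z)
            have b4 : 0 ≤ |f z| ^ p := by positivity
            have b5 : 0 ≤ |g z| ^ q := by positivity
            have b6 : 0 < (2:ℝ) ^ (p / 2) := by positivity
            have b7 : B * ((g z ^ 2 + κ ^ 2) ^ (q / 2) - (κ ^ 2) ^ (q / 2)) ≤ B * |g z| ^ q :=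
              mul_le_mul_of_nonneg_left (by linarith) hBp.le
            simp only
            nlinarith [mul_nonneg hBp.le b4, mul_nonneg b6.le b5]
        _ = _ := by
            rw [integral_add (i12.const_mul _) (i3.const_mul _), integral_const_mul,
              integral_const_mul, integral_add i1 i2]
    · intro u v
      have h1 : (κ ^ 2) ^ (p / 2) ≤ (u ^ 2 + κ ^ 2) ^ (p / 2) :=
        Real.rpow_le_rpow (by positivity) (by nlinarith) (by linarith)
      have h2 := mul_nonneg hBp.le (sub_nonneg.2 (h00 v))
      have h3 := hR0 u v
      linarith
    · intro u v
      have hS := bS_pos hκ v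
      refine ⟨c1 * bS κ v ^ ((2 - q) / 2), B * (q * (q - 1) * bS κ v ^ (- ((2 - q) / 2))),
        by positivity, by positivity, ?_, ?_, ?_, ?_⟩
      · have : bS κ v ^ ((2 - q) / 2) * bS κ v ^ (- ((2 - q) / 2)) = 1 := by
          rw [← Real.rpow_add hS]; simp
        have e : c1 * bS κ v ^ ((2 - q) / 2) * (B * (q * (q - 1) * bS κ v ^ (- ((2 - q) / 2)))) =
          B * (c1 * (q * (q - 1))) * (bS κ v ^ ((2 - q) / 2) * bS κ v ^ (- ((2 - q) / 2))) := by ring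
        rw [e, this, hB, mul_one, div_mul_cancel₀ _ (by positivity)]
      · have := uu_low hpq hp hκ u v
        simp only [mul_zero, zero_add]
        linarith
      · have h1 := mul_le_mul_of_nonneg_left (vv_low hq1 hq2 hκ v) hBp.le
        have h2 := bR_vv_nonneg hκ hq1.le u v
        simp only [zero_add]
        linarith
      · have := bR_uv_le hκ hq1.le hq2 u v
        simpa using this
  refine ⟨(key 1 one_pos).1, ?_⟩
  have hlim : Filter.Tendsto (fun κ : ℝ => (2 ^ (p / 2) + B + 2) * ((∫ z, |f z| ^ p) + ∫ z, |g z| ^ q) +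
        (2 ^ (p / 2) * κ ^ (p - 1) + κ) * ∫ z, |f z|) (nhdsWithin 0 (Set.Ioi 0))
      (nhds ((2 ^ (p / 2) + B + 2) * ((∫ z, |f z| ^ p) + ∫ z, |g z| ^ q) +
        (2 ^ (p / 2) * (0:ℝ) ^ (p - 1) + 0) * ∫ z, |f z|)) := by
    refine Filter.Tendsto.mono_left ?_ nhdsWithin_le_nhds
    have : Continuous fun κ : ℝ => κ ^ (p - 1) := continuous_id.rpow_const fun _ => Or.inr (by linarith)
    have h2 : Continuous (fun κ : ℝ => (2 ^ (p / 2) + B + 2) * ((∫ z, |f z| ^ p) + ∫ z, |g z| ^ q) +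
        (2 ^ (p / 2) * κ ^ (p - 1) + κ) * ∫ z, |f z|) := by fun_prop
    exact h2.tendsto 0
  rw [Real.zero_rpow (by linarith)] at hlim
  simp only [mul_zero, add_zero, zero_mul] at hlim
  refine ge_of_tendsto hlim ?_
  filter_upwards [self_mem_nhdsWithin] with κ hκ using (key κ hκ).2

theorem bell_sum {p q : ℝ} (hpq : p.HolderConjugate q) :
    ∃ C, 0 < C ∧ ∀ {f g : Pt N → ℝ}, Nice 2 f → Nice 2 g → ∀ {T : ℝ}, 0 ≤ T → ∀ a b : ι,
    IntervalIntegrable (fun t => t * ∫ z, |pd (s a) (heat s t f) z| * |pd (s b) (heat s t g) z|)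
      volume 0 T ∧
    ∫ t in (0:ℝ)..T, t * ∫ z, |pd (s a) (heat s t f) z| * |pd (s b) (heat s t g) z| ≤
      C * ((∫ z, |f z| ^ p) + ∫ z, |g z| ^ q) := by
  rcases le_total 2 p with hp | hp
  · exact bell_ge2 s hpq hp
  · have hq : 2 ≤ q := by nlinarith [hpq.mul_eq_add, hpq.lt, hpq.symm.lt]
    obtain ⟨C, hC, h⟩ := bell_ge2 s hpq.symm hq
    refine ⟨C, hC, fun {f g} hf hg {T} hT a b => ?_⟩
    have := h hg hf hT b a
    simp only [mul_comm |pd (s b) _ _|] at this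
    rw [add_comm (∫ z, |f z| ^ p)]
    exact this

/-- Bilinear embedding. -/
theorem bell {p q : ℝ} (hpq : p.HolderConjugate q) :
    ∃ C, 0 < C ∧ ∀ {f g : Pt N → ℝ}, Nice 2 f → Nice 2 g → ∀ {T : ℝ}, 0 ≤ T → ∀ a b : ι,
    IntervalIntegrable (fun t => t * ∫ z, |pd (s a) (heat s t f) z| * |pd (s b) (heat s t g) z|)
      volume 0 T ∧
    ∫ t in (0:ℝ)..T, t * ∫ z, |pd (s a) (heat s t f) z| * |pd (s b) (heat s t g) z| ≤
      C * ((∫ z, |f z| ^ p) ^ (1 / p) * (∫ z, |g z| ^ q) ^ (1 / q)) := by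
  obtain ⟨C, hC, h⟩ := bell_sum s hpq
  refine ⟨2 * C, by positivity, fun {f g} hf hg {T} hT a b => ⟨(h hf hg hT a b).1, ?_⟩⟩
  set F := ∫ z, |f z| ^ p with hF
  set G := ∫ z, |g z| ^ q with hG
  have hF0 : 0 ≤ F := integral_nonneg fun z => by positivity
  have hG0 : 0 ≤ G := integral_nonneg fun z => by positivity
  have hp0 := hpq.pos
  have hq0 := hpq.symm.pos
  have key : ∀ ε > 0, ∫ t in (0:ℝ)..T, t * ∫ z, |pd (s a) (heat s t f) z| * |pd (s b) (heat s t g) z| ≤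
      2 * C * ((F + ε) ^ (1 / p) * (G + ε) ^ (1 / q)) := by
    intro ε hε
    set A := (F + ε) ^ (1 / p) with hA
    set B := (G + ε) ^ (1 / q) with hB
    have hAp : 0 < A := by positivity
    have hBp : 0 < B := by positivity
    have hAe : A ^ p = F + ε := by
      rw [hA, ← Real.rpow_mul (by positivity)]; field_simp; simp
    have hBe : B ^ q = G + ε := by
      rw [hB, ← Real.rpow_mul (by positivity)]; field_simp; simp
    have := (h (hf.const_mul A⁻¹) (hg.const_mul B⁻¹) hT a b).2
    have e1 : ∀ t z, |pd (s a) (heat s t fun z => A⁻¹ * f z) z| = A⁻¹ * |pd (s a) (heat s t f) z| := by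
      intro t z
      rw [heat_const_mul, pd_const_mul _ (hf.heat s t).diff, abs_mul, abs_of_pos (by positivity : 0 < A⁻¹)]
    have e2 : ∀ t z, |pd (s b) (heat s t fun z => B⁻¹ * g z) z| = B⁻¹ * |pd (s b) (heat s t g) z| := by
      intro t z
      rw [heat_const_mul, pd_const_mul _ (hg.heat s t).diff, abs_mul, abs_of_pos (by positivity : 0 < B⁻¹)]
    have e3 : ∀ t, t * ∫ z, |pd (s a) (heat s t fun z => A⁻¹ * f z) z| * |pd (s b) (heat s t fun z => B⁻¹ * g z) z|
        = A⁻¹ * B⁻¹ * (t * ∫ z, |pd (s a) (heat s t f) z| * |pd (s b) (heat s t g) z|) := by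
      intro t
      simp only [e1, e2]
      rw [mul_left_comm (A⁻¹ * B⁻¹), ← integral_const_mul (A⁻¹ * B⁻¹)]
      congr 2; funext z; ring
    simp only [e3] at this
    rw [intervalIntegral.integral_const_mul] at this
    have e4 : ∫ z, |A⁻¹ * f z| ^ p = F / (F + ε) := by
      rw [← hAe, hF, div_eq_inv_mul, ← integral_const_mul]
      congr 1; funext z
      rw [abs_mul, Real.mul_rpow (abs_nonneg _) (abs_nonneg _), abs_of_pos (by positivity : 0 < A⁻¹),
        Real.inv_rpow hAp.le]
    have e5 : ∫ z, |B⁻¹ * g z| ^ q = G / (G + ε) := by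
      rw [← hBe, hG, div_eq_inv_mul, ← integral_const_mul]
      congr 1; funext z
      rw [abs_mul, Real.mul_rpow (abs_nonneg _) (abs_nonneg _), abs_of_pos (by positivity : 0 < B⁻¹),
        Real.inv_rpow hBp.le]
    rw [e4, e5] at this
    have l1 : F / (F + ε) ≤ 1 := by rw [div_le_one (by positivity)]; linarith
    have l2 : G / (G + ε) ≤ 1 := by rw [div_le_one (by positivity)]; linarith
    have l3 : C * (F / (F + ε) + G / (G + ε)) ≤ 2 * C := by nlinarith
    have l4 := this.trans l3
    rw [← mul_inv, inv_mul_le_iff₀ (by positivity)] at l4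
    linarith
  have hlim : Filter.Tendsto (fun ε : ℝ => 2 * C * ((F + ε) ^ (1 / p) * (G + ε) ^ (1 / q)))
      (nhdsWithin 0 (Set.Ioi 0)) (nhds (2 * C * ((F + 0) ^ (1 / p) * (G + 0) ^ (1 / q)))) := by
    refine Filter.Tendsto.mono_left ?_ nhdsWithin_le_nhds
    have h1 : Continuous fun ε : ℝ => (F + ε) ^ (1 / p) :=
      (continuous_const.add continuous_id).rpow_const fun _ => Or.inr (by positivity)
    have h2 : Continuous fun ε : ℝ => (G + ε) ^ (1 / q) :=
      (continuous_const.add continuous_id).rpow_const fun _ => Or.inr (by positivity)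
    exact ((h1.mul h2).const_mul (2 * C)).tendsto 0
  simp only [add_zero] at hlim
  refine ge_of_tendsto hlim ?_
  filter_upwards [self_mem_nhdsWithin] with ε hε using key ε hε

end

section
variable {N : ℕ}

lemma eLp_eq {α : Type*} [MeasurableSpace α] {μ : Measure α} {p : ℝ} (hp : 1 ≤ p) {f : α → ℝ}
    (hf : MemLp f (ENNReal.ofReal p) μ) :
    eLpNorm f (ENNReal.ofReal p) μ = ENNReal.ofReal ((∫ z, |f z| ^ p ∂μ) ^ (1 / p)) := by
  have h1 : ENNReal.ofReal p ≠ 0 := by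
    simp only [ne_eq, ENNReal.ofReal_eq_zero, not_le]; linarith
  rw [hf.eLpNorm_eq_integral_rpow_norm h1 ENNReal.ofReal_ne_top, ENNReal.toReal_ofReal (by linarith),
    one_div]
  rfl

lemma memLp_of_rpow {α : Type*} [MeasurableSpace α] {μ : Measure α} {p : ℝ} (hp : 1 ≤ p) {f : α → ℝ}
    (hm : AEStronglyMeasurable f μ) (hi : Integrable (fun z => |f z| ^ p) μ) :
    MemLp f (ENNReal.ofReal p) μ := by
  have h1 : ENNReal.ofReal p ≠ 0 := by
    simp only [ne_eq, ENNReal.ofReal_eq_zero, not_le]; linarith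
  rw [← integrable_norm_rpow_iff hm h1 ENNReal.ofReal_ne_top, ENNReal.toReal_ofReal (by linarith)]
  exact hi

lemma Nice.memLp {k : ℕ} {f : Pt N → ℝ} (hf : Nice k f) {p : ℝ} (hp : 1 ≤ p) :
    MemLp f (ENNReal.ofReal p) volume :=
  memLp_of_rpow hp hf.cont.aestronglyMeasurable (hf.rpow_int hp)

lemma dual_le {p q : ℝ} (hpq : p.HolderConjugate q) {f : Pt N → ℝ} (hf : Nice 0 f) {K : ℝ}
    (hK : 0 ≤ K) (h : ∀ ϑ : Pt N → ℝ, ContDiff ℝ (⊤ : ℕ∞) ϑ → HasCompactSupport ϑ →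
      |∫ z, f z * ϑ z| ≤ K * (∫ z, |ϑ z| ^ q) ^ (1 / q)) :
    (∫ z, |f z| ^ p) ^ (1 / p) ≤ K := by
  have hp1 := hpq.lt
  have hq1 := hpq.symm.lt
  set F := ∫ z, |f z| ^ p with hF
  have hF0 : 0 ≤ F := integral_nonneg fun z => by positivity
  set g : Pt N → ℝ := fun z => SignType.sign (f z) * |f z| ^ (p - 1) with hg
  have hgabs : ∀ z, |g z| ^ q = |f z| ^ p := by
    intro z
    rcases eq_or_ne (f z) 0 with h0 | h0
    · simp [hg, h0, Real.zero_rpow (by linarith : q ≠ 0), Real.zero_rpow (by linarith : p ≠ 0)]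
    · have : |g z| = |f z| ^ (p - 1) := by
        simp only [hg, abs_mul]
        rw [abs_of_nonneg (by positivity : 0 ≤ |f z| ^ (p - 1))]
        rcases lt_or_gt_of_ne h0 with h0 | h0
        · simp [sign_neg h0]
        · simp [sign_pos h0]
      rw [this, ← Real.rpow_mul (abs_nonneg _)]
      congr 1
      have := hpq.mul_eq_add
      linarith
  have hfg : ∀ z, f z * g z = |f z| ^ p := by
    intro z
    simp only [hg]
    rw [← mul_assoc, mul_comm (f z), sign_mul_self]
    rcases eq_or_lt_of_le (abs_nonneg (f z)) with h0 | h0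
    · rw [← h0, zero_mul, Real.zero_rpow (by linarith : p ≠ 0)]
    · rw [Real.rpow_sub_one h0.ne']; field_simp
  have hgm : AEStronglyMeasurable g volume := by
    refine Measurable.aestronglyMeasurable ?_
    have h1 : Measurable f := hf.cont.measurable
    have h2 : Measurable fun z => ((SignType.sign (f z) : SignType) : ℝ) := by
      have : (fun z => ((SignType.sign (f z) : SignType) : ℝ)) =
          fun z => if f z < 0 then -1 else if 0 < f z then (1:ℝ) else 0 := by
        funext z
        rcases lt_trichotomy (f z) 0 with h0 | h0 | h0
        · simp [h0]
        · simp [h0]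
        · simp [h0, h0.not_gt]
      rw [this]
      exact Measurable.ite (measurableSet_lt h1 measurable_const) measurable_const
        (Measurable.ite (measurableSet_lt measurable_const h1) measurable_const measurable_const)
    exact h2.mul (h1.abs.pow_const _)
  have hgL : MemLp g (ENNReal.ofReal q) volume :=
    memLp_of_rpow hq1.le hgm (by simpa only [hgabs] using hf.rpow_int hp1.le)
  have hfL := hf.memLp hp1.le
  have hq0 : ENNReal.ofReal q ≠ ⊤ := ENNReal.ofReal_ne_top
  have hq01 : 1 ≤ ENNReal.ofReal q := by rw [ENNReal.one_le_ofReal]; exact hq1.le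
  have key : ∀ ε > 0, F ≤ K * (F ^ (1 / q) + ε) + F ^ (1 / p) * ε := by
    intro ε hε
    obtain ⟨ϑ, hs, hc, he⟩ := hgL.exist_eLpNorm_sub_le hq0 hq01 hε
    have hϑ := Nice.of_cs 0 hc hs
    have hϑL := hϑ.memLp hq1.le
    have hd := hgL.sub hϑL
    rw [eLp_eq hq1.le hd, ENNReal.ofReal_le_ofReal_iff hε.le] at he
    have hϑn : (∫ z, |ϑ z| ^ q) ^ (1 / q) ≤ F ^ (1 / q) + ε := by
      have t1 : eLpNorm ϑ (ENNReal.ofReal q) volume ≤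
          eLpNorm g (ENNReal.ofReal q) volume + eLpNorm (g - ϑ) (ENNReal.ofReal q) volume := by
        have : ϑ = g - (g - ϑ) := by simp
        conv_lhs => rw [this]
        exact eLpNorm_sub_le hgL.1 hd.1 hq01
      rw [eLp_eq hq1.le hd, eLp_eq hq1.le hgL, eLp_eq hq1.le hϑL, ← ENNReal.ofReal_add (by positivity) (by positivity),
        ENNReal.ofReal_le_ofReal_iff (by positivity)] at t1
      simp only [hgabs] at t1
      linarith
    have i1 : Integrable fun z => f z * ϑ z := hf.mul_int hϑ
    have i0 : Integrable fun z => f z * g z := by simpa only [hfg] using hf.rpow_int hp1.le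
    have e1 : F = (∫ z, f z * ϑ z) + ∫ z, f z * (g z - ϑ z) := by
      simp only [mul_sub]
      rw [integral_sub i0 i1]; simp only [hfg]; ring
    have b1 := (le_abs_self _).trans (h ϑ hc hs)
    have b2 : ∫ z, f z * (g z - ϑ z) ≤ F ^ (1 / p) * ε := by
      have := integral_mul_norm_le_Lp_mul_Lq hpq hfL hd
      calc _ ≤ ∫ z, ‖f z‖ * ‖(g - ϑ) z‖ := by
            refine (le_abs_self _).trans (abs_integral_le_integral_abs.trans (le_of_eq ?_))
            congr 1; funext z; rw [abs_mul]; rfl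
        _ ≤ _ := this
        _ ≤ _ := mul_le_mul_of_nonneg_left he (by positivity)
    have b3 : K * (∫ z, |ϑ z| ^ q) ^ (1 / q) ≤ K * (F ^ (1 / q) + ε) := by gcongr
    linarith
  have hlim : F ≤ K * F ^ (1 / q) := by
    have hl : Filter.Tendsto (fun ε : ℝ => K * (F ^ (1 / q) + ε) + F ^ (1 / p) * ε)
        (nhdsWithin 0 (Set.Ioi 0)) (nhds (K * (F ^ (1 / q) + 0) + F ^ (1 / p) * 0)) :=
      Filter.Tendsto.mono_left ((by fun_prop : Continuous fun ε : ℝ =>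
        K * (F ^ (1 / q) + ε) + F ^ (1 / p) * ε).tendsto 0) nhdsWithin_le_nhds
    simp only [add_zero, mul_zero] at hl
    refine ge_of_tendsto hl ?_
    filter_upwards [self_mem_nhdsWithin] with ε hε using key ε hε
  rcases eq_or_lt_of_le hF0 with h0 | h0
  · rw [← h0, Real.zero_rpow (by rw [one_div]; exact inv_ne_zero (by linarith))]; exact hK
  · have e : F = F ^ (1 / p) * F ^ (1 / q) := by
      rw [← Real.rpow_add h0]
      have := hpq.inv_add_inv_eq_one
      simp only [one_div, this, Real.rpow_one]
    have : F ^ (1 / p) * F ^ (1 / q) ≤ K * F ^ (1 / q) := by rw [← e]; exact hlim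
    exact le_of_mul_le_mul_right this (by positivity)

lemma ibp {u w : Pt N → ℝ} (hu : Nice 1 u) (hw : Nice 1 w) (e : Pt N) :
    ∫ z, u z * pd e w z = - ∫ z, pd e u z * w z := by
  have := ibp_dir (F := fun a _ => a) (F1 := fun _ _ => 1) (F2 := fun _ _ => 0)
    continuous_fst continuous_const continuous_const
    (fun a b a' b' t ha _ => by simpa using ha) hu hw hw e
  simpa using this

variable {ι : Type} [Fintype ι] (s : ι → Pt N)

lemma ibp_op {u w : Pt N → ℝ} (hu : Nice 2 u) (hw : Nice 2 w) :
    ∫ z, ∑ k, pd (s k) u z * pd (s k) w z = - ∫ z, op s u z * w z := by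
  have hw1 : Nice 1 w := hw.mono (by omega)
  rw [integral_finsetSum _ fun k _ => (hu.pd (s k)).mul_int (hw.pd (s k))]
  have : ∀ z, op s u z * w z = ∑ k, pd (s k) (pd (s k) u) z * w z := fun z => by
    rw [op, Finset.sum_mul]
  simp only [this]
  rw [integral_finsetSum _ fun k _ => ((hu.pd (s k)).pd (s k)).mul_int hw1, ← Finset.sum_neg_distrib]
  refine Finset.sum_congr rfl fun k _ => ?_
  rw [ibp (hu.pd (s k)) hw1]

lemma op_pd {u : Pt N → ℝ} (hu : Nice 3 u) (v : Pt N) : op s (pd v u) = pd v (op s u) := by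
  unfold op
  rw [pd_sum]
  · funext z
    refine Finset.sum_congr rfl fun k _ => ?_
    rw [(hu.pd_comm (k := 1) (s k) v), ((hu.pd (s k)).pd_comm (k := 0) (s k) v)]
  · intro k; exact ((hu.pd (s k)).pd (s k)).diff

lemma decay {F θ : Pt N → ℝ} (hF : Nice 1 F) (hθ : Nice 0 θ) (a : ι) :
    ∃ C, ∀ T > 0, |∫ z, heat s T (pd (s a) F) z * heat s T θ z| ≤ C / T := by
  obtain ⟨M, hM⟩ := hF.bdd
  have hM0 : 0 ≤ M := (abs_nonneg _).trans (hM 0)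
  refine ⟨(∫ ζ : ι → ℝ, ‖ζ‖ ^ 1 ∂(gν ι)) * M * ∫ z, |θ z|, fun T hT => ?_⟩
  set m1 := ∫ ζ : ι → ℝ, ‖ζ‖ ^ 1 ∂(gν ι)
  have hb : ∀ z, |heat s T (pd (s a) F) z| ≤ m1 * M / T := by
    intro z
    rw [le_div_iff₀ hT, mul_comm, ← abs_of_pos hT, ← abs_mul, abs_of_pos hT, ← hF.heat_stein s T z a]
    calc _ ≤ ∫ ζ, ‖ζ a * F (z + T • hl s ζ)‖ ∂(gν ι) := norm_integral_le_integral_norm _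
      _ ≤ ∫ ζ : ι → ℝ, ‖ζ‖ ^ 1 * M ∂(gν ι) := by
        refine integral_mono_of_nonneg (Filter.Eventually.of_forall fun ζ => norm_nonneg _)
          ((gmoment 1).mul_const M) (Filter.Eventually.of_forall fun ζ => ?_)
        simp only [norm_mul, pow_one]
        exact mul_le_mul (norm_le_pi_norm ζ a) (hM _) (abs_nonneg _) (norm_nonneg _)
      _ = _ := integral_mul_const _ _
  have hm0 : 0 ≤ m1 := integral_nonneg fun ζ => by positivity
  calc _ ≤ ∫ z, ‖heat s T (pd (s a) F) z * heat s T θ z‖ := norm_integral_le_integral_norm _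
    _ ≤ ∫ z, m1 * M / T * |heat s T θ z| := by
        refine integral_mono_of_nonneg (Filter.Eventually.of_forall fun ζ => norm_nonneg _)
          ((hθ.heat s T).int.abs.const_mul _) (Filter.Eventually.of_forall fun z => ?_)
        simp only [norm_mul]
        exact mul_le_mul_of_nonneg_right (hb z) (abs_nonneg _)
    _ = m1 * M / T * ∫ z, |heat s T θ z| := integral_const_mul _ _
    _ ≤ m1 * M / T * ∫ z, |θ z| := mul_le_mul_of_nonneg_left (heat_norm_int_le s hθ T) (by positivity)
    _ = _ := by ring

/-- Lemma R. -/
theorem lemR {p q : ℝ} (hpq : p.HolderConjugate q) :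
    ∃ C, 0 < C ∧ ∀ (a b e : ι) (g0 h k : Pt N → ℝ), Nice 4 g0 → Nice 2 h → Nice 4 k →
      (∀ z, op s g0 z = h z + pd (s e) k z) →
      (∫ z, |pd (s a) (pd (s b) g0) z| ^ p) ^ (1 / p) ≤
        C * ((∫ z, |h z| ^ p) ^ (1 / p) + (∫ z, |pd (s b) k z| ^ p) ^ (1 / p)) := by
  obtain ⟨C, hC, hB⟩ := bell s hpq
  refine ⟨2 * C, by positivity, fun a b e g0 h k hg hh hk heq => ?_⟩
  have hf : Nice 2 (pd (s a) (pd (s b) g0)) := (hg.pd _).pd _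
  set f := pd (s a) (pd (s b) g0) with hfdef
  set Hn := (∫ z, |h z| ^ p) ^ (1 / p) with hHn
  set Kn := (∫ z, |pd (s b) k z| ^ p) ^ (1 / p) with hKn
  have hHn0 : 0 ≤ Hn := by positivity
  have hKn0 : 0 ≤ Kn := by positivity
  refine dual_le hpq hf.zero (by positivity) fun ϑ hϑc hϑs => ?_
  have hϑ := Nice.of_cs 2 hϑc hϑs
  set Θ := (∫ z, |ϑ z| ^ q) ^ (1 / q) with hΘ
  obtain ⟨D, hD⟩ := decay s (F := pd (s b) g0) ((hg.pd (s b)).mono (by omega)) hϑ.zero a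
  have hbk : Nice 2 (pd (s b) k) := (hk.pd _).mono (by omega)
  have hopg : op s g0 = fun z => h z + pd (s e) k z := funext heq
  -- the integrand identity
  have hid : ∀ t, (∫ z, Hd s (fun _ _ => 0) (fun _ _ => 1) (fun _ _ => 0) (heat s t f) (heat s t ϑ) z) =
      2 * ((∫ z, pd (s b) (heat s t h) z * pd (s a) (heat s t ϑ) z) +
        ∫ z, pd (s e) (heat s t (pd (s b) k)) z * pd (s a) (heat s t ϑ) z) := by
    intro t
    have h1 : ∀ z, Hd s (fun _ _ => 0) (fun _ _ => 1) (fun _ _ => 0) (heat s t f) (heat s t ϑ) z =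
        2 * ∑ k, pd (s k) (heat s t f) z * pd (s k) (heat s t ϑ) z := by
      intro z; unfold Hd; rw [Finset.mul_sum]
      refine Finset.sum_congr rfl fun k _ => by ring
    simp only [h1]
    rw [integral_const_mul, ibp_op s (hf.heat s t) (hϑ.heat s t), hf.heat_op s t]
    congr 1
    have hop : Nice 2 (op s g0) := hg.op s
    have h2 : heat s t (op s f) = pd (s a) (heat s t (pd (s b) (op s g0))) := by
      rw [hfdef, op_pd s ((hg.pd (s b)).mono (by omega)), op_pd s (hg.mono (by omega)),
        (hop.pd (s b)).heat_pd]
    rw [h2]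
    have h3 := ibp (((hϑ.mono (by omega) : Nice 1 ϑ)).heat s t) ((hop.pd (s b)).heat s t) (s a)
    simp only [mul_comm (heat s t ϑ _)] at h3
    rw [h3, neg_neg]
    have h4 : heat s t (pd (s b) (op s g0)) = fun z => pd (s b) (heat s t h) z +
        pd (s e) (heat s t (pd (s b) k)) z := by
      rw [hopg, pd_add hh.diff (hk.pd (s e)).diff, hk.pd_comm (k := 2), heat_add s (k := 0) ((hh.pd _).zero) ((hbk.pd _).zero),
        (hh.mono (by omega) : Nice 1 h).heat_pd, (hbk.mono (by omega) : Nice 1 (pd (s b) k)).heat_pd]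
    have hA := (hh.heat s t).pd (s b)
    have hBb := (hbk.heat s t).pd (s e)
    have hCc := (hϑ.heat s t).pd (s a)
    rw [← integral_add (hA.mul_int hCc) (hBb.mul_int hCc), h4]
    congr 1; funext z; ring
  have main : ∀ T > 0, |∫ z, f z * ϑ z| ≤ 2 * C * (Hn + Kn) * Θ + D / T := by
    intro T hT
    obtain ⟨hi, he⟩ := flow s C2fn_mul hf hϑ hT.le
    simp only [hid] at hi he
    obtain ⟨b1i, b1⟩ := hB hh hϑ hT.le b a
    obtain ⟨b2i, b2⟩ := hB hbk hϑ hT.le e a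
    have hle : |∫ t in (0:ℝ)..T, t * (2 * ((∫ z, pd (s b) (heat s t h) z * pd (s a) (heat s t ϑ) z) +
        ∫ z, pd (s e) (heat s t (pd (s b) k)) z * pd (s a) (heat s t ϑ) z))| ≤
        2 * (C * (Hn * Θ) + C * (Kn * Θ)) := by
      refine (intervalIntegral.abs_integral_le_integral_abs hT.le).trans ?_
      calc _ ≤ ∫ t in (0:ℝ)..T, 2 * (t * (∫ z, |pd (s b) (heat s t h) z| * |pd (s a) (heat s t ϑ) z|) +
              t * ∫ z, |pd (s e) (heat s t (pd (s b) k)) z| * |pd (s a) (heat s t ϑ) z|) := by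
            refine intervalIntegral.integral_mono_on hT.le hi.abs ((b1i.add b2i).const_mul 2) fun t ht => ?_
            have n1 : |∫ z, pd (s b) (heat s t h) z * pd (s a) (heat s t ϑ) z| ≤
                ∫ z, |pd (s b) (heat s t h) z| * |pd (s a) (heat s t ϑ) z| := by
              refine abs_integral_le_integral_abs.trans (le_of_eq ?_)
              congr 1; funext z; exact abs_mul _ _
            have n2 : |∫ z, pd (s e) (heat s t (pd (s b) k)) z * pd (s a) (heat s t ϑ) z| ≤
                ∫ z, |pd (s e) (heat s t (pd (s b) k)) z| * |pd (s a) (heat s t ϑ) z| := by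
              refine abs_integral_le_integral_abs.trans (le_of_eq ?_)
              congr 1; funext z; exact abs_mul _ _
            rw [abs_mul, abs_mul, abs_of_nonneg ht.1, abs_of_pos (two_pos : (0:ℝ) < 2)]
            have := (abs_add_le _ _).trans (add_le_add n1 n2)
            have := mul_le_mul_of_nonneg_left this ht.1
            linarith
        _ = 2 * ((∫ t in (0:ℝ)..T, t * (∫ z, |pd (s b) (heat s t h) z| * |pd (s a) (heat s t ϑ) z|)) +
              ∫ t in (0:ℝ)..T, t * ∫ z, |pd (s e) (heat s t (pd (s b) k)) z| * |pd (s a) (heat s t ϑ) z|) := by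
            rw [intervalIntegral.integral_const_mul, intervalIntegral.integral_add b1i b2i]
        _ ≤ _ := by linarith
    rw [he] at hle
    have hdT := hD T hT
    have := abs_sub_abs_le_abs_sub (∫ z, f z * ϑ z) (∫ z, heat s T f z * heat s T ϑ z)
    nlinarith
  have hlim : Filter.Tendsto (fun T : ℝ => 2 * C * (Hn + Kn) * Θ + D / T) Filter.atTop
      (nhds (2 * C * (Hn + Kn) * Θ + 0)) :=
    tendsto_const_nhds.add (Filter.Tendsto.const_div_atTop Filter.tendsto_id D)
  rw [add_zero] at hlim
  refine ge_of_tendsto hlim ?_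
  filter_upwards [Filter.eventually_gt_atTop 0] with T hT using main T hT

end

lemma mink {X Z : Type*} [MeasurableSpace X] [MeasurableSpace Z] (μ : Measure X) (κ : Measure Z)
    [SFinite μ] [SFinite κ] {p : ℝ} (hp : 1 < p) {w : Z → ENNReal} (hw : Measurable w)
    {G : X → Z → ENNReal} (hG : Measurable fun q : X × Z => G q.1 q.2) {M : ENNReal}
    (h : ∀ ζ, ∫⁻ x, G x ζ ^ p ∂μ ≤ M) :
    ∫⁻ x, (∫⁻ ζ, w ζ * G x ζ ∂κ) ^ p ∂μ ≤ (∫⁻ ζ, w ζ ∂κ) ^ p * M := by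
  have hpq := Real.HolderConjugate.conjExponent hp
  set q := p.conjExponent
  set W := ∫⁻ ζ, w ζ ∂κ
  have hGx : ∀ x, Measurable fun ζ => G x ζ := fun x => hG.comp measurable_prodMk_left
  have h1 : ∀ x, (∫⁻ ζ, w ζ * G x ζ ∂κ) ^ p ≤ W ^ (p - 1) * ∫⁻ ζ, w ζ * G x ζ ^ p ∂κ := by
    intro x
    have := ENNReal.lintegral_mul_le_Lp_mul_Lq (κ.withDensity w) hpq (hGx x).aemeasurable
      (g := fun _ => 1) aemeasurable_const
    simp only [Pi.mul_apply, mul_one, ENNReal.one_rpow, lintegral_const, one_mul] at this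
    rw [lintegral_withDensity_eq_lintegral_mul _ hw (hGx x),
      lintegral_withDensity_eq_lintegral_mul _ hw ((hGx x).pow_const _),
      withDensity_apply _ MeasurableSet.univ, Measure.restrict_univ] at this
    simp only [Pi.mul_apply] at this
    calc _ ≤ ((∫⁻ ζ, w ζ * G x ζ ^ p ∂κ) ^ (1 / p) * W ^ (1 / q)) ^ p :=
          ENNReal.rpow_le_rpow this (by linarith)
      _ = _ := by
          rw [ENNReal.mul_rpow_of_nonneg _ _ (by linarith), ← ENNReal.rpow_mul, ← ENNReal.rpow_mul,
            one_div, inv_mul_cancel₀ (by linarith), ENNReal.rpow_one, mul_comm]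
          congr 2
          have := hpq.sub_one_mul_conj
          have hq := hpq.symm.pos
          field_simp
          linarith
  calc ∫⁻ x, (∫⁻ ζ, w ζ * G x ζ ∂κ) ^ p ∂μ
      ≤ ∫⁻ x, W ^ (p - 1) * ∫⁻ ζ, w ζ * G x ζ ^ p ∂κ ∂μ := lintegral_mono h1
    _ = W ^ (p - 1) * ∫⁻ x, ∫⁻ ζ, w ζ * G x ζ ^ p ∂κ ∂μ := by
        rw [lintegral_const_mul]
        exact Measurable.lintegral_prod_right' (f := fun q : X × Z => w q.2 * G q.1 q.2 ^ p)
          ((hw.comp measurable_snd).mul (hG.pow_const _))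
    _ = W ^ (p - 1) * ∫⁻ ζ, ∫⁻ x, w ζ * G x ζ ^ p ∂μ ∂κ := by
        rw [lintegral_lintegral_swap]
        exact ((hw.comp measurable_snd).mul (hG.pow_const _)).aemeasurable
    _ ≤ W ^ (p - 1) * ∫⁻ ζ, w ζ * M ∂κ := by
        gcongr with ζ
        rw [lintegral_const_mul]
        · gcongr; exact h ζ
        · exact (hG.comp measurable_prodMk_right).pow_const _
    _ = _ := by
        rw [lintegral_mul_const _ hw, ← mul_assoc]
        congr 1
        change W ^ (p - 1) * W = W ^ p
        conv_lhs => rw [← ENNReal.rpow_one W, ← ENNReal.rpow_mul, one_mul]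
        rw [← ENNReal.rpow_add_of_nonneg _ _ (by linarith) (by norm_num)]
        congr 1; ring

lemma eLp_rpow {X : Type*} [MeasurableSpace X] (μ : Measure X) {p : ℝ} (hp : 0 < p) (g : X → ℝ) :
    eLpNorm g (ENNReal.ofReal p) μ ^ p = ∫⁻ x, ‖g x‖ₑ ^ p ∂μ := by
  rw [eLpNorm_eq_lintegral_rpow_enorm_toReal (by simpa using hp) ENNReal.ofReal_ne_top,
    ENNReal.toReal_ofReal hp.le, ← ENNReal.rpow_mul, one_div, inv_mul_cancel₀ hp.ne',
    ENNReal.rpow_one]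

lemma mink' {X Z : Type*} [MeasurableSpace X] [MeasurableSpace Z] (μ : Measure X) (κ : Measure Z)
    [SFinite μ] [SFinite κ] {p : ℝ} (hp : 1 < p) {w : Z → ENNReal} (hw : Measurable w)
    {G : X → Z → ℝ} (hG : Measurable fun q : X × Z => G q.1 q.2) {M : ENNReal}
    {g : X → ℝ} (hg : ∀ x, ‖g x‖ₑ ≤ ∫⁻ ζ, w ζ * ‖G x ζ‖ₑ ∂κ)
    (h : ∀ ζ, eLpNorm (fun x => G x ζ) (ENNReal.ofReal p) μ ≤ M) :
    eLpNorm g (ENNReal.ofReal p) μ ≤ (∫⁻ ζ, w ζ ∂κ) * M := by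
  have hp0 : 0 < p := by linarith
  have key := mink μ κ hp hw (G := fun x ζ => ‖G x ζ‖ₑ) hG.enorm (M := M ^ p) (fun ζ => by
    rw [← eLp_rpow μ hp0]; exact ENNReal.rpow_le_rpow (h ζ) hp0.le)
  rw [← ENNReal.mul_rpow_of_nonneg _ _ hp0.le] at key
  have := (lintegral_mono (μ := μ) fun x => ENNReal.rpow_le_rpow (hg x) hp0.le).trans key
  rw [← eLp_rpow μ hp0] at this
  exact (ENNReal.rpow_le_rpow_iff hp0).1 this

section
variable {N : ℕ}

/-- slice norm -/
def sl (p : ℝ) (F : Pt N → ℝ) (y : ℝ) : ENNReal :=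
  eLpNorm (fun x => F (x, y)) (ENNReal.ofReal p) volume

/-- the horizontal directions -/
def sx (ρ : ℝ) (i : Fin N) : Pt N := ρ • ex i

lemma hl_sx (ρ : ℝ) (ζ : Fin N → ℝ) : hl (sx ρ) ζ = (ρ • ζ, 0) := by
  ext i
  · simp [hl, sx, ex, Prod.fst_sum, Pi.single_apply, mul_comm]
  · simp [hl, sx, ex, Prod.snd_sum]

lemma sl_shift (p : ℝ) (F : Pt N → ℝ) (y : ℝ) (a : Fin N → ℝ) :
    eLpNorm (fun x => F (x + a, y)) (ENNReal.ofReal p) volume = sl p F y := by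
  unfold sl
  by_cases hp : ENNReal.ofReal p = 0
  · simp [hp]
  rw [eLpNorm_eq_lintegral_rpow_enorm_toReal hp ENNReal.ofReal_ne_top,
    eLpNorm_eq_lintegral_rpow_enorm_toReal hp ENNReal.ofReal_ne_top]
  congr 1
  exact lintegral_add_right_eq_self (fun x => ‖F (x, y)‖ₑ ^ (ENNReal.ofReal p).toReal) a

lemma sl_heat_arg (ρ t : ℝ) (x ζ : Fin N → ℝ) (y : ℝ) :
    ((x, y) : Pt N) + t • hl (sx ρ) ζ = (x + (t * ρ) • ζ, y) := by
  rw [hl_sx]; ext i <;> simp [mul_assoc]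

variable {p : ℝ} (ρ : ℝ)

lemma sl_heat_le (hp : 1 < p) {F : Pt N → ℝ} (hF : Continuous F) (t y : ℝ) :
    sl p (heat (sx ρ) t F) y ≤ sl p F y := by
  have := mink' (volume : Measure (Fin N → ℝ)) (gν (Fin N)) hp (w := fun _ => 1) measurable_const
    (G := fun x ζ => F (x + (t * ρ) • ζ, y)) (M := sl p F y)
    (g := fun x => heat (sx ρ) t F (x, y)) (by fun_prop) (fun x => ?_) (fun ζ => ?_)
  · simpa [sl] using this
  · simp only [one_mul, heat, sl_heat_arg]
    exact enorm_integral_le_lintegral_enorm _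
  · exact (sl_shift p F y _).le

/-- a finite gaussian constant -/
def gC (N : ℕ) : ENNReal := ∫⁻ ζ : Fin N → ℝ, ENNReal.ofReal (1 + ‖ζ‖ ^ 2) ∂(gν (Fin N))

lemma gC_lt : gC N < ⊤ := by
  have : Integrable (fun ζ : Fin N → ℝ => 1 + ‖ζ‖ ^ 2) (gν (Fin N)) :=
    (integrable_const 1).add (gmoment 2)
  exact this.lintegral_lt_top

lemma Nice.stein2 {F : Pt N → ℝ} (hF : Nice 2 F) (t : ℝ) (z : Pt N) (i j : Fin N) :
    t ^ 2 * _root_.heat (sx ρ) t (_root_.pd (sx ρ i) (_root_.pd (sx ρ j) F)) z =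
    ∫ ζ, (ζ i * ζ j - if i = j then 1 else 0) * F (z + t • hl (sx ρ) ζ) ∂(gν (Fin N)) := by
  have h1 := (hF.pd (sx ρ j)).heat_stein (sx ρ) t z i
  have hF1 : Nice 1 F := hF.mono (by omega)
  obtain ⟨C, hC⟩ := hF.bdd
  obtain ⟨D, hD⟩ := (hF.pd (sx ρ j)).bdd
  have hC0 : 0 ≤ C := (abs_nonneg _).trans (hC 0)
  have hD0 : 0 ≤ D := (abs_nonneg _).trans (hD 0)
  have cF : Continuous fun ζ => F (z + t • hl (sx ρ) ζ) := hF.cont.comp (heat_arg_cont _ t z)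
  have cD : Continuous fun ζ => _root_.pd (sx ρ j) F (z + t • hl (sx ρ) ζ) :=
    (hF.pd _).cont.comp (heat_arg_cont _ t z)
  have e : ∀ ζ, fderiv ℝ (fun ζ : Fin N → ℝ => ζ i * F (z + t • hl (sx ρ) ζ)) ζ (Pi.single j 1) =
      (if i = j then 1 else 0) * F (z + t • hl (sx ρ) ζ) +
        t * (ζ i * _root_.pd (sx ρ j) F (z + t • hl (sx ρ) ζ)) := by
    intro ζ
    have hd := hl_hasFDeriv (sx ρ) t z ζ (Pi.single j 1) hF1.diff
    have h0 : HasFDerivAt (fun ζ : Fin N → ℝ => ζ i) (ContinuousLinearMap.proj (R := ℝ) i) ζ :=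
      (ContinuousLinearMap.proj (R := ℝ) (φ := fun _ : Fin N => ℝ) i).hasFDerivAt
    rw [show (fun ζ : Fin N → ℝ => ζ i * F (z + t • hl (sx ρ) ζ)) = (fun ζ : Fin N → ℝ => ζ i) * fun ζ => F (z + t • hl (sx ρ) ζ) from rfl,
      (h0.mul hd.1.hasFDerivAt).fderiv]
    simp only [ContinuousLinearMap.add_apply, ContinuousLinearMap.smul_apply, smul_eq_mul, hd.2,
      hl_single, ContinuousLinearMap.proj_apply, Pi.single_apply, _root_.pd]
    ring
  have nb : ∀ (ζ : Fin N → ℝ) (k : Fin N), |ζ k| ≤ ‖ζ‖ := fun ζ k => norm_le_pi_norm ζ k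
  have st := stein (G := fun ζ : Fin N → ℝ => ζ i * F (z + t • hl (sx ρ) ζ)) j
    (fun ζ => (differentiableAt_apply i ζ).mul (hl_hasFDeriv (sx ρ) t z ζ 0 hF1.diff).1)
    (by
      simp only [e]
      exact (continuous_const.mul cF).add (continuous_const.mul ((continuous_apply i).mul cD))) (C + |t| * D) 1
    (fun ζ => by
      rw [abs_mul, pow_one]
      have := mul_le_mul (nb ζ i) (hC (z + t • hl (sx ρ) ζ)) (abs_nonneg _) (norm_nonneg _)
      have : 0 ≤ |t| * D * (1 + ‖ζ‖) := by positivity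
      nlinarith [norm_nonneg ζ])
    (fun ζ => by
      rw [e, pow_one]
      refine (abs_add_le _ _).trans ?_
      rw [abs_mul, abs_mul, abs_mul]
      have h1 : |(if i = j then (1:ℝ) else 0)| ≤ 1 := by split_ifs <;> simp
      have h2 := mul_le_mul h1 (hC (z + t • hl (sx ρ) ζ)) (abs_nonneg _) zero_le_one
      have h3 := mul_le_mul (nb ζ i) (hD (z + t • hl (sx ρ) ζ)) (abs_nonneg _) (norm_nonneg _)
      have h4 := mul_le_mul_of_nonneg_left h3 (abs_nonneg t)
      have : 0 ≤ |t| * D := by positivity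
      nlinarith [norm_nonneg ζ, mul_nonneg hC0 (norm_nonneg ζ)])
  simp only [e] at st
  have iD : Integrable (fun ζ : Fin N → ℝ => ζ i * _root_.pd (sx ρ j) F (z + t • hl (sx ρ) ζ))
      (gν (Fin N)) := by
    refine gint_poly (by fun_prop) D 1 fun ζ => ?_
    rw [abs_mul, pow_one, mul_comm]
    exact mul_le_mul (hD _) (nb ζ i) (abs_nonneg _) hD0
  have iF : Integrable (fun ζ : Fin N → ℝ => (if i = j then (1:ℝ) else 0) * F (z + t • hl (sx ρ) ζ))
      (gν (Fin N)) := (hF.heat_intble (sx ρ) t z).const_mul _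
  have iFF : Integrable (fun ζ : Fin N → ℝ => ζ j * (ζ i * F (z + t • hl (sx ρ) ζ)))
      (gν (Fin N)) := by
    refine gint_poly ((continuous_apply j).mul ((continuous_apply i).mul cF)) C 2 fun ζ => ?_
    rw [abs_mul, abs_mul]
    calc _ ≤ ‖ζ‖ * (‖ζ‖ * C) := by
          gcongr
          · exact nb ζ j
          · exact nb ζ i
          · exact hC _
      _ = _ := by ring
  rw [integral_add iF (iD.const_mul t), integral_const_mul t] at st
  have e2 : ∀ ζ : Fin N → ℝ, (ζ i * ζ j - if i = j then 1 else 0) * F (z + t • hl (sx ρ) ζ) =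
      ζ j * (ζ i * F (z + t • hl (sx ρ) ζ)) - (if i = j then (1:ℝ) else 0) * F (z + t • hl (sx ρ) ζ) := by
    intro ζ; ring
  simp only [e2]
  rw [integral_sub iFF iF, st, h1]
  ring

lemma sl_const_mul (c : ℝ) (F : Pt N → ℝ) (y : ℝ) :
    sl p (fun z => c * F z) y = ‖c‖ₑ * sl p F y := eLpNorm_const_smul c _ _ _

lemma sl_smooth (hp : 1 < p) {F : Pt N → ℝ} (hF : Nice 2 F) {t : ℝ} (ht : 0 < t) (y : ℝ)
    (i j : Fin N) :
    ENNReal.ofReal (t ^ 2) * sl p (heat (sx ρ) t (pd (sx ρ i) (pd (sx ρ j) F))) y ≤ gC N * sl p F y := by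
  have hc := hF.cont
  have := mink' (volume : Measure (Fin N → ℝ)) (gν (Fin N)) hp
    (w := fun ζ => ENNReal.ofReal (1 + ‖ζ‖ ^ 2)) (by fun_prop)
    (G := fun x ζ => F (x + (t * ρ) • ζ, y)) (M := sl p F y)
    (g := fun x => t ^ 2 * heat (sx ρ) t (pd (sx ρ i) (pd (sx ρ j) F)) (x, y)) (by fun_prop)
    (fun x => ?_) (fun ζ => ?_)
  · have e := sl_const_mul (p := p) (t ^ 2) (heat (sx ρ) t (pd (sx ρ i) (pd (sx ρ j) F))) y
    rw [Real.enorm_of_nonneg (by positivity)] at e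
    rw [← e]; exact this
  · simp only [hF.stein2, sl_heat_arg]
    refine (enorm_integral_le_lintegral_enorm _).trans (lintegral_mono fun ζ => ?_)
    simp only [enorm_mul]
    gcongr
    rw [← ofReal_norm]
    refine ENNReal.ofReal_le_ofReal ?_
    have h1 : |(if i = j then (1:ℝ) else 0)| ≤ 1 := by split_ifs <;> simp
    have h2 : |ζ i * ζ j| ≤ ‖ζ‖ ^ 2 := by
      rw [abs_mul, sq]
      exact mul_le_mul (norm_le_pi_norm ζ i) (norm_le_pi_norm ζ j) (abs_nonneg _) (norm_nonneg _)
    have := abs_sub (ζ i * ζ j) (if i = j then (1:ℝ) else 0)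
    change |_| ≤ _
    linarith
  · exact (sl_shift p F y _).le

end

section
variable {N : ℕ} {p : ℝ}

lemma sl_neg (F : Pt N → ℝ) (y : ℝ) : sl p (fun z => - F z) y = sl p F y := by
  have := sl_const_mul (p := p) (-1) F y
  simpa using this

lemma sl_add (hp : 1 < p) {F G : Pt N → ℝ} (hF : Continuous F) (hG : Continuous G) (y : ℝ) :
    sl p (fun z => F z + G z) y ≤ sl p F y + sl p G y :=
  eLpNorm_add_le (by fun_prop : Continuous fun x => F (x, y)).aestronglyMeasurable
    (by fun_prop : Continuous fun x => G (x, y)).aestronglyMeasurable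
    (by rw [ENNReal.one_le_ofReal]; exact hp.le)

lemma sl_sub (hp : 1 < p) {F G : Pt N → ℝ} (hF : Continuous F) (hG : Continuous G) (y : ℝ) :
    sl p (fun z => F z - G z) y ≤ sl p F y + sl p G y :=
  eLpNorm_sub_le (by fun_prop : Continuous fun x => F (x, y)).aestronglyMeasurable
    (by fun_prop : Continuous fun x => G (x, y)).aestronglyMeasurable
    (by rw [ENNReal.one_le_ofReal]; exact hp.le)

lemma sl_sum (hp : 1 < p) {ι : Type*} (S : Finset ι) {F : ι → Pt N → ℝ} (hF : ∀ i, Continuous (F i))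
    (y : ℝ) : sl p (fun z => ∑ i ∈ S, F i z) y ≤ ∑ i ∈ S, sl p (F i) y := by
  unfold sl
  have := eLpNorm_sum_le (μ := (volume : Measure (Fin N → ℝ))) (s := S)
    (f := fun i x => F i (x, y)) (p := ENNReal.ofReal p)
    (fun i _ => (by have := hF i; fun_prop : Continuous fun x => F i (x, y)).aestronglyMeasurable)
    (by rw [ENNReal.one_le_ofReal]; exact hp.le)
  refine le_trans (le_of_eq ?_) this
  congr 1; funext x; simp

lemma sl_abs (F : Pt N → ℝ) (y : ℝ) : sl p (fun z => |F z|) y = sl p F y := by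
  unfold sl; exact eLpNorm_norm (fun x => F (x, y))

lemma sl_psi2 (hp : 1 < p) (ρ : ℝ) {F : Pt N → ℝ} (hF : Nice 2 F) {t : ℝ} (ht : 0 ≤ t) (y : ℝ) :
    sl p (fun z => F z - heat (sx ρ) t F z) y ≤ ENNReal.ofReal (t ^ 2) * sl p (op (sx ρ) F) y := by
  have ho : Nice 0 (op (sx ρ) F) := hF.op (sx ρ)
  have hcj := heat_cont_joint (sx ρ) ho.cont ho.bdd
  have := mink' (volume : Measure (Fin N → ℝ)) (volume.restrict (Set.Ioc 0 t)) hp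
    (w := fun τ => ENNReal.ofReal τ) (by fun_prop)
    (G := fun x τ => heat (sx ρ) τ (op (sx ρ) F) (x, y)) (M := sl p (op (sx ρ) F) y)
    (g := fun x => F (x, y) - heat (sx ρ) t F (x, y))
    (Continuous.measurable (hcj.comp (by fun_prop : Continuous fun q : (Fin N → ℝ) × ℝ =>
      ((q.2, (q.1, y)) : ℝ × Pt N))))
    (fun x => ?_) (fun τ => sl_heat_le ρ hp ho.cont τ y)
  · refine this.trans ?_
    gcongr
    calc ∫⁻ τ in Set.Ioc 0 t, ENNReal.ofReal τ ≤ ∫⁻ τ in Set.Ioc 0 t, ENNReal.ofReal t := by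
          refine setLIntegral_mono measurable_const fun τ hτ => ENNReal.ofReal_le_ofReal hτ.2
      _ = _ := by
          rw [setLIntegral_const, Real.volume_Ioc, ← ENNReal.ofReal_mul ht]; congr 1; ring
  · have hc : Continuous fun τ => τ * heat (sx ρ) τ (op (sx ρ) F) (x, y) :=
      continuous_id.mul (hcj.comp (by fun_prop : Continuous fun τ : ℝ => ((τ, (x, y)) : ℝ × Pt N)))
    have h1 := intervalIntegral.integral_eq_sub_of_hasDerivAt
      (fun τ _ => hF.heat_deriv (sx ρ) τ (x, y)) (hc.intervalIntegrable 0 t)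
    rw [heat_zero, intervalIntegral.integral_of_le ht] at h1
    have : F (x, y) - heat (sx ρ) t F (x, y) =
        - ∫ τ in Set.Ioc 0 t, τ * heat (sx ρ) τ (op (sx ρ) F) (x, y) := by rw [h1]; ring
    rw [this, enorm_neg]
    refine (enorm_integral_le_lintegral_enorm _).trans ?_
    refine setLIntegral_mono' measurableSet_Ioc fun τ hτ => ?_
    rw [enorm_mul, Real.enorm_of_nonneg hτ.1.le]

lemma sl_psi1 (hp : 1 < p) (ρ : ℝ) {F : Pt N → ℝ} (hF : Nice 1 F) {t : ℝ} (ht : 0 ≤ t) (y : ℝ) :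
    sl p (fun z => F z - heat (sx ρ) t F z) y ≤
      gC N * (ENNReal.ofReal t * ∑ m, sl p (pd (sx ρ m) F) y) := by
  have hc : ∀ m, Continuous (pd (sx ρ m) F) := fun m => (hF.pd _).cont
  have := mink' (volume : Measure (Fin N → ℝ)) ((gν (Fin N)).prod (volume.restrict (Set.Ioc (0:ℝ) 1))) hp
    (w := fun q => ENNReal.ofReal (1 + ‖q.1‖ ^ 2)) (by fun_prop)
    (G := fun x q => t * ∑ m, |pd (sx ρ m) F (x + (q.2 * t * ρ) • q.1, y)|)
    (M := ENNReal.ofReal t * ∑ m, sl p (pd (sx ρ m) F) y)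
    (g := fun x => F (x, y) - heat (sx ρ) t F (x, y))
    (Continuous.measurable (by fun_prop)) (fun x => ?_) (fun q => ?_)
  · refine this.trans (le_of_eq ?_)
    congr 1
    rw [lintegral_prod _ (by fun_prop)]
    simp [gC]
  · have cG : Measurable fun q : (Fin N → ℝ) × ℝ => ENNReal.ofReal (1 + ‖q.1‖ ^ 2) *
        ‖t * ∑ m, |pd (sx ρ m) F (x + (q.2 * t * ρ) • q.1, y)|‖ₑ :=
      (by fun_prop : Measurable fun q : (Fin N → ℝ) × ℝ => ENNReal.ofReal (1 + ‖q.1‖ ^ 2)).mul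
        (Measurable.enorm (Continuous.measurable (by fun_prop)))
    rw [lintegral_prod _ cG.aemeasurable]
    have e : F (x, y) - heat (sx ρ) t F (x, y) =
        ∫ ζ, (F (x, y) - F ((x, y) + t • hl (sx ρ) ζ)) ∂(gν (Fin N)) := by
      rw [integral_sub (integrable_const _) (hF.heat_intble _ t _)]; simp [heat]
    rw [e]
    refine (enorm_integral_le_lintegral_enorm _).trans (lintegral_mono fun ζ => ?_)
    have hder : ∀ θ : ℝ, HasDerivAt (fun θ : ℝ => F ((x, y) + (θ * t) • hl (sx ρ) ζ))
        (t * ∑ m, ζ m * pd (sx ρ m) F (x + (θ * t * ρ) • ζ, y)) θ := by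
      intro θ
      have h1 : HasDerivAt (fun θ : ℝ => ((x, y) : Pt N) + (θ * t) • hl (sx ρ) ζ) (t • hl (sx ρ) ζ) θ := by
        simpa using (((hasDerivAt_id θ).mul_const t).smul_const (hl (sx ρ) ζ)).const_add ((x, y) : Pt N)
      refine ((hF.diff _).hasFDerivAt.comp_hasDerivAt θ h1).congr_deriv ?_
      rw [map_smul, smul_eq_mul, sl_heat_arg]
      congr 1
      conv_lhs => rw [hl.eq_1 (sx ρ) ζ]
      simp only [map_sum, map_smul, smul_eq_mul, pd]
    have hcont : Continuous fun θ : ℝ => t * ∑ m, ζ m * pd (sx ρ m) F (x + (θ * t * ρ) • ζ, y) := by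
      fun_prop
    have h1 := intervalIntegral.integral_eq_sub_of_hasDerivAt
      (fun θ _ => hder θ) (hcont.intervalIntegrable 0 1)
    simp only [one_mul, zero_mul, zero_smul, add_zero] at h1
    rw [intervalIntegral.integral_of_le zero_le_one] at h1
    have h2 : F (x, y) - F ((x, y) + t • hl (sx ρ) ζ) =
      - ∫ θ in Set.Ioc (0:ℝ) 1, t * ∑ m, ζ m * pd (sx ρ m) F (x + (θ * t * ρ) • ζ, y) := by
      rw [h1]; ring
    rw [h2, enorm_neg]
    refine (enorm_integral_le_lintegral_enorm _).trans (lintegral_mono fun θ => ?_)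
    have b0 : (0:ℝ) ≤ 1 + ‖ζ‖ ^ 2 := by positivity
    simp only
    rw [← Real.enorm_of_nonneg b0, ← enorm_mul]
    rw [enorm_le_iff_norm_le, Real.norm_eq_abs, Real.norm_eq_abs, abs_mul, abs_mul, abs_mul,
      abs_of_nonneg b0, abs_of_nonneg ht, mul_left_comm]
    refine mul_le_mul_of_nonneg_left ?_ ht
    rw [abs_of_nonneg (Finset.sum_nonneg fun m _ => abs_nonneg (pd (sx ρ m) F (x + (θ * t * ρ) • ζ, y))),
      Finset.mul_sum]
    refine (Finset.abs_sum_le_sum_abs _ _).trans (Finset.sum_le_sum fun m _ => ?_)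
    rw [abs_mul]
    have : |ζ m| ≤ ‖ζ‖ := norm_le_pi_norm ζ m
    refine mul_le_mul_of_nonneg_right ?_ (abs_nonneg _)
    nlinarith [sq_nonneg (‖ζ‖ - 1)]
  · have h1 : eLpNorm (fun x => t * ∑ m, |pd (sx ρ m) F (x + (q.2 * t * ρ) • q.1, y)|)
        (ENNReal.ofReal p) volume = sl p (fun z => t * ∑ m, |pd (sx ρ m) F z|) y :=
      sl_shift p (fun z => t * ∑ m, |pd (sx ρ m) F z|) y _
    rw [h1, sl_const_mul, Real.enorm_of_nonneg ht]
    gcongr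
    refine (sl_sum hp _ (fun m => (hc m).abs) y).trans (le_of_eq ?_)
    simp only [sl_abs]

end

section semigroup
variable {N : ℕ} {ι : Type} [Fintype ι] (s : ι → Pt N)

/-- heat in the natural time parameter -/
def hH (a : ℝ) (f : Pt N → ℝ) : Pt N → ℝ := heat s (√(2 * a)) f

lemma hH_deriv {F : Pt N → ℝ} (hF : Nice 2 F) (z : Pt N) {a : ℝ} (ha : 0 ≤ a) :
    HasDerivWithinAt (fun a => hH s a F z) (hH s a (op s F) z) (Set.Ici 0) a := by
  have ho : Nice 0 (op s F) := hF.op s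
  have pos : ∀ a : ℝ, 0 < a → HasDerivAt (fun a => hH s a F z) (hH s a (op s F) z) a := by
    intro a ha
    have h1 : HasDerivAt (fun a : ℝ => √(2 * a)) (1 / √(2 * a)) a := by
      have := ((hasDerivAt_id a).const_mul 2).sqrt (by simp; positivity)
      refine this.congr_deriv ?_
      simp; field_simp
    refine ((hF.heat_deriv s (√(2 * a)) z).comp a h1).congr_deriv ?_
    have : √(2 * a) ≠ 0 := by positivity
    rw [hH]; field_simp
  have cont : ∀ {G : Pt N → ℝ}, Nice 0 G → Continuous fun a => hH s a G z := fun {G} hG =>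
    (heat_cont_joint s hG.cont hG.bdd).comp (by fun_prop : Continuous fun a : ℝ => (√(2 * a), z))
  rcases ha.eq_or_lt with rfl | ha
  · refine hasDerivWithinAt_Ici_of_tendsto_deriv (s := Set.Ioi 0)
      (fun a ha => (pos a ha).differentiableAt.differentiableWithinAt)
      (cont hF.zero).continuousWithinAt self_mem_nhdsWithin ?_
    refine Filter.Tendsto.congr' (f₁ := fun a => hH s a (op s F) z) ?_
      ((cont ho).tendsto 0 |>.mono_left nhdsWithin_le_nhds)
    filter_upwards [self_mem_nhdsWithin] with a ha using (pos a ha).deriv.symm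
  · exact (pos a ha).hasDerivWithinAt

lemma hH_lip {F : Pt N → ℝ} (hF : Nice 2 F) {C : ℝ} (hC : ∀ z, |op s F z| ≤ C) (z : Pt N) {a b : ℝ}
    (ha : 0 ≤ a) (hb : 0 ≤ b) : |hH s b F z - hH s a F z| ≤ C * |b - a| :=
  (convex_Ici (0:ℝ)).norm_image_sub_le_of_norm_hasDerivWithin_le
    (fun a ha => hH_deriv s hF z ha) (fun a _ => heat_bound s hC _ _) ha hb

lemma hH_taylor {F : Pt N → ℝ} (hF : Nice 4 F) {C : ℝ} (hC : ∀ z, |op s (op s F) z| ≤ C) (z : Pt N)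
    {a b : ℝ} (ha : 0 ≤ a) (hb : 0 ≤ b) :
    |hH s b F z - hH s a F z - (b - a) * hH s a (op s F) z| ≤ C * |b - a| ^ 2 := by
  have ho : Nice 2 (op s F) := hF.op s
  have hsub : Set.uIcc a b ⊆ Set.Ici 0 := fun τ hτ => (le_min ha hb).trans hτ.1
  have := (convex_uIcc a b).norm_image_sub_le_of_norm_hasDerivWithin_le
    (f := fun τ => hH s τ F z - τ * hH s a (op s F) z)
    (f' := fun τ => hH s τ (op s F) z - hH s a (op s F) z) (C := C * |b - a|)
    (fun τ hτ => ((hH_deriv s (hF.mono (by omega)) z (hsub hτ)).mono hsub).sub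
      (((hasDerivAt_id τ).mul_const _).hasDerivWithinAt.congr_deriv (by simp)))
    (fun τ hτ => (hH_lip s ho hC z ha (hsub hτ)).trans (by
      have : 0 ≤ C := (abs_nonneg _).trans (hC 0)
      gcongr 1
      exact Set.abs_sub_left_of_mem_uIcc hτ)) Set.left_mem_uIcc Set.right_mem_uIcc
  rw [Real.norm_eq_abs, Real.norm_eq_abs] at this
  rw [sq, ← mul_assoc]
  convert this using 2
  ring

lemma semigroup {F : Pt N → ℝ} (hF : Nice 4 F) {a S : ℝ} (ha : 0 ≤ a) (haS : a ≤ S) (z : Pt N) :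
    hH s (S - a) (hH s a F) z = hH s S F z := by
  have hF2 : Nice 2 F := hF.mono (by omega)
  have ho : Nice 2 (op s F) := hF.op s
  obtain ⟨C, hC⟩ := (ho.op s).bdd
  have hC0 : 0 ≤ C := (abs_nonneg _).trans (hC 0)
  have nH : ∀ τ, Nice 4 (hH s τ F) := fun τ => hF.heat s _
  have oH : ∀ τ, op s (hH s τ F) = hH s τ (op s F) := fun τ => hF2.heat_op s _
  have ooH : ∀ τ, op s (hH s τ (op s F)) = hH s τ (op s (op s F)) := fun τ => ho.heat_op s _
  have bnd : ∀ τ ∈ Set.Icc 0 S, ∀ σ ∈ Set.Icc 0 S,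
      |hH s (S - σ) (hH s σ F) z - hH s (S - τ) (hH s τ F) z| ≤ 3 * C * |σ - τ| ^ 2 := by
    intro τ hτ σ hσ
    have t1 : |hH s (S - σ) (fun z => (hH s σ F z - hH s τ F z) - (σ - τ) * hH s τ (op s F) z) z| ≤
        C * |σ - τ| ^ 2 := heat_bound s (fun z => hH_taylor s hF hC z hτ.1 hσ.1) _ _
    have e1 : hH s (S - σ) (fun z => (hH s σ F z - hH s τ F z) - (σ - τ) * hH s τ (op s F) z) z =
        (hH s (S - σ) (hH s σ F) z - hH s (S - σ) (hH s τ F) z) -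
          (σ - τ) * hH s (S - σ) (hH s τ (op s F)) z := by
      have i1 := heat_sub s (nH σ) (nH τ) (√(2 * (S - σ)))
      have i2 := heat_sub s ((nH σ).sub (nH τ)).zero (((ho.heat s (√(2 * τ))).const_mul (σ - τ))).zero
        (√(2 * (S - σ)))
      have i3 := heat_const_mul s (σ - τ) (hH s τ (op s F)) (√(2 * (S - σ)))
      have := congrFun i2 z
      simp only [hH] at *
      rw [this, i1, i3]
    have t2 := hH_taylor s (nH τ) (C := C) (fun z => by
      rw [oH, ooH]; exact heat_bound s hC _ _) z (a := S - τ) (b := S - σ) (by linarith [hτ.2]) (by linarith [hσ.2])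
    have t3 := hH_lip s (ho.heat s (√(2 * τ))) (C := C) (fun z => by
      change |op s (hH s τ (op s F)) z| ≤ C
      rw [ooH]; exact heat_bound s hC _ _) z (a := S - τ) (b := S - σ) (by linarith [hτ.2]) (by linarith [hσ.2])
    rw [e1] at t1
    rw [oH] at t2
    change |hH s (S - σ) (hH s τ (op s F)) z - hH s (S - τ) (hH s τ (op s F)) z| ≤ _ at t3
    have e2 : S - σ - (S - τ) = -(σ - τ) := by ring
    rw [e2, abs_neg] at t2 t3
    have t4 : |(σ - τ) * (hH s (S - σ) (hH s τ (op s F)) z - hH s (S - τ) (hH s τ (op s F)) z)| ≤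
        C * |σ - τ| ^ 2 := by
      rw [abs_mul]
      calc _ ≤ |σ - τ| * (C * |σ - τ|) := by gcongr
        _ = _ := by ring
    have := abs_add_three ((hH s (S - σ) (hH s σ F) z - hH s (S - σ) (hH s τ F) z) -
          (σ - τ) * hH s (S - σ) (hH s τ (op s F)) z)
      (hH s (S - σ) (hH s τ F) z - hH s (S - τ) (hH s τ F) z - -(σ - τ) * hH s (S - τ) (hH s τ (op s F)) z)
      ((σ - τ) * (hH s (S - σ) (hH s τ (op s F)) z - hH s (S - τ) (hH s τ (op s F)) z))
    refine le_trans (le_of_eq ?_) (this.trans (by linarith))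
    congr 1; ring
  have hder : ∀ τ ∈ Set.Icc 0 S, HasDerivWithinAt
      (fun σ => hH s (S - σ) (hH s σ F) z) 0 (Set.Icc 0 S) τ := by
    intro τ hτ
    have h1 : HasFDerivWithinAt (fun σ => hH s (S - σ) (hH s σ F) z - hH s (S - τ) (hH s τ F) z)
        (0 : ℝ →L[ℝ] ℝ) (Set.Icc 0 S) τ := by
      refine Asymptotics.IsBigO.hasFDerivWithinAt (n := 2) ?_ hτ (by norm_num)
      refine Asymptotics.IsBigO.of_bound (3 * C) ?_
      filter_upwards [self_mem_nhdsWithin] with σ hσ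
      simpa using bnd τ hτ σ hσ
    have h2 := h1.hasDerivWithinAt
    simpa using h2.add_const (hH s (S - τ) (hH s τ F) z)
  have := (convex_Icc (0:ℝ) S).norm_image_sub_le_of_norm_hasDerivWithin_le hder (C := 0)
    (fun τ _ => by simp) (⟨le_rfl, ha.trans haS⟩ : (0:ℝ) ∈ Set.Icc 0 S) (⟨ha, haS⟩ : a ∈ Set.Icc 0 S)
  rw [zero_mul, norm_le_zero_iff, sub_eq_zero] at this
  simpa [hH, heat_zero] using this

end semigroup

lemma sl_heat_anti {N : ℕ} {p : ℝ} (hp : 1 < p) (ρ : ℝ) {F : Pt N → ℝ} (hF : Nice 4 F) {t t' : ℝ}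
    (h0 : 0 ≤ t') (h : t' ≤ t) (y : ℝ) :
    sl p (heat (sx ρ) t F) y ≤ sl p (heat (sx ρ) t' F) y := by
  have e : ∀ t : ℝ, 0 ≤ t → heat (sx ρ) t F = hH (sx ρ) (t ^ 2 / 2) F := by
    intro t ht
    rw [hH, show 2 * (t ^ 2 / 2) = t ^ 2 by ring, Real.sqrt_sq ht]
  have h2 : hH (sx ρ) (t ^ 2 / 2) F =
      heat (sx ρ) (√(2 * (t ^ 2 / 2 - t' ^ 2 / 2))) (heat (sx ρ) t' F) := by
    funext z
    rw [← semigroup (sx ρ) hF (a := t' ^ 2 / 2) (by positivity) (by gcongr), ← e t' h0]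
    rfl
  rw [e t (h0.trans h), h2]
  exact sl_heat_le ρ hp (hF.heat (sx ρ) t').cont _ y

section
variable {N : ℕ} {p : ℝ}

lemma sl_meas (hp : 1 < p) {F : Pt N → ℝ} (hF : Continuous F) : Measurable (sl p F) := by
  have h0 : ENNReal.ofReal p ≠ 0 := by simp; linarith
  have e : sl p F = fun y => (∫⁻ x, ‖F (x, y)‖ₑ ^ p) ^ (1 / p) := by
    funext y
    rw [sl, eLpNorm_eq_lintegral_rpow_enorm_toReal h0 ENNReal.ofReal_ne_top,
      ENNReal.toReal_ofReal (by linarith)]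
  rw [e]
  refine Measurable.pow_const ?_ _
  exact Measurable.lintegral_prod_left' (f := fun q : Pt N => ‖F q‖ₑ ^ p)
    ((hF.measurable.enorm).pow_const _)

lemma eLp_slice (hp : 1 < p) {F : Pt N → ℝ} (hF : Continuous F) :
    eLpNorm F (ENNReal.ofReal p) volume ^ p = ∫⁻ y, sl p F y ^ p := by
  have hp0 : 0 < p := by linarith
  rw [eLp_rpow _ hp0, Measure.volume_eq_prod, lintegral_prod_symm _
    ((hF.measurable.enorm).pow_const _).aemeasurable]
  congr 1; funext y
  rw [sl, eLp_rpow _ hp0]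

lemma rpow_add_le2 (hp : 1 < p) (a b : ENNReal) :
    (a + b) ^ p ≤ 2 ^ (p - 1) * (a ^ p + b ^ p) := by
  have := ENNReal.rpow_add_le_mul_rpow_add_rpow a b hp.le
  simpa using this

lemma lemR_slice {ι : Type} [Fintype ι] (s : ι → Pt N) (hp : 1 < p) :
    ∃ C : ENNReal, C ≠ ⊤ ∧ ∀ (a b e : ι) (g0 h k : Pt N → ℝ), Nice 4 g0 → Nice 2 h → Nice 4 k →
      (∀ z, op s g0 z = h z + pd (s e) k z) →
      ∫⁻ y, sl p (pd (s a) (pd (s b) g0)) y ^ p ≤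
        C * ((∫⁻ y, sl p h y ^ p) + ∫⁻ y, sl p (pd (s b) k) y ^ p) := by
  have hp0 : 0 < p := by linarith
  obtain ⟨C, hC, H⟩ := lemR s (Real.HolderConjugate.conjExponent hp)
  refine ⟨ENNReal.ofReal C ^ p * 2 ^ (p - 1), ?_, fun a b e g0 h k hg hh hk heq => ?_⟩
  · exact ENNReal.mul_ne_top (ENNReal.rpow_ne_top_of_nonneg hp0.le ENNReal.ofReal_ne_top)
      (ENNReal.rpow_ne_top_of_nonneg (by linarith) (by simp))
  have key := H a b e g0 h k hg hh hk heq
  have n1 : Nice 2 (pd (s a) (pd (s b) g0)) := (hg.pd _).pd _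
  have n2 : Nice 3 (pd (s b) k) := hk.pd _
  rw [← eLp_slice hp n1.cont, ← eLp_slice hp hh.cont, ← eLp_slice hp n2.cont]
  have key2 := ENNReal.ofReal_le_ofReal key
  rw [ENNReal.ofReal_mul hC.le, ENNReal.ofReal_add (by positivity) (by positivity),
    ← eLp_eq hp.le (n1.memLp hp.le), ← eLp_eq hp.le (hh.memLp hp.le), ← eLp_eq hp.le (n2.memLp hp.le)] at key2
  have key3 := ENNReal.rpow_le_rpow key2 hp0.le
  rw [ENNReal.mul_rpow_of_nonneg _ _ hp0.le] at key3
  refine key3.trans ?_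
  rw [mul_assoc]
  gcongr
  exact rpow_add_le2 hp _ _

/-- products of a function vanishing near zero with a function smooth on the half line -/
lemma smooth_mul_half {η g : ℝ → ℝ} (hη : ContDiff ℝ (⊤ : ℕ∞) η) {t0 : ℝ} (h0 : 0 < t0)
    (hz : ∀ t < t0, η t = 0) (hg : ContDiffOn ℝ (⊤ : ℕ∞) g (Set.Ioi 0)) :
    ContDiff ℝ (⊤ : ℕ∞) fun t => η t * g t := by
  rw [contDiff_iff_contDiffAt]
  intro t
  by_cases ht : 0 < t
  · exact hη.contDiffAt.mul (hg.contDiffAt (Ioi_mem_nhds ht))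
  · have : (fun t => η t * g t) =ᶠ[nhds t] fun _ => 0 := by
      filter_upwards [Iio_mem_nhds (show t < t0 by linarith)] with τ hτ
      rw [hz τ hτ, zero_mul]
    exact contDiffAt_const.congr_of_eventuallyEq this

/-- The family of cut-off functions. -/
lemma cutoffs (γ c : ℝ) : ∃ (η e X : ℝ → ℝ) (K : ℝ), 0 ≤ K ∧
    ContDiff ℝ (⊤ : ℕ∞) η ∧ HasCompactSupport η ∧ ContDiff ℝ (⊤ : ℕ∞) X ∧ HasCompactSupport X ∧
    (∀ t ∈ Set.Icc (1:ℝ) 2, η t = 1) ∧ (∀ t, e t * t = η t) ∧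
    (∀ t, X t = 2 * γ * deriv η t - c * e t) ∧
    (∀ t, |η t| ≤ K * (Set.Icc (1/2) 4).indicator 1 t) ∧
    (∀ t, |deriv η t| ≤ K * (Set.Icc (1/2) 4).indicator 1 t) ∧
    (∀ t, |e t| ≤ K * (Set.Icc (1/2) 4).indicator 1 t) ∧
    (∀ t, |X t| ≤ K * (Set.Icc (1/2) 4).indicator 1 t) ∧
    (∀ t, |γ * deriv (deriv η) t - deriv X t| ≤ K * (Set.Icc (1/2) 4).indicator 1 t) := by
  let B : ContDiffBump (3/2 : ℝ) := ⟨1/2, 3/4, by norm_num, by norm_num⟩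
  set η : ℝ → ℝ := (fun t => B t) with hηd
  have hη : ContDiff ℝ (⊤ : ℕ∞) η := B.contDiff
  have hηs : HasCompactSupport η := B.hasCompactSupport
  have hsup : tsupport η ⊆ Set.Icc (1/2) 4 := by
    rw [hηd, show (fun t => B t) = (B : ℝ → ℝ) from rfl, B.tsupport_eq, Real.closedBall_eq_Icc]
    exact Set.Icc_subset_Icc (by norm_num [B]) (by norm_num [B])
  have hz : ∀ t < 3/4, η t = 0 := by
    intro t ht
    refine B.zero_of_le_dist ?_
    rw [Real.dist_eq, abs_sub_comm, abs_of_nonneg (by linarith)]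
    norm_num [B]; linarith
  set e : ℝ → ℝ := fun t => η t * t⁻¹ with he
  have hes : ContDiff ℝ (⊤ : ℕ∞) e := smooth_mul_half hη (by norm_num) hz
    (contDiffOn_id.inv fun t ht => (Set.mem_Ioi.1 ht).ne')
  have hec : HasCompactSupport e := hηs.mul_right
  have hesup : tsupport e ⊆ Set.Icc (1/2) 4 := (tsupport_mul_subset_left).trans hsup
  have hd : ContDiff ℝ (⊤ : ℕ∞) (deriv η) := hη.iterate_deriv 1
  have hdsup : tsupport (deriv η) ⊆ Set.Icc (1/2) 4 := (tsupport_deriv_subset (𝕜 := ℝ)).trans hsup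
  set X : ℝ → ℝ := fun t => 2 * γ * deriv η t - c * e t with hX
  have hXs : ContDiff ℝ (⊤ : ℕ∞) X := (contDiff_const.mul hd).sub (contDiff_const.mul hes)
  have bd : ∀ G : ℝ → ℝ, Continuous G → (∀ t, t ∉ Set.Icc (1/2:ℝ) 4 → G t = 0) →
      ∃ K, 0 ≤ K ∧ ∀ t, |G t| ≤ K * (Set.Icc (1/2) 4).indicator 1 t := by
    intro G hG h0
    obtain ⟨K, hK⟩ := isCompact_Icc.exists_bound_of_continuousOn (s := Set.Icc (1/2:ℝ) 4) hG.continuousOn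
    refine ⟨K, (norm_nonneg _).trans (hK 1 (by constructor <;> norm_num)), fun t => ?_⟩
    by_cases ht : t ∈ Set.Icc (1/2:ℝ) 4
    · rw [Set.indicator_of_mem ht, Pi.one_apply, mul_one]; exact hK t ht
    · rw [Set.indicator_of_notMem ht, h0 t ht]; simp
  have z1 : ∀ t, t ∉ Set.Icc (1/2:ℝ) 4 → η t = 0 := fun t ht =>
    image_eq_zero_of_notMem_tsupport fun h => ht (hsup h)
  have z2 : ∀ t, t ∉ Set.Icc (1/2:ℝ) 4 → deriv η t = 0 := fun t ht =>
    image_eq_zero_of_notMem_tsupport fun h => ht (hdsup h)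
  have z3 : ∀ t, t ∉ Set.Icc (1/2:ℝ) 4 → e t = 0 := fun t ht =>
    image_eq_zero_of_notMem_tsupport fun h => ht (hesup h)
  have z4 : ∀ t, t ∉ Set.Icc (1/2:ℝ) 4 → X t = 0 := fun t ht => by
    simp only [hX, z2 t ht, z3 t ht]; ring
  have hXsup : tsupport X ⊆ Set.Icc (1/2) 4 :=
    closure_minimal (fun t ht => by by_contra h; exact ht (z4 t h)) isClosed_Icc
  have hXc : HasCompactSupport X := HasCompactSupport.intro isCompact_Icc z4
  have z5 : ∀ t, t ∉ Set.Icc (1/2:ℝ) 4 → γ * deriv (deriv η) t - deriv X t = 0 := fun t ht => by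
    rw [image_eq_zero_of_notMem_tsupport fun h => ht (hdsup (tsupport_deriv_subset (𝕜 := ℝ) h)),
      image_eq_zero_of_notMem_tsupport fun h => ht (hXsup (tsupport_deriv_subset (𝕜 := ℝ) h))]
    ring
  have hdd : Continuous (deriv (deriv η)) := (hd.iterate_deriv 1).continuous
  have hdX : Continuous (deriv X) := (hXs.iterate_deriv 1).continuous
  obtain ⟨K1, k1, b1⟩ := bd _ hη.continuous z1
  obtain ⟨K2, k2, b2⟩ := bd _ hd.continuous z2
  obtain ⟨K3, k3, b3⟩ := bd _ hes.continuous z3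
  obtain ⟨K4, k4, b4⟩ := bd _ hXs.continuous z4
  obtain ⟨K5, k5, b5⟩ := bd _ ((continuous_const.mul hdd).sub hdX) z5
  have up : ∀ (K : ℝ) (t : ℝ), K ≤ K1 + K2 + K3 + K4 + K5 → K * (Set.Icc (1/2:ℝ) 4).indicator 1 t ≤
      (K1 + K2 + K3 + K4 + K5) * (Set.Icc (1/2:ℝ) 4).indicator 1 t := fun K t h =>
    mul_le_mul_of_nonneg_right h (Set.indicator_nonneg (fun _ _ => zero_le_one) _)
  refine ⟨η, e, X, K1 + K2 + K3 + K4 + K5, by positivity, hη, hηs, hXs, hXc, ?_, ?_, fun t => rfl,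
    fun t => (b1 t).trans (up _ t (by linarith)), fun t => (b2 t).trans (up _ t (by linarith)),
    fun t => (b3 t).trans (up _ t (by linarith)), fun t => (b4 t).trans (up _ t (by linarith)),
    fun t => (b5 t).trans (up _ t (by linarith))⟩
  · intro t ht
    refine B.one_of_mem_closedBall ?_
    rw [Real.closedBall_eq_Icc]
    constructor
    · have := ht.1; norm_num [B]; linarith
    · have := ht.2; norm_num [B]; linarith
  · intro t
    simp only [he]
    by_cases h : t = 0
    · rw [h, hz 0 (by norm_num)]; ring
    · field_simp

end

section
variable {N : ℕ} {p : ℝ} {ι : Type} [Fintype ι]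

/-- sum of the horizontal second order slices -/
def S2 (p ρ : ℝ) (φ : Pt N → ℝ) (y : ℝ) : ENNReal :=
  ∑ m, ∑ l, sl p (pd (sx ρ m) (pd (sx ρ l) φ)) y

lemma sl_congr {F G : Pt N → ℝ} {y : ℝ} (h : ∀ x, F (x, y) = G (x, y)) : sl p F y = sl p G y := by
  unfold sl; congr 1; funext x; exact h x

lemma sl_zero_of {F : Pt N → ℝ} {y : ℝ} (h : ∀ x, F (x, y) = 0) : sl p F y = 0 := by
  rw [sl_congr (G := fun _ => 0) h]; unfold sl; exact eLpNorm_zero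

lemma op_eta (s : ι → Pt N) {ψ : Pt N → ℝ} {k : ℕ} (hψ : Nice (k + 2) ψ) {η : ℝ → ℝ}
    (hη : ContDiff ℝ (⊤ : ℕ∞) η) (z : Pt N) :
    op s (fun z => η z.2 * ψ z) z = (∑ k, (s k).2 ^ 2) * deriv (deriv η) z.2 * ψ z
      + 2 * deriv η z.2 * pd (∑ k, (s k).2 • s k) ψ z + η z.2 * op s ψ z := by
  have hd1 : Differentiable ℝ (fun z : Pt N => η z.2) :=
    (hη.differentiable (by simp)).comp differentiable_snd
  have hη' : ContDiff ℝ (⊤ : ℕ∞) (deriv η) := hη.iterate_deriv 1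
  have hd2 : ∀ c : ℝ, Differentiable ℝ (fun z : Pt N => c * deriv η z.2) := fun c =>
    ((hη'.differentiable (by simp)).comp differentiable_snd).const_mul c
  have hψ1 : Nice (k + 1) ψ := hψ.mono (by omega)
  have hterm : ∀ v : Pt N, pd v (pd v (fun z => η z.2 * ψ z)) z = v.2 ^ 2 * deriv (deriv η) z.2 * ψ z
      + 2 * deriv η z.2 * (v.2 * pd v ψ z) + η z.2 * pd v (pd v ψ) z := by
    intro v
    have hpψ : Differentiable ℝ (pd v ψ) := (hψ.pd v).diff
    have k3 : Differentiable ℝ (fun z : Pt N => deriv η z.2) :=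
      (hη'.differentiable (by simp)).comp differentiable_snd
    have k1 : Differentiable ℝ (fun z : Pt N => v.2 * deriv η z.2 * ψ z) := (hd2 _).mul hψ1.diff
    have k2 : Differentiable ℝ (fun z : Pt N => η z.2 * pd v ψ z) := hd1.mul hpψ
    rw [pd_mul hd1 hψ1.diff, pd_snd (hη.differentiable (by simp)),
      pd_add k1 k2, pd_mul (hd2 _) hψ1.diff, pd_mul hd1 hpψ,
      pd_snd (hη.differentiable (by simp)), pd_const_mul v.2 k3,
      pd_snd (hη'.differentiable (by simp))]
    ring
  unfold op
  rw [Finset.sum_congr rfl fun k _ => hterm (s k), Finset.sum_add_distrib, Finset.sum_add_distrib,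
    pd_sum_dir, Finset.mul_sum, Finset.mul_sum, Finset.sum_mul, Finset.sum_mul]
  simp only [pd_smul_dir]

/-- The remainder after x-smoothing. -/
def psi (ρ t : ℝ) (φ : Pt N → ℝ) (z : Pt N) : ℝ := φ z - heat (sx ρ) t φ z

lemma Nice.psi {ρ t : ℝ} {k : ℕ} {φ : Pt N → ℝ} (h : Nice k φ) : Nice k (psi ρ t φ) :=
  h.sub (h.heat _ t)

lemma psi_pd {ρ t : ℝ} {φ : Pt N → ℝ} (h : Nice 1 φ) (v : Pt N) :
    pd v (psi ρ t φ) = psi ρ t (pd v φ) := by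
  unfold psi
  have h' : Nice 1 (heat (sx ρ) t φ) := h.heat _ t
  rw [pd_sub h.diff h'.diff, h.heat_pd]

lemma psi_op (s : ι → Pt N) {ρ t : ℝ} {φ : Pt N → ℝ} (h : Nice 2 φ) :
    op s (psi ρ t φ) = psi ρ t (op s φ) := by
  funext z
  have h1 : Nice 1 φ := h.mono (by omega)
  have e : ∀ v, pd v (pd v (psi ρ t φ)) z = psi ρ t (pd v (pd v φ)) z := fun v => by
    rw [psi_pd h1, psi_pd (h.pd v)]
  unfold op
  rw [Finset.sum_congr rfl fun k _ => e (s k)]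
  unfold psi
  rw [heat_sum (sx ρ) _ (fun i => (h.pd (s i)).pd (s i)) t, Finset.sum_sub_distrib]

lemma psi_slice_mul {ρ t : ℝ} {F G H : Pt N → ℝ} {k : ℕ} (hG : Nice k G) (hH : Nice k H) {a y : ℝ}
    (h : ∀ x, F (x, y) = G (x, y) - a * H (x, y)) (x : Fin N → ℝ) :
    psi ρ t F (x, y) = psi ρ t G (x, y) - a * psi ρ t H (x, y) := by
  unfold psi heat
  simp only [sl_heat_arg, h]
  have i1 := hG.heat_intble (sx ρ) t (x, y)
  have i2 := hH.heat_intble (sx ρ) t (x, y)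
  simp only [sl_heat_arg] at i1 i2
  rw [integral_sub i1 (i2.const_mul a), integral_const_mul]; ring

lemma S2_le (m l : Fin N) (ρ : ℝ) (φ : Pt N → ℝ) (y : ℝ) :
    sl p (pd (sx ρ m) (pd (sx ρ l) φ)) y ≤ S2 p ρ φ y := by
  unfold S2
  exact (Finset.single_le_sum (f := fun l => sl p (pd (sx ρ m) (pd (sx ρ l) φ)) y)
    (fun _ _ => zero_le) (Finset.mem_univ l)).trans
    (Finset.single_le_sum (f := fun m => ∑ l, sl p (pd (sx ρ m) (pd (sx ρ l) φ)) y)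
    (fun _ _ => zero_le) (Finset.mem_univ m))

lemma psi_b0 (hp : 1 < p) {ρ t : ℝ} (ht : 0 ≤ t) {φ : Pt N → ℝ} (h : Nice 2 φ) (y : ℝ) :
    sl p (psi ρ t φ) y ≤ ENNReal.ofReal (t ^ 2) * S2 p ρ φ y := by
  refine (sl_psi2 hp ρ h ht y).trans ?_
  gcongr
  refine (sl_sum hp _ (fun i => ((h.pd (sx ρ i)).pd (sx ρ i)).cont) y).trans ?_
  unfold S2
  exact Finset.sum_le_sum fun m _ => Finset.single_le_sum
    (f := fun l => sl p (pd (sx ρ m) (pd (sx ρ l) φ)) y) (fun _ _ => zero_le) (Finset.mem_univ m)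

lemma psi_b1 (hp : 1 < p) {ρ t : ℝ} (ht : 0 ≤ t) {φ : Pt N → ℝ} (h : Nice 2 φ) (y : ℝ) (l : Fin N) :
    sl p (pd (sx ρ l) (psi ρ t φ)) y ≤ gC N * (ENNReal.ofReal t * S2 p ρ φ y) := by
  rw [psi_pd (h.mono (by omega))]
  refine (sl_psi1 hp ρ (h.pd _) ht y).trans ?_
  gcongr
  unfold S2
  exact Finset.sum_le_sum fun m _ => Finset.single_le_sum
    (f := fun l => sl p (pd (sx ρ m) (pd (sx ρ l) φ)) y) (fun _ _ => zero_le) (Finset.mem_univ l)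

lemma psi_ba (hp : 1 < p) {ρ : ℝ} (hρ : 0 < ρ) (a : Pt N) (ha : a.2 = 0) : ∃ C : ENNReal, C ≠ ⊤ ∧
    ∀ (t : ℝ) (φ : Pt N → ℝ) (y : ℝ), 0 ≤ t → Nice 2 φ →
      sl p (pd a (psi ρ t φ)) y ≤ C * (ENNReal.ofReal t * S2 p ρ φ y) := by
  refine ⟨∑ l, ‖a.1 l / ρ‖ₑ * gC N, ?_, fun t φ y ht h => ?_⟩
  · exact ENNReal.sum_ne_top.2 fun l _ => ENNReal.mul_ne_top enorm_ne_top gC_lt.ne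
  have hψ : Nice 2 (psi ρ t φ) := h.psi
  have e : pd a (psi ρ t φ) = fun z => ∑ l, (a.1 l / ρ) * pd (sx ρ l) (psi ρ t φ) z := by
    conv_lhs => rw [pt_decomp a, ha, zero_smul, add_zero, pd_sum_dir]
    funext z
    refine Finset.sum_congr rfl fun l _ => ?_
    rw [pd_smul_dir, sx, pd_smul_dir]
    field_simp
  rw [e]
  refine (sl_sum hp _ (fun l => continuous_const.mul (hψ.pd _).cont) y).trans ?_
  rw [Finset.sum_mul]
  refine Finset.sum_le_sum fun l _ => ?_
  refine (sl_const_mul (a.1 l / ρ) (pd (sx ρ l) (psi ρ t φ)) y).le.trans ?_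
  rw [mul_assoc]
  gcongr
  exact psi_b1 hp ht h y l

lemma sl4 (hp : 1 < p) {F1 F2 F3 F4 : Pt N → ℝ} (h1 : Continuous F1) (h2 : Continuous F2)
    (h3 : Continuous F3) (h4 : Continuous F4) (c1 c2 c3 c4 y : ℝ) :
    sl p (fun z => c1 * F1 z + c2 * F2 z + c3 * F3 z + c4 * F4 z) y ≤
      ‖c1‖ₑ * sl p F1 y + ‖c2‖ₑ * sl p F2 y + ‖c3‖ₑ * sl p F3 y + ‖c4‖ₑ * sl p F4 y := by
  have k1 : Continuous fun z => c1 * F1 z := by fun_prop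
  have k2 : Continuous fun z => c2 * F2 z := by fun_prop
  have k3 : Continuous fun z => c3 * F3 z := by fun_prop
  have k4 : Continuous fun z => c4 * F4 z := by fun_prop
  simp only [← sl_const_mul]
  refine (sl_add hp ((k1.add k2).add k3) k4 y).trans ?_
  gcongr
  refine (sl_add hp (k1.add k2) k3 y).trans ?_
  gcongr
  exact sl_add hp k1 k2 y

end

section
variable {N : ℕ} {p : ℝ} {ι : Type} [Fintype ι]

structure Setup (s : ι → Pt N) (ρ : ℝ) (ix : Fin N → ι) (iy : ι) : Prop where
  hρ : 0 < ρ
  hx : ∀ i, s (ix i) = sx ρ i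
  hy : s iy = ρ • ey

structure Eqn (s : ι → Pt N) (v : Pt N) (φ f : Pt N → ℝ) : Prop where
  sφ : ContDiff ℝ (⊤ : ℕ∞) φ
  cφ : HasCompactSupport φ
  sf : ContDiff ℝ (⊤ : ℕ∞) f
  cf : HasCompactSupport f
  eq : ∀ z : Pt N, 0 < z.2 → f z = op s φ z + z.2⁻¹ * pd v φ z

lemma Eqn.nφ {s : ι → Pt N} {v : Pt N} {φ f : Pt N → ℝ} (h : Eqn s v φ f) (k : ℕ) : Nice k φ :=
  Nice.of_cs k h.sφ h.cφ

lemma Eqn.nf {s : ι → Pt N} {v : Pt N} {φ f : Pt N → ℝ} (h : Eqn s v φ f) (k : ℕ) : Nice k f :=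
  Nice.of_cs k h.sf h.cf

lemma scal_smooth {η : ℝ → ℝ} (hη : ContDiff ℝ (⊤ : ℕ∞) η) (R : ℝ) :
    ContDiff ℝ (⊤ : ℕ∞) (fun t => η (R * t)) := hη.comp (contDiff_const.mul contDiff_id)

lemma scal_cs {η : ℝ → ℝ} (hη : HasCompactSupport η) {R : ℝ} (hR : R ≠ 0) :
    HasCompactSupport (fun t => η (R * t)) :=
  hη.comp_homeomorph (Homeomorph.mulLeft₀ R hR)

lemma scal_deriv {η : ℝ → ℝ} (_hη : Differentiable ℝ η) (R : ℝ) :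
    deriv (fun t => η (R * t)) = fun t => R * deriv η (R * t) := by
  funext t
  rw [deriv_comp_mul_left]; simp

/-- pointwise identity for the localized equation -/
lemma loc_id (s : ι → Pt N) {ρ : ℝ} {ix : Fin N → ι} {iy : ι} (hS : Setup s ρ ix iy) (v : Pt N)
    {η e X : ℝ → ℝ} (hη : ContDiff ℝ (⊤ : ℕ∞) η) (hX : ContDiff ℝ (⊤ : ℕ∞) X)
    (hee : ∀ t, e t * t = η t) (hXe : ∀ t, X t = 2 * (∑ k, (s k).2 ^ 2) * deriv η t - v.2 * e t)
    {φ f : Pt N → ℝ} (h : Eqn s v φ f) (t : ℝ) {R : ℝ} (hR : 0 < R) (x : Fin N → ℝ) {y : ℝ} (hy : 0 < y) :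
    op s (fun z => η (R * z.2) * psi ρ t φ z) (x, y)
      - pd (s iy) (fun z => (ρ⁻¹ * (R * X (R * z.2))) * psi ρ t φ z) (x, y) =
    η (R * y) * psi ρ t f (x, y)
      + (2 * R * deriv η (R * y)) * pd ((∑ k, (s k).2 • s k).1, 0) (psi ρ t φ) (x, y)
      + (- R * e (R * y)) * pd (v.1, 0) (psi ρ t φ) (x, y)
      + (R ^ 2 * ((∑ k, (s k).2 ^ 2) * deriv (deriv η) (R * y) - deriv X (R * y))) * psi ρ t φ (x, y) := by
  have hψ : Nice 4 (psi ρ t φ) := (h.nφ 4).psi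
  have hρ := hS.hρ
  have hη' : ContDiff ℝ (⊤ : ℕ∞) (deriv η) := hη.iterate_deriv 1
  rw [op_eta s (k := 2) hψ (scal_smooth hη R), scal_deriv (hη.differentiable (by simp))]
  have hdd : deriv (fun t => R * deriv η (R * t)) y = R ^ 2 * deriv (deriv η) (R * y) := by
    rw [deriv_const_mul_field, scal_deriv (hη'.differentiable (by simp))]; ring
  have hXs : ContDiff ℝ (⊤ : ℕ∞) (fun t => ρ⁻¹ * (R * X (R * t))) :=
    contDiff_const.mul (contDiff_const.mul (scal_smooth hX R))
  have hXd : deriv (fun t => ρ⁻¹ * (R * X (R * t))) y = ρ⁻¹ * (R * (R * deriv X (R * y))) := by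
    rw [deriv_const_mul_field, deriv_const_mul_field, scal_deriv (hX.differentiable (by simp))]
  have hXd1 : Differentiable ℝ (fun z : Pt N => ρ⁻¹ * (R * X (R * z.2))) :=
    (hXs.differentiable (by simp)).comp differentiable_snd
  rw [pd_mul hXd1 hψ.diff, pd_snd (η := fun t => ρ⁻¹ * (R * X (R * t))) (hXs.differentiable (by simp)), hS.hy, pd_smul_dir]
  simp only [hdd, hXd]
  have e1 : pd (∑ k, (s k).2 • s k) (psi ρ t φ) (x, y) =
      pd ((∑ k, (s k).2 • s k).1, 0) (psi ρ t φ) (x, y) + (∑ k, (s k).2 ^ 2) * pd ey (psi ρ t φ) (x, y) := by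
    have : (∑ k, (s k).2 • s k) = (((∑ k, (s k).2 • s k).1, 0) : Pt N) + (∑ k, (s k).2 ^ 2) • ey := by
      ext i
      · simp [ey]
      · simp [ey, Prod.snd_sum, sq]
    conv_lhs => rw [this, pd_add_dir, pd_smul_dir]
  have e2 : pd v (psi ρ t φ) (x, y) = pd (v.1, 0) (psi ρ t φ) (x, y) + v.2 * pd ey (psi ρ t φ) (x, y) := by
    have : v = ((v.1, 0) : Pt N) + v.2 • ey := by
      ext i <;> simp [ey]
    conv_lhs => rw [this, pd_add_dir, pd_smul_dir]
  have e3 : op s (psi ρ t φ) (x, y) = psi ρ t f (x, y) - y⁻¹ * pd v (psi ρ t φ) (x, y) := by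
    rw [psi_op s (h.nφ 2), psi_pd (h.nφ 1)]
    refine psi_slice_mul (h.nf 0) ((h.nφ 1).pd v) (fun x => ?_) x
    rw [h.eq (x, y) hy]; ring
  have e4 : η (R * y) = e (R * y) * (R * y) := (hee _).symm
  have e5 := hXe (R * y)
  have e6 : (ρ • (ey : Pt N)).2 = ρ := by simp [ey]
  rw [e1, e3, e2, e6, e5, e4]
  field_simp
  ring

lemma loc (hp : 1 < p) (s : ι → Pt N) {ρ : ℝ} {ix : Fin N → ι} {iy : ι} (hS : Setup s ρ ix iy) (v : Pt N) :
    ∃ C : ENNReal, C ≠ ⊤ ∧ ∀ (φ f : Pt N → ℝ), Eqn s v φ f → ∀ (ε r : ℝ), 0 < ε → ε ≤ 1 → 0 < r →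
      ∀ i j : Fin N,
      ∫⁻ y in Set.Icc r (2 * r), sl p (pd (sx ρ i) (pd (sx ρ j) (psi ρ (ε * r) φ))) y ^ p ≤
        C * ∫⁻ y in Set.Icc (r / 2) (4 * r), (sl p f y + ENNReal.ofReal ε * S2 p ρ φ y) ^ p := by
  have hp0 : 0 < p := by linarith
  have hρ := hS.hρ
  obtain ⟨η, e, X, K, hK, hη, hηc, hX, hXc, hη1, hee, hXe, b1, b2, b3, b4, b5⟩ := cutoffs (∑ k, (s k).2 ^ 2) v.2
  obtain ⟨Ca, hCa, Ha⟩ := psi_ba (p := p) hp hρ ((∑ k, (s k).2 • s k).1, 0) rfl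
  obtain ⟨Cb, hCb, Hb⟩ := psi_ba (p := p) hp hρ (v.1, 0) rfl
  obtain ⟨CR, hCR, HR⟩ := lemR_slice (p := p) s hp
  set k' := ENNReal.ofReal K with hk'
  set C1 : ENNReal := k' * 2 + k' * 2 * Ca + k' * Cb + k' + ENNReal.ofReal (ρ⁻¹) * k' * gC N with hC1
  have hC1t : C1 ≠ ⊤ := by
    have := (gC_lt (N := N)).ne
    simp only [hC1, hk']
    finiteness
  refine ⟨CR * (C1 ^ p + C1 ^ p), by finiteness, fun φ f h ε r hε hε1 hr i j => ?_⟩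
  set t := ε * r with ht
  have ht0 : 0 ≤ t := by positivity
  set R := r⁻¹ with hRd
  have hR : 0 < R := by positivity
  set ψ := psi ρ t φ with hψd
  have hψ : ∀ k, Nice k ψ := fun k => (h.nφ k).psi
  have nψf : Nice 0 (psi ρ t f) := (h.nf 0).psi
  set g0 : Pt N → ℝ := fun z => η (R * z.2) * ψ z with hg0
  have ng0 : ∀ k, Nice k g0 := fun k =>
    Nice.mul (Bd.of_snd k (scal_smooth hη R) (scal_cs hηc hR.ne')) (hψ k)
  have hXs : ContDiff ℝ (⊤ : ℕ∞) (fun t => ρ⁻¹ * (R * X (R * t))) :=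
    contDiff_const.mul (contDiff_const.mul (scal_smooth hX R))
  have hXsc : HasCompactSupport (fun t => ρ⁻¹ * (R * X (R * t))) :=
    ((scal_cs hXc hR.ne').mul_left (f := fun _ => R)).mul_left (f := fun _ => ρ⁻¹)
  set k : Pt N → ℝ := fun z => (ρ⁻¹ * (R * X (R * z.2))) * ψ z with hk
  have nk : ∀ l, Nice l k := fun l => Nice.mul (Bd.of_snd l hXs hXsc) (hψ l)
  set hh : Pt N → ℝ := fun z => op s g0 z - pd (s iy) k z with hhd
  have nh : Nice 2 hh := Nice.sub ((ng0 4).op s) ((nk 3).pd _)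
  have main := HR (ix i) (ix j) iy g0 hh k (ng0 4) nh (nk 4) (fun z => by simp [hhd])
  rw [hS.hx, hS.hx] at main
  set M : ℝ → ENNReal := fun y => sl p f y + ENNReal.ofReal ε * S2 p ρ φ y with hM
  -- the indicator
  have ind : ∀ {G : ℝ → ℝ} {y : ℝ}, (∀ t, |G t| ≤ K * (Set.Icc (1/2) 4).indicator 1 t) →
      ‖G (R * y)‖ₑ ≤ k' := by
    intro G y hG
    rw [← ofReal_norm, hk']
    refine ENNReal.ofReal_le_ofReal ((hG _).trans ?_)
    by_cases hy : R * y ∈ Set.Icc (1/2:ℝ) 4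
    · rw [Set.indicator_of_mem hy]; simp
    · rw [Set.indicator_of_notMem hy]; simpa
  have ind0 : ∀ {G : ℝ → ℝ} {y : ℝ}, (∀ t, |G t| ≤ K * (Set.Icc (1/2) 4).indicator 1 t) →
      y ∉ Set.Icc (r/2) (4*r) → G (R * y) = 0 := by
    intro G y hG hy
    have : R * y ∉ Set.Icc (1/2:ℝ) 4 := by
      intro h'
      refine hy ⟨?_, ?_⟩
      · have := h'.1
        rw [hRd, inv_mul_eq_div, le_div_iff₀ hr] at this; linarith
      · have := h'.2
        rw [hRd, inv_mul_eq_div, div_le_iff₀ hr] at this; linarith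
    have := hG (R * y)
    rw [Set.indicator_of_notMem ‹_›] at this
    simpa using this
  have Rt : ‖R‖ₑ * ENNReal.ofReal t = ENNReal.ofReal ε := by
    rw [Real.enorm_of_nonneg hR.le, ← ENNReal.ofReal_mul hR.le]
    congr 1; rw [ht, hRd]; field_simp
  have Rt2 : ‖R ^ 2‖ₑ * ENNReal.ofReal (t ^ 2) ≤ ENNReal.ofReal ε := by
    rw [Real.enorm_of_nonneg (by positivity), ← ENNReal.ofReal_mul (by positivity)]
    refine ENNReal.ofReal_le_ofReal ?_
    have : R ^ 2 * t ^ 2 = ε ^ 2 := by rw [ht, hRd]; field_simp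
    rw [this]; nlinarith
  have offy : ∀ y ∉ Set.Icc (r/2) (4*r), ∀ x, ∀ᶠ z in nhds ((x, y) : Pt N), g0 z = 0 ∧ k z = 0 := by
    intro y hy x
    have : ∀ᶠ z in nhds ((x, y) : Pt N), z.2 ∈ (Set.Icc (r/2) (4*r))ᶜ :=
      continuous_snd.continuousAt.eventually (isClosed_Icc.isOpen_compl.mem_nhds hy)
    filter_upwards [this] with z hz
    simp [hg0, hk, ind0 b1 hz, ind0 b4 hz]
  have bh : ∀ y, sl p hh y ≤ (Set.Icc (r/2) (4*r)).indicator (fun y => C1 * M y) y := by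
    intro y
    by_cases hy : y ∈ Set.Icc (r/2) (4*r)
    · rw [Set.indicator_of_mem hy]
      have hy0 : 0 < y := by have := hy.1; linarith
      rw [sl_congr (F := hh) (G := fun z => η (R * y) * psi ρ t f z
        + (2 * R * deriv η (R * y)) * pd ((∑ k, (s k).2 • s k).1, 0) ψ z
        + (- R * e (R * y)) * pd (v.1, 0) ψ z
        + (R ^ 2 * ((∑ k, (s k).2 ^ 2) * deriv (deriv η) (R * y) - deriv X (R * y))) * ψ z)
        (fun x => loc_id s hS v hη hX hee hXe h t hR x hy0)]
      refine (sl4 hp nψf.cont ((hψ 1).pd _).cont ((hψ 1).pd _).cont (hψ 0).cont _ _ _ _ y).trans ?_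
      have q1 : sl p (psi ρ t f) y ≤ 2 * sl p f y := by
        refine (sl_sub hp (h.nf 0).cont ((h.nf 0).heat _ t).cont y).trans ?_
        rw [two_mul]; gcongr; exact sl_heat_le ρ hp (h.nf 0).cont t y
      have q2 := Ha t φ y ht0 (h.nφ 2)
      have q3 := Hb t φ y ht0 (h.nφ 2)
      have q4 := psi_b0 (p := p) hp (ρ := ρ) ht0 (h.nφ 2) y
      have m1 : sl p f y ≤ M y := le_self_add
      have m2 : ENNReal.ofReal ε * S2 p ρ φ y ≤ M y := le_add_self
      have t1 : ‖η (R * y)‖ₑ * sl p (psi ρ t f) y ≤ k' * 2 * M y := by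
        rw [mul_assoc]; gcongr
        · exact ind b1
        · exact q1.trans (by gcongr)
      have t2 : ‖2 * R * deriv η (R * y)‖ₑ * sl p (pd ((∑ k, (s k).2 • s k).1, 0) ψ) y ≤ k' * 2 * Ca * M y := by
        rw [enorm_mul, enorm_mul]
        calc _ ≤ ‖(2:ℝ)‖ₑ * ‖R‖ₑ * k' * (Ca * (ENNReal.ofReal t * S2 p ρ φ y)) := by
              gcongr; exact ind b2
          _ = k' * ‖(2:ℝ)‖ₑ * Ca * ((‖R‖ₑ * ENNReal.ofReal t) * S2 p ρ φ y) := by ring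
          _ ≤ _ := by
              rw [Rt, Real.enorm_of_nonneg (by norm_num)]
              norm_num
              gcongr
      have t3 : ‖-R * e (R * y)‖ₑ * sl p (pd (v.1, 0) ψ) y ≤ k' * Cb * M y := by
        rw [enorm_mul, enorm_neg]
        calc _ ≤ ‖R‖ₑ * k' * (Cb * (ENNReal.ofReal t * S2 p ρ φ y)) := by
              gcongr; exact ind b3
          _ = k' * Cb * ((‖R‖ₑ * ENNReal.ofReal t) * S2 p ρ φ y) := by ring
          _ ≤ _ := by rw [Rt]; gcongr
      have t4 : ‖R ^ 2 * ((∑ k, (s k).2 ^ 2) * deriv (deriv η) (R * y) - deriv X (R * y))‖ₑ * sl p ψ y ≤ k' * M y := by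
        rw [enorm_mul]
        calc _ ≤ ‖R ^ 2‖ₑ * k' * (ENNReal.ofReal (t ^ 2) * S2 p ρ φ y) := by
              gcongr
              exact ind (G := fun τ => (∑ k, (s k).2 ^ 2) * deriv (deriv η) τ - deriv X τ) b5
          _ = k' * ((‖R ^ 2‖ₑ * ENNReal.ofReal (t ^ 2)) * S2 p ρ φ y) := by ring
          _ ≤ k' * (ENNReal.ofReal ε * S2 p ρ φ y) := by gcongr
          _ ≤ _ := by gcongr
      calc _ ≤ k' * 2 * M y + k' * 2 * Ca * M y + k' * Cb * M y + k' * M y := by gcongr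
        _ = (k' * 2 + k' * 2 * Ca + k' * Cb + k') * M y := by ring
        _ ≤ C1 * M y := by rw [hC1]; exact mul_le_mul' le_self_add le_rfl
    · rw [Set.indicator_of_notMem hy]
      refine le_of_eq (sl_zero_of fun x => ?_)
      have z1 : g0 =ᶠ[nhds (x, y)] fun _ => 0 := (offy y hy x).mono fun _ h => h.1
      have z2 : k =ᶠ[nhds (x, y)] fun _ => 0 := (offy y hy x).mono fun _ h => h.2
      have pz : ∀ (w : Pt N) (G : Pt N → ℝ), G =ᶠ[nhds (x, y)] (fun _ => 0) →
          pd w G =ᶠ[nhds (x, y)] fun _ => 0 := by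
        intro w G hG
        filter_upwards [hG.eventuallyEq_nhds] with z hz
        simp [pd, hz.fderiv_eq]
      have o1 : op s g0 (x, y) = 0 := by
        unfold op
        exact Finset.sum_eq_zero fun l _ => (pz _ _ (pz _ _ z1)).eq_of_nhds
      simp only [hhd, o1, (pz (s iy) k z2).eq_of_nhds, sub_zero]
  have bk : ∀ y, sl p (pd (sx ρ j) k) y ≤ (Set.Icc (r/2) (4*r)).indicator (fun y => C1 * M y) y := by
    intro y
    have hXd1 : Differentiable ℝ (fun z : Pt N => ρ⁻¹ * (R * X (R * z.2))) :=
      (hXs.differentiable (by simp)).comp differentiable_snd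
    have e0 : pd (sx ρ j) k = fun z => (ρ⁻¹ * (R * X (R * z.2))) * pd (sx ρ j) ψ z := by
      rw [hk, pd_mul hXd1 (hψ 1).diff, pd_snd (η := fun t => ρ⁻¹ * (R * X (R * t))) (hXs.differentiable (by simp))]
      funext z; simp [sx, ex]
    rw [e0, sl_congr (G := fun z => (ρ⁻¹ * (R * X (R * y))) * pd (sx ρ j) ψ z) (fun x => rfl), sl_const_mul]
    by_cases hy : y ∈ Set.Icc (r/2) (4*r)
    · rw [Set.indicator_of_mem hy]
      have m2 : ENNReal.ofReal ε * S2 p ρ φ y ≤ M y := le_add_self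
      rw [enorm_mul, enorm_mul]
      calc _ ≤ ‖ρ⁻¹‖ₑ * (‖R‖ₑ * k') * (gC N * (ENNReal.ofReal t * S2 p ρ φ y)) := by
            gcongr
            · exact ind b4
            · exact psi_b1 hp ht0 (h.nφ 2) y j
        _ = ENNReal.ofReal (ρ⁻¹) * k' * gC N * ((‖R‖ₑ * ENNReal.ofReal t) * S2 p ρ φ y) := by
            rw [Real.enorm_of_nonneg (by positivity : 0 ≤ ρ⁻¹)]; ring
        _ ≤ ENNReal.ofReal (ρ⁻¹) * k' * gC N * M y := by rw [Rt]; gcongr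
        _ ≤ C1 * M y := by rw [hC1]; exact mul_le_mul' le_add_self le_rfl
    · rw [Set.indicator_of_notMem hy, ind0 b4 hy]; simp
  have intb : ∀ G : ℝ → ENNReal, (∀ y, G y ≤ (Set.Icc (r/2) (4*r)).indicator (fun y => C1 * M y) y) →
      ∫⁻ y, G y ^ p ≤ C1 ^ p * ∫⁻ y in Set.Icc (r/2) (4*r), M y ^ p := by
    intro G hG
    rw [← lintegral_const_mul' _ _ (by finiteness), ← lintegral_indicator measurableSet_Icc]
    refine lintegral_mono fun y => ?_
    refine (ENNReal.rpow_le_rpow (hG y) hp0.le).trans ?_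
    by_cases hy : y ∈ Set.Icc (r/2) (4*r)
    · rw [Set.indicator_of_mem hy, Set.indicator_of_mem hy, ENNReal.mul_rpow_of_nonneg _ _ hp0.le]
    · rw [Set.indicator_of_notMem hy, ENNReal.zero_rpow_of_pos hp0]; exact zero_le
  calc ∫⁻ y in Set.Icc r (2 * r), sl p (pd (sx ρ i) (pd (sx ρ j) ψ)) y ^ p
      = ∫⁻ y in Set.Icc r (2 * r), sl p (pd (sx ρ i) (pd (sx ρ j) g0)) y ^ p := by
        refine setLIntegral_congr_fun measurableSet_Icc fun y hy => ?_
        congr 1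
        refine sl_congr fun x => ?_
        have hd1 : Differentiable ℝ (fun z : Pt N => η (R * z.2)) :=
          ((scal_smooth hη R).differentiable (by simp)).comp differentiable_snd
        have ee : ∀ G : Pt N → ℝ, Nice 1 G →
            pd (sx ρ j) (fun z => η (R * z.2) * G z) = fun z => η (R * z.2) * pd (sx ρ j) G z := by
          intro G hG
          rw [pd_mul hd1 hG.diff, pd_snd (η := fun t => η (R * t)) ((scal_smooth hη R).differentiable (by simp))]
          funext z; simp [sx, ex]
        have ee' : ∀ G : Pt N → ℝ, Nice 1 G →
            pd (sx ρ i) (fun z => η (R * z.2) * G z) = fun z => η (R * z.2) * pd (sx ρ i) G z := by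
          intro G hG
          rw [pd_mul hd1 hG.diff, pd_snd (η := fun t => η (R * t)) ((scal_smooth hη R).differentiable (by simp))]
          funext z; simp [sx, ex]
        rw [hg0, ee ψ (hψ 1), ee' _ ((hψ 2).pd _)]
        simp only
        rw [hη1, one_mul]
        constructor
        · rw [hRd, inv_mul_eq_div, le_div_iff₀ hr]; linarith [hy.1]
        · rw [hRd, inv_mul_eq_div, div_le_iff₀ hr]; linarith [hy.2]
    _ ≤ ∫⁻ y, sl p (pd (sx ρ i) (pd (sx ρ j) g0)) y ^ p := setLIntegral_le_lintegral _ _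
    _ ≤ _ := main
    _ ≤ CR * (C1 ^ p * (∫⁻ y in Set.Icc (r/2) (4*r), M y ^ p) + C1 ^ p * ∫⁻ y in Set.Icc (r/2) (4*r), M y ^ p) := by
        gcongr
        · exact intb _ bh
        · exact intb _ bk
    _ = _ := by ring

end

section
variable {N : ℕ} {p : ℝ} {ι : Type} [Fintype ι]

lemma rpow_cmp (ν : ℝ) {r y : ℝ} (hy : 0 < y) (h1 : y / 4 ≤ r) (h2 : r ≤ 2 * y) :
    (4:ℝ) ^ (-|ν|) * y ^ ν ≤ r ^ ν ∧ r ^ ν ≤ (4:ℝ) ^ |ν| * y ^ ν := by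
  have hr : 0 < r := by linarith
  have key : ∀ a : ℝ, 1/4 ≤ a → a ≤ 4 → a ^ ν ≤ (4:ℝ) ^ |ν| := by
    intro a ha ha2
    have ha0 : 0 < a := by linarith
    rcases le_total 0 ν with h | h
    · rw [abs_of_nonneg h]; exact rpow_le_rpow ha0.le ha2 h
    · rw [abs_of_nonpos h]
      have e : a ^ ν = (a⁻¹) ^ (-ν) := by rw [inv_rpow ha0.le, rpow_neg ha0.le, inv_inv]
      rw [e]
      refine rpow_le_rpow (by positivity) ?_ (by linarith)
      rw [inv_le_comm₀ ha0 (by norm_num)]; linarith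
  constructor
  · have := key (y / r) (by rw [le_div_iff₀ hr]; linarith) (by rw [div_le_iff₀ hr]; linarith)
    rw [div_rpow hy.le hr.le, div_le_iff₀ (rpow_pos_of_pos hr _)] at this
    rw [rpow_neg (by norm_num), inv_mul_le_iff₀ (by positivity)]
    exact this
  · have := key (r / y) (by rw [le_div_iff₀ hy]; linarith) (by rw [div_le_iff₀ hy]; linarith)
    rwa [div_rpow hr.le hy.le, div_le_iff₀ (rpow_pos_of_pos hy _)] at this

lemma swap_lem {w M : ℝ → ENNReal} (hw : Measurable w) (hM : Measurable M) {a b : ℝ} (ha : 0 < a)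
    (hb : 0 < b) :
    ∫⁻ r in Set.Ioi 0, w r * ∫⁻ y in Set.Icc (a * r) (b * r), M y =
      ∫⁻ y in Set.Ioi 0, M y * ∫⁻ r in Set.Icc (y / b) (y / a), w r := by
  set T : ℝ → ℝ → ENNReal := fun r y => {q : ℝ × ℝ | a * q.1 ≤ q.2 ∧ q.2 ≤ b * q.1}.indicator
    (fun q => w q.1 * M q.2) (r, y) with hT
  have hS : MeasurableSet {q : ℝ × ℝ | a * q.1 ≤ q.2 ∧ q.2 ≤ b * q.1} := by
    have e : {q : ℝ × ℝ | a * q.1 ≤ q.2 ∧ q.2 ≤ b * q.1} =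
        {q : ℝ × ℝ | a * q.1 ≤ q.2} ∩ {q : ℝ × ℝ | q.2 ≤ b * q.1} := by ext q; simp
    rw [e]
    exact (measurableSet_le (f := fun q : ℝ × ℝ => a * q.1) (g := fun q : ℝ × ℝ => q.2) (by fun_prop) (by fun_prop)).inter
      (measurableSet_le (f := fun q : ℝ × ℝ => q.2) (g := fun q : ℝ × ℝ => b * q.1) (by fun_prop) (by fun_prop))
  have hTm : Measurable (Function.uncurry T) :=
    Measurable.indicator ((hw.comp measurable_fst).mul (hM.comp measurable_snd)) hS
  have e1 : ∀ r ∈ Set.Ioi (0:ℝ), w r * ∫⁻ y in Set.Icc (a * r) (b * r), M y = ∫⁻ y in Set.Ioi 0, T r y := by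
    intro r hr
    rw [Set.mem_Ioi] at hr
    rw [← lintegral_const_mul _ hM, ← lintegral_indicator measurableSet_Icc, ← lintegral_indicator measurableSet_Ioi]
    congr 1; funext y
    by_cases hy : y ∈ Set.Icc (a * r) (b * r)
    · have h0 : y ∈ Set.Ioi (0:ℝ) := lt_of_lt_of_le (by positivity) hy.1
      rw [Set.indicator_of_mem hy, Set.indicator_of_mem h0, hT]
      simp only
      rw [Set.indicator_of_mem (show (r, y) ∈ {q : ℝ × ℝ | a * q.1 ≤ q.2 ∧ q.2 ≤ b * q.1} from hy)]
    · have : T r y = 0 := Set.indicator_of_notMem (show (r, y) ∉ {q : ℝ × ℝ | a * q.1 ≤ q.2 ∧ q.2 ≤ b * q.1} from hy) _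
      rw [Set.indicator_of_notMem hy]
      simp [Set.indicator, this]
  have e2 : ∀ y ∈ Set.Ioi (0:ℝ), M y * ∫⁻ r in Set.Icc (y / b) (y / a), w r = ∫⁻ r in Set.Ioi 0, T r y := by
    intro y hy
    rw [Set.mem_Ioi] at hy
    rw [← lintegral_const_mul _ hw, ← lintegral_indicator measurableSet_Icc, ← lintegral_indicator measurableSet_Ioi]
    congr 1; funext r
    have iff : r ∈ Set.Icc (y / b) (y / a) ↔ (r, y) ∈ {q : ℝ × ℝ | a * q.1 ≤ q.2 ∧ q.2 ≤ b * q.1} := by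
      simp only [Set.mem_Icc, Set.mem_ofPred_eq, div_le_iff₀ hb, le_div_iff₀ ha]
      rw [mul_comm r b, mul_comm r a]; tauto
    by_cases hr : r ∈ Set.Icc (y / b) (y / a)
    · have h0 : r ∈ Set.Ioi (0:ℝ) := lt_of_lt_of_le (by positivity) hr.1
      rw [Set.indicator_of_mem hr, Set.indicator_of_mem h0, hT]
      simp only
      rw [Set.indicator_of_mem (iff.1 hr), mul_comm]
    · have : T r y = 0 := Set.indicator_of_notMem (fun h => hr (iff.2 h)) _
      rw [Set.indicator_of_notMem hr]
      simp [Set.indicator, this]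
  rw [setLIntegral_congr_fun measurableSet_Ioi e1, setLIntegral_congr_fun measurableSet_Ioi e2]
  exact lintegral_lintegral_swap hTm.aemeasurable

lemma scale_int (μ : ℝ) : ∃ K : ENNReal, K ≠ ⊤ ∧ ∀ (C : ENNReal) (G M : ℝ → ENNReal), C ≠ ⊤ → Measurable G →
    Measurable M → (∀ r : ℝ, 0 < r → ∫⁻ y in Set.Icc r (2 * r), G y ≤ C * ∫⁻ y in Set.Icc (r / 2) (4 * r), M y) →
    ∫⁻ y in Set.Ioi 0, G y * ENNReal.ofReal (y ^ μ) ≤ K * C * ∫⁻ y in Set.Ioi 0, M y * ENNReal.ofReal (y ^ μ) := by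
  set ν := μ - 1 with hν
  set k := (4:ℝ) ^ |ν| with hk
  have hk0 : 0 < k := by positivity
  refine ⟨ENNReal.ofReal (2 * k) * ENNReal.ofReal (2 * k), by finiteness, fun C G M hC hG hM h => ?_⟩
  set w : ℝ → ENNReal := fun r => ENNReal.ofReal (r ^ ν) with hw
  have hwm : Measurable w := by fun_prop
  have A : ∫⁻ r in Set.Ioi 0, w r * ∫⁻ y in Set.Icc (1 * r) (2 * r), G y ≤
      C * ∫⁻ r in Set.Ioi 0, w r * ∫⁻ y in Set.Icc (2⁻¹ * r) (4 * r), M y := by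
    rw [← lintegral_const_mul' _ _ hC]
    refine setLIntegral_mono' measurableSet_Ioi fun r hr => ?_
    have := h r hr
    rw [show r / 2 = 2⁻¹ * r by ring] at this
    simp only [one_mul]
    calc _ ≤ w r * (C * ∫⁻ y in Set.Icc (2⁻¹ * r) (4 * r), M y) := by gcongr
      _ = _ := by ring
  rw [swap_lem hwm hG one_pos two_pos, swap_lem hwm hM (by norm_num) (by norm_num)] at A
  have low : ∀ y ∈ Set.Ioi (0:ℝ), G y * ENNReal.ofReal (y ^ μ) ≤
      ENNReal.ofReal (2 * k) * (G y * ∫⁻ r in Set.Icc (y / 2) (y / 1), w r) := by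
    intro y hy
    have hy : 0 < y := hy
    have : ENNReal.ofReal (k⁻¹ * y ^ ν) * ENNReal.ofReal (y / 2) ≤ ∫⁻ r in Set.Icc (y / 2) (y / 1), w r := by
      calc _ = ∫⁻ r in Set.Icc (y / 2) (y / 1), ENNReal.ofReal (k⁻¹ * y ^ ν) := by
            rw [setLIntegral_const, Real.volume_Icc]; congr 2; ring
        _ ≤ _ := setLIntegral_mono' measurableSet_Icc fun r hr => ENNReal.ofReal_le_ofReal (by
            have := (rpow_cmp ν hy (r := r) (by linarith [hr.1]) (by have := hr.2; linarith)).1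
            rwa [rpow_neg (by norm_num)] at this)
    calc G y * ENNReal.ofReal (y ^ μ)
        = ENNReal.ofReal (2 * k) * (G y * (ENNReal.ofReal (k⁻¹ * y ^ ν) * ENNReal.ofReal (y / 2))) := by
          rw [← ENNReal.ofReal_mul (by positivity), mul_left_comm, ← ENNReal.ofReal_mul (by positivity)]
          congr 2
          rw [hν, rpow_sub_one hy.ne']; field_simp
      _ ≤ _ := by gcongr
  have up : ∀ y ∈ Set.Ioi (0:ℝ), M y * ∫⁻ r in Set.Icc (y / 4) (y / 2⁻¹), w r ≤
      ENNReal.ofReal (2 * k) * (M y * ENNReal.ofReal (y ^ μ)) := by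
    intro y hy
    have hy : 0 < y := hy
    have : ∫⁻ r in Set.Icc (y / 4) (y / 2⁻¹), w r ≤ ENNReal.ofReal (2 * k) * ENNReal.ofReal (y ^ μ) := by
      calc _ ≤ ∫⁻ r in Set.Icc (y / 4) (y / 2⁻¹), ENNReal.ofReal (k * y ^ ν) :=
            setLIntegral_mono' measurableSet_Icc fun r hr => ENNReal.ofReal_le_ofReal
              (rpow_cmp ν hy (r := r) hr.1 (by have := hr.2; simp at this; linarith)).2
        _ = ENNReal.ofReal (k * y ^ ν) * ENNReal.ofReal (y / 2⁻¹ - y / 4) := by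
            rw [setLIntegral_const, Real.volume_Icc]
        _ ≤ _ := by
            rw [← ENNReal.ofReal_mul (by positivity), ← ENNReal.ofReal_mul (by positivity)]
            refine ENNReal.ofReal_le_ofReal ?_
            rw [hν, rpow_sub_one hy.ne']
            have hpos : 0 < y ^ μ := rpow_pos_of_pos hy _
            have e : k * (y ^ μ / y) * (y / 2⁻¹ - y / 4) = (7/4) * (k * y ^ μ) := by field_simp; ring
            rw [e]; nlinarith [mul_pos hk0 hpos]
    calc _ ≤ M y * (ENNReal.ofReal (2 * k) * ENNReal.ofReal (y ^ μ)) := by gcongr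
      _ = _ := by ring
  calc _ ≤ ∫⁻ y in Set.Ioi 0, ENNReal.ofReal (2 * k) * (G y * ∫⁻ r in Set.Icc (y / 2) (y / 1), w r) :=
        setLIntegral_mono' measurableSet_Ioi low
    _ = ENNReal.ofReal (2 * k) * ∫⁻ y in Set.Ioi 0, (G y * ∫⁻ r in Set.Icc (y / 2) (y / 1), w r) :=
        lintegral_const_mul' _ _ (by finiteness)
    _ ≤ ENNReal.ofReal (2 * k) * (C * ∫⁻ y in Set.Ioi 0, M y * ∫⁻ r in Set.Icc (y / 4) (y / 2⁻¹), w r) := by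
        gcongr
    _ ≤ ENNReal.ofReal (2 * k) * (C * (ENNReal.ofReal (2 * k) * ∫⁻ y in Set.Ioi 0, M y * ENNReal.ofReal (y ^ μ))) := by
        gcongr
        rw [← lintegral_const_mul' _ _ (by finiteness)]
        exact setLIntegral_mono' measurableSet_Ioi up
    _ = _ := by ring

end

section
variable {N : ℕ} {p : ℝ} {ι : Type} [Fintype ι]

/-- weighted norm to the power p -/
def Wn (p μ : ℝ) (F : Pt N → ℝ) : ENNReal :=
  ∫⁻ y in Set.Ioi 0, sl p F y ^ p * ENNReal.ofReal (y ^ μ)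

/-- weighted norm (power p) of heat averages at scale proportional to y -/
def nW (p μ ρ κ : ℝ) (G : Pt N → ℝ) : ENNReal :=
  ∫⁻ y in Set.Ioi 0, sl p (heat (sx ρ) (κ * y) G) y ^ p * ENNReal.ofReal (y ^ μ)

lemma nsl_meas (hp : 1 < p) (ρ κ : ℝ) {G : Pt N → ℝ} {k : ℕ} (hG : Nice k G) :
    Measurable fun y => sl p (heat (sx ρ) (κ * y) G) y := by
  have hc : Continuous fun z : Pt N => heat (sx ρ) (κ * z.2) G z :=
    (heat_cont_joint (sx ρ) hG.cont hG.bdd).comp (by fun_prop : Continuous fun z : Pt N => (κ * z.2, z))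
  have e : (fun y => sl p (heat (sx ρ) (κ * y) G) y) = sl p (fun z : Pt N => heat (sx ρ) (κ * z.2) G z) := by
    funext y
    exact sl_congr (F := heat (sx ρ) (κ * y) G) (G := fun z : Pt N => heat (sx ρ) (κ * z.2) G z) fun x => rfl
  rw [e]
  exact sl_meas hp hc

lemma S2_meas (hp : 1 < p) (ρ : ℝ) {φ : Pt N → ℝ} {k : ℕ} (h : Nice (k + 2) φ) : Measurable (S2 p ρ φ) := by
  unfold S2
  refine Finset.measurable_sum _ fun m _ => Finset.measurable_sum _ fun l _ => ?_
  exact sl_meas hp ((h.pd _).pd _).cont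

lemma sum_rpow_le (hp : 1 < p) {κ : Type*} (S : Finset κ) (a : κ → ENNReal) :
    (∑ i ∈ S, a i) ^ p ≤ (S.card : ENNReal) ^ (p - 1) * ∑ i ∈ S, a i ^ p :=
  ENNReal.rpow_sum_le_const_mul_sum_rpow S a hp.le

lemma partI (hp : 1 < p) (s : ι → Pt N) {ρ : ℝ} {ix : Fin N → ι} {iy : ι} (hS : Setup s ρ ix iy) (v : Pt N)
    (μ : ℝ) :
    ∃ C : ENNReal, C ≠ ⊤ ∧ ∀ (φ f : Pt N → ℝ), Eqn s v φ f → ∀ ε : ℝ, 0 < ε → ε ≤ 1 → ∀ i j : Fin N,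
      Wn p μ (pd (sx ρ i) (pd (sx ρ j) φ)) ≤ C * (Wn p μ f
        + ENNReal.ofReal ε ^ p * (∑ m, ∑ l, Wn p μ (pd (sx ρ m) (pd (sx ρ l) φ)))
        + nW p μ ρ (ε / 2) (pd (sx ρ i) (pd (sx ρ j) φ))) := by
  have hp0 : 0 < p := by linarith
  have hp1 : 0 ≤ p - 1 := by linarith
  obtain ⟨C0, hC0, H0⟩ := loc hp s hS v
  obtain ⟨K, hK, HK⟩ := scale_int μ
  set A : ENNReal := 2 ^ (p - 1) * (C0 + 1) with hA
  have hAt : A ≠ ⊤ := by rw [hA]; finiteness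
  set B : ENNReal := 2 ^ (p - 1) * (((Finset.univ : Finset (Fin N)).card : ENNReal) ^ (p - 1) *
    ((Finset.univ : Finset (Fin N)).card : ENNReal) ^ (p - 1)) + 2 ^ (p - 1) + 1 with hB
  have hBt : B ≠ ⊤ := by rw [hB]; finiteness
  refine ⟨K * A * B, by finiteness, fun φ f h ε hε hε1 i j => ?_⟩
  set ω := pd (sx ρ i) (pd (sx ρ j) φ) with hω
  have nω : ∀ k, Nice k ω := fun k => ((h.nφ (k + 2)).pd _).pd _
  set Mp : ℝ → ENNReal := fun y => (sl p f y + ENNReal.ofReal ε * S2 p ρ φ y) ^ p with hMp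
  set Hn : ℝ → ENNReal := fun y => sl p (heat (sx ρ) (ε / 2 * y) ω) y ^ p with hHn
  have mS2 := S2_meas hp ρ (h.nφ 2)
  have mf := sl_meas hp (h.nf 0).cont
  have mMp : Measurable Mp := (mf.add (mS2.const_mul _)).pow_const _
  have mHn : Measurable Hn := (nsl_meas hp ρ (ε / 2) (nω 0)).pow_const _
  have mG : Measurable fun y => sl p ω y ^ p := (sl_meas hp (nω 0).cont).pow_const _
  have key := HK A (fun y => sl p ω y ^ p) (fun y => Mp y + Hn y) hAt mG (mMp.add mHn) (fun r hr => by
    have e1 : ∀ y ∈ Set.Icc r (2 * r), sl p ω y ^ p ≤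
        2 ^ (p - 1) * (sl p (pd (sx ρ i) (pd (sx ρ j) (psi ρ (ε * r) φ))) y ^ p + Hn y) := by
      intro y hy
      refine le_trans ?_ (rpow_add_le2 hp _ _) |>.trans (mul_le_mul' le_rfl (add_le_add le_rfl
        (ENNReal.rpow_le_rpow (sl_heat_anti hp ρ (nω 4) (t' := ε / 2 * y) (t := ε * r) ?_ ?_ y) hp0.le)))
      · refine ENNReal.rpow_le_rpow ?_ hp0.le
        have n2 : Nice 0 (psi ρ (ε * r) ω) := (nω 0).psi
        rw [psi_pd (h.nφ 1), psi_pd ((h.nφ 2).pd _)]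
        refine le_trans (le_of_eq ?_) (sl_add hp n2.cont ((nω 0).heat (sx ρ) (ε * r)).cont y)
        refine sl_congr fun x => ?_
        simp [psi]
      · have := hy.1; have : 0 < y := by linarith
        positivity
      · have := hy.2; nlinarith
    have sub : Set.Icc r (2 * r) ⊆ Set.Icc (r / 2) (4 * r) := Set.Icc_subset_Icc (by linarith) (by linarith)
    have mψ : Measurable fun y => sl p (pd (sx ρ i) (pd (sx ρ j) (psi ρ (ε * r) φ))) y ^ p := by
      have n2 : Nice 2 (psi ρ (ε * r) φ) := (h.nφ 2).psi
      exact (sl_meas hp ((n2.pd _).pd _).cont).pow_const _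
    calc _ ≤ ∫⁻ y in Set.Icc r (2 * r),
          2 ^ (p - 1) * (sl p (pd (sx ρ i) (pd (sx ρ j) (psi ρ (ε * r) φ))) y ^ p + Hn y) :=
          setLIntegral_mono' measurableSet_Icc e1
      _ = 2 ^ (p - 1) * ((∫⁻ y in Set.Icc r (2 * r), sl p (pd (sx ρ i) (pd (sx ρ j) (psi ρ (ε * r) φ))) y ^ p)
          + ∫⁻ y in Set.Icc r (2 * r), Hn y) := by
          rw [lintegral_const_mul' _ _ (by finiteness), lintegral_add_left mψ]
      _ ≤ 2 ^ (p - 1) * ((C0 + 1) * (∫⁻ y in Set.Icc (r/2) (4 * r), Mp y)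
          + (C0 + 1) * ∫⁻ y in Set.Icc (r/2) (4 * r), Hn y) := by
          gcongr
          · exact (H0 φ f h ε r hε hε1 hr i j).trans (mul_le_mul' le_self_add le_rfl)
          · exact (lintegral_mono_set sub).trans (le_mul_of_one_le_left' le_add_self)
      _ = _ := by rw [lintegral_add_left mMp, hA]; ring)
  have e2 : ∀ y, Mp y ≤ B * (sl p f y ^ p + ENNReal.ofReal ε ^ p * ∑ m, ∑ l, sl p (pd (sx ρ m) (pd (sx ρ l) φ)) y ^ p) := by
    intro y
    refine (rpow_add_le2 hp _ _).trans ?_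
    rw [mul_add, mul_add]
    refine add_le_add (mul_le_mul' ?_ le_rfl) ?_
    · rw [hB, add_assoc]; exact le_add_self.trans' le_self_add
    · rw [ENNReal.mul_rpow_of_nonneg _ _ hp0.le]
      have : S2 p ρ φ y ^ p ≤ (((Finset.univ : Finset (Fin N)).card : ENNReal) ^ (p - 1) *
          ((Finset.univ : Finset (Fin N)).card : ENNReal) ^ (p - 1)) *
          ∑ m, ∑ l, sl p (pd (sx ρ m) (pd (sx ρ l) φ)) y ^ p := by
        unfold S2
        refine (sum_rpow_le hp _ _).trans ?_
        rw [mul_assoc]; gcongr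
        rw [Finset.mul_sum]
        exact Finset.sum_le_sum fun m _ => sum_rpow_le hp _ _
      calc _ ≤ 2 ^ (p - 1) * (ENNReal.ofReal ε ^ p * ((((Finset.univ : Finset (Fin N)).card : ENNReal) ^ (p - 1) *
          ((Finset.univ : Finset (Fin N)).card : ENNReal) ^ (p - 1)) *
          ∑ m, ∑ l, sl p (pd (sx ρ m) (pd (sx ρ l) φ)) y ^ p)) := by gcongr
        _ = 2 ^ (p - 1) * (((Finset.univ : Finset (Fin N)).card : ENNReal) ^ (p - 1) *
          ((Finset.univ : Finset (Fin N)).card : ENNReal) ^ (p - 1)) * (ENNReal.ofReal ε ^ p *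
          ∑ m, ∑ l, sl p (pd (sx ρ m) (pd (sx ρ l) φ)) y ^ p) := by ring
        _ ≤ _ := by
          refine mul_le_mul' ?_ le_rfl
          rw [hB, add_assoc]; exact le_self_add
  have hw : Measurable fun y : ℝ => ENNReal.ofReal (y ^ μ) := by fun_prop
  have mml : ∀ m l, Measurable fun y => sl p (pd (sx ρ m) (pd (sx ρ l) φ)) y ^ p := fun m l =>
    (sl_meas hp (((h.nφ 2).pd _).pd _).cont).pow_const _
  calc Wn p μ ω ≤ _ := key
    _ ≤ K * A * ∫⁻ y in Set.Ioi 0, (B * (sl p f y ^ p * ENNReal.ofReal (y ^ μ)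
          + ENNReal.ofReal ε ^ p * (∑ m, ∑ l, sl p (pd (sx ρ m) (pd (sx ρ l) φ)) y ^ p * ENNReal.ofReal (y ^ μ))
          + Hn y * ENNReal.ofReal (y ^ μ))) := by
        refine mul_le_mul' le_rfl (lintegral_mono fun y => ?_)
        calc _ ≤ (B * (sl p f y ^ p + ENNReal.ofReal ε ^ p * ∑ m, ∑ l, sl p (pd (sx ρ m) (pd (sx ρ l) φ)) y ^ p) + B * Hn y) * ENNReal.ofReal (y ^ μ) := by
              refine mul_le_mul' (add_le_add ?_ ?_) le_rfl
              · exact e2 y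
              · exact le_mul_of_one_le_left' (by rw [hB]; exact le_add_self)
          _ = _ := by
              simp only [← Finset.sum_mul]; ring
    _ = _ := by
        have m1 : Measurable fun y => Hn y * ENNReal.ofReal (y ^ μ) := mHn.mul hw
        have m2 : Measurable fun y => sl p f y ^ p * ENNReal.ofReal (y ^ μ) := (mf.pow_const _).mul hw
        have m3 : ∀ m l, Measurable fun y => sl p (pd (sx ρ m) (pd (sx ρ l) φ)) y ^ p * ENNReal.ofReal (y ^ μ) :=
          fun m l => (mml m l).mul hw
        rw [lintegral_const_mul' _ _ hBt, lintegral_add_right _ m1,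
          lintegral_add_left m2, lintegral_const_mul' _ _ (by finiteness),
          lintegral_finsetSum _ (fun m _ => Finset.measurable_fun_sum _ fun l _ => m3 m l)]
        rw [Finset.sum_congr rfl fun m _ => lintegral_finsetSum _ (fun l _ => m3 m l)]
        unfold Wn nW
        ring

end

section
variable {N : ℕ} {p : ℝ}

/-- mean value inequality in `L^p` -/
lemma mvtL (hp : 1 < p) {G G' : ℝ → (Fin N → ℝ) → ℝ} {h : ℝ} (hh : 0 ≤ h) {M : ENNReal}
    (hd : ∀ τ ∈ Set.Icc 0 h, ∀ x, HasDerivAt (fun τ => G τ x) (G' τ x) τ)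
    (hc : Continuous fun q : (Fin N → ℝ) × ℝ => G' q.2 q.1) (h0 : ∀ x, G 0 x = 0)
    (hM : ∀ τ ∈ Set.Icc 0 h, eLpNorm (G' τ) (ENNReal.ofReal p) volume ≤ M) :
    eLpNorm (G h) (ENNReal.ofReal p) volume ≤ ENNReal.ofReal h * M := by
  have hcl : ∀ τ : ℝ, max 0 (min τ h) ∈ Set.Icc 0 h := fun τ =>
    ⟨le_max_left _ _, max_le hh (min_le_right _ _)⟩
  have := mink' (volume : Measure (Fin N → ℝ)) (volume.restrict (Set.Ioc 0 h)) hp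
    (w := fun _ => 1) measurable_const
    (G := fun x τ => G' (max 0 (min τ h)) x) (M := M) (g := G h)
    (Continuous.measurable (hc.comp (by fun_prop : Continuous fun q : (Fin N → ℝ) × ℝ =>
      (q.1, max 0 (min q.2 h)))))
    (fun x => ?_) (fun τ => hM _ (hcl τ))
  · refine this.trans (le_of_eq ?_)
    simp
  · have hcx : Continuous fun τ => G' τ x := hc.comp (by fun_prop : Continuous fun τ : ℝ => (x, τ))
    have h1 := intervalIntegral.integral_eq_sub_of_hasDerivAt (a := 0) (b := h)
      (fun τ hτ => hd τ (by rwa [Set.uIcc_of_le hh] at hτ) x) (hcx.intervalIntegrable 0 h)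
    rw [h0, sub_zero, intervalIntegral.integral_of_le hh] at h1
    rw [← h1]
    refine (enorm_integral_le_lintegral_enorm _).trans (le_of_eq ?_)
    refine setLIntegral_congr_fun measurableSet_Ioc fun τ hτ => ?_
    simp [min_eq_left hτ.2, max_eq_right hτ.1.le]

lemma path_deriv {F : Pt N → ℝ} (hF : Differentiable ℝ F) (z v : Pt N) (τ : ℝ) :
    HasDerivAt (fun τ : ℝ => F (z + τ • v)) (pd v F (z + τ • v)) τ := by
  have h1 : HasDerivAt (fun τ : ℝ => z + τ • v) v τ := by
    simpa using ((hasDerivAt_id τ).smul_const v).const_add z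
  exact (hF _).hasFDerivAt.comp_hasDerivAt τ h1

lemma path_deriv' {F : Pt N → ℝ} (hF : Differentiable ℝ F) (z v : Pt N) (τ : ℝ) :
    HasDerivAt (fun τ : ℝ => F (z - τ • v)) (- pd v F (z - τ • v)) τ := by
  have h1 : HasDerivAt (fun τ : ℝ => z - τ • v) (-v) τ := by
    simpa using ((hasDerivAt_id τ).smul_const v).const_sub z
  have := (hF (z - τ • v)).hasFDerivAt.comp_hasDerivAt τ h1
  refine this.congr_deriv ?_
  simp [pd]

lemma sl_shift' (F : Pt N → ℝ) (y : ℝ) (v : Pt N) :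
    eLpNorm (fun x => F ((x, y) + v)) (ENNReal.ofReal p) volume = sl p F (y + v.2) :=
  sl_shift p F (y + v.2) v.1

lemma sl_shift'' (F : Pt N → ℝ) (y : ℝ) (v : Pt N) :
    eLpNorm (fun x => F ((x, y) - v)) (ENNReal.ofReal p) volume = sl p F (y - v.2) := by
  have := sl_shift' (p := p) F y (-v)
  simpa [sub_eq_add_neg] using this

lemma sl_diff1 (hp : 1 < p) {F : Pt N → ℝ} (hF : Nice 2 F) (v : Pt N) {M : ENNReal}
    (hM : ∀ y, sl p (pd v (pd v F)) y ≤ M) {h : ℝ} (hh : 0 ≤ h) (y : ℝ) :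
    eLpNorm (fun x => F ((x, y) + h • v) - F (x, y) - h * pd v F (x, y)) (ENNReal.ofReal p) volume
      ≤ ENNReal.ofReal h * (ENNReal.ofReal h * M) := by
  have c1 := (hF.pd v).cont
  have c2 := ((hF.pd v).pd v).cont
  have a1 : ∀ τ ∈ Set.Icc 0 h, eLpNorm (fun x => pd v F ((x, y) + τ • v) - pd v F (x, y)) (ENNReal.ofReal p) volume
      ≤ ENNReal.ofReal h * M := by
    intro τ hτ
    refine (mvtL hp (G := fun τ x => pd v F ((x, y) + τ • v) - pd v F (x, y))
      (G' := fun τ x => pd v (pd v F) ((x, y) + τ • v)) hτ.1 (M := M) ?_ ?_ ?_ ?_).trans ?_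
    · intro τ _ x
      exact (path_deriv (hF.pd v).diff _ _ _).sub_const _
    · fun_prop
    · intro x; simp
    · intro τ _; rw [sl_shift']; exact hM _
    · gcongr; exact hτ.2
  refine mvtL hp (G := fun τ x => F ((x, y) + τ • v) - F (x, y) - τ * pd v F (x, y))
      (G' := fun τ x => pd v F ((x, y) + τ • v) - pd v F (x, y)) hh ?_ ?_ ?_ a1
  · intro τ _ x
    refine ((path_deriv hF.diff (x, y) v τ).sub_const _).sub ?_
    simpa using (hasDerivAt_id τ).mul_const (pd v F (x, y))
  · fun_prop
  · intro x; simp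

lemma sl_diff2 (hp : 1 < p) {F : Pt N → ℝ} (hF : Nice 3 F) (v : Pt N) {M : ENNReal}
    (hM : ∀ y, sl p (pd v (pd v (pd v F))) y ≤ M) {h : ℝ} (hh : 0 ≤ h) (y : ℝ) :
    eLpNorm (fun x => F ((x, y) + h • v) + F ((x, y) - h • v) - 2 * F (x, y) - h ^ 2 * pd v (pd v F) (x, y))
      (ENNReal.ofReal p) volume ≤ ENNReal.ofReal h * (ENNReal.ofReal h * (ENNReal.ofReal h * (M + M))) := by
  have c1 := (hF.pd v).cont
  have c2 := ((hF.pd v).pd v).cont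
  have c3 := (((hF.pd v).pd v).pd v).cont
  have a2 : ∀ τ ∈ Set.Icc 0 h, eLpNorm (fun x => pd v (pd v F) ((x, y) + τ • v) + pd v (pd v F) ((x, y) - τ • v)
      - 2 * pd v (pd v F) (x, y)) (ENNReal.ofReal p) volume
      ≤ ENNReal.ofReal h * (M + M) := by
    intro τ hτ
    refine (mvtL hp (G := fun τ x => pd v (pd v F) ((x, y) + τ • v) + pd v (pd v F) ((x, y) - τ • v)
      - 2 * pd v (pd v F) (x, y))
      (G' := fun τ x => pd v (pd v (pd v F)) ((x, y) + τ • v) - pd v (pd v (pd v F)) ((x, y) - τ • v))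
      hτ.1 (M := M + M) ?_ ?_ ?_ ?_).trans ?_
    · intro τ _ x
      exact ((path_deriv ((hF.pd v).pd v).diff (x, y) v τ).add
        (path_deriv' ((hF.pd v).pd v).diff (x, y) v τ)).sub_const _
    · fun_prop
    · intro x; simp; ring
    · intro τ _
      refine (eLpNorm_sub_le (by fun_prop : Continuous _).aestronglyMeasurable
        (by fun_prop : Continuous _).aestronglyMeasurable (by rw [ENNReal.one_le_ofReal]; exact hp.le)).trans ?_
      rw [sl_shift', sl_shift'']; exact add_le_add (hM _) (hM _)
    · gcongr; exact hτ.2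
  have a1 : ∀ τ ∈ Set.Icc 0 h, eLpNorm (fun x => pd v F ((x, y) + τ • v) - pd v F ((x, y) - τ • v)
      - 2 * τ * pd v (pd v F) (x, y)) (ENNReal.ofReal p) volume
      ≤ ENNReal.ofReal h * (ENNReal.ofReal h * (M + M)) := by
    intro τ hτ
    refine (mvtL hp (G := fun τ x => pd v F ((x, y) + τ • v) - pd v F ((x, y) - τ • v)
      - 2 * τ * pd v (pd v F) (x, y))
      (G' := fun τ x => pd v (pd v F) ((x, y) + τ • v) + pd v (pd v F) ((x, y) - τ • v)
      - 2 * pd v (pd v F) (x, y))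
      hτ.1 ?_ ?_ ?_ (fun τ' hτ' => a2 τ' ⟨hτ'.1, hτ'.2.trans hτ.2⟩)).trans ?_
    · intro τ _ x
      refine HasDerivAt.congr_deriv (((path_deriv (hF.pd v).diff (x, y) v τ).sub
        (path_deriv' (hF.pd v).diff (x, y) v τ)).sub
        (((hasDerivAt_id τ).const_mul 2).mul_const (pd v (pd v F) (x, y)))) ?_
      ring
    · fun_prop
    · intro x; simp
    · gcongr; exact hτ.2
  refine mvtL hp (G := fun τ x => F ((x, y) + τ • v) + F ((x, y) - τ • v) - 2 * F (x, y) - τ ^ 2 * pd v (pd v F) (x, y))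
      (G' := fun τ x => pd v F ((x, y) + τ • v) - pd v F ((x, y) - τ • v)
      - 2 * τ * pd v (pd v F) (x, y)) hh ?_ ?_ ?_ a1
  · intro τ _ x
    refine HasDerivAt.congr_deriv ((((path_deriv hF.diff (x, y) v τ).add
        (path_deriv' hF.diff (x, y) v τ)).sub_const _).sub
        ((hasDerivAt_pow 2 τ).mul_const (pd v (pd v F) (x, y)))) ?_
    ring
  · fun_prop
  · intro x; simp; ring

lemma sl_difft (hp : 1 < p) (ρ : ℝ) {F : Pt N → ℝ} (hF : Nice 4 F) {M : ENNReal}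
    (hM : ∀ y, sl p (op (sx ρ) (op (sx ρ) F)) y ≤ M) {s h : ℝ} (hs : 0 < s) (hh : 0 ≤ h) (y : ℝ) :
    eLpNorm (fun x => hH (sx ρ) (s + h) F (x, y) - hH (sx ρ) s F (x, y) - h * hH (sx ρ) s (op (sx ρ) F) (x, y))
      (ENNReal.ofReal p) volume ≤ ENNReal.ofReal h * (ENNReal.ofReal h * M) := by
  have n2 : Nice 2 (op (sx ρ) F) := hF.op _
  have n0 : Nice 0 (op (sx ρ) (op (sx ρ) F)) := n2.op _
  have cj : ∀ {G : Pt N → ℝ}, Nice 0 G → Continuous fun q : (Fin N → ℝ) × ℝ => hH (sx ρ) (s + q.2) G (q.1, y) := by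
    intro G hG
    have := heat_cont_joint (sx ρ) hG.cont hG.bdd
    exact this.comp (by fun_prop : Continuous fun q : (Fin N → ℝ) × ℝ => (√(2 * (s + q.2)), (q.1, y)))
  have cs : ∀ {G : Pt N → ℝ}, Nice 0 G → Continuous fun q : (Fin N → ℝ) × ℝ => hH (sx ρ) s G (q.1, y) := by
    intro G hG
    have := heat_cont_joint (sx ρ) hG.cont hG.bdd
    exact this.comp (by fun_prop : Continuous fun q : (Fin N → ℝ) × ℝ => (√(2 * s), (q.1, y)))
  have dd : ∀ {G : Pt N → ℝ}, Nice 2 G → ∀ τ : ℝ, 0 ≤ τ → ∀ x, HasDerivAt (fun τ => hH (sx ρ) (s + τ) G (x, y))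
      (hH (sx ρ) (s + τ) (op (sx ρ) G) (x, y)) τ := by
    intro G hG τ hτ x
    have hp : 0 < s + τ := by linarith
    have := (hH_deriv (sx ρ) hG (x, y) hp.le).hasDerivAt (Ici_mem_nhds hp)
    exact this.comp_const_add s τ
  have a1 : ∀ τ ∈ Set.Icc 0 h, eLpNorm (fun x => hH (sx ρ) (s + τ) (op (sx ρ) F) (x, y)
      - hH (sx ρ) s (op (sx ρ) F) (x, y)) (ENNReal.ofReal p) volume ≤ ENNReal.ofReal h * M := by
    intro τ hτ
    refine (mvtL hp (G := fun τ x => hH (sx ρ) (s + τ) (op (sx ρ) F) (x, y)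
      - hH (sx ρ) s (op (sx ρ) F) (x, y))
      (G' := fun τ x => hH (sx ρ) (s + τ) (op (sx ρ) (op (sx ρ) F)) (x, y)) hτ.1 (M := M) ?_ ?_ ?_ ?_).trans ?_
    · intro τ hτ x
      exact (dd n2 τ hτ.1 x).sub_const _
    · exact cj n0
    · intro x; simp
    · intro τ _; exact (sl_heat_le ρ hp n0.cont _ y).trans (hM _)
    · gcongr; exact hτ.2
  refine mvtL hp (G := fun τ x => hH (sx ρ) (s + τ) F (x, y) - hH (sx ρ) s F (x, y)
    - τ * hH (sx ρ) s (op (sx ρ) F) (x, y))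
      (G' := fun τ x => hH (sx ρ) (s + τ) (op (sx ρ) F) (x, y) - hH (sx ρ) s (op (sx ρ) F) (x, y)) hh ?_ ?_ ?_ a1
  · intro τ hτ x
    refine ((dd (hF.mono (by omega)) τ hτ.1 x).sub_const _).sub ?_
    simpa using (hasDerivAt_id τ).mul_const (hH (sx ρ) s (op (sx ρ) F) (x, y))
  · exact (cj n2.zero).sub (cs n2.zero)
  · intro x; simp

lemma sl_bdd (hp : 1 < p) {F : Pt N → ℝ} (hF : Continuous F) (hs : HasCompactSupport F) :
    ∃ M : ENNReal, M ≠ ⊤ ∧ ∀ y, sl p F y ≤ M := by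
  obtain ⟨C, hC⟩ := hs.exists_bound_of_continuous hF
  have hp0 : 0 < p := by linarith
  have hK : IsCompact (Set.image Prod.fst (tsupport F)) := hs.image continuous_fst
  have hC0 : 0 ≤ C := (norm_nonneg _).trans (hC 0)
  refine ⟨eLpNorm ((Set.image Prod.fst (tsupport F)).indicator fun _ => C) (ENNReal.ofReal p) volume, ?_, fun y => ?_⟩
  · rw [eLpNorm_indicator_const hK.measurableSet (by simpa using hp0) ENNReal.ofReal_ne_top]
    have := hK.measure_lt_top (μ := (volume : Measure (Fin N → ℝ)))
    have : 0 ≤ 1 / (ENNReal.ofReal p).toReal := by positivity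
    finiteness
  · refine eLpNorm_mono_real fun x => ?_
    by_cases hx : x ∈ Set.image Prod.fst (tsupport F)
    · rw [Set.indicator_of_mem hx]; exact hC _
    · rw [Set.indicator_of_notMem hx]
      have : F (x, y) = 0 := by
        by_contra h
        exact hx ⟨(x, y), subset_tsupport _ h, rfl⟩
      simp [this]

end

section
variable {N : ℕ} {p : ℝ} {κ : Type} [Fintype κ]

/-- `L^p` bound for a continuous function -/
def LB (p : ℝ) (g : (Fin N → ℝ) → ℝ) (A : ℝ) : Prop :=
  Continuous g ∧ 0 ≤ A ∧ eLpNorm g (ENNReal.ofReal p) volume ≤ ENNReal.ofReal A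

lemma LB.add (hp : 1 < p) {g g' : (Fin N → ℝ) → ℝ} {A A' : ℝ} (h : LB p g A) (h' : LB p g' A') :
    LB p (fun x => g x + g' x) (A + A') := by
  refine ⟨h.1.add h'.1, add_nonneg h.2.1 h'.2.1, ?_⟩
  rw [ENNReal.ofReal_add h.2.1 h'.2.1]
  exact (eLpNorm_add_le h.1.aestronglyMeasurable h'.1.aestronglyMeasurable
    (by rw [ENNReal.one_le_ofReal]; exact hp.le)).trans (add_le_add h.2.2 h'.2.2)

lemma LB.mul {g : (Fin N → ℝ) → ℝ} {A : ℝ} (h : LB p g A) {c : ℝ} (hc : 0 ≤ c) :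
    LB p (fun x => c * g x) (c * A) := by
  refine ⟨h.1.const_mul c, mul_nonneg hc h.2.1, ?_⟩
  have := eLpNorm_const_smul c g (ENNReal.ofReal p) (volume : Measure (Fin N → ℝ))
  rw [ENNReal.ofReal_mul hc]
  calc _ = _ := this
    _ ≤ _ := by
      rw [Real.enorm_eq_ofReal hc]
      exact mul_le_mul' le_rfl h.2.2

lemma LB.neg {g : (Fin N → ℝ) → ℝ} {A : ℝ} (h : LB p g A) : LB p (fun x => - g x) A := by
  refine ⟨h.1.neg, h.2.1, ?_⟩
  have := eLpNorm_neg g (ENNReal.ofReal p) (volume : Measure (Fin N → ℝ))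
  exact this.le.trans h.2.2

lemma LB.sub (hp : 1 < p) {g g' : (Fin N → ℝ) → ℝ} {A A' : ℝ} (h : LB p g A) (h' : LB p g' A') :
    LB p (fun x => g x - g' x) (A + A') := by
  simpa [sub_eq_add_neg] using h.add hp h'.neg

lemma LB.sum (hp : 1 < p) {ι : Type*} (S : Finset ι) {g : ι → (Fin N → ℝ) → ℝ} {A : ι → ℝ}
    (h : ∀ i, LB p (g i) (A i)) : LB p (fun x => ∑ i ∈ S, g i x) (∑ i ∈ S, A i) := by
  classical
  induction S using Finset.induction_on with
  | empty => simp [LB, continuous_const]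
  | insert a S ha ih =>
    simp only [Finset.sum_insert ha]
    exact (h a).add hp ih

/-- real-valued slice norm of the heat flow -/
def nk (p ρ : ℝ) (ω : Pt N → ℝ) (s y : ℝ) : ℝ := (sl p (hH (sx ρ) s ω) y).toReal

lemma nk_nonneg (ρ : ℝ) (ω : Pt N → ℝ) (s y : ℝ) : 0 ≤ nk p ρ ω s y := ENNReal.toReal_nonneg

lemma nk_ofReal (hp : 1 < p) (ρ : ℝ) {ω : Pt N → ℝ} (hω : Continuous ω) (hc : HasCompactSupport ω) (s y : ℝ) :
    ENNReal.ofReal (nk p ρ ω s y) = sl p (hH (sx ρ) s ω) y := by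
  obtain ⟨M, hM, h⟩ := sl_bdd hp hω hc
  refine ENNReal.ofReal_toReal (ne_top_of_le_ne_top hM ?_)
  exact (sl_heat_le ρ hp hω _ y).trans (h y)

lemma pd_slice {f f1 f2 : Pt N → ℝ} (hf : Differentiable ℝ f) (h1 : Differentiable ℝ f1)
    (h2 : Differentiable ℝ f2) (e : ∀ z : Pt N, 0 < z.2 → f z = f1 z + z.2⁻¹ * f2 z) (w : Pt N) (hw : w.2 = 0)
    (z : Pt N) (hz : 0 < z.2) : pd w f z = pd w f1 z + z.2⁻¹ * pd w f2 z := by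
  have a := path_deriv hf z w 0
  have b := (path_deriv h1 z w 0).add ((path_deriv h2 z w 0).const_mul z.2⁻¹)
  have : (fun τ : ℝ => f (z + τ • w)) = fun τ : ℝ => f1 (z + τ • w) + z.2⁻¹ * f2 (z + τ • w) := by
    funext τ
    have hz2 : (z + τ • w).2 = z.2 := by simp [hw]
    rw [e _ (by rw [hz2]; exact hz), hz2]
  rw [this] at a
  have := a.unique b
  simpa using this

lemma op_pdc (s : κ → Pt N) {φ : Pt N → ℝ} (h : Nice 3 φ) (w : Pt N) :
    pd w (op s φ) = op s (pd w φ) := by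
  unfold op
  rw [pd_sum _ (fun k => ((h.pd (s k)).pd (s k)).diff)]
  funext z
  refine Finset.sum_congr rfl fun k _ => ?_
  rw [Nice.pd_comm (k := 0) (h.pd (s k)) w (s k), Nice.pd_comm (k := 1) h w (s k)]

lemma heat_eqn (ρ : ℝ) (σ : κ → Pt N) {v : Pt N} {φ f : Pt N → ℝ}
    (h : Eqn (Sum.elim (sx ρ) σ) v φ f) (i j : Fin N) (s : ℝ) (x : Fin N → ℝ) {y : ℝ} (hy : 0 < y) :
    hH (sx ρ) s (pd (sx ρ i) (pd (sx ρ j) f)) (x, y) =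
      hH (sx ρ) s (op (sx ρ) (pd (sx ρ i) (pd (sx ρ j) φ))) (x, y)
      + (∑ k, pd (σ k) (pd (σ k) (hH (sx ρ) s (pd (sx ρ i) (pd (sx ρ j) φ)))) (x, y))
      + y⁻¹ * pd v (hH (sx ρ) s (pd (sx ρ i) (pd (sx ρ j) φ))) (x, y) := by
  set ω := pd (sx ρ i) (pd (sx ρ j) φ) with hω
  have nω : ∀ k, Nice k ω := fun k => ((h.nφ (k + 2)).pd _).pd _
  have hw : ∀ i : Fin N, (sx ρ i).2 = 0 := fun i => by simp [sx, ex]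
  have nop : ∀ k, Nice k (op (Sum.elim (sx ρ) σ) φ) := fun k => (h.nφ (k + 2)).op _
  have e1 : ∀ z : Pt N, 0 < z.2 → pd (sx ρ i) (pd (sx ρ j) f) z = op (Sum.elim (sx ρ) σ) ω z + z.2⁻¹ * pd v ω z := by
    intro z hz
    have a1 : ∀ z : Pt N, 0 < z.2 → _ := pd_slice (h.nf 1).diff (nop 1).diff ((h.nφ 2).pd v).diff h.eq (sx ρ j) (hw j)
    have := pd_slice ((h.nf 2).pd _).diff ((nop 2).pd _).diff (((h.nφ 3).pd v).pd _).diff a1 (sx ρ i) (hw i) z hz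
    rw [this, op_pdc _ (h.nφ 3), op_pdc _ ((h.nφ 4).pd _), Nice.pd_comm (k := 0) (h.nφ 2) (sx ρ j) v,
      Nice.pd_comm (k := 0) ((h.nφ 3).pd _) (sx ρ i) v]
  have e2 : hH (sx ρ) s (pd (sx ρ i) (pd (sx ρ j) f)) (x, y) =
      hH (sx ρ) s (fun z => op (Sum.elim (sx ρ) σ) ω z + y⁻¹ * pd v ω z) (x, y) := by
    unfold hH heat
    congr 1; funext ζ
    have : (((x, y) : Pt N) + √(2 * s) • hl (sx ρ) ζ).2 = y := by simp [hl_sx]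
    rw [e1 _ (by rw [this]; exact hy), this]
  rw [e2]
  have n1 : Nice 1 (op (Sum.elim (sx ρ) σ) ω) := (nω 3).op _
  have n2 : Nice 1 (pd v ω) := (nω 2).pd _
  have e3 : op (Sum.elim (sx ρ) σ) ω = fun z => op (sx ρ) ω z + ∑ k, pd (σ k) (pd (σ k) ω) z := by
    funext z; simp [op, Fintype.sum_sum_type]
  unfold hH
  rw [heat_add (sx ρ) n1 (n2.const_mul y⁻¹), heat_const_mul, e3,
    heat_add (sx ρ) (k := 0) ((nω 2).op (sx ρ)) (Nice.sum _ fun k => ((nω 2).pd _).pd _),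
    heat_sum (sx ρ) _ (k := 0) (fun k => ((nω 2).pd _).pd _), (nω 1).heat_pd]
  show _ + _ + _ = _
  congr 2
  refine Finset.sum_congr rfl fun k _ => ?_
  rw [(nω 1).heat_pd, ((nω 2).pd _).heat_pd]

lemma kato (hp : 1 < p) (ρ : ℝ) (σ : κ → Pt N) {v : Pt N} {φ f : Pt N → ℝ}
    (h : Eqn (Sum.elim (sx ρ) σ) v φ f) (i j : Fin N) :
    ∃ M : ℝ, 0 ≤ M ∧ ∀ s y l : ℝ, 0 < s → 0 < y → 0 < l → l ≤ 1 →
      (2 * (Fintype.card κ : ℝ) + l / y + 1) * nk p ρ (pd (sx ρ i) (pd (sx ρ j) φ)) s y ≤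
      (∑ k, (nk p ρ (pd (sx ρ i) (pd (sx ρ j) φ)) s (y + l * (σ k).2) +
        nk p ρ (pd (sx ρ i) (pd (sx ρ j) φ)) s (y - l * (σ k).2)))
      + l / y * nk p ρ (pd (sx ρ i) (pd (sx ρ j) φ)) s (y + l * v.2)
      + nk p ρ (pd (sx ρ i) (pd (sx ρ j) φ)) (s + l ^ 2) y
      + l ^ 2 * nk p ρ (pd (sx ρ i) (pd (sx ρ j) f)) s y + l ^ 3 * (1 + 1 / y) * M := by
  set ω := pd (sx ρ i) (pd (sx ρ j) φ) with hω
  set g := pd (sx ρ i) (pd (sx ρ j) f) with hg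
  have nω : ∀ k, Nice k ω := fun k => ((h.nφ (k + 2)).pd _).pd _
  have cω : HasCompactSupport ω := pd_hcs (pd_hcs h.cφ _) _
  have sω : ContDiff ℝ (⊤ : ℕ∞) ω := pd_contDiff (pd_contDiff h.sφ _) _
  have ng : ∀ k, Nice k g := fun k => ((h.nf (k + 2)).pd _).pd _
  have cg : HasCompactSupport g := pd_hcs (pd_hcs h.cf _) _
  have cop : ∀ {F : Pt N → ℝ}, HasCompactSupport F → HasCompactSupport (op (sx ρ) F) := by
    intro F hF
    have : op (sx ρ) F = ∑ k, pd (sx ρ k) (pd (sx ρ k) F) := by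
      funext z; simp [op]
    rw [this]
    refine HasCompactSupport.of_support_subset_isCompact hF ?_
    intro z hz
    by_contra hz'
    apply hz
    rw [Finset.sum_apply]
    refine Finset.sum_eq_zero fun k _ => ?_
    have a1 : tsupport (pd (sx ρ k) (pd (sx ρ k) F)) ⊆ tsupport F := by
      have b : ∀ G : Pt N → ℝ, tsupport (pd (sx ρ k) G) ⊆ tsupport G := by
        intro G
        refine closure_minimal (fun z hz => ?_) (isClosed_tsupport G)
        refine support_fderiv_subset ℝ (fun h0 => hz ?_)
        simp [pd, h0]
      exact (b _).trans (b F)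
    exact image_eq_zero_of_notMem_tsupport fun hh => hz' (a1 hh)
  -- bounds
  have bk : ∀ k, ∃ M : ℝ, 0 ≤ M ∧ ∀ y, sl p (pd (σ k) (pd (σ k) (pd (σ k) ω))) y ≤ ENNReal.ofReal M := fun k => by
    obtain ⟨M, hM, hb⟩ := sl_bdd hp (((((nω 3).pd _).pd _).pd (σ k)).cont) (pd_hcs (pd_hcs (pd_hcs cω (σ k)) (σ k)) (σ k))
    exact ⟨M.toReal, ENNReal.toReal_nonneg, by rwa [ENNReal.ofReal_toReal hM]⟩
  choose Mk hMk0 hMk using bk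
  obtain ⟨Mv, hMv0, hMv⟩ : ∃ M : ℝ, 0 ≤ M ∧ ∀ y, sl p (pd v (pd v ω)) y ≤ ENNReal.ofReal M := by
    obtain ⟨M, hM, hb⟩ := sl_bdd hp ((((nω 2).pd _).pd v).cont) ((pd_hcs (pd_hcs cω v) v))
    exact ⟨M.toReal, ENNReal.toReal_nonneg, by rwa [ENNReal.ofReal_toReal hM]⟩
  have nt : Nice 0 (op (sx ρ) (op (sx ρ) ω)) := ((nω 4).op _).op _
  obtain ⟨Mt, hMt0, hMt⟩ : ∃ M : ℝ, 0 ≤ M ∧ ∀ y, sl p (op (sx ρ) (op (sx ρ) ω)) y ≤ ENNReal.ofReal M := by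
    obtain ⟨M, hM, hb⟩ := sl_bdd hp nt.cont (cop (cop cω))
    exact ⟨M.toReal, ENNReal.toReal_nonneg, by rwa [ENNReal.ofReal_toReal hM]⟩
  have hS0 : 0 ≤ ∑ k, (Mk k + Mk k) := Finset.sum_nonneg fun k _ => by have := hMk0 k; positivity
  refine ⟨(∑ k, (Mk k + Mk k)) + Mv + Mt, by positivity, fun s y l hs hy hl hl1 => ?_⟩
  set V := hH (sx ρ) s ω with hV
  have nV : ∀ k, Nice k V := fun k => (nω k).heat _ _
  have nkO := fun s y => nk_ofReal hp ρ (nω 0).cont cω s y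
  have cV := (nV 0).cont
  -- pieces
  have p1 : ∀ k, LB p (fun x => V ((x, y) + l • σ k)) (nk p ρ ω s (y + l * (σ k).2)) := fun k => by
    refine ⟨by fun_prop, nk_nonneg _ _ _ _, ?_⟩
    rw [nkO, sl_shift']; simp [hV]
  have p2 : ∀ k, LB p (fun x => V ((x, y) - l • σ k)) (nk p ρ ω s (y - l * (σ k).2)) := fun k => by
    refine ⟨by fun_prop, nk_nonneg _ _ _ _, ?_⟩
    rw [nkO, sl_shift'']; simp [hV]
  have p3 : LB p (fun x => V ((x, y) + l • v)) (nk p ρ ω s (y + l * v.2)) := by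
    refine ⟨by fun_prop, nk_nonneg _ _ _ _, ?_⟩
    rw [nkO, sl_shift']; simp [hV]
  have cVt : Continuous (hH (sx ρ) (s + l ^ 2) ω) := ((nω 0).heat _ _).cont
  have p4 : LB p (fun x => hH (sx ρ) (s + l ^ 2) ω (x, y)) (nk p ρ ω (s + l ^ 2) y) := by
    refine ⟨by fun_prop, nk_nonneg _ _ _ _, ?_⟩
    rw [nkO]; rfl
  have cgt : Continuous (hH (sx ρ) s g) := ((ng 0).heat _ _).cont
  have p5 : LB p (fun x => hH (sx ρ) s g (x, y)) (nk p ρ g s y) := by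
    refine ⟨by fun_prop, nk_nonneg _ _ _ _, ?_⟩
    rw [nk_ofReal hp ρ (ng 0).cont cg]; rfl
  have hp3 : ∀ k, pd (σ k) (pd (σ k) (pd (σ k) V)) = hH (sx ρ) s (pd (σ k) (pd (σ k) (pd (σ k) ω))) := fun k => by
    rw [hV, hH, (nω 1).heat_pd, ((nω 2).pd _).heat_pd, (((nω 3).pd _).pd _).heat_pd]; rfl
  have q1 : ∀ k, LB p (fun x => V ((x, y) + l • σ k) + V ((x, y) - l • σ k) - 2 * V (x, y)
      - l ^ 2 * pd (σ k) (pd (σ k) V) (x, y)) (l ^ 3 * (Mk k + Mk k)) := fun k => by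
    have := (((nV 2).pd (σ k)).pd (σ k)).cont
    have h0 := hMk0 k
    refine ⟨by fun_prop, by positivity, ?_⟩
    refine (sl_diff2 hp (nV 3) (σ k) (M := ENNReal.ofReal (Mk k)) (fun y => ?_) hl.le y).trans (le_of_eq ?_)
    · rw [hp3]
      exact (sl_heat_le ρ hp ((((nω 3).pd _).pd _).pd _).cont _ y).trans (hMk k y)
    · rw [← ENNReal.ofReal_add h0 h0, ← ENNReal.ofReal_mul hl.le, ← ENNReal.ofReal_mul hl.le, ← ENNReal.ofReal_mul hl.le]
      congr 1; ring
  have hp2 : pd v (pd v V) = hH (sx ρ) s (pd v (pd v ω)) := by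
    rw [hV, hH, (nω 1).heat_pd, ((nω 2).pd _).heat_pd]; rfl
  have q2 : LB p (fun x => V ((x, y) + l • v) - V (x, y) - l * pd v V (x, y)) (l ^ 2 * Mv) := by
    have := ((nV 1).pd v).cont
    refine ⟨by fun_prop, by positivity, ?_⟩
    refine (sl_diff1 hp (nV 2) v (M := ENNReal.ofReal Mv) (fun y => ?_) hl.le y).trans (le_of_eq ?_)
    · rw [hp2]
      exact (sl_heat_le ρ hp (((nω 2).pd _).pd _).cont _ y).trans (hMv y)
    · rw [← ENNReal.ofReal_mul hl.le, ← ENNReal.ofReal_mul hl.le]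
      congr 1; ring
  have q3 : LB p (fun x => hH (sx ρ) (s + l ^ 2) ω (x, y) - V (x, y) - l ^ 2 * hH (sx ρ) s (op (sx ρ) ω) (x, y))
      (l ^ 4 * Mt) := by
    have : Continuous (hH (sx ρ) s (op (sx ρ) ω)) := (((nω 2).op _).heat _ _).cont
    refine ⟨by fun_prop, by positivity, ?_⟩
    have hl2 : 0 ≤ l ^ 2 := by positivity
    refine (sl_difft hp ρ (nω 4) hMt hs hl2 y).trans (le_of_eq ?_)
    rw [← ENNReal.ofReal_mul hl2, ← ENNReal.ofReal_mul hl2]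
    congr 1; ring
  have hly : 0 ≤ l / y := by positivity
  have tot := (((((LB.sum hp Finset.univ fun k => (p1 k).add hp (p2 k)).add hp (p3.mul hly)).add hp p4).add hp
    ((LB.sum hp Finset.univ fun k => (q1 k).neg).add hp ((q2.neg.mul hly).add hp q3.neg))).sub hp
    (p5.mul (sq_nonneg l)))
  have id : ∀ x, (∑ k, (V ((x, y) + l • σ k) + V ((x, y) - l • σ k)) + l / y * V ((x, y) + l • v)
      + hH (sx ρ) (s + l ^ 2) ω (x, y)
      + ((∑ k, -(V ((x, y) + l • σ k) + V ((x, y) - l • σ k) - 2 * V (x, y) - l ^ 2 * pd (σ k) (pd (σ k) V) (x, y)))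
        + (l / y * -(V ((x, y) + l • v) - V (x, y) - l * pd v V (x, y))
          + -(hH (sx ρ) (s + l ^ 2) ω (x, y) - V (x, y) - l ^ 2 * hH (sx ρ) s (op (sx ρ) ω) (x, y)))))
      - l ^ 2 * hH (sx ρ) s g (x, y) = (2 * (Fintype.card κ : ℝ) + l / y + 1) * V (x, y) := by
    intro x
    rw [heat_eqn ρ σ h i j s x hy]
    simp only [Finset.sum_neg_distrib, Finset.sum_sub_distrib, Finset.sum_const, Finset.card_univ, nsmul_eq_mul,
      ← Finset.mul_sum]
    field_simp
    ring
  have t2 := tot.2.2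
  simp only [id] at t2
  have hpos : 0 ≤ 2 * (Fintype.card κ : ℝ) + l / y + 1 := by positivity
  have t3 : ENNReal.ofReal ((2 * (Fintype.card κ : ℝ) + l / y + 1) * nk p ρ ω s y) ≤
      eLpNorm (fun x => (2 * (Fintype.card κ : ℝ) + l / y + 1) * V (x, y)) (ENNReal.ofReal p) volume := by
    rw [ENNReal.ofReal_mul hpos, nkO]
    have := eLpNorm_const_smul (2 * (Fintype.card κ : ℝ) + l / y + 1) (fun x => V (x, y)) (ENNReal.ofReal p) (volume : Measure (Fin N → ℝ))
    rw [Real.enorm_eq_ofReal hpos] at this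
    exact this.symm.le
  replace t3 := t3.trans t2
  rw [ENNReal.ofReal_le_ofReal_iff tot.2.1] at t3
  refine t3.trans ?_
  have l4 : l ^ 4 * Mt ≤ l ^ 3 * Mt := by
    have : l ^ 4 ≤ l ^ 3 := pow_le_pow_of_le_one hl.le hl1 (by norm_num)
    gcongr
  have r1 : 0 ≤ l ^ 3 * Mv := by positivity
  have r2 : 0 ≤ l ^ 3 * (1 / y) * ((∑ k, (Mk k + Mk k)) + Mt) := by positivity
  have r3 : l / y * (l ^ 2 * Mv) = l ^ 3 * (1 / y) * Mv := by field_simp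
  rw [← Finset.mul_sum, r3]
  linarith [mul_add (l ^ 3) (∑ k, (Mk k + Mk k)) Mv]

end

section
variable {N : ℕ} {p : ℝ} {κ : Type} [Fintype κ]

lemma nk_anti (hp : 1 < p) (ρ : ℝ) {ω : Pt N → ℝ} (hω : ContDiff ℝ (⊤ : ℕ∞) ω) (hc : HasCompactSupport ω)
    {s s' : ℝ} (h0 : 0 ≤ s') (h : s' ≤ s) (y : ℝ) : nk p ρ ω s y ≤ nk p ρ ω s' y := by
  have n4 := Nice.of_cs 4 hω hc
  have := sl_heat_anti hp ρ n4 (Real.sqrt_nonneg (2 * s')) (Real.sqrt_le_sqrt (by linarith : 2 * s' ≤ 2 * s)) y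
  have e := nk_ofReal hp ρ n4.cont hc s y
  have e' := nk_ofReal hp ρ n4.cont hc s' y
  rw [← ENNReal.ofReal_le_ofReal_iff (nk_nonneg _ _ _ _), e, e']
  exact this

lemma nk_meas (hp : 1 < p) (ρ : ℝ) {ω : Pt N → ℝ} {k : ℕ} (hω : Nice k ω) :
    Measurable fun q : ℝ × ℝ => nk p ρ ω q.1 q.2 := by
  refine Measurable.ennreal_toReal ?_
  have hp0 : 0 < p := by linarith
  have hc := heat_cont_joint (sx ρ) hω.cont hω.bdd
  have hc2 : Continuous fun r : (ℝ × ℝ) × (Fin N → ℝ) => hH (sx ρ) r.1.1 ω (r.2, r.1.2) :=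
    hc.comp (by fun_prop : Continuous fun r : (ℝ × ℝ) × (Fin N → ℝ) => (√(2 * r.1.1), (r.2, r.1.2)))
  have e : (fun q : ℝ × ℝ => sl p (hH (sx ρ) q.1 ω) q.2) =
      fun q : ℝ × ℝ => (∫⁻ x, ‖hH (sx ρ) q.1 ω (x, q.2)‖ₑ ^ p) ^ (1 / p) := by
    funext q
    unfold sl
    rw [eLpNorm_eq_lintegral_rpow_enorm_toReal (by simpa using hp0) ENNReal.ofReal_ne_top, ENNReal.toReal_ofReal hp0.le]
  rw [e]
  refine Measurable.pow_const ?_ _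
  refine Measurable.lintegral_prod_right' (f := fun r : (ℝ × ℝ) × (Fin N → ℝ) => ‖hH (sx ρ) r.1.1 ω (r.2, r.1.2)‖ₑ ^ p) ?_
  exact hc2.measurable.enorm.pow_const _

lemma nk_bdd (hp : 1 < p) (ρ : ℝ) {ω : Pt N → ℝ} (hω : Continuous ω) (hc : HasCompactSupport ω) :
    ∃ M : ℝ, 0 ≤ M ∧ ∀ s y, nk p ρ ω s y ≤ M := by
  obtain ⟨M, hM, h⟩ := sl_bdd hp hω hc
  refine ⟨M.toReal, ENNReal.toReal_nonneg, fun s y => ENNReal.toReal_mono hM ?_⟩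
  exact (sl_heat_le ρ hp hω _ y).trans (h y)

lemma nk_zero (ρ : ℝ) {ω : Pt N → ℝ} (hc : HasCompactSupport ω) :
    ∃ R : ℝ, 0 < R ∧ ∀ s y, R ≤ y → nk p ρ ω s y = 0 := by
  obtain ⟨R, hR, h⟩ := hc.isBounded.exists_pos_norm_lt
  refine ⟨R, hR, fun s y hy => ?_⟩
  have hz : ∀ x, ω (x, y) = 0 := fun x => by
    by_contra hne
    have := h _ (subset_tsupport _ hne)
    have h2 : |y| ≤ ‖((x, y) : Pt N)‖ := norm_snd_le ((x, y) : Pt N)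
    have := le_abs_self y
    linarith
  unfold nk
  rw [sl_zero_of]; · simp
  intro x
  unfold hH heat
  simp only [sl_heat_arg, hz, integral_zero]


lemma pd_slab {g : Pt N → ℝ} (hg : Differentiable ℝ g) {δ : ℝ} (h : ∀ z : Pt N, 0 ≤ z.2 → z.2 ≤ δ → g z = 0)
    (w : Pt N) (hw : w.2 = 0) : ∀ z : Pt N, 0 ≤ z.2 → z.2 ≤ δ → pd w g z = 0 := by
  intro z h0 h1
  have a := path_deriv hg z w 0
  have : (fun τ : ℝ => g (z + τ • w)) = fun _ => 0 := by
    funext τ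
    have hz2 : (z + τ • w).2 = z.2 := by simp [hw]
    exact h _ (by rw [hz2]; exact h0) (by rw [hz2]; exact h1)
  rw [this] at a
  have := a.unique (hasDerivAt_const 0 0)
  simpa using this

lemma nk_const (ρ : ℝ) {v : Pt N} (hv : 0 < v.2) {φ : Pt N → ℝ} (hφ : ∀ k, Nice k φ) {δ : ℝ}
    (h : ∀ z : Pt N, 0 ≤ z.2 → z.2 ≤ δ → pd v φ z = 0) (i j : Fin N) (s y : ℝ) (h0 : 0 ≤ y) (hy : y ≤ δ) :
    nk p ρ (pd (sx ρ i) (pd (sx ρ j) φ)) s y = nk p ρ (pd (sx ρ i) (pd (sx ρ j) φ)) s 0 := by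
  set ω := pd (sx ρ i) (pd (sx ρ j) φ) with hω
  have hs : ∀ i : Fin N, (sx ρ i : Pt N).2 = 0 := fun i => by simp [sx, ex]
  have nω : ∀ k, Nice k ω := fun k => ((hφ (k + 2)).pd _).pd _
  have e : pd v ω = pd (sx ρ i) (pd (sx ρ j) (pd v φ)) := by
    rw [hω, Nice.pd_comm (k := 0) ((hφ 3).pd _) v (sx ρ i), Nice.pd_comm (k := 0) (hφ 2) v (sx ρ j)]
  have z1 : ∀ z : Pt N, 0 ≤ z.2 → z.2 ≤ δ → pd v ω z = 0 := by
    rw [e]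
    exact pd_slab (((hφ 3).pd v).pd _).diff (pd_slab ((hφ 2).pd v).diff h _ (hs j)) _ (hs i)
  set F := hH (sx ρ) s ω with hF
  have nF : Nice 1 F := (nω 1).heat _ _
  have z2 : ∀ z : Pt N, 0 ≤ z.2 → z.2 ≤ δ → pd v F z = 0 := by
    intro z h0 h1
    have : pd v F = heat (sx ρ) (√(2 * s)) (pd v ω) := (nω 1).heat_pd _ _ _
    rw [this]
    obtain ⟨x, y⟩ := z
    unfold heat
    have hz : ∀ x', pd v ω (x', y) = 0 := fun x' => z1 _ h0 h1
    simp only [sl_heat_arg, hz, integral_zero]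
  have key : ∀ x, F ((x, 0) + (y / v.2) • v) = F (x, 0) := by
    intro x
    have := constant_of_has_deriv_right_zero (f := fun τ : ℝ => F ((x, 0) + τ • v)) (a := 0) (b := y / v.2)
      (fun τ _ => (path_deriv nF.diff (x, 0) v τ).continuousAt.continuousWithinAt) (fun τ hτ => ?_)
      (y / v.2) (Set.right_mem_Icc.2 (by positivity))
    · simpa using this
    · have a := (path_deriv nF.diff (x, 0) v τ).hasDerivWithinAt (s := Set.Ici τ)
      refine a.congr_deriv (z2 _ ?_ ?_)
      · have := mul_nonneg hτ.1 hv.le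
        simpa using this
      · have := (lt_div_iff₀ hv).1 hτ.2
        have h3 : ((x, 0) + τ • v : Pt N).2 = τ * v.2 := by simp
        rw [h3]; linarith
  have := sl_shift' (p := p) F 0 ((y / v.2) • v)
  simp only [key] at this
  have h3 : (0 : ℝ) + ((y / v.2) • v).2 = y := by
    have : v.2 ≠ 0 := hv.ne'
    simp; field_simp
  rw [h3] at this
  unfold nk
  rw [← hF, ← this]; rfl

lemma nk_source (hp : 1 < p) (ρ : ℝ) {f : Pt N → ℝ} (hf : ContDiff ℝ (⊤ : ℕ∞) f) (hc : HasCompactSupport f)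
    (i j : Fin N) {s : ℝ} (hs : 0 < s) (y : ℝ) :
    nk p ρ (pd (sx ρ i) (pd (sx ρ j) f)) s y ≤ (gC N).toReal / (2 * s) * (sl p f y).toReal := by
  have := sl_smooth ρ hp (Nice.of_cs 2 hf hc) (t := √(2 * s)) (by positivity) y i j
  obtain ⟨M, hM, hb⟩ := sl_bdd hp hf.continuous hc
  have h1 : sl p f y ≠ ⊤ := ne_top_of_le_ne_top hM (hb y)
  have h2 := ENNReal.toReal_mono (ENNReal.mul_ne_top gC_lt.ne h1) this
  rw [ENNReal.toReal_mul, ENNReal.toReal_mul, ENNReal.toReal_ofReal (by positivity), Real.sq_sqrt (by positivity)] at h2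
  unfold nk hH
  rw [div_mul_eq_mul_div, le_div_iff₀ (by positivity)]
  linarith

end

section

lemma second_diff {f f' f'' : ℝ → ℝ} (h1 : ∀ y, HasDerivAt f (f' y) y) (h2 : ∀ y, HasDerivAt f' (f'' y) y)
    (y t : ℝ) : ∃ ξ, |ξ - y| ≤ |t| ∧ f (y - t) + f (y + t) - 2 * f y = t ^ 2 * f'' ξ := by
  wlog ht : 0 < t generalizing t with H
  · rcases (not_lt.1 ht).eq_or_lt with h | h
    · exact ⟨y, by simp, by subst h; simp; ring⟩
    · obtain ⟨ξ, a, b⟩ := H (-t) (by linarith)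
      refine ⟨ξ, by simpa using a, ?_⟩
      have : f (y - -t) + f (y + -t) - 2 * f y = f (y - t) + f (y + t) - 2 * f y := by
        rw [sub_neg_eq_add, ← sub_eq_add_neg]; ring
      rw [← this, b]; ring
  set g : ℝ → ℝ := fun τ => f (y - τ) + f (y + τ) with hg
  have dg : ∀ τ, HasDerivAt g (f' (y + τ) - f' (y - τ)) τ := fun τ => by
    have a := (h1 (y - τ)).comp τ ((hasDerivAt_id τ).const_sub y)
    have b := (h1 (y + τ)).comp τ ((hasDerivAt_id τ).const_add y)
    exact (a.add b).congr_deriv (by ring)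
  obtain ⟨τ, hτ, e⟩ := exists_ratio_hasDerivAt_eq_ratio_slope g (fun τ => f' (y + τ) - f' (y - τ)) ht
    (fun τ _ => (dg τ).continuousAt.continuousWithinAt) (fun τ _ => dg τ)
    (fun τ => τ ^ 2) (fun τ => 2 * τ) (by fun_prop) (fun τ _ => ((hasDerivAt_pow 2 τ).congr_deriv (by simp)))
  obtain ⟨ξ, hξ, e2⟩ := exists_hasDerivAt_eq_slope f' f'' (by linarith [hτ.1] : y - τ < y + τ)
    (fun τ _ => (h2 τ).continuousAt.continuousWithinAt) (fun τ _ => h2 τ)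
  refine ⟨ξ, ?_, ?_⟩
  · rw [abs_of_pos ht, abs_le]; exact ⟨by linarith [hξ.1, hτ.2], by linarith [hξ.2, hτ.2]⟩
  · have h0 : (y + τ) - (y - τ) ≠ 0 := by have := hτ.1; intro h; linarith
    rw [eq_div_iff h0] at e2
    have g0 : g 0 = 2 * f y := by simp [hg]; ring
    have gt : g t = f (y - t) + f (y + t) := rfl
    rw [← e2, g0, gt] at e
    have : (2 * τ) ≠ 0 := by have := hτ.1; positivity
    apply mul_right_cancel₀ this
    linarith

lemma first_diff {f f' : ℝ → ℝ} (h1 : ∀ y, HasDerivAt f (f' y) y) (y t : ℝ) :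
    ∃ ξ, |ξ - y| ≤ |t| ∧ f (y - t) - f y = - t * f' ξ := by
  rcases lt_trichotomy t 0 with h | h | h
  · obtain ⟨ξ, hξ, e⟩ := exists_hasDerivAt_eq_slope f f' (by linarith : y < y - t)
      (fun τ _ => (h1 τ).continuousAt.continuousWithinAt) (fun τ _ => h1 τ)
    rw [eq_div_iff (by linarith)] at e
    refine ⟨ξ, ?_, by linarith⟩
    rw [abs_of_neg h, abs_le]; exact ⟨by linarith [hξ.1], by linarith [hξ.2]⟩
  · exact ⟨y, by simp, by simp [h]⟩
  · obtain ⟨ξ, hξ, e⟩ := exists_hasDerivAt_eq_slope f f' (by linarith : y - t < y)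
      (fun τ _ => (h1 τ).continuousAt.continuousWithinAt) (fun τ _ => h1 τ)
    rw [eq_div_iff (by linarith)] at e
    refine ⟨ξ, ?_, by linarith⟩
    rw [abs_of_pos h, abs_le]; exact ⟨by linarith [hξ.1], by linarith [hξ.2]⟩

/-- integrable with zero integral -/
def ZI (h : ℝ × ℝ → ℝ) : Prop := Integrable h ∧ ∫ q, h q = 0

lemma ZI.add {h g : ℝ × ℝ → ℝ} (a : ZI h) (b : ZI g) : ZI fun q => h q + g q :=
  ⟨a.1.add b.1, by rw [integral_add a.1 b.1, a.2, b.2, add_zero]⟩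

lemma ZI.mul {h : ℝ × ℝ → ℝ} (a : ZI h) (c : ℝ) : ZI fun q => c * h q :=
  ⟨a.1.const_mul c, by rw [integral_const_mul, a.2, mul_zero]⟩

lemma ZI.sum {ι : Type*} (S : Finset ι) {h : ι → ℝ × ℝ → ℝ} (a : ∀ i, ZI (h i)) :
    ZI fun q => ∑ i ∈ S, h i q :=
  ⟨integrable_finsetSum _ fun i _ => (a i).1, by
    rw [integral_finsetSum _ fun i _ => (a i).1]; exact Finset.sum_eq_zero fun i _ => (a i).2⟩

lemma ZI.tr {n G : ℝ × ℝ → ℝ} (hn : Measurable n) {M : ℝ} (hM : ∀ q, |n q| ≤ M) (hG : Integrable G)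
    (w : ℝ × ℝ) : ZI fun q => n (q + w) * G q - n q * G (q - w) := by
  have i1 : Integrable fun q => n (q + w) * G q :=
    hG.bdd_mul (c := M) (hn.comp (measurable_id.add_const w)).aestronglyMeasurable (ae_of_all _ fun q => hM _)
  have i2 : Integrable fun q => n q * G (q - w) :=
    (hG.comp_sub_right w).bdd_mul (c := M) hn.aestronglyMeasurable (ae_of_all _ fun q => hM _)
  refine ⟨i1.sub i2, ?_⟩
  rw [integral_sub i1 i2, ← integral_sub_right_eq_self (fun q => n (q + w) * G q) w]
  simp

end

section

structure TF (Θ Θy Θyy Ψ Ψy Θs : ℝ × ℝ → ℝ) (R : ℝ) : Prop where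
  dy : ∀ s y, HasDerivAt (fun y => Θ (s, y)) (Θy (s, y)) y
  dyy : ∀ s y, HasDerivAt (fun y => Θy (s, y)) (Θyy (s, y)) y
  dΨ : ∀ s y, HasDerivAt (fun y => Ψ (s, y)) (Ψy (s, y)) y
  ds : ∀ y s, HasDerivAt (fun s => Θ (s, y)) (Θs (s, y)) s
  hΨ : ∀ q : ℝ × ℝ, Ψ q = Θ q / q.2
  c0 : Continuous Θ
  c1 : Continuous Ψ
  c2 : Continuous Θyy
  c3 : Continuous Ψy
  c4 : Continuous Θs
  z0 : ∀ q, R < ‖q‖ → Θ q = 0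
  z1 : ∀ q, R < ‖q‖ → Ψ q = 0
  z2 : ∀ q, R < ‖q‖ → Θyy q = 0
  z3 : ∀ q, R < ‖q‖ → Ψy q = 0
  z4 : ∀ q, R < ‖q‖ → Θs q = 0
  nn : ∀ q, 0 ≤ Θ q
  pos : ∀ q, Θ q ≠ 0 → 0 < q.1 ∧ 0 < q.2

lemma cs_of_z {G : ℝ × ℝ → ℝ} {R : ℝ} (z : ∀ q, R < ‖q‖ → G q = 0) : HasCompactSupport G := by
  refine HasCompactSupport.of_support_subset_isCompact (isCompact_closedBall (0 : ℝ × ℝ) R) fun q hq => ?_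
  rw [mem_closedBall_zero_iff]
  by_contra h
  exact hq (z q (not_le.1 h))

lemma bd_of_z {G : ℝ × ℝ → ℝ} {R : ℝ} (hc : Continuous G) (z : ∀ q, R < ‖q‖ → G q = 0) :
    ∃ C, 0 ≤ C ∧ ∀ q, |G q| ≤ C := by
  obtain ⟨C, hC⟩ := hc.bounded_above_of_compact_support (cs_of_z z)
  exact ⟨C, (norm_nonneg _).trans (hC 0), hC⟩

lemma tend_of_near {G : ℝ × ℝ → ℝ} (hc : Continuous G) (q : ℝ × ℝ) {X : ℝ → ℝ} {e : ℝ → ℝ} (A : ℝ)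
    (he : Filter.Tendsto e (nhdsWithin 0 (Set.Ioi 0)) (nhds 0))
    (h : ∀ l, 0 < l → ∃ ξ : ℝ × ℝ, ‖ξ - q‖ ≤ e l ∧ X l = A * G ξ) :
    Filter.Tendsto X (nhdsWithin 0 (Set.Ioi 0)) (nhds (A * G q)) := by
  choose! ξ h1 h2 using h
  have t1 : Filter.Tendsto ξ (nhdsWithin 0 (Set.Ioi 0)) (nhds q) := by
    rw [tendsto_iff_norm_sub_tendsto_zero]
    refine squeeze_zero' (Filter.Eventually.of_forall fun _ => norm_nonneg _) ?_ he
    filter_upwards [self_mem_nhdsWithin] with l hl using h1 l hl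
  have := ((hc.tendsto q).comp t1).const_mul A
  refine this.congr' ?_
  filter_upwards [self_mem_nhdsWithin] with l hl
  rw [h2 l hl]; rfl

variable {κ : Type} [Fintype κ]

/-- discrete adjoint operator -/
def Bl (σ : κ → ℝ) (c : ℝ) (Θ Ψ : ℝ × ℝ → ℝ) (l : ℝ) (q : ℝ × ℝ) : ℝ :=
  (∑ k, (Θ (q.1, q.2 - l * σ k) + Θ (q.1, q.2 + l * σ k) - 2 * Θ q) / l ^ 2)
  + (Ψ (q.1, q.2 - l * c) - Ψ q) / l + (Θ (q.1 - l ^ 2, q.2) - Θ q) / l ^ 2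

lemma Bl_rep {Θ Θy Θyy Ψ Ψy Θs : ℝ × ℝ → ℝ} {R : ℝ} (T : TF Θ Θy Θyy Ψ Ψy Θs R) (q : ℝ × ℝ) {l : ℝ} (hl : 0 < l) :
   (∀ τ : ℝ, ∃ ξ : ℝ × ℝ, ‖ξ - q‖ ≤ |l * τ| ∧
     (Θ (q.1, q.2 - l * τ) + Θ (q.1, q.2 + l * τ) - 2 * Θ q) / l ^ 2 = τ ^ 2 * Θyy ξ) ∧
   (∀ c : ℝ, ∃ ξ : ℝ × ℝ, ‖ξ - q‖ ≤ |l * c| ∧ (Ψ (q.1, q.2 - l * c) - Ψ q) / l = (-c) * Ψy ξ) ∧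
   (∃ ξ : ℝ × ℝ, ‖ξ - q‖ ≤ l ^ 2 ∧ (Θ (q.1 - l ^ 2, q.2) - Θ q) / l ^ 2 = (-1) * Θs ξ) := by
  obtain ⟨s, y⟩ := q
  refine ⟨fun τ => ?_, fun c => ?_, ?_⟩
  · obtain ⟨ξ, a, b⟩ := second_diff (T.dy s) (T.dyy s) y (l * τ)
    refine ⟨(s, ξ), by simpa [Prod.norm_def] using a, ?_⟩
    simp only
    rw [b]; field_simp
  · obtain ⟨ξ, a, b⟩ := first_diff (T.dΨ s) y (l * c)
    refine ⟨(s, ξ), by simpa [Prod.norm_def] using a, ?_⟩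
    simp only
    rw [b]; field_simp
  · obtain ⟨ξ, a, b⟩ := first_diff (T.ds y) s (l ^ 2)
    refine ⟨(ξ, y), ?_, ?_⟩
    · rw [abs_of_nonneg (sq_nonneg l)] at a
      simpa [Prod.norm_def] using a
    · simp only
      rw [b]; field_simp

lemma Bl_tendsto {Θ Θy Θyy Ψ Ψy Θs : ℝ × ℝ → ℝ} {R : ℝ} (T : TF Θ Θy Θyy Ψ Ψy Θs R) (σ : κ → ℝ) (c : ℝ) (q : ℝ × ℝ) :
    Filter.Tendsto (fun l => Bl σ c Θ Ψ l q) (nhdsWithin 0 (Set.Ioi 0))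
      (nhds ((∑ k, σ k ^ 2) * Θyy q - c * Ψy q - Θs q)) := by
  have e : (∑ k, σ k ^ 2) * Θyy q - c * Ψy q - Θs q = (∑ k, σ k ^ 2 * Θyy q) + (-c) * Ψy q + (-1) * Θs q := by
    rw [Finset.sum_mul]; ring
  rw [e]
  have lim : ∀ τ : ℝ, Filter.Tendsto (fun l : ℝ => |l * τ|) (nhdsWithin 0 (Set.Ioi 0)) (nhds 0) := fun τ => by
    have : Continuous fun l : ℝ => |l * τ| := by fun_prop
    have := this.tendsto 0
    simp only [zero_mul, abs_zero] at this
    exact this.mono_left nhdsWithin_le_nhds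
  have lim2 : Filter.Tendsto (fun l : ℝ => l ^ 2) (nhdsWithin 0 (Set.Ioi 0)) (nhds 0) := by
    have : Continuous fun l : ℝ => l ^ 2 := by fun_prop
    have := this.tendsto 0
    simp only [ne_eq, OfNat.ofNat_ne_zero, not_false_eq_true, zero_pow] at this
    exact this.mono_left nhdsWithin_le_nhds
  refine (Filter.Tendsto.add ?_ ?_).add ?_
  · refine tendsto_finsetSum _ fun k _ => ?_
    exact tend_of_near T.c2 q _ (lim (σ k)) fun l hl => (Bl_rep T q hl).1 (σ k)
  · exact tend_of_near T.c3 q _ (lim c) fun l hl => (Bl_rep T q hl).2.1 c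
  · exact tend_of_near T.c4 q _ lim2 fun l hl => (Bl_rep T q hl).2.2

lemma Bl_bdd {Θ Θy Θyy Ψ Ψy Θs : ℝ × ℝ → ℝ} {R : ℝ} (T : TF Θ Θy Θyy Ψ Ψy Θs R) (σ : κ → ℝ) (c : ℝ) :
    ∃ C W, 0 ≤ C ∧ ∀ l, 0 < l → l ≤ 1 → ∀ q, |Bl σ c Θ Ψ l q| ≤ C ∧ (W < ‖q‖ → Bl σ c Θ Ψ l q = 0) := by
  obtain ⟨C2, h2, b2⟩ := bd_of_z T.c2 T.z2
  obtain ⟨C3, h3, b3⟩ := bd_of_z T.c3 T.z3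
  obtain ⟨C4, h4, b4⟩ := bd_of_z T.c4 T.z4
  refine ⟨(∑ k, σ k ^ 2 * C2) + |c| * C3 + C4, R + ((∑ k, |σ k|) + |c| + 1), by positivity, fun l hl hl1 q => ?_⟩
  obtain ⟨r1, r2, r3⟩ := Bl_rep T q hl
  constructor
  · unfold Bl
    refine (abs_add_le _ _).trans (add_le_add ((abs_add_le _ _).trans (add_le_add ?_ ?_)) ?_)
    · refine (Finset.abs_sum_le_sum_abs _ _).trans (Finset.sum_le_sum fun k _ => ?_)
      obtain ⟨ξ, _, e⟩ := r1 (σ k)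
      rw [e, abs_mul, abs_of_nonneg (sq_nonneg (σ k))]
      exact mul_le_mul_of_nonneg_left (b2 ξ) (sq_nonneg _)
    · obtain ⟨ξ, _, e⟩ := r2 c
      rw [e, abs_mul, abs_neg]
      exact mul_le_mul_of_nonneg_left (b3 ξ) (abs_nonneg _)
    · obtain ⟨ξ, _, e⟩ := r3
      rw [e]
      simpa using b4 ξ
  · intro hW
    have hpos : 0 ≤ ∑ k, |σ k| := Finset.sum_nonneg fun k _ => abs_nonneg _
    have far : ∀ ξ : ℝ × ℝ, ‖ξ - q‖ ≤ (∑ k, |σ k|) + |c| + 1 → R < ‖ξ‖ := fun ξ h => by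
      have := norm_sub_norm_le q ξ
      rw [norm_sub_rev] at this
      linarith
    unfold Bl
    have e1 : ∀ k, (Θ (q.1, q.2 - l * σ k) + Θ (q.1, q.2 + l * σ k) - 2 * Θ q) / l ^ 2 = 0 := fun k => by
      obtain ⟨ξ, hξ, e⟩ := r1 (σ k)
      rw [e, T.z2 ξ (far ξ ?_), mul_zero]
      have : |σ k| ≤ ∑ k, |σ k| := Finset.single_le_sum (f := fun k => |σ k|) (fun k _ => abs_nonneg _) (Finset.mem_univ k)
      rw [abs_mul, abs_of_pos hl] at hξ
      have : l * |σ k| ≤ 1 * |σ k| := mul_le_mul_of_nonneg_right hl1 (abs_nonneg _)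
      linarith [abs_nonneg c]
    have e2 : (Ψ (q.1, q.2 - l * c) - Ψ q) / l = 0 := by
      obtain ⟨ξ, hξ, e⟩ := r2 c
      rw [e, T.z3 ξ (far ξ ?_), mul_zero]
      rw [abs_mul, abs_of_pos hl] at hξ
      have : l * |c| ≤ 1 * |c| := mul_le_mul_of_nonneg_right hl1 (abs_nonneg _)
      linarith
    have e3 : (Θ (q.1 - l ^ 2, q.2) - Θ q) / l ^ 2 = 0 := by
      obtain ⟨ξ, hξ, e⟩ := r3
      rw [e, T.z4 ξ (far ξ ?_), mul_zero]
      have : l ^ 2 ≤ 1 := by nlinarith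
      linarith [abs_nonneg c]
    simp only [e1, e2, e3, Finset.sum_const_zero, add_zero]

lemma weak {Θ Θy Θyy Ψ Ψy Θs : ℝ × ℝ → ℝ} {R : ℝ} (T : TF Θ Θy Θyy Ψ Ψy Θs R) (σ : κ → ℝ) (c : ℝ)
    {n H : ℝ × ℝ → ℝ} {M M' l0 : ℝ} (hn : Measurable n) (hM : ∀ q, |n q| ≤ M) (hl0 : 0 < l0)
    (ineq : ∀ s y l, 0 < s → 0 < y → 0 < l → l ≤ l0 →
      (2 * (Fintype.card κ : ℝ) + l / y + 1) * n (s, y) ≤ (∑ k, (n (s, y + l * σ k) + n (s, y - l * σ k)))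
        + l / y * n (s, y + l * c) + n (s + l ^ 2, y) + l ^ 2 * H (s, y) + l ^ 3 * (1 + 1 / y) * M')
    (hH : Integrable fun q => H q * Θ q) :
    0 ≤ ∫ q, (n q * ((∑ k, σ k ^ 2) * Θyy q - c * Ψy q - Θs q) + H q * Θ q) := by
  have hM0 : 0 ≤ M := (abs_nonneg _).trans (hM 0)
  obtain ⟨C, W, hC, hB⟩ := Bl_bdd T σ c
  have iΘ : Integrable Θ := T.c0.integrable_of_hasCompactSupport (cs_of_z T.z0)
  have iΨ : Integrable Ψ := T.c1.integrable_of_hasCompactSupport (cs_of_z T.z1)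
  have cB : ∀ l, Continuous (Bl σ c Θ Ψ l) := fun l => by
    have := T.c0; have := T.c1
    unfold Bl
    fun_prop
  set Y : ℝ → ℝ × ℝ → ℝ := fun l q => n q * Bl σ c Θ Ψ l q + H q * Θ q + l * (M' * (Θ q + Ψ q)) with hY
  set dom : ℝ × ℝ → ℝ := fun q => M * (Metric.closedBall (0 : ℝ × ℝ) W).indicator (fun _ => C) q + |H q * Θ q|
    + |M'| * (|Θ q| + |Ψ q|) with hdom
  have idom : Integrable dom := by
    refine ((Integrable.const_mul ?_ M).add hH.abs).add ((iΘ.abs.add iΨ.abs).const_mul _)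
    exact (integrable_indicator_iff Metric.isClosed_closedBall.measurableSet).2
      (integrableOn_const (isCompact_closedBall _ _).measure_lt_top.ne)
  have mY : ∀ l, AEStronglyMeasurable (Y l) := fun l =>
    ((hn.mul (cB l).measurable).aestronglyMeasurable.add hH.1).add (((iΘ.add iΨ).const_mul M').const_mul l).1
  have bY : ∀ l, 0 < l → l ≤ 1 → ∀ q, ‖Y l q‖ ≤ dom q := fun l h0 h1 q => by
    refine (norm_add_le _ _).trans (add_le_add ((norm_add_le _ _).trans (add_le_add ?_ le_rfl)) ?_)
    · rw [norm_mul]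
      refine mul_le_mul (hM q) ?_ (norm_nonneg _) hM0
      by_cases hq : q ∈ Metric.closedBall (0 : ℝ × ℝ) W
      · rw [Set.indicator_of_mem hq]; exact (hB l h0 h1 q).1
      · rw [Set.indicator_of_notMem hq, (hB l h0 h1 q).2 (by simpa using hq)]; simp
    · rw [norm_mul, norm_mul, Real.norm_eq_abs, abs_of_pos h0]
      have : ‖Θ q + Ψ q‖ ≤ |Θ q| + |Ψ q| := norm_add_le _ _
      calc l * (‖M'‖ * ‖Θ q + Ψ q‖) ≤ 1 * (‖M'‖ * ‖Θ q + Ψ q‖) := mul_le_mul_of_nonneg_right h1 (by positivity)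
        _ ≤ |M'| * (|Θ q| + |Ψ q|) := by rw [one_mul]; exact mul_le_mul_of_nonneg_left this (abs_nonneg _)
  have lim : Filter.Tendsto (fun l => ∫ q, Y l q) (nhdsWithin 0 (Set.Ioi 0))
      (nhds (∫ q, (n q * ((∑ k, σ k ^ 2) * Θyy q - c * Ψy q - Θs q) + H q * Θ q))) := by
    refine tendsto_integral_filter_of_dominated_convergence dom (Filter.Eventually.of_forall mY) ?_ idom
      (ae_of_all _ fun q => ?_)
    · filter_upwards [self_mem_nhdsWithin, Ioc_mem_nhdsGT (zero_lt_one' ℝ)] with l hl hl1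
      exact ae_of_all _ fun q => bY l hl hl1.2 q
    · have t1 := ((Bl_tendsto T σ c q).const_mul (n q)).add_const (H q * Θ q)
      have t2 : Filter.Tendsto (fun l : ℝ => l * (M' * (Θ q + Ψ q))) (nhdsWithin 0 (Set.Ioi 0)) (nhds 0) := by
        have : Continuous fun l : ℝ => l * (M' * (Θ q + Ψ q)) := by fun_prop
        have := this.tendsto 0
        simp only [zero_mul] at this
        exact this.mono_left nhdsWithin_le_nhds
      have := t1.add t2
      simpa only [add_zero] using this
  refine ge_of_tendsto lim ?_
  filter_upwards [self_mem_nhdsWithin, Ioc_mem_nhdsGT (zero_lt_one' ℝ), Ioc_mem_nhdsGT hl0] with l hl hl1 hl2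
  have hl : 0 < l := hl
  set Z : ℝ × ℝ → ℝ := fun q =>
    (∑ k, (1 / l ^ 2 * (n (q + (0, l * σ k)) * Θ q - n q * Θ (q - (0, l * σ k)))
      + 1 / l ^ 2 * (n (q + (0, - (l * σ k))) * Θ q - n q * Θ (q - (0, - (l * σ k))))))
    + 1 / l * (n (q + (0, l * c)) * Ψ q - n q * Ψ (q - (0, l * c)))
    + 1 / l ^ 2 * (n (q + (l ^ 2, 0)) * Θ q - n q * Θ (q - (l ^ 2, 0))) with hZ
  have zZ : ZI Z := by
    refine ((ZI.sum _ fun k => ?_).add ?_).add ?_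
    · exact ((ZI.tr hn hM iΘ _).mul _).add ((ZI.tr hn hM iΘ _).mul _)
    · exact (ZI.tr hn hM iΨ _).mul _
    · exact (ZI.tr hn hM iΘ _).mul _
  have iY : Integrable (Y l) := idom.mono' (mY l) (ae_of_all _ (bY l hl hl1.2))
  have : ∫ q, Y l q = ∫ q, (Y l q + Z q) := by rw [integral_add iY zZ.1, zZ.2, add_zero]
  rw [this]
  refine integral_nonneg fun q => ?_
  show 0 ≤ Y l q + Z q
  obtain ⟨s, y⟩ := q
  have eq1 : Y l (s, y) + Z (s, y) = Θ (s, y) / l ^ 2 * ((∑ k, (n (s, y + l * σ k) + n (s, y - l * σ k)))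
        + n (s + l ^ 2, y) + l ^ 2 * H (s, y) - (2 * (Fintype.card κ : ℝ) + 1) * n (s, y))
        + Ψ (s, y) * (1 / l * (n (s, y + l * c) - n (s, y))) + l * (M' * (Θ (s, y) + Ψ (s, y))) := by
    simp only [hY, hZ, Bl, Prod.mk_add_mk, Prod.mk_sub_mk, add_zero, sub_zero, sub_neg_eq_add, ← sub_eq_add_neg]
    have card : (Fintype.card κ : ℝ) = ∑ _k : κ, (1 : ℝ) := by simp
    rw [card]
    have e2 : ∀ a b : κ → ℝ, (∑ k, a k) = (∑ k, b k) - (∑ k, (b k - a k)) := fun a b => by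
      rw [Finset.sum_sub_distrib]; ring
    have s1 : n (s, y) * (∑ k, (Θ (s, y - l * σ k) + Θ (s, y + l * σ k) - 2 * Θ (s, y)) / l ^ 2)
      + (∑ k, (1 / l ^ 2 * (n (s, y + l * σ k) * Θ (s, y) - n (s, y) * Θ (s, y - l * σ k))
        + 1 / l ^ 2 * (n (s, y - l * σ k) * Θ (s, y) - n (s, y) * Θ (s, y + l * σ k))))
      = Θ (s, y) / l ^ 2 * ((∑ k, (n (s, y + l * σ k) + n (s, y - l * σ k))) - (2 * (∑ _k : κ, (1 : ℝ))) * n (s, y)) := by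
      rw [Finset.mul_sum, ← Finset.sum_add_distrib, Finset.mul_sum, Finset.sum_mul, ← Finset.sum_sub_distrib, Finset.mul_sum]
      refine Finset.sum_congr rfl fun k _ => ?_
      field_simp
      ring
    have s2 : l ^ 2 ≠ 0 := by positivity
    have s3 : H (s, y) * Θ (s, y) = Θ (s, y) / l ^ 2 * (l ^ 2 * H (s, y)) := by field_simp
    rw [s3]
    linear_combination s1
  by_cases h0 : Θ (s, y) = 0
  · rw [eq1, T.hΨ, h0]; simp
  · obtain ⟨hs, hy⟩ := T.pos _ h0
    simp only at hs hy
    have := ineq s y l hs hy hl hl2.2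
    have eq2 : Y l (s, y) + Z (s, y) = Θ (s, y) / l ^ 2 * ((∑ k, (n (s, y + l * σ k) + n (s, y - l * σ k)))
        + l / y * n (s, y + l * c) + n (s + l ^ 2, y) + l ^ 2 * H (s, y) + l ^ 3 * (1 + 1 / y) * M'
        - (2 * (Fintype.card κ : ℝ) + l / y + 1) * n (s, y)) := by
      rw [eq1, T.hΨ]
      field_simp
      ring
    rw [eq2]
    exact mul_nonneg (div_nonneg (T.nn _) (by positivity)) (by linarith)

end

section

structure CB (y1 B : ℝ) (b b' b'' : ℝ → ℝ) : Prop where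
  d1 : ∀ y, HasDerivAt b (b' y) y
  d2 : ∀ y, HasDerivAt b' (b'' y) y
  c2 : Continuous b''
  z : ∀ y, y ≤ y1 → b y = 0 ∧ b' y = 0 ∧ b'' y = 0
  zB : ∀ y, B + 1 ≤ y → b y = 0 ∧ b' y = 0 ∧ b'' y = 0
  mid : ∀ y, 2 * y1 ≤ y → y ≤ B → b y = 1 ∧ b' y = 0 ∧ b'' y = 0
  pos : ∀ y, y ≤ B → 0 ≤ b' y
  nn : ∀ y, 0 ≤ b y
  le1 : ∀ y, b y ≤ 1

structure CA (T C0 : ℝ) (a a' : ℝ → ℝ) : Prop where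
  d1 : ∀ y, HasDerivAt a (a' y) y
  c1 : Continuous a'
  z1 : ∀ s, s ≤ 1 → a s = 0 ∧ a' s = 0
  z2 : ∀ s, 2 * T ≤ s → a s = 0 ∧ a' s = 0
  mid : ∀ s, 2 ≤ s → s ≤ T → a' s = 0
  pos : ∀ s, s ≤ T → 0 ≤ a' s
  bd : ∀ s, T ≤ s → |a' s| ≤ C0 / T
  nn : ∀ s, 0 ≤ a s
  le1 : ∀ s, a s ≤ 1
  a1 : a 1 = 0
  a2 : a 2 = 1

lemma const_d {f : ℝ → ℝ} {f' y k : ℝ} {S : Set ℝ} (h : HasDerivAt f f' y) (hk : ∀ z ∈ S, f z = k)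
    (hu : UniqueDiffWithinAt ℝ S y) (hy : y ∈ S) : f' = 0 := by
  have h1 := h.hasDerivWithinAt (s := S)
  have h2 : HasDerivWithinAt f 0 S y := (hasDerivWithinAt_const y S k).congr (fun z hz => hk z hz) (hk y hy)
  rw [← h1.derivWithin hu, h2.derivWithin hu]

lemma const_d2 {f f' f'' : ℝ → ℝ} {k : ℝ} {S : Set ℝ} (h1 : ∀ y, HasDerivAt f (f' y) y)
    (h2 : ∀ y, HasDerivAt f' (f'' y) y) (hk : ∀ z ∈ S, f z = k)
    (hu : UniqueDiffOn ℝ S) : ∀ y ∈ S, f y = k ∧ f' y = 0 ∧ f'' y = 0 := by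
  have a1 : ∀ y ∈ S, f' y = 0 := fun y hy => const_d (h1 y) hk (hu y hy) hy
  exact fun y hy => ⟨hk y hy, a1 y hy, const_d (h2 y) a1 (hu y hy) hy⟩

lemma mono_d {f : ℝ → ℝ} {f' y : ℝ} {S : Set ℝ} (h : HasDerivAt f f' y) (hm : MonotoneOn f S)
    (hu : UniqueDiffWithinAt ℝ S y) : 0 ≤ f' := by
  rw [← (h.hasDerivWithinAt (s := S)).derivWithin hu]
  exact hm.derivWithin_nonneg

lemma exists_CB {y1 B : ℝ} (h1 : 0 < y1) (hB : 2 * y1 < B) : ∃ b b' b'', CB y1 B b b' b'' := by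
  set b : ℝ → ℝ := fun y => smoothTransition ((y - y1) / y1) * smoothTransition (B + 1 - y) with hb
  have sb : ContDiff ℝ (⊤ : ℕ∞) b :=
    (smoothTransition.contDiff.comp (by fun_prop)).mul (smoothTransition.contDiff.comp (by fun_prop))
  have s1 : ContDiff ℝ (⊤ : ℕ∞) (deriv b) := by
    have := (contDiff_infty_iff_deriv (f := b)).1 sb
    exact this.2
  have s2 : ContDiff ℝ (⊤ : ℕ∞) (deriv (deriv b)) := (contDiff_infty_iff_deriv.1 s1).2
  have d1 : ∀ y, HasDerivAt b (deriv b y) y := fun y => (sb.differentiable (by simp) y).hasDerivAt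
  have d2 : ∀ y, HasDerivAt (deriv b) (deriv (deriv b) y) y := fun y => (s1.differentiable (by simp) y).hasDerivAt
  have one : ∀ y, y ≤ B → b y = smoothTransition ((y - y1) / y1) := fun y hy => by
    simp only [hb]
    rw [smoothTransition.one_of_one_le (x := B + 1 - y) (by linarith), mul_one]
  refine ⟨b, deriv b, deriv (deriv b), d1, d2, s2.continuous, ?_, ?_, ?_, ?_, ?_, ?_⟩
  · intro y hy
    refine const_d2 d1 d2 (S := Set.Iic y1) (fun z hz => ?_) (uniqueDiffOn_Iic _) y hy
    simp only [hb]
    rw [smoothTransition.zero_of_nonpos, zero_mul]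
    exact div_nonpos_of_nonpos_of_nonneg (by linarith [Set.mem_Iic.1 hz]) h1.le
  · intro y hy
    refine const_d2 d1 d2 (S := Set.Ici (B + 1)) (fun z hz => ?_) (uniqueDiffOn_Ici _) y hy
    simp only [hb]
    rw [smoothTransition.zero_of_nonpos (x := B + 1 - z), mul_zero]
    linarith [Set.mem_Ici.1 hz]
  · intro y hy hy2
    refine const_d2 d1 d2 (S := Set.Icc (2 * y1) B) (fun z hz => ?_) (uniqueDiffOn_Icc hB) y ⟨hy, hy2⟩
    rw [one z hz.2, smoothTransition.one_of_one_le]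
    rw [le_div_iff₀ h1]; linarith [hz.1]
  · intro y hy
    refine mono_d (d1 y) (S := Set.Iic B) ?_ (uniqueDiffOn_Iic B y hy)
    intro u hu v hv huv
    rw [one u hu, one v hv]
    exact smoothTransition.monotone (by gcongr)
  · exact fun y => mul_nonneg (smoothTransition.nonneg _) (smoothTransition.nonneg _)
  · exact fun y => mul_le_one₀ (smoothTransition.le_one _) (smoothTransition.nonneg _) (smoothTransition.le_one _)

lemma exists_CA : ∃ C0, 0 ≤ C0 ∧ ∀ T : ℝ, 2 < T → ∃ a a', CA T C0 a a' := by
  have s0 : ContDiff ℝ (⊤ : ℕ∞) smoothTransition := smoothTransition.contDiff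
  have s1 : Continuous (deriv smoothTransition) := (contDiff_infty_iff_deriv.1 s0).2.continuous
  have d0 : ∀ y, HasDerivAt smoothTransition (deriv smoothTransition y) y :=
    fun y => (s0.differentiable (by simp) y).hasDerivAt
  obtain ⟨C0, hC0⟩ := isCompact_Icc.exists_bound_of_continuousOn (s := Set.Icc (0 : ℝ) 1) s1.continuousOn
  have hC : 0 ≤ C0 := (norm_nonneg _).trans (hC0 0 (by simp))
  have bd : ∀ x, 0 ≤ x → |deriv smoothTransition x| ≤ C0 := fun x hx => by
    rcases le_total x 1 with h | h
    · exact hC0 x ⟨hx, h⟩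
    · rw [const_d (d0 x) (S := Set.Ici 1) (k := 1) (fun z hz => smoothTransition.one_of_one_le hz)
        (uniqueDiffOn_Ici _ x h) h]
      simpa using hC
  refine ⟨C0, hC, fun T hT => ?_⟩
  have T0 : 0 < T := by linarith
  set a : ℝ → ℝ := fun s => smoothTransition (s - 1) * (1 - smoothTransition ((s - T) / T)) with ha
  have sa : ContDiff ℝ (⊤ : ℕ∞) a :=
    (smoothTransition.contDiff.comp (by fun_prop)).mul
      (contDiff_const.sub (smoothTransition.contDiff.comp (by fun_prop)))
  have d1 : ∀ y, HasDerivAt a (deriv a y) y := fun y => (sa.differentiable (by simp) y).hasDerivAt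
  have lo : ∀ s, s ≤ T → a s = smoothTransition (s - 1) := fun s hs => by
    simp only [ha]
    rw [smoothTransition.zero_of_nonpos (x := (s - T) / T), sub_zero, mul_one]
    exact div_nonpos_of_nonpos_of_nonneg (by linarith) T0.le
  have hi : ∀ s, 2 ≤ s → a s = 1 - smoothTransition ((s - T) / T) := fun s hs => by
    simp only [ha]
    rw [smoothTransition.one_of_one_le (x := s - 1) (by linarith), one_mul]
  refine ⟨a, deriv a, d1, (contDiff_infty_iff_deriv.1 sa).2.continuous, ?_, ?_, ?_, ?_, ?_, ?_, ?_, ?_, ?_⟩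
  · intro s hs
    have z : ∀ s ∈ Set.Iic (1 : ℝ), a s = 0 := fun s hs => by
      rw [lo s (by linarith [Set.mem_Iic.1 hs]), smoothTransition.zero_of_nonpos]
      linarith [Set.mem_Iic.1 hs]
    exact ⟨z s hs, const_d (d1 s) z (uniqueDiffOn_Iic _ s hs) hs⟩
  · intro s hs
    have z : ∀ s ∈ Set.Ici (2 * T), a s = 0 := fun s hs => by
      have := Set.mem_Ici.1 hs
      rw [hi s (by linarith), smoothTransition.one_of_one_le, sub_self]
      rw [le_div_iff₀ T0]; linarith
    exact ⟨z s hs, const_d (d1 s) z (uniqueDiffOn_Ici _ s hs) hs⟩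
  · intro s hs hs2
    refine const_d (d1 s) (k := 1) (S := Set.Icc 2 T) (fun z hz => ?_) (uniqueDiffOn_Icc hT s ⟨hs, hs2⟩) ⟨hs, hs2⟩
    rw [lo z hz.2, smoothTransition.one_of_one_le]
    linarith [hz.1]
  · intro s hs
    refine mono_d (d1 s) (S := Set.Iic T) ?_ (uniqueDiffOn_Iic T s hs)
    intro u hu v hv huv
    rw [lo u hu, lo v hv]
    exact smoothTransition.monotone (by gcongr)
  · intro s hs
    have h2 : HasDerivAt (fun s => 1 - smoothTransition ((s - T) / T)) (-(deriv smoothTransition ((s - T) / T) * (1 / T))) s := by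
      have := (d0 ((s - T) / T)).comp s (((hasDerivAt_id s).sub_const T).div_const T)
      exact this.const_sub 1
    have h3 : deriv a s = -(deriv smoothTransition ((s - T) / T) * (1 / T)) := by
      rw [← h2.deriv]
      apply Filter.EventuallyEq.deriv_eq
      filter_upwards [lt_mem_nhds (by linarith : (2 : ℝ) < s)] with z hz using hi z hz.le
    rw [h3, abs_neg, abs_mul, abs_of_pos (by positivity : (0 : ℝ) < 1 / T), mul_one_div]
    gcongr
    exact bd _ (div_nonneg (by linarith) T0.le)
  · exact fun y => mul_nonneg (smoothTransition.nonneg _) (by linarith [smoothTransition.le_one ((y - T) / T)])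
  · exact fun y => mul_le_one₀ (smoothTransition.le_one _) (by linarith [smoothTransition.le_one ((y - T) / T)])
      (by linarith [smoothTransition.nonneg ((y - T) / T)])
  · rw [lo 1 (by linarith)]; simp
  · rw [lo 2 (by linarith)]; norm_num

end

section

def EE (r g : ℝ) (q : ℝ × ℝ) : ℝ := exp (r * log q.2 - (r + 1) / 2 * log q.1 - q.2 ^ 2 / (4 * g * q.1))
def e1 (r g : ℝ) (q : ℝ × ℝ) : ℝ := r / q.2 - q.2 / (2 * g * q.1)
def e2 (r g : ℝ) (q : ℝ × ℝ) : ℝ := - (r + 1) / (2 * q.1) + q.2 ^ 2 / (4 * g * q.1 ^ 2)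

lemma EE_pos (r g : ℝ) (q : ℝ × ℝ) : 0 < EE r g q := exp_pos _

lemma EE_dy (r : ℝ) {g : ℝ} (hg : 0 < g) (s : ℝ) {y : ℝ} (hy : 0 < y) :
    HasDerivAt (fun y => EE r g (s, y)) (EE r g (s, y) * e1 r g (s, y)) y := by
  have h := ((((hasDerivAt_log hy.ne').const_mul r).sub_const ((r + 1) / 2 * log s)).sub
    ((hasDerivAt_pow 2 y).div_const (4 * g * s))).exp
  refine h.congr_deriv ?_
  simp only [EE, e1]
  congr 1
  rcases eq_or_ne s 0 with rfl | hs
  · simp; field_simp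
  · field_simp; push_cast; ring

lemma EE_ds (r : ℝ) {g : ℝ} (hg : 0 < g) {s : ℝ} (hs : 0 < s) (y : ℝ) :
    HasDerivAt (fun s => EE r g (s, y)) (EE r g (s, y) * e2 r g (s, y)) s := by
  have h := ((((hasDerivAt_log hs.ne').const_mul ((r + 1) / 2)).const_sub (r * log y)).sub
    ((((hasDerivAt_id s).const_mul (4 * g)).fun_inv (by simp; exact ⟨hg.ne', hs.ne'⟩)).const_mul (y ^ 2))).exp
  refine h.congr_deriv ?_
  simp only [EE, e2]
  congr 1
  simp only [id]
  field_simp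
  ring

lemma e1_dy (r : ℝ) {g : ℝ} (hg : 0 < g) (s : ℝ) {y : ℝ} (hy : 0 < y) :
    HasDerivAt (fun y => e1 r g (s, y)) (- r / y ^ 2 - 1 / (2 * g * s)) y := by
  have h := (((hasDerivAt_inv hy.ne').const_mul r)).sub ((hasDerivAt_id y).div_const (2 * g * s))
  refine h.congr_deriv ?_
  ring

lemma EE_cont (r : ℝ) {g : ℝ} (hg : 0 < g) {q : ℝ × ℝ} (hs : 0 < q.1) (hy : 0 < q.2) : ContinuousAt (EE r g) q := by
  unfold EE
  have h1 := hs.ne'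
  have h2 := hy.ne'
  have h3 : 4 * g * q.1 ≠ 0 := by positivity
  fun_prop (disch := assumption)

lemma e1_cont (r : ℝ) {g : ℝ} (hg : 0 < g) {q : ℝ × ℝ} (hs : 0 < q.1) (hy : 0 < q.2) : ContinuousAt (e1 r g) q := by
  unfold e1
  have h2 := hy.ne'
  have h3 : 2 * g * q.1 ≠ 0 := by positivity
  fun_prop (disch := assumption)

lemma e2_cont (r : ℝ) {g : ℝ} (hg : 0 < g) {q : ℝ × ℝ} (hs : 0 < q.1) (_hy : 0 < q.2) : ContinuousAt (e2 r g) q := by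
  unfold e2
  have h2 : 2 * q.1 ≠ 0 := by positivity
  have h3 : 4 * g * q.1 ^ 2 ≠ 0 := by positivity
  fun_prop (disch := assumption)

lemma hd_cut {F F' : ℝ → ℝ} {y1 : ℝ} (h1 : 0 < y1) (h : ∀ y, 0 < y → HasDerivAt F (F' y) y)
    (z : ∀ y, y ≤ y1 → F y = 0) (z' : ∀ y, y ≤ y1 → F' y = 0) (y : ℝ) : HasDerivAt F (F' y) y := by
  rcases lt_or_ge 0 y with hy | hy
  · exact h y hy
  · rw [z' y (by linarith)]
    refine (hasDerivAt_const y (0 : ℝ)).congr_of_eventuallyEq ?_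
    filter_upwards [gt_mem_nhds (by linarith : y < y1)] with w hw using z w hw.le

lemma cont_cut {G : ℝ × ℝ → ℝ} {y1 : ℝ} (h1 : 0 < y1) (h : ∀ q : ℝ × ℝ, 0 < q.1 → 0 < q.2 → ContinuousAt G q)
    (z : ∀ q : ℝ × ℝ, q.2 ≤ y1 → G q = 0) (z' : ∀ q : ℝ × ℝ, q.1 ≤ 1 → G q = 0) : Continuous G := by
  rw [continuous_iff_continuousAt]
  intro q
  by_cases hs : 0 < q.1
  · by_cases hy : 0 < q.2
    · exact h q hs hy
    · refine (continuousAt_const (y := (0 : ℝ))).congr ?_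
      have : ∀ᶠ w : ℝ × ℝ in nhds q, w.2 < y1 := continuous_snd.continuousAt.eventually_lt continuousAt_const (by linarith)
      filter_upwards [this] with w hw using (z w hw.le).symm
  · refine (continuousAt_const (y := (0 : ℝ))).congr ?_
    have : ∀ᶠ w : ℝ × ℝ in nhds q, w.1 < 1 := continuous_fst.continuousAt.eventually_lt continuousAt_const (by linarith)
    filter_upwards [this] with w hw using (z' w hw.le).symm

def Th (r g : ℝ) (a b : ℝ → ℝ) (q : ℝ × ℝ) : ℝ := a q.1 * (b q.2 * EE r g q)
def Thy (r g : ℝ) (a b b' : ℝ → ℝ) (q : ℝ × ℝ) : ℝ := a q.1 * (b' q.2 * EE r g q + b q.2 * (EE r g q * e1 r g q))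
def Thyy (r g : ℝ) (a b b' b'' : ℝ → ℝ) (q : ℝ × ℝ) : ℝ :=
  a q.1 * (b'' q.2 * EE r g q + 2 * b' q.2 * (EE r g q * e1 r g q)
    + b q.2 * (EE r g q * (e1 r g q ^ 2 - r / q.2 ^ 2 - 1 / (2 * g * q.1))))
def Ps (r g : ℝ) (a b : ℝ → ℝ) (q : ℝ × ℝ) : ℝ := a q.1 * (b q.2 * EE r g q) / q.2
def Psy (r g : ℝ) (a b b' : ℝ → ℝ) (q : ℝ × ℝ) : ℝ :=
  a q.1 * (b' q.2 * EE r g q + b q.2 * (EE r g q * e1 r g q)) / q.2 - a q.1 * (b q.2 * EE r g q) / q.2 ^ 2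
def Ths (r g : ℝ) (a a' b : ℝ → ℝ) (q : ℝ × ℝ) : ℝ :=
  a' q.1 * (b q.2 * EE r g q) + a q.1 * (b q.2 * (EE r g q * e2 r g q))

lemma tf (r : ℝ) {g : ℝ} (hg : 0 < g) {y1 B T C0 : ℝ} (h1 : 0 < y1) (hT : 2 < T) (hB0 : 0 < B) {a a' b b' b'' : ℝ → ℝ}
    (hb : CB y1 B b b' b'') (ha : CA T C0 a a') :
    TF (Th r g a b) (Thy r g a b b') (Thyy r g a b b' b'') (Ps r g a b) (Psy r g a b b') (Ths r g a a' b)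
      (2 * T + (B + 1)) := by
  have cb : Continuous b := continuous_iff_continuousAt.2 fun y => (hb.d1 y).continuousAt
  have cb' : Continuous b' := continuous_iff_continuousAt.2 fun y => (hb.d2 y).continuousAt
  have cb'' := hb.c2
  have ca : Continuous a := continuous_iff_continuousAt.2 fun y => (ha.d1 y).continuousAt
  have ca' := ha.c1
  have out : ∀ q : ℝ × ℝ, 2 * T + (B + 1) < ‖q‖ → (a q.1 = 0 ∧ a' q.1 = 0) ∨ (b q.2 = 0 ∧ b' q.2 = 0 ∧ b'' q.2 = 0) := by
    intro q hq
    rw [Prod.norm_def, lt_max_iff] at hq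
    rcases hq with h | h
    · left
      rw [Real.norm_eq_abs, lt_abs] at h
      rcases h with h | h
      · exact ha.z2 _ (by linarith)
      · exact ha.z1 _ (by linarith)
    · right
      rw [Real.norm_eq_abs, lt_abs] at h
      rcases h with h | h
      · exact hb.zB _ (by linarith)
      · exact hb.z _ (by linarith)
  have cc : ∀ q : ℝ × ℝ, 0 < q.1 → 0 < q.2 → ContinuousAt (EE r g) q ∧ ContinuousAt (e1 r g) q ∧ ContinuousAt (e2 r g) q :=
    fun q hs hy => ⟨EE_cont r hg hs hy, e1_cont r hg hs hy, e2_cont r hg hs hy⟩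
  have dbE : ∀ s y, 0 < y → HasDerivAt (fun y => b y * EE r g (s, y))
      (b' y * EE r g (s, y) + b y * (EE r g (s, y) * e1 r g (s, y))) y := fun s y hy =>
    (hb.d1 y).mul (EE_dy r hg s hy)
  constructor
  · intro s
    exact hd_cut h1 (fun y hy => (dbE s y hy).const_mul (a s)) (fun y hy => by simp [Th, (hb.z y hy).1])
      (fun y hy => by simp [Thy, hb.z y hy])
  · intro s
    refine hd_cut h1 (fun y hy => ?_) (fun y hy => by simp [Thy, hb.z y hy])
      (fun y hy => by simp [Thyy, hb.z y hy])
    have h := (((hb.d2 y).mul (EE_dy r hg s hy)).add ((hb.d1 y).mul ((EE_dy r hg s hy).mul (e1_dy r hg s hy)))).const_mul (a s)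
    refine h.congr_deriv ?_
    simp only [Thyy, Pi.mul_apply]
    ring
  · intro s
    refine hd_cut h1 (fun y hy => ?_) (fun y hy => by simp [Ps, (hb.z y hy).1])
      (fun y hy => by simp [Psy, hb.z y hy])
    have h := ((dbE s y hy).const_mul (a s)).div (hasDerivAt_id y) hy.ne'
    refine h.congr_deriv ?_
    simp only [Psy, id]
    field_simp
  · intro y
    refine hd_cut (y1 := 1) one_pos (fun s hs => ?_) (fun s hs => by simp [Th, (ha.z1 s hs).1])
      (fun s hs => by simp [Ths, ha.z1 s hs])
    exact (ha.d1 s).mul ((EE_ds r hg hs y).const_mul (b y))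
  · intro q; rfl
  · refine cont_cut h1 (fun q hs hy => ?_) (fun q hy => by simp [Th, hb.z q.2 hy]) (fun q hy => by simp [Th, ha.z1 q.1 hy])
    obtain ⟨k1, k2, k3⟩ := cc q hs hy
    unfold Th; fun_prop
  · refine cont_cut h1 (fun q hs hy => ?_) (fun q hy => by simp [Ps, hb.z q.2 hy]) (fun q hy => by simp [Ps, ha.z1 q.1 hy])
    obtain ⟨k1, k2, k3⟩ := cc q hs hy
    have h2 := hy.ne'
    unfold Ps; fun_prop (disch := assumption)
  · refine cont_cut h1 (fun q hs hy => ?_) (fun q hy => by simp [Thyy, hb.z q.2 hy]) (fun q hy => by simp [Thyy, ha.z1 q.1 hy])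
    obtain ⟨k1, k2, k3⟩ := cc q hs hy
    have h2 : q.2 ^ 2 ≠ 0 := by positivity
    have h3 : 2 * g * q.1 ≠ 0 := by positivity
    unfold Thyy; fun_prop (disch := assumption)
  · refine cont_cut h1 (fun q hs hy => ?_) (fun q hy => by simp [Psy, hb.z q.2 hy]) (fun q hy => by simp [Psy, ha.z1 q.1 hy])
    obtain ⟨k1, k2, k3⟩ := cc q hs hy
    have h2 : q.2 ^ 2 ≠ 0 := by positivity
    have h3 := hy.ne'
    unfold Psy; fun_prop (disch := assumption)
  · refine cont_cut h1 (fun q hs hy => ?_) (fun q hy => by simp [Ths, hb.z q.2 hy]) (fun q hy => by simp [Ths, ha.z1 q.1 hy])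
    obtain ⟨k1, k2, k3⟩ := cc q hs hy
    unfold Ths; fun_prop
  · intro q hq; rcases out q hq with h | h <;> simp [Th, h]
  · intro q hq; rcases out q hq with h | h <;> simp [Ps, h]
  · intro q hq; rcases out q hq with h | h <;> simp [Thyy, h]
  · intro q hq; rcases out q hq with h | h <;> simp [Psy, h]
  · intro q hq; rcases out q hq with h | h <;> simp [Ths, h]
  · intro q; exact mul_nonneg (ha.nn _) (mul_nonneg (hb.nn _) (EE_pos _ _ _).le)
  · intro q hq
    constructor
    · by_contra h
      exact hq (by simp [Th, ha.z1 q.1 (by linarith)])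
    · by_contra h
      exact hq (by simp [Th, hb.z q.2 (by linarith)])

/-- the leftover term -/
def Gt (r g : ℝ) (b' b'' : ℝ → ℝ) (q : ℝ × ℝ) : ℝ :=
  g * (b'' q.2 * EE r g q + b' q.2 * (EE r g q * e1 r g q)) - b' q.2 * EE r g q * q.2 / (2 * q.1)

lemma adj_id (r : ℝ) {g : ℝ} (hg : 0 < g) (a a' b b' b'' : ℝ → ℝ) {q : ℝ × ℝ} (hs : 0 < q.1) (hy : 0 < q.2) :
    g * Thyy r g a b b' b'' q - (g * r) * Psy r g a b b' q - Ths r g a a' b q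
      = - a' q.1 * (b q.2 * EE r g q) + a q.1 * Gt r g b' b'' q := by
  simp only [Thyy, Psy, Ths, Gt, e1, e2]
  field_simp
  ring

end

section

lemma adj_id' (r : ℝ) {g : ℝ} (hg : 0 < g) {y1 B T C0 : ℝ} (h1 : 0 < y1) {a a' b b' b'' : ℝ → ℝ}
    (hb : CB y1 B b b' b'') (ha : CA T C0 a a') (q : ℝ × ℝ) :
    g * Thyy r g a b b' b'' q - (g * r) * Psy r g a b b' q - Ths r g a a' b q
      = - a' q.1 * (b q.2 * EE r g q) + a q.1 * Gt r g b' b'' q := by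
  by_cases hs : 0 < q.1
  · by_cases hy : 0 < q.2
    · exact adj_id r hg a a' b b' b'' hs hy
    · simp [Thyy, Psy, Ths, Gt, hb.z q.2 (by linarith)]
  · simp [Thyy, Psy, Ths, Gt, ha.z1 q.1 (by linarith)]

lemma Gt_int (r : ℝ) {g : ℝ} (hg : 0 < g) {y1 B : ℝ} (h1 : 0 < y1) (hB : 2 * y1 < B) {b b' b'' : ℝ → ℝ}
    (hb : CB y1 B b b' b'') {s : ℝ} (hs : 0 < s) : ∫ y in y1..(2 * y1), Gt r g b' b'' (s, y) ≤ 0 := by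
  have cb' : Continuous b' := continuous_iff_continuousAt.2 fun y => (hb.d2 y).continuousAt
  have cb'' := hb.c2
  have hle : y1 ≤ 2 * y1 := by linarith
  have cE : ∀ y ∈ Set.Icc y1 (2 * y1), ContinuousAt (fun y => EE r g (s, y)) y := fun y hy =>
    (EE_dy r hg s (by linarith [hy.1])).continuousAt
  have ce : ∀ y ∈ Set.Icc y1 (2 * y1), ContinuousAt (fun y => e1 r g (s, y)) y := fun y hy =>
    (e1_dy r hg s (by linarith [hy.1])).continuousAt
  set D : ℝ → ℝ := fun y => g * (b'' y * EE r g (s, y) + b' y * (EE r g (s, y) * e1 r g (s, y))) with hD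
  have cD : ContinuousOn D (Set.Icc y1 (2 * y1)) := fun y hy => by
    have k1 := cE y hy
    have k2 := ce y hy
    refine ContinuousAt.continuousWithinAt ?_
    fun_prop
  have cG : ContinuousOn (fun y => Gt r g b' b'' (s, y)) (Set.Icc y1 (2 * y1)) := fun y hy => by
    have k1 := cE y hy
    have k2 := ce y hy
    refine ContinuousAt.continuousWithinAt ?_
    have h4 : 2 * s ≠ 0 := by positivity
    simp only [Gt]
    fun_prop (disch := assumption)
  have iD : IntervalIntegrable D volume y1 (2 * y1) := (cD.mono (by rw [Set.uIcc_of_le hle])).intervalIntegrable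
  have iG : IntervalIntegrable (fun y => Gt r g b' b'' (s, y)) volume y1 (2 * y1) :=
    (cG.mono (by rw [Set.uIcc_of_le hle])).intervalIntegrable
  calc ∫ y in y1..(2 * y1), Gt r g b' b'' (s, y) ≤ ∫ y in y1..(2 * y1), D y := by
        refine intervalIntegral.integral_mono_on hle iG iD fun y hy => ?_
        have := hb.pos y (by linarith [hy.2])
        have h3 : 0 ≤ b' y * EE r g (s, y) * y / (2 * s) := by
          have := (EE_pos r g (s, y)).le
          have : 0 ≤ y := by linarith [hy.1]
          positivity
        simp only [Gt, hD]
        linarith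
    _ = g * (b' (2 * y1) * EE r g (s, 2 * y1)) - g * (b' y1 * EE r g (s, y1)) := by
        refine intervalIntegral.integral_eq_sub_of_hasDerivAt (f := fun y => g * (b' y * EE r g (s, y))) (fun y hy => ?_) iD
        rw [Set.uIcc_of_le hle] at hy
        exact ((hb.d2 y).mul (EE_dy r hg s (by linarith [hy.1]))).const_mul g
    _ = 0 := by
        rw [(hb.mid (2 * y1) le_rfl hB.le).2.1, (hb.z y1 le_rfl).2.1]; simp

lemma leftover (r : ℝ) {g : ℝ} (hg : 0 < g) {y1 B T C0 : ℝ} (h1 : 0 < y1) (hB : 2 * y1 < B) {a a' b b' b'' : ℝ → ℝ}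
    (hb : CB y1 B b b' b'') (ha : CA T C0 a a') {n : ℝ × ℝ → ℝ} (hn : ∀ q, 0 ≤ n q)
    (hc : ∀ s y, 0 < s → 0 ≤ y → y ≤ 2 * y1 → n (s, y) = n (s, 0)) (hz : ∀ s y, B ≤ y → n (s, y) = 0)
    (hi : Integrable fun q => n q * (a q.1 * Gt r g b' b'' q)) :
    ∫ q, n q * (a q.1 * Gt r g b' b'' q) ≤ 0 := by
  rw [Measure.volume_eq_prod] at hi ⊢
  rw [integral_prod _ hi]
  refine integral_nonpos fun s => ?_
  show ∫ y, n (s, y) * (a s * Gt r g b' b'' (s, y)) ≤ 0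
  by_cases hs : 0 < s
  · have e : (fun y => n (s, y) * (a s * Gt r g b' b'' (s, y))) =
        (Set.Ioc y1 (2 * y1)).indicator fun y => (n (s, 0) * a s) * Gt r g b' b'' (s, y) := by
      funext y
      by_cases hy : y ∈ Set.Ioc y1 (2 * y1)
      · rw [Set.indicator_of_mem hy, hc s y hs (by linarith [hy.1]) hy.2]; ring
      · rw [Set.indicator_of_notMem hy]
        by_cases h2 : y ≤ y1
        · simp [Gt, hb.z y h2]
        · have h3 : 2 * y1 < y := by
            by_contra h4
            exact hy ⟨not_le.1 h2, not_lt.1 h4⟩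
          by_cases h5 : y ≤ B
          · simp [Gt, hb.mid y h3.le h5]
          · rw [hz s y (by linarith), zero_mul]
    rw [e, integral_indicator measurableSet_Ioc, integral_const_mul, ← intervalIntegral.integral_of_le (by linarith)]
    exact mul_nonpos_of_nonneg_of_nonpos (mul_nonneg (hn _) (ha.nn _)) (Gt_int r hg h1 hB hb hs)
  · simp [ha.z1 s (by linarith)]

lemma pow_exp_le {k x : ℝ} (hk : 0 < k) (hx : 0 < x) : exp (-x) ≤ k ^ k * x ^ (-k) := by
  have h1 : x / k ≤ exp (x / k) := by linarith [add_one_le_exp (x / k)]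
  have h2 : (x / k) ^ k ≤ exp x := by
    calc (x / k) ^ k ≤ (exp (x / k)) ^ k := rpow_le_rpow (by positivity) h1 hk.le
      _ = exp x := by rw [← exp_mul]; congr 1; field_simp
  rw [div_rpow hx.le hk.le, div_le_iff₀ (by positivity)] at h2
  rw [exp_neg, rpow_neg hx.le, ← div_eq_mul_inv, le_div_iff₀ (by positivity), mul_comm, ← div_eq_mul_inv, div_le_iff₀ (exp_pos x)]
  linarith

/-- integrable majorant of the source term -/
lemma source_dom {r g θ : ℝ} (hg : 0 < g) (hθ : 0 < θ) (hr : θ < r + 1) :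
    ∃ J : ℝ × ℝ → ℝ, Integrable J ∧ (∀ q, 0 ≤ J q) ∧
      ∀ s y, 1 < s → 0 < y → s⁻¹ * y ^ (-θ) * EE r g (s, y) ≤ J (s, y) := by
  set k : ℝ := (r + 1) / 2 - θ / 4 with hk
  have k0 : 0 < k := by rw [hk]; linarith
  set K : ℝ := k ^ k * (4 * g) ^ k with hK
  set A1 : ℝ → ℝ := (Set.Ioi 1).indicator fun s => s ^ (-1 - (r + 1) / 2) with hA1
  set B1 : ℝ → ℝ := (Set.Ioc 0 1).indicator fun y => y ^ (r - θ) with hB1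
  set A2 : ℝ → ℝ := (Set.Ioi 1).indicator fun s => s ^ (-1 - θ / 4) with hA2
  set B2 : ℝ → ℝ := (Set.Ioi 1).indicator fun y => y ^ (-1 - θ / 2) with hB2
  have nA1 : ∀ s, 0 ≤ A1 s := fun s => Set.indicator_nonneg (fun s hs => rpow_nonneg (by linarith [Set.mem_Ioi.1 hs]) _) s
  have nA2 : ∀ s, 0 ≤ A2 s := fun s => Set.indicator_nonneg (fun s hs => rpow_nonneg (by linarith [Set.mem_Ioi.1 hs]) _) s
  have nB1 : ∀ s, 0 ≤ B1 s := fun s => Set.indicator_nonneg (fun s hs => rpow_nonneg (by linarith [hs.1]) _) s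
  have nB2 : ∀ s, 0 ≤ B2 s := fun s => Set.indicator_nonneg (fun s hs => rpow_nonneg (by linarith [Set.mem_Ioi.1 hs]) _) s
  have iA1 : Integrable A1 := (integrable_indicator_iff measurableSet_Ioi).2 (integrableOn_Ioi_rpow_of_lt (by linarith) one_pos)
  have iA2 : Integrable A2 := (integrable_indicator_iff measurableSet_Ioi).2 (integrableOn_Ioi_rpow_of_lt (by linarith) one_pos)
  have iB2 : Integrable B2 := (integrable_indicator_iff measurableSet_Ioi).2 (integrableOn_Ioi_rpow_of_lt (by linarith) one_pos)
  have iB1 : Integrable B1 := by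
    refine (integrable_indicator_iff measurableSet_Ioc).2 ?_
    have := intervalIntegral.intervalIntegrable_rpow' (a := 0) (b := 1) (r := r - θ) (by linarith)
    exact (intervalIntegrable_iff_integrableOn_Ioc_of_le zero_le_one).1 this
  refine ⟨fun q => A1 q.1 * B1 q.2 + K * (A2 q.1 * B2 q.2), ?_, ?_, ?_⟩
  · exact (iA1.mul_prod iB1).add ((iA2.mul_prod iB2).const_mul K)
  · intro q
    have := nA1 q.1; have := nA2 q.1; have := nB1 q.2; have := nB2 q.2
    positivity
  · intro s y hs hy
    have s0 : 0 < s := by linarith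
    have eE : EE r g (s, y) = y ^ r * s ^ (-((r + 1) / 2)) * exp (-(y ^ 2 / (4 * g * s))) := by
      unfold EE
      rw [rpow_def_of_pos hy, rpow_def_of_pos s0, ← exp_add, ← exp_add]
      congr 1; simp only; ring
    have eP : s⁻¹ * y ^ (-θ) * EE r g (s, y) = s ^ (-1 - (r + 1) / 2) * y ^ (r - θ) * exp (-(y ^ 2 / (4 * g * s))) := by
      rw [eE, sub_eq_add_neg (-1 : ℝ), rpow_add s0, rpow_neg_one, sub_eq_add_neg r, rpow_add hy]; ring
    rw [eP]
    have hsm : A1 s = s ^ (-1 - (r + 1) / 2) := Set.indicator_of_mem (Set.mem_Ioi.2 hs) _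
    have hsm2 : A2 s = s ^ (-1 - θ / 4) := Set.indicator_of_mem (Set.mem_Ioi.2 hs) _
    have pA := nA2 s; have pB := nB2 y; have pA1 := nA1 s; have pB1 := nB1 y
    rcases le_or_gt y 1 with h | h
    · have : B1 y = y ^ (r - θ) := Set.indicator_of_mem (s := Set.Ioc (0 : ℝ) 1) ⟨hy, h⟩ _
      simp only
      rw [hsm, this]
      have e1 : exp (-(y ^ 2 / (4 * g * s))) ≤ 1 := exp_le_one_iff.2 (neg_nonpos.2 (by positivity))
      have : 0 ≤ s ^ (-1 - (r + 1) / 2) * y ^ (r - θ) := by positivity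
      have : 0 ≤ K * (A2 s * B2 y) := by positivity
      nlinarith
    · have : B2 y = y ^ (-1 - θ / 2) := Set.indicator_of_mem (s := Set.Ioi (1 : ℝ)) h _
      simp only
      have e1 := pow_exp_le k0 (x := y ^ 2 / (4 * g * s)) (by positivity)
      have e3 : s ^ (-1 - (r + 1) / 2) * y ^ (r - θ) * (k ^ k * (y ^ 2 / (4 * g * s)) ^ (-k)) = K * (A2 s * B2 y) := by
        rw [hsm2, this, hK, div_rpow (by positivity) (by positivity), mul_rpow (by positivity) s0.le,
          rpow_neg (by positivity : (0 : ℝ) ≤ 4 * g), rpow_neg s0.le, ← rpow_natCast y 2, ← rpow_mul hy.le]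
        have a1 : s ^ (-1 - θ / 4) = s ^ (-1 - (r + 1) / 2) * s ^ k := by
          rw [← rpow_add s0]; congr 1; rw [hk]; ring
        have a2 : y ^ (-1 - θ / 2) = y ^ (r - θ) * y ^ (((2 : ℕ) : ℝ) * -k) := by
          rw [← rpow_add hy]; congr 1; rw [hk]; push_cast; ring
        rw [a1, a2]
        field_simp
      have : s ^ (-1 - (r + 1) / 2) * y ^ (r - θ) * exp (-(y ^ 2 / (4 * g * s))) ≤ K * (A2 s * B2 y) := by
        rw [← e3]
        exact mul_le_mul_of_nonneg_left e1 (by positivity)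
      have : 0 ≤ A1 s * B1 y := by positivity
      linarith

end

section

lemma EE_lower {r g Y : ℝ} (hg : 0 < g) (hr : 0 ≤ r) (hY : 0 < Y) {s y : ℝ} (h1 : 1 ≤ s) (h2 : s ≤ 2)
    (h3 : Y ≤ y) (h4 : y ≤ 2 * Y) : exp (r * log Y - (r + 1) / 2 * log 2 - Y ^ 2 / g) ≤ EE r g (s, y) := by
  unfold EE
  have s0 : 0 < s := by linarith
  refine exp_le_exp.2 (sub_le_sub (sub_le_sub ?_ ?_) ?_)
  · exact mul_le_mul_of_nonneg_left (log_le_log hY h3) hr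
  · exact mul_le_mul_of_nonneg_left (log_le_log s0 h2) (by linarith)
  · show y ^ 2 / (4 * g * s) ≤ _
    rw [div_le_div_iff₀ (by positivity) hg]
    have : y ^ 2 ≤ (2 * Y) ^ 2 := by gcongr; linarith
    calc y ^ 2 * g ≤ (2 * Y) ^ 2 * g := by gcongr
      _ = Y ^ 2 * (4 * g * 1) := by ring
      _ ≤ Y ^ 2 * (4 * g * s) := by gcongr

lemma EE_upper {r g T B : ℝ} (hg : 0 < g) (hr : 0 ≤ r) (hT : 0 < T) {s y : ℝ} (h1 : T ≤ s) (h3 : 0 < y) (h4 : y ≤ B) :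
    EE r g (s, y) ≤ exp (r * log B - (r + 1) / 2 * log T) := by
  unfold EE
  have s0 : 0 < s := by linarith
  refine exp_le_exp.2 ?_
  have a1 : r * log y ≤ r * log B := mul_le_mul_of_nonneg_left (log_le_log h3 h4) hr
  have a2 : (r + 1) / 2 * log T ≤ (r + 1) / 2 * log s := mul_le_mul_of_nonneg_left (log_le_log hT h1) (by linarith)
  have a3 : 0 ≤ y ^ 2 / (4 * g * s) := by positivity
  simp only
  linarith

lemma Kpure_T {κ : Type} [Fintype κ] {σ : κ → ℝ} {r g θ Y C0 T y1 B Cs L : ℝ} (hg : 0 < g) (hr : 0 ≤ r)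
    (hθ : 0 < θ) (hY : 0 < Y) (hσ : ∑ k, σ k ^ 2 = g) {J : ℝ × ℝ → ℝ} (hJ : Integrable J) (nJ : ∀ q, 0 ≤ J q)
    (dJ : ∀ s y, 1 < s → 0 < y → s⁻¹ * y ^ (-θ) * EE r g (s, y) ≤ J (s, y))
    {a a' b b' b'' : ℝ → ℝ} (h1 : 0 < y1) (h1Y : 2 * y1 ≤ Y) (hT : 2 < T) (hBY : 2 * Y ≤ B)
    (hb : CB y1 B b b' b'') (ha : CA T C0 a a') (hC0 : 0 ≤ C0)
    {n : ℝ × ℝ → ℝ} {M M' l0 : ℝ} (hn : Measurable n) (hn0 : ∀ q, 0 ≤ n q) (hM : ∀ q, n q ≤ M) (hl0 : 0 < l0)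
    (hc : ∀ s y, 0 < s → 0 ≤ y → y ≤ 2 * y1 → n (s, y) = n (s, 0)) (hz : ∀ s y, B ≤ y → n (s, y) = 0)
    (hCs : 0 ≤ Cs)
    (ineq : ∀ s y l, 0 < s → 0 < y → 0 < l → l ≤ l0 →
      (2 * (Fintype.card κ : ℝ) + l / y + 1) * n (s, y) ≤ (∑ k, (n (s, y + l * σ k) + n (s, y - l * σ k)))
        + l / y * n (s, y + l * (g * r)) + n (s + l ^ 2, y) + l ^ 2 * (Cs * (s⁻¹ * y ^ (-θ))) + l ^ 3 * (1 + 1 / y) * M')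
    (hL : 0 ≤ L) (hLn : ∀ s y, 1 ≤ s → s ≤ 2 → Y ≤ y → y ≤ 2 * Y → L ≤ n (s, y)) :
    L * (exp (r * log Y - (r + 1) / 2 * log 2 - Y ^ 2 / g) * Y) ≤
      Cs * (∫ q, J q) + M * C0 * B * exp (r * log B - (r + 1) / 2 * log T) := by
  have T0 : 0 < T := by linarith
  have B0 : 0 < B := by linarith
  have M0 : 0 ≤ M := (hn0 0).trans (hM 0)
  have nM : ∀ q, |n q| ≤ M := fun q => by rw [abs_of_nonneg (hn0 q)]; exact hM q
  have tF := tf r hg h1 hT B0 hb ha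
  set e0 := exp (r * log Y - (r + 1) / 2 * log 2 - Y ^ 2 / g) with he0
  set ET := exp (r * log B - (r + 1) / 2 * log T) with hET
  set H : ℝ × ℝ → ℝ := fun q => Cs * (q.1⁻¹ * q.2 ^ (-θ)) with hH
  have bHJ : ∀ q, 0 ≤ H q * Th r g a b q ∧ H q * Th r g a b q ≤ Cs * J q := by
    intro q
    by_cases h0 : Th r g a b q = 0
    · rw [h0, mul_zero]; exact ⟨le_rfl, mul_nonneg hCs (nJ q)⟩
    · have hs : 1 < q.1 := by
        by_contra h
        exact h0 (by simp [Th, ha.z1 q.1 (by linarith)])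
      have hy := (tF.pos q h0).2
      have hE := (EE_pos r g q).le
      have s0 : 0 < q.1 := by linarith
      have : Th r g a b q ≤ EE r g q := by
        have h5 : b q.2 * EE r g q ≤ EE r g q := mul_le_of_le_one_left hE (hb.le1 _)
        exact (mul_le_of_le_one_left (mul_nonneg (hb.nn _) hE) (ha.le1 _)).trans h5
      have hH0 : 0 ≤ H q := by simp only [hH]; positivity
      refine ⟨mul_nonneg hH0 (tF.nn q), ?_⟩
      calc H q * Th r g a b q ≤ H q * EE r g q := mul_le_mul_of_nonneg_left this hH0
        _ = Cs * (q.1⁻¹ * q.2 ^ (-θ) * EE r g q) := by simp only [hH]; ring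
        _ ≤ Cs * J q := mul_le_mul_of_nonneg_left (dJ q.1 q.2 hs hy) hCs
  have mH : Measurable H := by
    simp only [hH]; fun_prop
  have iH : Integrable fun q => H q * Th r g a b q := by
    refine (hJ.const_mul Cs).mono' (mH.mul tF.c0.measurable).aestronglyMeasurable (ae_of_all _ fun q => ?_)
    rw [Real.norm_eq_abs, abs_of_nonneg (bHJ q).1]
    exact (bHJ q).2
  have W := weak tF σ (g * r) (H := H) hn nM hl0 ineq iH
  rw [hσ] at W
  -- the three pieces
  have iΘ : ∀ {G : ℝ × ℝ → ℝ} {R : ℝ}, Continuous G → (∀ q, R < ‖q‖ → G q = 0) → Integrable fun q => n q * G q :=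
    fun {G R} cG zG => (cG.integrable_of_hasCompactSupport (cs_of_z zG)).bdd_mul (c := M) hn.aestronglyMeasurable
      (ae_of_all _ nM)
  have iadj : Integrable fun q => n q * (g * Thyy r g a b b' b'' q - (g * r) * Psy r g a b b' q - Ths r g a a' b q) := by
    have := ((iΘ tF.c2 tF.z2).const_mul g).sub ((iΘ tF.c3 tF.z3).const_mul (g * r)) |>.sub (iΘ tF.c4 tF.z4)
    refine this.congr (ae_of_all _ fun q => ?_)
    simp only [Pi.sub_apply]; ring
  have ca' : Continuous fun q : ℝ × ℝ => a' q.1 * (b q.2 * EE r g q) := by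
    have k1 := ha.c1
    have k2 : Continuous b := continuous_iff_continuousAt.2 fun y => (hb.d1 y).continuousAt
    refine cont_cut h1 (fun q hs hy => ?_) (fun q hy => by simp [hb.z q.2 hy]) (fun q hy => by simp [ha.z1 q.1 hy])
    have := EE_cont r hg hs hy
    fun_prop
  have ia' : Integrable fun q => n q * (a' q.1 * (b q.2 * EE r g q)) := by
    refine iΘ (R := 2 * T + (B + 1)) ca' fun q hq => ?_
    rw [Prod.norm_def, lt_max_iff] at hq
    rcases hq with h | h
    · rw [Real.norm_eq_abs, lt_abs] at h
      rcases h with h | h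
      · simp [ha.z2 q.1 (by linarith)]
      · simp [ha.z1 q.1 (by linarith)]
    · rw [Real.norm_eq_abs, lt_abs] at h
      rcases h with h | h
      · simp [hb.zB q.2 (by linarith)]
      · simp [hb.z q.2 (by linarith)]
  have eG : ∀ q, n q * (a q.1 * Gt r g b' b'' q) =
      n q * (g * Thyy r g a b b' b'' q - (g * r) * Psy r g a b b' q - Ths r g a a' b q) + n q * (a' q.1 * (b q.2 * EE r g q)) := by
    intro q
    rw [adj_id' r hg h1 hb ha q]; ring
  have iG : Integrable fun q => n q * (a q.1 * Gt r g b' b'' q) := by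
    simp only [eG]; exact iadj.add ia'
  have lo := leftover r hg h1 (by linarith) hb ha hn0 hc hz iG
  have split : ∫ q, (n q * (g * Thyy r g a b b' b'' q - (g * r) * Psy r g a b b' q - Ths r g a a' b q) + H q * Th r g a b q)
      = - (∫ q, n q * (a' q.1 * (b q.2 * EE r g q))) + (∫ q, n q * (a q.1 * Gt r g b' b'' q)) + ∫ q, H q * Th r g a b q := by
    rw [integral_add iadj iH]
    simp only [eG]
    rw [integral_add iadj ia']; ring
  have i3 : ∫ q, H q * Th r g a b q ≤ Cs * ∫ q, J q := by
    rw [← integral_const_mul]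
    exact integral_mono iH (hJ.const_mul Cs) fun q => (bHJ q).2
  set X1 : ℝ → ℝ := (Set.Ioc 1 2).indicator a' with hX1
  set X2 : ℝ → ℝ := (Set.Ioc Y (2 * Y)).indicator fun _ => e0 * L with hX2
  set X3 : ℝ → ℝ := (Set.Ioc T (2 * T)).indicator fun _ => M * (C0 / T) * ET with hX3
  set X4 : ℝ → ℝ := (Set.Ioc 0 B).indicator fun _ => (1 : ℝ) with hX4
  have j1 : Integrable X1 := (integrable_indicator_iff measurableSet_Ioc).2
    (ha.c1.integrableOn_Icc.mono_set Set.Ioc_subset_Icc_self)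
  have j2 : Integrable X2 := (integrable_indicator_iff measurableSet_Ioc).2 (integrableOn_const (by simp))
  have j3 : Integrable X3 := (integrable_indicator_iff measurableSet_Ioc).2 (integrableOn_const (by simp))
  have j4 : Integrable X4 := (integrable_indicator_iff measurableSet_Ioc).2 (integrableOn_const (by simp))
  have v1 : ∫ s, X1 s = 1 := by
    rw [integral_indicator measurableSet_Ioc, ← intervalIntegral.integral_of_le (by norm_num),
      intervalIntegral.integral_eq_sub_of_hasDerivAt (fun s _ => ha.d1 s) (ha.c1.intervalIntegrable _ _), ha.a1, ha.a2]
    norm_num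
  have v2 : ∫ s, X2 s = Y * (e0 * L) := by
    rw [integral_indicator measurableSet_Ioc, setIntegral_const, Measure.real, Real.volume_Ioc, ENNReal.toReal_ofReal (by linarith), smul_eq_mul]
    ring
  have v3 : ∫ s, X3 s = T * (M * (C0 / T) * ET) := by
    rw [integral_indicator measurableSet_Ioc, setIntegral_const, Measure.real, Real.volume_Ioc, ENNReal.toReal_ofReal (by linarith), smul_eq_mul]
    ring
  have v4 : ∫ s, X4 s = B := by
    rw [integral_indicator measurableSet_Ioc, setIntegral_const, Measure.real, Real.volume_Ioc, ENNReal.toReal_ofReal (by linarith), smul_eq_mul]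
    ring
  have i1 : ∫ q : ℝ × ℝ, (X1 q.1 * X2 q.2 - X3 q.1 * X4 q.2) ≤ ∫ q, n q * (a' q.1 * (b q.2 * EE r g q)) := by
    refine integral_mono ((j1.mul_prod j2).sub (j3.mul_prod j4)) ia' fun q => ?_
    obtain ⟨s, y⟩ := q
    simp only
    have hE := (EE_pos r g (s, y)).le
    have hbE : 0 ≤ n (s, y) * (b y * EE r g (s, y)) := mul_nonneg (hn0 _) (mul_nonneg (hb.nn _) hE)
    have nX2 : ∀ y, 0 ≤ X2 y := fun y => Set.indicator_nonneg (fun _ _ => mul_nonneg (exp_pos _).le hL) y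
    have nX4 : ∀ y, 0 ≤ X4 y := fun y => Set.indicator_nonneg (fun _ _ => zero_le_one) y
    rcases le_or_gt s 1 with c1 | c1
    · have w1 : X1 s = 0 := Set.indicator_of_notMem (fun h => by linarith [h.1]) _
      have w3 : X3 s = 0 := Set.indicator_of_notMem (fun h => by linarith [h.1]) _
      rw [w1, w3, (ha.z1 s c1).2]; simp
    rcases le_or_gt s 2 with c2 | c2
    · have w1 : X1 s = a' s := Set.indicator_of_mem (s := Set.Ioc (1 : ℝ) 2) ⟨c1, c2⟩ _
      have w3 : X3 s = 0 := Set.indicator_of_notMem (fun h => by linarith [h.1]) _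
      have ap := ha.pos s (by linarith)
      rw [w1, w3]
      have : X2 y ≤ n (s, y) * (b y * EE r g (s, y)) := by
        by_cases hy : y ∈ Set.Ioc Y (2 * Y)
        · have w2 : X2 y = e0 * L := Set.indicator_of_mem hy _
          rw [w2, (hb.mid y (by linarith [hy.1]) (by linarith [hy.2])).1, one_mul, mul_comm]
          exact mul_le_mul (hLn s y c1.le c2 hy.1.le hy.2) (EE_lower hg hr hY c1.le c2 hy.1.le hy.2) (exp_pos _).le (hn0 _)
        · have w2 : X2 y = 0 := Set.indicator_of_notMem hy _
          rw [w2]; exact hbE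
      nlinarith
    rcases le_or_gt s T with c3 | c3
    · have w1 : X1 s = 0 := Set.indicator_of_notMem (fun h => by linarith [h.2]) _
      have w3 : X3 s = 0 := Set.indicator_of_notMem (fun h => by linarith [h.1]) _
      rw [w1, w3, ha.mid s c2.le c3]; simp
    have w1 : X1 s = 0 := Set.indicator_of_notMem (fun h => by linarith [h.2]) _
    rw [w1]
    rcases le_or_gt s (2 * T) with c4 | c4
    · have w3 : X3 s = M * (C0 / T) * ET := Set.indicator_of_mem (s := Set.Ioc T (2 * T)) ⟨c3, c4⟩ _
      rw [w3]
      by_cases hy0 : y ≤ 0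
      · rw [(hb.z y (by linarith)).1]
        have := nX4 y
        have : 0 ≤ M * (C0 / T) * ET * X4 y := by positivity
        simp; linarith
      rw [not_le] at hy0
      by_cases hyB : B < y
      · rw [hz s y hyB.le]
        have := nX4 y
        have : 0 ≤ M * (C0 / T) * ET * X4 y := by positivity
        simp; linarith
      rw [not_lt] at hyB
      have w4 : X4 y = 1 := Set.indicator_of_mem (s := Set.Ioc (0 : ℝ) B) ⟨hy0, hyB⟩ _
      rw [w4]
      have b1 : -(C0 / T) ≤ a' s := (abs_le.1 (ha.bd s c3.le)).1
      have b2 : n (s, y) * (b y * EE r g (s, y)) ≤ M * ET := by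
        refine mul_le_mul (hM _) ?_ (mul_nonneg (hb.nn _) hE) M0
        exact (mul_le_of_le_one_left hE (hb.le1 _)).trans (EE_upper hg hr T0 c3.le hy0 hyB)
      have : 0 ≤ C0 / T := by positivity
      calc 0 * X2 y - M * (C0 / T) * ET * 1 = -(C0 / T) * (M * ET) := by ring
        _ ≤ -(C0 / T) * (n (s, y) * (b y * EE r g (s, y))) := by nlinarith
        _ ≤ a' s * (n (s, y) * (b y * EE r g (s, y))) := mul_le_mul_of_nonneg_right b1 hbE
        _ = _ := by ring
    · have w3 : X3 s = 0 := Set.indicator_of_notMem (fun h => by linarith [h.2]) _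
      rw [w3, (ha.z2 s c4.le).2]; simp
  have i2 : ∫ q : ℝ × ℝ, (X1 q.1 * X2 q.2 - X3 q.1 * X4 q.2) = Y * (e0 * L) - T * (M * (C0 / T) * ET) * B := by
    rw [Measure.volume_eq_prod, integral_sub (j1.mul_prod j2) (j3.mul_prod j4), integral_prod_mul, integral_prod_mul, v1, v2, v3, v4, one_mul]
  have i4 : T * (M * (C0 / T) * ET) * B = M * C0 * B * ET := by field_simp
  rw [split] at W
  rw [i2, i4] at i1
  linarith

theorem Kpure {r g θ Y : ℝ} (hg : 0 < g) (hr : 0 ≤ r) (hθ : 0 < θ) (hrθ : θ < r + 1) (hY : 0 < Y) :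
    ∃ C, 0 ≤ C ∧ ∀ {κ : Type} [Fintype κ] (σ : κ → ℝ), ∑ k, σ k ^ 2 = g →
    ∀ (n : ℝ × ℝ → ℝ) (M M' l0 δ R Cs L : ℝ), Measurable n → (∀ q, 0 ≤ n q) → (∀ q, n q ≤ M) → 0 < l0 → 0 < δ →
    (∀ s y, 0 < s → 0 ≤ y → y ≤ δ → n (s, y) = n (s, 0)) → (∀ s y, R ≤ y → n (s, y) = 0) →
    0 ≤ Cs →
    (∀ s y l, 0 < s → 0 < y → 0 < l → l ≤ l0 →
      (2 * (Fintype.card κ : ℝ) + l / y + 1) * n (s, y) ≤ (∑ k, (n (s, y + l * σ k) + n (s, y - l * σ k)))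
        + l / y * n (s, y + l * (g * r)) + n (s + l ^ 2, y) + l ^ 2 * (Cs * (s⁻¹ * y ^ (-θ))) + l ^ 3 * (1 + 1 / y) * M') →
    0 ≤ L → (∀ s y, 1 ≤ s → s ≤ 2 → Y ≤ y → y ≤ 2 * Y → L ≤ n (s, y)) → L ≤ C * Cs := by
  obtain ⟨J, hJ, nJ, dJ⟩ := source_dom hg hθ hrθ
  obtain ⟨C0, hC0, hCA⟩ := exists_CA
  set e0 := exp (r * log Y - (r + 1) / 2 * log 2 - Y ^ 2 / g) with he0
  have e0p : 0 < e0 := exp_pos _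
  refine ⟨(∫ q, J q) / (e0 * Y), div_nonneg (integral_nonneg nJ) (by positivity), ?_⟩
  intro κ _ σ hσ n M M' l0 δ R Cs L hn hn0 hM hl0 hδ hc hz hCs ineq hL hLn
  set y1 := min (δ / 2) (Y / 2) with hy1
  have y1p : 0 < y1 := by rw [hy1]; positivity
  have y1δ : 2 * y1 ≤ δ := by have := min_le_left (δ / 2) (Y / 2); rw [← hy1] at this; linarith
  have y1Y : 2 * y1 ≤ Y := by have := min_le_right (δ / 2) (Y / 2); rw [← hy1] at this; linarith
  set B := max R (2 * Y) with hB
  have BR : R ≤ B := le_max_left _ _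
  have BY : 2 * Y ≤ B := le_max_right _ _
  obtain ⟨b, b', b'', hb⟩ := exists_CB y1p (by linarith : 2 * y1 < B)
  have key : ∀ T, 2 < T → L * (e0 * Y) ≤ Cs * (∫ q, J q) + M * C0 * B * exp (r * log B - (r + 1) / 2 * log T) := by
    intro T hT
    obtain ⟨a, a', ha⟩ := hCA T hT
    exact Kpure_T hg hr hθ hY hσ hJ nJ dJ y1p y1Y hT BY hb ha hC0 hn hn0 hM hl0
      (fun s y hs h0 h2 => hc s y hs h0 (by linarith)) (fun s y h => hz s y (by linarith)) hCs ineq hL hLn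
  have lim : Filter.Tendsto (fun T => Cs * (∫ q, J q) + M * C0 * B * exp (r * log B - (r + 1) / 2 * log T)) Filter.atTop
      (nhds (Cs * (∫ q, J q) + M * C0 * B * 0)) := by
    refine Filter.Tendsto.const_add _ (Filter.Tendsto.const_mul _ ?_)
    refine tendsto_exp_atBot.comp ?_
    have h1 := tendsto_log_atTop.const_mul_atTop (by linarith : 0 < (r + 1) / 2)
    have := Filter.tendsto_atBot_add_const_left _ (r * log B) (Filter.tendsto_neg_atTop_atBot.comp h1)
    simpa [sub_eq_add_neg] using this
  have fin : L * (e0 * Y) ≤ Cs * (∫ q, J q) + M * C0 * B * 0 := by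
    refine ge_of_tendsto lim ?_
    filter_upwards [Filter.eventually_gt_atTop 2] with T hT using key T hT
  rw [div_mul_eq_mul_div, le_div_iff₀ (by positivity)]
  linarith

end

section
variable {X : Type*} [MeasurableSpace X] {ν : Measure X} {p : ℝ}

/-- real valued `L^p` norm -/
def LN (p : ℝ) (ν : Measure X) (F : X → ℝ) : ℝ := (eLpNorm F (ENNReal.ofReal p) ν).toReal

/-- membership with a bound -/
def MB (p : ℝ) (ν : Measure X) (F : X → ℝ) (A : ℝ) : Prop :=
  AEStronglyMeasurable F ν ∧ 0 ≤ A ∧ eLpNorm F (ENNReal.ofReal p) ν ≤ ENNReal.ofReal A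

lemma MB.self {F : X → ℝ} (h : MemLp F (ENNReal.ofReal p) ν) : MB p ν F (LN p ν F) :=
  ⟨h.1, ENNReal.toReal_nonneg, by rw [LN, ENNReal.ofReal_toReal h.2.ne]⟩

lemma MB.add (hp : 1 < p) {F G : X → ℝ} {A B : ℝ} (hF : MB p ν F A) (hG : MB p ν G B) :
    MB p ν (fun x => F x + G x) (A + B) := by
  refine ⟨hF.1.add hG.1, add_nonneg hF.2.1 hG.2.1, ?_⟩
  rw [ENNReal.ofReal_add hF.2.1 hG.2.1]
  exact (eLpNorm_add_le hF.1 hG.1 (by simpa using hp.le)).trans (add_le_add hF.2.2 hG.2.2)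

lemma MB.const_mul {F : X → ℝ} {A c : ℝ} (hc : 0 ≤ c) (hF : MB p ν F A) : MB p ν (fun x => c * F x) (c * A) := by
  refine ⟨hF.1.const_mul c, mul_nonneg hc hF.2.1, ?_⟩
  have := eLpNorm_const_smul c F (ENNReal.ofReal p) ν
  have e : (fun x => c * F x) = c • F := rfl
  rw [e, this, ENNReal.ofReal_mul hc, Real.enorm_eq_ofReal hc]
  exact mul_le_mul' le_rfl hF.2.2

lemma MB.sum (hp : 1 < p) {ι : Type*} (s : Finset ι) {F : ι → X → ℝ} {A : ι → ℝ} (h : ∀ i, MB p ν (F i) (A i)) :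
    MB p ν (fun x => ∑ i ∈ s, F i x) (∑ i ∈ s, A i) := by
  classical
  induction s using Finset.induction_on with
  | empty => exact ⟨by simpa using aestronglyMeasurable_const, by simp, by simp⟩
  | insert a s ha ih => simp only [Finset.sum_insert ha]; exact (h a).add hp ih

lemma MB.le {F G : X → ℝ} {A : ℝ} (hG : MB p ν G A) (h : ∀ᵐ x ∂ν, 0 ≤ F x ∧ F x ≤ G x) : LN p ν F ≤ A := by
  have : eLpNorm F (ENNReal.ofReal p) ν ≤ ENNReal.ofReal A := by
    refine le_trans (eLpNorm_mono_ae_real ?_) hG.2.2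
    filter_upwards [h] with x hx
    rw [Real.norm_of_nonneg hx.1]; exact hx.2
  exact ENNReal.toReal_le_of_le_ofReal hG.2.1 this

lemma LN.const_mul {F : X → ℝ} {c : ℝ} (hc : 0 ≤ c) : LN p ν (fun x => c * F x) = c * LN p ν F := by
  have := eLpNorm_const_smul c F (ENNReal.ofReal p) ν
  have e : (fun x => c * F x) = c • F := rfl
  rw [LN, e, this, ENNReal.toReal_mul, Real.enorm_eq_ofReal hc, ENNReal.toReal_ofReal hc, LN]

/-- the weighted measure on a bounded interval -/
def nuL (μ Λ : ℝ) : Measure ℝ := (volume.restrict (Set.Icc (1 / Λ) Λ)).withDensity fun l => ENNReal.ofReal (l ^ μ)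

lemma nuL_lint (μ Λ : ℝ) {F : ℝ → ENNReal} (hF : Measurable F) :
    ∫⁻ l, F l ∂(nuL μ Λ) = ∫⁻ l in Set.Icc (1 / Λ) Λ, F l * ENNReal.ofReal (l ^ μ) := by
  rw [nuL, lintegral_withDensity_eq_lintegral_mul _ (by fun_prop) hF]
  refine lintegral_congr fun l => ?_
  simp [mul_comm]

lemma nuL_fin {μ Λ : ℝ} (hΛ : 1 ≤ Λ) : IsFiniteMeasure (nuL μ Λ) := by
  refine isFiniteMeasure_withDensity ?_
  have hΛ0 : 0 < Λ := by linarith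
  have : ContinuousOn (fun l : ℝ => l ^ μ) (Set.Icc (1 / Λ) Λ) := by
    intro l hl
    have : 0 < 1 / Λ := by positivity
    exact (Real.continuousAt_rpow_const _ _ (Or.inl (by linarith [hl.1]))).continuousWithinAt
  have h := (this.integrableOn_compact isCompact_Icc (μ := volume)).2
  refine ne_of_lt (lt_of_le_of_lt (lintegral_mono fun l => ?_) h)
  rw [← ofReal_norm_eq_enorm]
  exact ENNReal.ofReal_le_ofReal (le_abs_self _)

lemma nuL_ae {μ Λ : ℝ} : ∀ᵐ l ∂(nuL μ Λ), l ∈ Set.Icc (1 / Λ) Λ :=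
  (withDensity_absolutelyContinuous _ _).ae_le (ae_restrict_mem measurableSet_Icc)

lemma scale_lint {a : ℝ} (ha : 0 < a) {g : ℝ → ENNReal} (hg : Measurable g) :
    ∫⁻ x, g (a * x) = ENNReal.ofReal a⁻¹ * ∫⁻ x, g x := by
  have h := Real.map_volume_mul_left ha.ne'
  rw [← lintegral_map (μ := volume) hg (measurable_const_mul a), h, lintegral_smul_measure, abs_of_pos (by positivity)]
  rfl

end

section
variable {N : ℕ} {p : ℝ}

lemma nu_scale {μ Λ y : ℝ} (hΛ : 1 ≤ Λ) (hy : 0 < y) {h : ℝ → ENNReal} (hh : Measurable h) :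
    ∫⁻ l in Set.Icc (1 / Λ) Λ, h (l * y) * ENNReal.ofReal (l ^ μ) =
      ENNReal.ofReal (y ^ (-(μ + 1))) * ∫⁻ t in Set.Icc (y / Λ) (y * Λ), h t * ENNReal.ofReal (t ^ μ) := by
  have hΛ0 : 0 < Λ := by linarith
  rw [← lintegral_indicator measurableSet_Icc, ← lintegral_indicator measurableSet_Icc]
  set G : ℝ → ENNReal := (Set.Icc (y / Λ) (y * Λ)).indicator fun t => h t * ENNReal.ofReal (t ^ μ) with hG
  have mG : Measurable G := Measurable.indicator (by fun_prop) measurableSet_Icc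
  have e : ∀ l, (Set.Icc (1 / Λ) Λ).indicator (fun l => h (l * y) * ENNReal.ofReal (l ^ μ)) l =
      ENNReal.ofReal (y ^ (-μ)) * G (y * l) := by
    intro l
    by_cases hl : l ∈ Set.Icc (1 / Λ) Λ
    · have hl0 : 0 < l := lt_of_lt_of_le (by positivity) hl.1
      have hl2 : y * l ∈ Set.Icc (y / Λ) (y * Λ) := by
        constructor
        · have := mul_le_mul_of_nonneg_left hl.1 hy.le
          rwa [mul_one_div] at this
        · exact mul_le_mul_of_nonneg_left hl.2 hy.le
      rw [Set.indicator_of_mem hl, hG, Set.indicator_of_mem hl2, mul_comm l y, Real.mul_rpow hy.le hl0.le,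
        ENNReal.ofReal_mul (by positivity), Real.rpow_neg hy.le]
      have : ENNReal.ofReal (y ^ μ)⁻¹ * ENNReal.ofReal (y ^ μ) = 1 := by
        rw [← ENNReal.ofReal_mul (by positivity), inv_mul_cancel₀ (by positivity), ENNReal.ofReal_one]
      calc _ = 1 * (h (y * l) * ENNReal.ofReal (l ^ μ)) := by rw [one_mul]
        _ = _ := by rw [← this]; ring
    · have hl2 : y * l ∉ Set.Icc (y / Λ) (y * Λ) := by
        intro hh
        apply hl
        constructor
        · rw [div_le_iff₀ hΛ0]
          have := hh.1
          rw [div_le_iff₀ hΛ0, mul_assoc] at this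
          by_contra hc
          rw [not_le] at hc
          nlinarith
        · exact le_of_mul_le_mul_left hh.2 hy
      rw [Set.indicator_of_notMem hl, hG, Set.indicator_of_notMem hl2, mul_zero]
  rw [lintegral_congr e, lintegral_const_mul _ (by fun_prop), scale_lint hy mG, ← mul_assoc,
    ← ENNReal.ofReal_mul (by positivity)]
  congr 2
  rw [neg_add, Real.rpow_add hy, Real.rpow_neg_one]

lemma src_le (hp : 1 < p) {μ Λ y : ℝ} (hΛ : 1 ≤ Λ) (hy : 0 < y) {f : Pt N → ℝ} (hf : Continuous f)
    (hc : HasCompactSupport f) :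
    eLpNorm (fun l => (sl p f (l * y)).toReal) (ENNReal.ofReal p) (nuL μ Λ) ≤
      ENNReal.ofReal (y ^ (-((μ + 1) / p))) * Wn p μ f ^ (1 / p) := by
  have hp0 : 0 < p := by linarith
  have hΛ0 : 0 < Λ := by linarith
  have ms := sl_meas hp hf
  obtain ⟨M, hM, hb⟩ := sl_bdd hp hf hc
  rw [← ENNReal.rpow_le_rpow_iff hp0, eLp_rpow _ hp0, nuL_lint _ _ (by fun_prop),
    ENNReal.mul_rpow_of_nonneg _ _ hp0.le, ← ENNReal.rpow_mul, one_div_mul_cancel hp0.ne', ENNReal.rpow_one,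
    ENNReal.ofReal_rpow_of_pos (by positivity), ← Real.rpow_mul hy.le]
  have e : ∀ l, ‖(sl p f (l * y)).toReal‖ₑ ^ p * ENNReal.ofReal (l ^ μ) =
      (fun t => sl p f t ^ p) (l * y) * ENNReal.ofReal (l ^ μ) := by
    intro l
    rw [Real.enorm_eq_ofReal ENNReal.toReal_nonneg, ENNReal.ofReal_toReal (ne_top_of_le_ne_top hM (hb _))]
  rw [lintegral_congr e, nu_scale hΛ hy (h := fun t => sl p f t ^ p) (by fun_prop)]
  have : -((μ + 1) / p) * p = -(μ + 1) := by field_simp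
  rw [this]
  refine mul_le_mul' le_rfl (lintegral_mono_set ?_)
  intro t ht
  exact lt_of_lt_of_le (by positivity : 0 < y / Λ) ht.1

/-- the averaged kernel norm -/
def NL (p ρ μ Λ : ℝ) (ω : Pt N → ℝ) (q : ℝ × ℝ) : ℝ :=
  LN p (nuL μ Λ) fun l => nk p ρ ω (l ^ 2 * q.1) (l * q.2)

lemma NL_meas (hp : 1 < p) {ρ μ Λ : ℝ} (hΛ : 1 ≤ Λ) {k : ℕ} {ω : Pt N → ℝ} (hω : Nice k ω) : Measurable (NL p ρ μ Λ ω) := by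
  have hp0 : 0 < p := by linarith
  have := nuL_fin (μ := μ) hΛ
  refine Measurable.ennreal_toReal ?_
  have e : (fun q : ℝ × ℝ => eLpNorm (fun l => nk p ρ ω (l ^ 2 * q.1) (l * q.2)) (ENNReal.ofReal p) (nuL μ Λ)) =
      fun q : ℝ × ℝ => (∫⁻ l, ‖nk p ρ ω (l ^ 2 * q.1) (l * q.2)‖ₑ ^ p ∂(nuL μ Λ)) ^ (1 / p) := by
    funext q
    rw [eLpNorm_eq_lintegral_rpow_enorm_toReal (by simpa using hp0) ENNReal.ofReal_ne_top, ENNReal.toReal_ofReal hp0.le]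
  rw [e]
  refine Measurable.pow_const ?_ _
  refine Measurable.lintegral_prod_right' (f := fun r : (ℝ × ℝ) × ℝ => ‖nk p ρ ω (r.2 ^ 2 * r.1.1) (r.2 * r.1.2)‖ₑ ^ p) ?_
  have m := (nk_meas hp ρ hω).comp (by fun_prop : Measurable fun r : (ℝ × ℝ) × ℝ => (r.2 ^ 2 * r.1.1, r.2 * r.1.2))
  exact m.enorm.pow_const _

lemma nk_meas' (hp : 1 < p) {ρ : ℝ} {k : ℕ} {ω : Pt N → ℝ} (hω : Nice k ω) (s y : ℝ) :
    Measurable fun l : ℝ => nk p ρ ω (l ^ 2 * s) (l * y) := by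
  have h1 : Measurable fun l : ℝ => (l ^ 2 * s, l * y) :=
    Measurable.prodMk ((measurable_id.pow_const 2).mul_const s) (measurable_id.mul_const y)
  have h2 := Measurable.comp (nk_meas hp ρ hω) h1
  exact h2

lemma nk_memLp (hp : 1 < p) {ρ μ Λ : ℝ} (hΛ : 1 ≤ Λ) {k : ℕ} {ω : Pt N → ℝ} (hω : Nice k ω) (hc : HasCompactSupport ω)
    (s y : ℝ) : MemLp (fun l => nk p ρ ω (l ^ 2 * s) (l * y)) (ENNReal.ofReal p) (nuL μ Λ) := by
  have := nuL_fin (μ := μ) hΛ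
  obtain ⟨M, hM, hb⟩ := nk_bdd hp ρ hω.cont hc
  refine MemLp.of_bound (nk_meas' hp hω s y).aestronglyMeasurable M (Filter.Eventually.of_forall fun l => ?_)
  rw [Real.norm_of_nonneg (nk_nonneg _ _ _ _)]; exact hb _ _

/-- integrated lower bound -/
lemma NL_lower (hp : 1 < p) {ρ μ Λ Y : ℝ} (hμ : 0 < μ + 1) (hΛ : 1 ≤ Λ) (hY : 0 < Y) {ω : Pt N → ℝ}
    (hω : ContDiff ℝ (⊤ : ℕ∞) ω) (hc : HasCompactSupport ω) {s y : ℝ} (hs : 1 ≤ s) (hs2 : s ≤ 2) (hy : Y ≤ y) (hy2 : y ≤ 2 * Y) :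
    ENNReal.ofReal ((2 * Y) ^ (-(μ + 1))) * (∫⁻ t in Set.Icc (2 * Y / Λ) (Y * Λ), sl p (heat (sx ρ) (2 / Y * t) ω) t ^ p * ENNReal.ofReal (t ^ μ))
      ≤ ENNReal.ofReal (NL p ρ μ Λ ω (s, y)) ^ p := by
  have hp0 : 0 < p := by linarith
  have hΛ0 : 0 < Λ := by linarith
  have hy0 : 0 < y := by linarith
  have nω := Nice.of_cs 4 hω hc
  have mm := nk_memLp (ρ := ρ) (μ := μ) hp hΛ nω hc s y
  have ms := nsl_meas hp ρ (2 / Y) nω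
  rw [NL, LN, ENNReal.ofReal_toReal mm.2.ne, eLp_rpow _ hp0, nuL_lint _ _ ((nk_meas' hp nω s y).enorm.pow_const _)]
  have step : ∫⁻ l in Set.Icc (1 / Λ) Λ, (fun t => sl p (heat (sx ρ) (2 / Y * t) ω) t ^ p) (l * y) * ENNReal.ofReal (l ^ μ) ≤
      ∫⁻ l in Set.Icc (1 / Λ) Λ, ‖nk p ρ ω (l ^ 2 * s) (l * y)‖ₑ ^ p * ENNReal.ofReal (l ^ μ) := by
    refine setLIntegral_mono' measurableSet_Icc fun l hl => ?_
    have hl0 : 0 < l := lt_of_lt_of_le (by positivity) hl.1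
    refine mul_le_mul' (ENNReal.rpow_le_rpow ?_ hp0.le) le_rfl
    rw [Real.enorm_eq_ofReal (nk_nonneg _ _ _ _)]
    have a := nk_anti hp ρ hω hc (s := 2 * (l * y) ^ 2 / Y ^ 2) (s' := l ^ 2 * s) (by positivity) (by
      rw [le_div_iff₀ (by positivity)]
      have : s * Y ^ 2 ≤ 2 * y ^ 2 := mul_le_mul hs2 (by gcongr) (by positivity) (by norm_num)
      calc l ^ 2 * s * Y ^ 2 = l ^ 2 * (s * Y ^ 2) := by ring
        _ ≤ l ^ 2 * (2 * y ^ 2) := by gcongr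
        _ = _ := by ring) (l * y)
    refine le_trans (le_of_eq ?_) (ENNReal.ofReal_le_ofReal a)
    rw [nk_ofReal hp ρ nω.cont hc, hH]
    congr 2
    rw [show 2 * (2 * (l * y) ^ 2 / Y ^ 2) = (2 / Y * (l * y)) ^ 2 by field_simp, Real.sqrt_sq (by positivity)]
  refine le_trans ?_ step
  rw [nu_scale hΛ hy0 (h := fun t => sl p (heat (sx ρ) (2 / Y * t) ω) t ^ p) (by fun_prop)]
  refine mul_le_mul' (ENNReal.ofReal_le_ofReal ?_) (lintegral_mono_set ?_)
  · exact Real.rpow_le_rpow_of_nonpos hy0 hy2 (by linarith)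
  · exact Set.Icc_subset_Icc (by gcongr) (by gcongr)

end

section
variable {N : ℕ} {p : ℝ} {κ : Type} [Fintype κ]

set_option maxHeartbeats 1600000 in
lemma NL_ineq (hp : 1 < p) (ρ μ : ℝ) {σ : κ → Pt N} {v : Pt N} {φ f : Pt N → ℝ}
    (h : Eqn (Sum.elim (sx ρ) σ) v φ f) (i j : Fin N) {Λ : ℝ} (hΛ : 1 ≤ Λ) (hW : Wn p μ f ≠ ⊤) :
    ∃ M' : ℝ, ∀ s y l, 0 < s → 0 < y → 0 < l → l ≤ 1 / Λ →
      (2 * (Fintype.card κ : ℝ) + l / y + 1) * NL p ρ μ Λ (pd (sx ρ i) (pd (sx ρ j) φ)) (s, y) ≤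
        (∑ k, (NL p ρ μ Λ (pd (sx ρ i) (pd (sx ρ j) φ)) (s, y + l * (σ k).2) +
          NL p ρ μ Λ (pd (sx ρ i) (pd (sx ρ j) φ)) (s, y - l * (σ k).2)))
        + l / y * NL p ρ μ Λ (pd (sx ρ i) (pd (sx ρ j) φ)) (s, y + l * v.2)
        + NL p ρ μ Λ (pd (sx ρ i) (pd (sx ρ j) φ)) (s + l ^ 2, y)
        + l ^ 2 * ((gC N).toReal / 2 * (Wn p μ f ^ (1 / p)).toReal * (s⁻¹ * y ^ (-((μ + 1) / p)))) + l ^ 3 * (1 + 1 / y) * M' := by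
  have hp0 : 0 < p := by linarith
  have hΛ0 : 0 < Λ := by linarith
  obtain ⟨M, hM0, hM⟩ := kato hp ρ σ h i j
  set ω := pd (sx ρ i) (pd (sx ρ j) φ) with hω
  have nω : Nice 4 ω := ((h.nφ 6).pd _).pd _
  have cω : HasCompactSupport ω := pd_hcs (pd_hcs h.cφ _) _
  have := nuL_fin (μ := μ) hΛ
  set ν := nuL μ Λ with hν
  set F := (Wn p μ f ^ (1 / p)).toReal with hF
  have hF' : ENNReal.ofReal F = Wn p μ f ^ (1 / p) :=
    ENNReal.ofReal_toReal (ENNReal.rpow_ne_top_of_nonneg (by positivity) hW)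
  have mU : ∀ s y, MB p ν (fun l : ℝ => nk p ρ ω (l ^ 2 * s) (l * y)) (NL p ρ μ Λ ω (s, y)) :=
    fun s y => MB.self (nk_memLp hp hΛ nω cω s y)
  have m1 : MB p ν (fun _ : ℝ => (1 : ℝ)) (LN p ν fun _ => (1 : ℝ)) := MB.self (memLp_const 1)
  have ms := sl_meas hp h.sf.continuous
  have mS : ∀ y, 0 < y → MB p ν (fun l => (sl p f (l * y)).toReal) (y ^ (-((μ + 1) / p)) * F) := by
    intro y hy
    refine ⟨Measurable.aestronglyMeasurable (by fun_prop), mul_nonneg (by positivity) ENNReal.toReal_nonneg, ?_⟩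
    rw [ENNReal.ofReal_mul (by positivity), hF']
    exact src_le hp hΛ hy h.sf.continuous h.cf
  refine ⟨Λ ^ 3 * M * LN p ν fun _ => (1 : ℝ), fun s y l hs hy hl hl1 => ?_⟩
  have g0 : 0 ≤ (gC N).toReal := ENNReal.toReal_nonneg
  have A1 := MB.sum hp Finset.univ fun k : κ => (mU s (y + l * (σ k).2)).add hp (mU s (y - l * (σ k).2))
  have A2 := A1.add hp ((mU s (y + l * v.2)).const_mul (by positivity : 0 ≤ l / y))
  have A3 := A2.add hp (mU (s + l ^ 2) y)
  have A4 := A3.add hp ((mS y hy).const_mul (by positivity : 0 ≤ l ^ 2 * ((gC N).toReal / (2 * s))))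
  have A5 := A4.add hp (m1.const_mul (by positivity : 0 ≤ l ^ 3 * (1 + 1 / y) * (Λ ^ 3 * M)))
  have A6 := A5.le (F := fun lam : ℝ => (2 * (Fintype.card κ : ℝ) + l / y + 1) * nk p ρ ω (lam ^ 2 * s) (lam * y)) (by
    filter_upwards [nuL_ae (μ := μ) (Λ := Λ)] with lam hlam
    have hlam0 : 0 < lam := lt_of_lt_of_le (by positivity) hlam.1
    refine ⟨mul_nonneg (by positivity) (nk_nonneg _ _ _ _), ?_⟩
    have k := hM (lam ^ 2 * s) (lam * y) (lam * l) (by positivity) (by positivity) (by positivity) (by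
      calc lam * l ≤ Λ * (1 / Λ) := by gcongr; exact hlam.2
        _ = 1 := by field_simp)
    have r1 : lam * l / (lam * y) = l / y := by field_simp
    have r2 : ∀ t, lam * y + lam * l * t = lam * (y + l * t) := fun t => by ring
    have r3 : ∀ t, lam * y - lam * l * t = lam * (y - l * t) := fun t => by ring
    have r4 : lam ^ 2 * s + (lam * l) ^ 2 = lam ^ 2 * (s + l ^ 2) := by ring
    rw [r1, r4] at k
    simp only [r2, r3] at k
    refine k.trans ?_
    refine add_le_add (add_le_add le_rfl ?_) ?_
    · have := nk_source hp ρ h.sf h.cf i j (s := lam ^ 2 * s) (by positivity) (lam * y)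
      calc (lam * l) ^ 2 * nk p ρ (pd (sx ρ i) (pd (sx ρ j) f)) (lam ^ 2 * s) (lam * y) ≤
          (lam * l) ^ 2 * ((gC N).toReal / (2 * (lam ^ 2 * s)) * (sl p f (lam * y)).toReal) := by gcongr
        _ = _ := by field_simp
    · rw [mul_one]
      have : lam ^ 3 * (1 + 1 / (lam * y)) ≤ (1 + 1 / y) * Λ ^ 3 := by
        have e : lam ^ 3 * (1 + 1 / (lam * y)) = lam ^ 3 + lam ^ 2 * (1 / y) := by field_simp
        have b1 : lam ^ 3 ≤ Λ ^ 3 := by gcongr; exact hlam.2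
        have b2 : lam ^ 2 ≤ Λ ^ 3 := (by gcongr; exact hlam.2 : lam ^ 2 ≤ Λ ^ 2).trans (pow_le_pow_right₀ hΛ (by norm_num))
        have b3 : lam ^ 2 * (1 / y) ≤ Λ ^ 3 * (1 / y) := by gcongr
        rw [e]; linarith
      calc (lam * l) ^ 3 * (1 + 1 / (lam * y)) * M = l ^ 3 * M * (lam ^ 3 * (1 + 1 / (lam * y))) := by ring
        _ ≤ l ^ 3 * M * ((1 + 1 / y) * Λ ^ 3) := by gcongr
        _ = _ := by ring)
  rw [LN.const_mul (by positivity)] at A6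
  refine le_trans A6 (le_of_eq ?_)
  have : l ^ 2 * ((gC N).toReal / (2 * s)) * (y ^ (-((μ + 1) / p)) * F) = l ^ 2 * ((gC N).toReal / 2 * F * (s⁻¹ * y ^ (-((μ + 1) / p)))) := by
    field_simp
  rw [this]; ring

end

section
variable {N : ℕ} {p : ℝ} {κ : Type} [Fintype κ]

lemma pd_cs {f : Pt N → ℝ} (hf : ContDiff ℝ (⊤ : ℕ∞) f) (v : Pt N) : ContDiff ℝ (⊤ : ℕ∞) (pd v f) := pd_contDiff hf v

set_option maxHeartbeats 1600000 in
theorem partK (hp : 1 < p) (ρ : ℝ) (σ : κ → Pt N) (v : Pt N) {μ g r κ0 : ℝ} (hg : 0 < g) (hσ : ∑ k, (σ k).2 ^ 2 = g)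
    (hr : 0 < r) (hv : v.2 = g * r) (hμ : 0 < μ + 1) (hθ : (μ + 1) / p < r + 1) (hκ : 0 < κ0) :
    ∃ C : ENNReal, C ≠ ⊤ ∧ ∀ (φ f : Pt N → ℝ) (δ : ℝ), Eqn (Sum.elim (sx ρ) σ) v φ f → 0 < δ →
      (∀ z : Pt N, 0 ≤ z.2 → z.2 ≤ δ → pd v φ z = 0) → ∀ i j : Fin N,
      nW p μ ρ κ0 (pd (sx ρ i) (pd (sx ρ j) φ)) ≤ C * Wn p μ f := by
  have hp0 : 0 < p := by linarith
  set Y := 2 / κ0 with hYd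
  have hY : 0 < Y := by positivity
  obtain ⟨C0, hC0, HK⟩ := Kpure (θ := (μ + 1) / p) hg hr.le (by positivity) hθ hY
  have g0 : 0 ≤ (gC N).toReal := ENNReal.toReal_nonneg
  refine ⟨ENNReal.ofReal ((2 * Y) ^ (μ + 1)) * ENNReal.ofReal (C0 * ((gC N).toReal / 2)) ^ p + 1, ?_, ?_⟩
  · exact ENNReal.add_ne_top.2 ⟨ENNReal.mul_ne_top ENNReal.ofReal_ne_top
      (ENNReal.rpow_ne_top_of_nonneg hp0.le ENNReal.ofReal_ne_top), ENNReal.one_ne_top⟩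
  intro φ f δ h hδ hz i j
  by_cases hW : Wn p μ f = ⊤
  · rw [hW, ENNReal.mul_top (by simp)]; exact le_top
  set ω := pd (sx ρ i) (pd (sx ρ j) φ) with hω
  have sω : ContDiff ℝ (⊤ : ℕ∞) ω := pd_contDiff (pd_contDiff h.sφ _) _
  have cω : HasCompactSupport ω := pd_hcs (pd_hcs h.cφ _) _
  have nω : Nice 4 ω := Nice.of_cs 4 sω cω
  set F := (Wn p μ f ^ (1 / p)).toReal with hF
  have F0 : 0 ≤ F := ENNReal.toReal_nonneg
  have hF' : ENNReal.ofReal F = Wn p μ f ^ (1 / p) :=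
    ENNReal.ofReal_toReal (ENNReal.rpow_ne_top_of_nonneg (by positivity) hW)
  have hκY : κ0 = 2 / Y := by rw [hYd]; field_simp
  set H : ℝ → ENNReal := fun t => sl p (heat (sx ρ) (2 / Y * t) ω) t ^ p * ENNReal.ofReal (t ^ μ) with hH
  have key : ∀ Λ : ℝ, 1 ≤ Λ → ∫⁻ t in Set.Icc (2 * Y / Λ) (Y * Λ), H t ≤
      ENNReal.ofReal ((2 * Y) ^ (μ + 1)) * ENNReal.ofReal (C0 * ((gC N).toReal / 2)) ^ p * Wn p μ f := by
    intro Λ hΛ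
    have hΛ0 : 0 < Λ := by linarith
    have fin := nuL_fin (μ := μ) hΛ
    set I := ∫⁻ t in Set.Icc (2 * Y / Λ) (Y * Λ), H t with hI
    set Lp := ENNReal.ofReal ((2 * Y) ^ (-(μ + 1))) * I with hLp
    have low : ∀ s y, 1 ≤ s → s ≤ 2 → Y ≤ y → y ≤ 2 * Y → Lp ≤ ENNReal.ofReal (NL p ρ μ Λ ω (s, y)) ^ p :=
      fun s y h1 h2 h3 h4 => NL_lower hp hμ hΛ hY sω cω h1 h2 h3 h4
    have low2 : ∀ s y, 1 ≤ s → s ≤ 2 → Y ≤ y → y ≤ 2 * Y → Lp ^ (1 / p) ≤ ENNReal.ofReal (NL p ρ μ Λ ω (s, y)) := by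
      intro s y h1 h2 h3 h4
      have := ENNReal.rpow_le_rpow (low s y h1 h2 h3 h4) (by positivity : 0 ≤ 1 / p)
      rwa [← ENNReal.rpow_mul, mul_one_div_cancel hp0.ne', ENNReal.rpow_one] at this
    have Lt : Lp ^ (1 / p) ≠ ⊤ := ne_top_of_le_ne_top ENNReal.ofReal_ne_top
      (low2 1 Y le_rfl (by norm_num) le_rfl (by linarith))
    obtain ⟨M, hM0, hM⟩ := nk_bdd hp ρ nω.cont cω
    obtain ⟨R, hR0, hR⟩ := nk_zero (p := p) ρ cω
    obtain ⟨M', hM'⟩ := NL_ineq hp ρ μ h i j hΛ hW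
    have m1 : MB p (nuL μ Λ) (fun _ : ℝ => M) (LN p (nuL μ Λ) fun _ => M) := MB.self (memLp_const M)
    have fz : ∀ s y, (∀ l, 1 / Λ ≤ l → l ≤ Λ → nk p ρ ω (l ^ 2 * s) (l * y) = 0) → NL p ρ μ Λ ω (s, y) = 0 := by
      intro s y hh
      have : (fun l : ℝ => nk p ρ ω (l ^ 2 * s) (l * y)) =ᵐ[nuL μ Λ] fun _ => 0 := by
        filter_upwards [nuL_ae (μ := μ) (Λ := Λ)] with l hl
        exact hh l hl.1 hl.2
      rw [NL, LN, eLpNorm_congr_ae this]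
      simp
    have res := HK (fun k => (σ k).2) hσ (NL p ρ μ Λ ω) (LN p (nuL μ Λ) fun _ => M) M' (1 / Λ) (δ / Λ) (R * Λ)
      ((gC N).toReal / 2 * F) (Lp ^ (1 / p)).toReal (NL_meas hp hΛ nω) (fun q => ENNReal.toReal_nonneg)
      (fun q => m1.le (Filter.Eventually.of_forall fun l => ⟨nk_nonneg _ _ _ _, hM _ _⟩))
      (by positivity) (by positivity)
      (by
        intro s y hs h0 h1
        have : (fun l : ℝ => nk p ρ ω (l ^ 2 * s) (l * y)) =ᵐ[nuL μ Λ] fun l => nk p ρ ω (l ^ 2 * s) (l * 0) := by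
          filter_upwards [nuL_ae (μ := μ) (Λ := Λ)] with l hl
          have hl0 : 0 < l := lt_of_lt_of_le (by positivity) hl.1
          rw [mul_zero]
          refine nk_const ρ (by rw [hv]; positivity) h.nφ hz i j _ _ (by positivity) ?_
          calc l * y ≤ Λ * (δ / Λ) := by gcongr; exact hl.2
            _ = δ := by field_simp
        simp only [NL, LN]
        rw [eLpNorm_congr_ae this])
      (by
        intro s y hy
        refine fz s y fun l hl hl2 => hR _ _ ?_
        calc R = (1 / Λ) * (R * Λ) := by field_simp
          _ ≤ l * y := mul_le_mul hl hy (by positivity) (le_trans (by positivity) hl))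
      (by positivity)
      (by
        intro s y l hs hy hl hl1
        have := hM' s y l hs hy hl hl1
        rw [hv] at this
        exact this)
      ENNReal.toReal_nonneg
      (fun s y h1 h2 h3 h4 => ENNReal.toReal_le_of_le_ofReal ENNReal.toReal_nonneg (low2 s y h1 h2 h3 h4))
    have r2 : Lp ^ (1 / p) ≤ ENNReal.ofReal (C0 * ((gC N).toReal / 2)) * Wn p μ f ^ (1 / p) := by
      rw [← hF', ← ENNReal.ofReal_mul (by positivity), ← ENNReal.ofReal_toReal Lt]
      refine ENNReal.ofReal_le_ofReal (res.trans (le_of_eq (by ring)))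
    have r3 := ENNReal.rpow_le_rpow r2 hp0.le
    rw [ENNReal.mul_rpow_of_nonneg _ _ hp0.le, ← ENNReal.rpow_mul, ← ENNReal.rpow_mul, one_div_mul_cancel hp0.ne',
      ENNReal.rpow_one, ENNReal.rpow_one] at r3
    have one : ENNReal.ofReal ((2 * Y) ^ (μ + 1)) * ENNReal.ofReal ((2 * Y) ^ (-(μ + 1))) = 1 := by
      rw [← ENNReal.ofReal_mul (by positivity), ← Real.rpow_add (by positivity)]; simp
    calc I = ENNReal.ofReal ((2 * Y) ^ (μ + 1)) * Lp := by rw [hLp, ← mul_assoc, one, one_mul]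
      _ ≤ ENNReal.ofReal ((2 * Y) ^ (μ + 1)) * (ENNReal.ofReal (C0 * ((gC N).toReal / 2)) ^ p * Wn p μ f) :=
          mul_le_mul' le_rfl r3
      _ = _ := by rw [mul_assoc]
  have mono : Monotone fun n : ℕ => Set.Icc (2 * Y / ((n : ℝ) + 1)) (Y * ((n : ℝ) + 1)) := by
    intro a b hab
    have : (a : ℝ) ≤ b := by exact_mod_cast hab
    exact Set.Icc_subset_Icc (by gcongr) (by gcongr)
  have sub : Set.Ioi (0 : ℝ) ⊆ ⋃ n : ℕ, Set.Icc (2 * Y / ((n : ℝ) + 1)) (Y * ((n : ℝ) + 1)) := by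
    intro t ht
    rw [Set.mem_Ioi] at ht
    obtain ⟨n, hn⟩ := exists_nat_gt (max (2 * Y / t) (t / Y))
    refine Set.mem_iUnion.2 ⟨n, ?_, ?_⟩
    · have := (le_max_left _ _).trans_lt hn
      rw [div_lt_iff₀ ht] at this
      rw [div_le_iff₀ (by positivity)]
      nlinarith
    · have := (le_max_right _ _).trans_lt hn
      rw [div_lt_iff₀ hY] at this
      nlinarith
  have fin : nW p μ ρ κ0 ω ≤ ENNReal.ofReal ((2 * Y) ^ (μ + 1)) * ENNReal.ofReal (C0 * ((gC N).toReal / 2)) ^ p * Wn p μ f := by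
    rw [nW, hκY]
    refine (lintegral_mono_set sub).trans ?_
    rw [setLIntegral_iUnion_of_directed _ mono.directed_le]
    refine iSup_le fun n => key _ ?_
    linarith [(Nat.cast_nonneg n : (0 : ℝ) ≤ n)]
  refine fin.trans (mul_le_mul' le_self_add le_rfl)

end

section
variable {N : ℕ} {p : ℝ} {κ : Type} [Fintype κ]

lemma Wn_fin (hp : 1 < p) {μ : ℝ} (hμ : 0 < μ + 1) {G : Pt N → ℝ} (hG : Continuous G) (hc : HasCompactSupport G) :
    Wn p μ G ≠ ⊤ := by
  have hp0 : 0 < p := by linarith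
  obtain ⟨M, hM, hb⟩ := sl_bdd hp hG hc
  obtain ⟨R, hR0, hR⟩ := hc.isBounded.exists_pos_norm_lt
  have hz : ∀ y, R ≤ y → sl p G y = 0 := by
    intro y hy
    refine sl_zero_of fun x => ?_
    by_contra hne
    have := hR _ (subset_tsupport _ hne)
    have h2 : |y| ≤ ‖((x, y) : Pt N)‖ := norm_snd_le ((x, y) : Pt N)
    have := le_abs_self y
    linarith
  have i1 : IntegrableOn (fun y : ℝ => y ^ μ) (Set.Ioc 0 R) := by
    rw [← intervalIntegrable_iff_integrableOn_Ioc_of_le hR0.le]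
    exact intervalIntegral.intervalIntegrable_rpow' (by linarith)
  have b : Wn p μ G ≤ M ^ p * ∫⁻ y in Set.Ioc 0 R, ENNReal.ofReal (y ^ μ) := by
    rw [Wn, ← lintegral_const_mul _ (by fun_prop), ← lintegral_indicator measurableSet_Ioi, ← lintegral_indicator measurableSet_Ioc]
    refine lintegral_mono fun y => ?_
    by_cases h1 : y ∈ Set.Ioi (0 : ℝ)
    · rw [Set.indicator_of_mem h1]
      by_cases h2 : y ≤ R
      · rw [Set.indicator_of_mem (s := Set.Ioc 0 R) ⟨h1, h2⟩]
        exact mul_le_mul' (ENNReal.rpow_le_rpow (hb y) hp0.le) le_rfl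
      · rw [hz y (not_le.1 h2).le, ENNReal.zero_rpow_of_pos hp0, zero_mul]; exact bot_le
    · rw [Set.indicator_of_notMem h1]; exact bot_le
  refine ne_top_of_le_ne_top (ENNReal.mul_ne_top (ENNReal.rpow_ne_top_of_nonneg hp0.le hM) ?_) b
  refine ne_top_of_le_ne_top i1.2.ne (lintegral_mono fun y => ?_)
  rw [← ofReal_norm]
  exact ENNReal.ofReal_le_ofReal (le_abs_self _)

set_option maxHeartbeats 1600000 in
theorem mainW (hp : 1 < p) (ρ : ℝ) (σ : κ → Pt N) (iy : κ) (hS : Setup (Sum.elim (sx ρ) σ) ρ Sum.inl (Sum.inr iy)) (v : Pt N)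
    {μ g r : ℝ} (hg : 0 < g) (hσ : ∑ k, (σ k).2 ^ 2 = g)
    (hr : 0 < r) (hv : v.2 = g * r) (hμ : 0 < μ + 1) (hθ : (μ + 1) / p < r + 1) :
    ∃ C : ENNReal, C ≠ ⊤ ∧ ∀ (φ f : Pt N → ℝ) (δ : ℝ), Eqn (Sum.elim (sx ρ) σ) v φ f → 0 < δ →
      (∀ z : Pt N, 0 ≤ z.2 → z.2 ≤ δ → pd v φ z = 0) → ∀ i j : Fin N,
      Wn p μ (pd (sx ρ i) (pd (sx ρ j) φ)) ≤ C * Wn p μ f := by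
  have hp0 : 0 < p := by linarith
  obtain ⟨C1, hC1, H1⟩ := partI hp _ hS v μ
  set Nn : ENNReal := (N : ENNReal) * N with hNn
  have hNt : Nn * C1 ≠ ⊤ := ENNReal.mul_ne_top (ENNReal.mul_ne_top (ENNReal.natCast_ne_top _) (ENNReal.natCast_ne_top _)) hC1
  set K := (Nn * C1).toReal with hK
  have K0 : 0 ≤ K := ENNReal.toReal_nonneg
  set ε := 1 / (2 * K + 2) with hε
  have ε0 : 0 < ε := by positivity
  have ε1 : ε ≤ 1 := by rw [hε, div_le_one (by positivity)]; linarith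
  have eps : Nn * C1 * ENNReal.ofReal ε ^ p ≤ 1 / 2 := by
    have : ENNReal.ofReal ε ^ p ≤ ENNReal.ofReal ε := by
      calc ENNReal.ofReal ε ^ p ≤ ENNReal.ofReal ε ^ (1 : ℝ) :=
            ENNReal.rpow_le_rpow_of_exponent_ge (by simpa using ε1) hp.le
        _ = _ := ENNReal.rpow_one _
    calc _ ≤ Nn * C1 * ENNReal.ofReal ε := mul_le_mul' le_rfl this
      _ = ENNReal.ofReal (K * ε) := by rw [ENNReal.ofReal_mul K0, hK, ENNReal.ofReal_toReal hNt]
      _ ≤ ENNReal.ofReal (1 / 2) := by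
        refine ENNReal.ofReal_le_ofReal ?_
        rw [hε, mul_one_div, div_le_div_iff₀ (by positivity) (by norm_num)]; linarith
      _ = 1 / 2 := by rw [ENNReal.ofReal_div_of_pos (by norm_num)]; simp
  obtain ⟨C2, hC2, H2⟩ := partK hp ρ σ v hg hσ hr hv hμ hθ (by positivity : 0 < ε / 2)
  refine ⟨2 * (Nn * C1 * (1 + C2)), ENNReal.mul_ne_top (by simp) (ENNReal.mul_ne_top hNt (ENNReal.add_ne_top.2 ⟨by simp, hC2⟩)), ?_⟩
  intro φ f δ h hδ hz i j
  set T := ∑ m : Fin N, ∑ l : Fin N, Wn p μ (pd (sx ρ m) (pd (sx ρ l) φ)) with hT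
  have Tt : T ≠ ⊤ := by
    refine ENNReal.sum_ne_top.2 fun a _ => ENNReal.sum_ne_top.2 fun b _ => ?_
    exact Wn_fin hp hμ (pd_contDiff (pd_contDiff h.sφ _) _).continuous (pd_hcs (pd_hcs h.cφ _) _)
  have e1 : ∀ a b : Fin N, Wn p μ (pd (sx ρ a) (pd (sx ρ b) φ)) ≤
      C1 * (Wn p μ f + ENNReal.ofReal ε ^ p * T + C2 * Wn p μ f) := by
    intro a b
    refine (H1 φ f h ε ε0 ε1 a b).trans (mul_le_mul' le_rfl (add_le_add le_rfl ?_))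
    exact H2 φ f δ h hδ hz a b
  have e2 : T ≤ Nn * C1 * (1 + C2) * Wn p μ f + 1 / 2 * T := by
    calc T ≤ ∑ m : Fin N, ∑ l : Fin N, C1 * (Wn p μ f + ENNReal.ofReal ε ^ p * T + C2 * Wn p μ f) :=
          Finset.sum_le_sum fun a _ => Finset.sum_le_sum fun b _ => e1 a b
      _ = Nn * C1 * (1 + C2) * Wn p μ f + Nn * C1 * ENNReal.ofReal ε ^ p * T := by
          simp only [Finset.sum_const, Finset.card_univ, Fintype.card_fin, nsmul_eq_mul]
          rw [hNn]; ring
      _ ≤ _ := add_le_add le_rfl (mul_le_mul' eps le_rfl)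
  have e3 : T ≤ 2 * (Nn * C1 * (1 + C2) * Wn p μ f) := by
    by_cases hW : Nn * C1 * (1 + C2) * Wn p μ f = ⊤
    · rw [hW]; simp
    set B := Nn * C1 * (1 + C2) * Wn p μ f with hB
    have f1 : (1 / 2 : ENNReal) * T ≠ ⊤ := ENNReal.mul_ne_top (by simp) Tt
    have := ENNReal.toReal_mono (ENNReal.add_ne_top.2 ⟨hW, f1⟩) e2
    have half : ((1 / 2 : ENNReal) * T).toReal = 1 / 2 * T.toReal := by rw [ENNReal.toReal_mul]; simp
    rw [ENNReal.toReal_add hW f1, half] at this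
    rw [← ENNReal.toReal_le_toReal Tt (ENNReal.mul_ne_top (by simp) hW), ENNReal.toReal_mul]
    have two : (2 : ENNReal).toReal = 2 := by simp
    rw [two]
    linarith
  refine le_trans ?_ (e3.trans (le_of_eq (by ring)))
  refine le_trans ?_ (Finset.single_le_sum (f := fun m => ∑ l : Fin N, Wn p μ (pd (sx ρ m) (pd (sx ρ l) φ))) (fun _ _ => bot_le) (Finset.mem_univ i))
  exact Finset.single_le_sum (f := fun l => Wn p μ (pd (sx ρ i) (pd (sx ρ l) φ))) (fun _ _ => bot_le) (Finset.mem_univ j)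

end

section
variable {N : ℕ}

lemma posdef_split {n : ℕ} {A : Matrix (Fin (n + 1)) (Fin (n + 1)) ℝ} (hA : A.PosDef) :
    ∃ k0 : ℝ, 0 < k0 ∧ ∃ B : Fin (n + 1) → Fin (n + 1) → ℝ, ∀ i j,
      A i j = k0 * (if i = j then 1 else 0) + ∑ k, B k i * B k j := by
  have hH := hA.1
  obtain ⟨i0, -, hi0⟩ := Finset.exists_min_image Finset.univ hH.eigenvalues ⟨0, Finset.mem_univ _⟩
  set k0 := hH.eigenvalues i0 with hk0
  set U : Matrix (Fin (n + 1)) (Fin (n + 1)) ℝ := (hH.eigenvectorUnitary).1 with hU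
  have e1 : ∀ i j, A i j = ∑ k, U i k * hH.eigenvalues k * U j k := by
    intro i j
    have := hH.spectral_theorem
    rw [Unitary.conjStarAlgAut_apply] at this
    have h2 := congrFun (congrFun this i) j
    rw [h2, Matrix.mul_apply]
    refine Finset.sum_congr rfl fun k _ => ?_
    rw [Matrix.mul_diagonal]
    simp [hU, Matrix.star_apply]
  have e2 : ∀ i j, (if i = j then (1 : ℝ) else 0) = ∑ k, U i k * U j k := by
    intro i j
    have := (Unitary.mul_star_self hH.eigenvectorUnitary)
    have h1 : U * star U = 1 := by
      have := congrArg Subtype.val this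
      simpa [hU] using this
    have h2 := congrFun (congrFun h1 i) j
    rw [Matrix.mul_apply, Matrix.one_apply] at h2
    rw [← h2]
    simp [Matrix.star_apply]
  refine ⟨k0, hA.eigenvalues_pos i0, fun k i => √(hH.eigenvalues k - k0) * U i k, fun i j => ?_⟩
  rw [e1, e2, Finset.mul_sum, ← Finset.sum_add_distrib]
  refine Finset.sum_congr rfl fun k _ => ?_
  have := Real.mul_self_sqrt (sub_nonneg.2 (hi0 k (Finset.mem_univ k)))
  calc _ = (k0 + (hH.eigenvalues k - k0)) * (U i k * U j k) := by ring
    _ = (k0 + √(hH.eigenvalues k - k0) * √(hH.eigenvalues k - k0)) * (U i k * U j k) := by rw [this]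
    _ = _ := by ring

lemma bvec_cast (i : Fin N) : (bvec (Fin.castSucc i) : Pt N) = ex i := by simp [bvec]

lemma bvec_last : (bvec (Fin.last N) : Pt N) = ey := by simp [bvec]

lemma bvec_snd (i : Fin (N + 1)) : (bvec i : Pt N).2 = if i = Fin.last N then 1 else 0 := by
  induction i using Fin.lastCases with
  | last => simp [bvec_last, ey]
  | cast i => simp [bvec_cast, ex, Fin.castSucc_ne_last]

lemma decomp {A : Matrix (Fin (N + 1)) (Fin (N + 1)) ℝ} (hA : A.PosDef) :
    ∃ ρ : ℝ, 0 < ρ ∧ ∃ σ : Option (Fin (N + 1)) → Pt N, σ none = ρ • ey ∧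
      ∑ k, (σ k).2 ^ 2 = A (Fin.last N) (Fin.last N) ∧
      ∀ φ : Pt N → ℝ, ContDiff ℝ (⊤ : ℕ∞) φ → ∀ z, op (Sum.elim (sx ρ) σ) φ z = trHess A φ z := by
  obtain ⟨k0, hk, B, hB⟩ := posdef_split hA
  have hs : √k0 ^ 2 = k0 := Real.sq_sqrt hk.le
  refine ⟨√k0, by positivity, fun o => o.elim (√k0 • ey) fun k => ∑ i, B k i • bvec i, rfl, ?_, ?_⟩
  · rw [Fintype.sum_option, hB]
    congr 1
    · simp [ey, hs]
    · refine Finset.sum_congr rfl fun k _ => ?_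
      have : (∑ i, B k i • (bvec i : Pt N)).2 = B k (Fin.last N) := by
        rw [Prod.snd_sum]
        simp [bvec_snd]
      simp only [Option.elim]
      rw [this, sq]
  · intro φ hφ z
    have dd : ∀ v, Differentiable ℝ (pd v φ) := fun v => (pd_contDiff hφ v).differentiable (by simp)
    have sm : ∀ (c : ℝ) (w : Pt N), pd (c • w) (pd (c • w) φ) z = c ^ 2 * pd w (pd w φ) z := by
      intro c w
      rw [pd_smul_dir c w φ, pd_const_mul c (dd w), pd_smul_dir]
      ring
    have sg : ∀ k, pd (∑ i, B k i • (bvec i : Pt N)) (pd (∑ i, B k i • (bvec i : Pt N)) φ) z =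
        ∑ i, ∑ j, B k i * B k j * pd (bvec i) (pd (bvec j) φ) z := by
      intro k
      have e1 : pd (∑ i, B k i • (bvec i : Pt N)) φ = fun z => ∑ j, B k j * pd (bvec j) φ z := by
        rw [pd_sum_dir]; simp only [pd_smul_dir]
      rw [e1, pd_sum_dir]
      refine Finset.sum_congr rfl fun i _ => ?_
      rw [pd_smul_dir, pd_sum _ fun j => (dd _).const_mul _]
      change B k i * ∑ i_1, pd (bvec i) (fun y => B k i_1 * pd (bvec i_1) φ y) z = _
      rw [Finset.mul_sum]
      refine Finset.sum_congr rfl fun j _ => ?_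
      rw [pd_const_mul _ (dd _)]; ring
    rw [op, Fintype.sum_sum_type, Fintype.sum_option]
    simp only [Sum.elim_inl, Sum.elim_inr, Option.elim, sg, sx, sm, hs]
    have t1 : trHess A φ z = ∑ i, k0 * pd (bvec i) (pd (bvec i) φ) z
        + ∑ k, ∑ i, ∑ j, B k i * B k j * pd (bvec i) (pd (bvec j) φ) z := by
      rw [trHess]
      simp only [hB, add_mul, Finset.sum_add_distrib]
      congr 1
      · refine Finset.sum_congr rfl fun i _ => ?_
        simp
      · simp only [Finset.sum_mul]
        have : ∀ i, ∑ j, ∑ k, B k i * B k j * pd (bvec i) (pd (bvec j) φ) z = ∑ k, ∑ j, B k i * B k j * pd (bvec i) (pd (bvec j) φ) z :=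
          fun i => Finset.sum_comm
        simp only [this]
        rw [Finset.sum_comm]
    have t2 : ∑ i : Fin (N + 1), k0 * pd (bvec i) (pd (bvec i) φ) z =
        ∑ i : Fin N, k0 * pd (ex i) (pd (ex i) φ) z + k0 * pd ey (pd ey φ) z := by
      rw [Fin.sum_univ_castSucc]
      simp only [bvec_cast, bvec_last]
    rw [t1, t2]
    ring

end

section
variable {N : ℕ} {p : ℝ}

lemma pd_pow_mul {a : ℝ} {ψ : Pt N → ℝ} (hψ : Differentiable ℝ ψ) (v : Pt N) {z : Pt N} (hz : 0 < z.2) :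
    pd v (fun z : Pt N => z.2 ^ a * ψ z) z = a * z.2 ^ (a - 1) * v.2 * ψ z + z.2 ^ a * pd v ψ z := by
  have h1 : HasFDerivAt (fun z : Pt N => z.2 ^ a) ((a * z.2 ^ (a - 1)) • ContinuousLinearMap.snd ℝ (Fin N → ℝ) ℝ) z :=
    HasFDerivAt.rpow_const (hasFDerivAt_snd) (Or.inl hz.ne')
  have h2 := h1.mul (hψ z).hasFDerivAt
  have h3 : fderiv ℝ (fun z : Pt N => z.2 ^ a * ψ z) z = _ := h2.fderiv
  rw [pd, h3]
  simp [pd]; ring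

lemma half_open : IsOpen {z : Pt N | 0 < z.2} := isOpen_lt continuous_const continuous_snd

lemma pd_pd_pow_mul {a : ℝ} {φ : Pt N → ℝ} (hφ : ContDiff ℝ (⊤ : ℕ∞) φ) (v w : Pt N) {z : Pt N} (hz : 0 < z.2) :
    pd v (pd w (fun z : Pt N => z.2 ^ a * φ z)) z = z.2 ^ a * pd v (pd w φ) z
      + a * z.2 ^ (a - 1) * (w.2 * pd v φ z + v.2 * pd w φ z) + a * (a - 1) * z.2 ^ (a - 2) * (v.2 * w.2) * φ z := by
  have dφ : Differentiable ℝ φ := hφ.differentiable (by simp)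
  have dw : Differentiable ℝ (pd w φ) := (pd_contDiff hφ w).differentiable (by simp)
  have d1 : Differentiable ℝ fun z => a * w.2 * φ z := dφ.const_mul _
  have ev : pd w (fun z : Pt N => z.2 ^ a * φ z) =ᶠ[nhds z]
      fun z => z.2 ^ (a - 1) * (a * w.2 * φ z) + z.2 ^ a * pd w φ z := by
    filter_upwards [half_open.mem_nhds hz] with y hy
    rw [pd_pow_mul dφ w hy]; ring
  have e1 := pd_pow_mul (a := a - 1) d1 v hz
  have e2 := pd_pow_mul (a := a) dw v hz
  have da : ∀ (a : ℝ) {ψ : Pt N → ℝ}, Differentiable ℝ ψ → DifferentiableAt ℝ (fun z : Pt N => z.2 ^ a * ψ z) z := by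
    intro a ψ hψ
    have h1 : HasFDerivAt (fun z : Pt N => z.2 ^ a) ((a * z.2 ^ (a - 1)) • ContinuousLinearMap.snd ℝ (Fin N → ℝ) ℝ) z :=
      HasFDerivAt.rpow_const (hasFDerivAt_snd) (Or.inl hz.ne')
    exact h1.differentiableAt.mul (hψ z)
  have e3 : pd v (fun z : Pt N => z.2 ^ (a - 1) * (a * w.2 * φ z) + z.2 ^ a * pd w φ z) z =
      pd v (fun z : Pt N => z.2 ^ (a - 1) * (a * w.2 * φ z)) z + pd v (fun z : Pt N => z.2 ^ a * pd w φ z) z := by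
    exact congrArg (fun L => L v) (fderiv_fun_add (da (a - 1) d1) (da a dw))
  have e4 : pd v (pd w (fun z : Pt N => z.2 ^ a * φ z)) z =
      pd v (fun z : Pt N => z.2 ^ (a - 1) * (a * w.2 * φ z) + z.2 ^ a * pd w φ z) z := by
    have := ev.fderiv_eq (𝕜 := ℝ)
    rw [pd, this]; rfl
  rw [e4, e3, e1, e2, pd_const_mul _ dφ]
  have : a - 1 - 1 = a - 2 := by ring
  rw [this]; ring

lemma trHess_u {Q : Matrix (Fin N) (Fin N) ℝ} {q : Fin N → ℝ} {γ a : ℝ} {φ : Pt N → ℝ}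
    (hφ : ContDiff ℝ (⊤ : ℕ∞) φ) {z : Pt N} (hz : 0 < z.2) :
    trHess (blockA Q q γ) (fun z : Pt N => z.2 ^ a * φ z) z = z.2 ^ a * trHess (blockA Q q γ) φ z
      + 2 * a * z.2 ^ (a - 1) * ((∑ i, q i * pd (ex i) φ z) + γ * pd ey φ z) + a * (a - 1) * z.2 ^ (a - 2) * γ * φ z := by
  have bl : ∀ i : Fin N, blockA Q q γ (Fin.castSucc i) (Fin.last N) = q i := fun i => by simp [blockA]
  have lb : ∀ i : Fin N, blockA Q q γ (Fin.last N) (Fin.castSucc i) = q i := fun i => by simp [blockA]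
  have ll : blockA Q q γ (Fin.last N) (Fin.last N) = γ := by simp [blockA]
  set A := blockA Q q γ with hA
  have r1 : ∑ i, ∑ j, A i j * ((bvec j : Pt N).2 * pd (bvec i) φ z) = (∑ i, q i * pd (ex i) φ z) + γ * pd ey φ z := by
    have : ∀ i, ∑ j, A i j * ((bvec j : Pt N).2 * pd (bvec i) φ z) = A i (Fin.last N) * pd (bvec i) φ z := by
      intro i; simp [bvec_snd]
    simp only [this]
    rw [Fin.sum_univ_castSucc]
    simp only [bl, ll, bvec_cast, bvec_last]
  have r2 : ∑ i, ∑ j, A i j * ((bvec i : Pt N).2 * pd (bvec j) φ z) = (∑ i, q i * pd (ex i) φ z) + γ * pd ey φ z := by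
    rw [Finset.sum_comm]
    have : ∀ j, ∑ i, A i j * ((bvec i : Pt N).2 * pd (bvec j) φ z) = A (Fin.last N) j * pd (bvec j) φ z := by
      intro i; simp [bvec_snd]
    simp only [this]
    rw [Fin.sum_univ_castSucc]
    simp only [lb, ll, bvec_cast, bvec_last]
  have r3 : ∑ i, ∑ j, A i j * ((bvec i : Pt N).2 * (bvec j : Pt N).2) = γ := by
    simp [bvec_snd, ll]
  have e : ∀ i j, A i j * pd (bvec i) (pd (bvec j) fun z : Pt N => z.2 ^ a * φ z) z =
      z.2 ^ a * (A i j * pd (bvec i) (pd (bvec j) φ) z) + a * z.2 ^ (a - 1) * (A i j * ((bvec j : Pt N).2 * pd (bvec i) φ z))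
      + a * z.2 ^ (a - 1) * (A i j * ((bvec i : Pt N).2 * pd (bvec j) φ z))
      + a * (a - 1) * z.2 ^ (a - 2) * φ z * (A i j * ((bvec i : Pt N).2 * (bvec j : Pt N).2)) := by
    intro i j
    rw [pd_pd_pow_mul hφ _ _ hz]; ring
  rw [trHess, trHess]
  simp only [e, Finset.sum_add_distrib, ← Finset.mul_sum]
  rw [r1, r2, r3]; ring

lemma Lu_eq {Q : Matrix (Fin N) (Fin N) ℝ} {q d : Fin N → ℝ} {γ c b s α : ℝ} {φ : Pt N → ℝ}
    (hs : s * (s + 1) * γ - c * s - b = 0)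
    (hφ : ContDiff ℝ (⊤ : ℕ∞) φ) {z : Pt N} (hz : 0 < z.2) :
    z.2 ^ α * trHess (blockA Q q γ) (fun z : Pt N => z.2 ^ (-s) * φ z) z
      + z.2 ^ (α - 1) * ((∑ i, d i * pd (ex i) (fun z : Pt N => z.2 ^ (-s) * φ z) z) + c * pd ey (fun z : Pt N => z.2 ^ (-s) * φ z) z)
      - b * z.2 ^ (α - 2) * (z.2 ^ (-s) * φ z) =
    z.2 ^ (α - s) * (trHess (blockA Q q γ) φ z + z.2⁻¹ *
      ((∑ i, (d i - 2 * s * q i) * pd (ex i) φ z) + (c - 2 * s * γ) * pd ey φ z)) := by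
  have dφ : Differentiable ℝ φ := hφ.differentiable (by simp)
  rw [trHess_u hφ hz, pd_pow_mul dφ _ hz]
  have e : ∀ i, pd (ex i) (fun z : Pt N => z.2 ^ (-s) * φ z) z = z.2 ^ (-s) * pd (ex i) φ z := by
    intro i
    rw [pd_pow_mul dφ _ hz]; simp [ex]
  have e2 : (ey : Pt N).2 = 1 := rfl
  have f1 : ∀ i, d i * (z.2 ^ (-s) * pd (ex i) φ z) = z.2 ^ (-s) * (d i * pd (ex i) φ z) := fun i => by ring
  have f2 : ∑ i, (d i - 2 * s * q i) * pd (ex i) φ z = ∑ i, d i * pd (ex i) φ z - 2 * s * ∑ i, q i * pd (ex i) φ z := by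
    rw [Finset.mul_sum, ← Finset.sum_sub_distrib]
    exact Finset.sum_congr rfl fun i _ => by ring
  simp only [e, e2, f1, ← Finset.mul_sum, f2]
  have p1 : z.2 ^ (α - 1) = z.2 ^ α * z.2⁻¹ := by rw [Real.rpow_sub hz, Real.rpow_one]; rfl
  have p2 : z.2 ^ (α - 2) = z.2 ^ α * (z.2⁻¹ * z.2⁻¹) := by
    rw [Real.rpow_sub hz, Real.rpow_two]; field_simp
  have p3 : z.2 ^ (-s - 1) = z.2 ^ (-s) * z.2⁻¹ := by rw [Real.rpow_sub hz, Real.rpow_one]; rfl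
  have p4 : z.2 ^ (-s - 2) = z.2 ^ (-s) * (z.2⁻¹ * z.2⁻¹) := by
    rw [Real.rpow_sub hz, Real.rpow_two]; field_simp
  have p5 : z.2 ^ (α - s) = z.2 ^ α * z.2 ^ (-s) := by rw [sub_eq_add_neg, Real.rpow_add hz]
  rw [p1, p2, p3, p4, p5]
  linear_combination (z.2 ^ α * z.2 ^ (-s) * (z.2⁻¹ * z.2⁻¹) * φ z) * hs

lemma vec_pd (d : Fin N → ℝ) (c : ℝ) (φ : Pt N → ℝ) (z : Pt N) :
    pd ((d, c) : Pt N) φ z = (∑ i, d i * pd (ex i) φ z) + c * pd ey φ z := by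
  have : ((d, c) : Pt N) = (∑ i, d i • (ex i : Pt N)) + c • ey := by
    refine Prod.ext ?_ ?_
    · funext k
      simp [ex, ey, Prod.fst_sum, Finset.sum_apply, Pi.single_apply]
    · simp [ex, ey, Prod.snd_sum]
  rw [this, pd_add_dir, pd_sum_dir, pd_smul_dir]
  simp only [pd_smul_dir]

lemma Wn_const_mul (hp : 1 < p) (μ c : ℝ) {G : Pt N → ℝ} (hG : Continuous G) :
    Wn p μ (fun z => c * G z) = ENNReal.ofReal |c| ^ p * Wn p μ G := by
  have hp0 : 0 < p := by linarith
  have ms := sl_meas hp hG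
  rw [Wn, Wn, ← lintegral_const_mul _ (by fun_prop)]
  refine lintegral_congr fun y => ?_
  have : sl p (fun z => c * G z) y = ENNReal.ofReal |c| * sl p G y := by
    have := eLpNorm_const_smul c (fun x => G (x, y)) (ENNReal.ofReal p) volume
    rw [← Real.norm_eq_abs, ofReal_norm]
    exact this
  rw [this, ENNReal.mul_rpow_of_nonneg _ _ hp0.le, mul_assoc]

lemma LpmW (hp : 1 < p) {m e : ℝ} {F G : Pt N → ℝ} (hG : Continuous G) (h : ∀ z : Pt N, 0 < z.2 → F z = z.2 ^ e * G z) :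
    LpmNorm N p m F = (Wn p (m + e * p) G).toReal ^ (1 / p) := by
  have hp0 : 0 < p := by linarith
  have hS : MeasurableSet {z : Pt N | 0 < z.2} := half_open.measurableSet
  rw [LpmNorm]
  congr 1
  have e1 : ∫ z in {z : Pt N | 0 < z.2}, |F z| ^ p * z.2 ^ m =
      ∫ z in {z : Pt N | 0 < z.2}, |G z| ^ p * z.2 ^ (m + e * p) := by
    refine setIntegral_congr_fun hS fun z hz => ?_
    have hz' : 0 < z.2 := hz
    rw [h z hz, abs_mul, abs_of_pos (by positivity), Real.mul_rpow (by positivity) (abs_nonneg _), ← Real.rpow_mul hz'.le,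
      Real.rpow_add hz']
    ring
  have mG : Measurable fun z : Pt N => |G z| ^ p * z.2 ^ (m + e * p) := by
    have := hG.measurable
    fun_prop
  rw [e1, integral_eq_lintegral_of_nonneg_ae ?_ mG.aestronglyMeasurable]
  · congr 1
    have e2 : ∫⁻ z in {z : Pt N | 0 < z.2}, ENNReal.ofReal (|G z| ^ p * z.2 ^ (m + e * p)) =
        ∫⁻ z in {z : Pt N | 0 < z.2}, ‖G z‖ₑ ^ p * ENNReal.ofReal (z.2 ^ (m + e * p)) := by
      refine setLIntegral_congr_fun hS fun z hz => ?_
      rw [ENNReal.ofReal_mul (by positivity), ← ENNReal.ofReal_rpow_of_nonneg (abs_nonneg _) hp0.le, ← Real.norm_eq_abs, ofReal_norm]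
    have mm : Measurable fun z : Pt N => ‖G z‖ₑ ^ p * ENNReal.ofReal (z.2 ^ (m + e * p)) := by
      have := hG.measurable
      fun_prop
    have e3 : {z : Pt N | 0 < z.2} = Set.univ ×ˢ Set.Ioi (0 : ℝ) := by ext z; simp
    rw [e2, e3, Measure.volume_eq_prod, ← Measure.prod_restrict, Measure.restrict_univ, lintegral_prod_symm _ mm.aemeasurable, Wn]
    refine lintegral_congr fun y => ?_
    have mx : Measurable fun x => G (x, y) := by have := hG.measurable; fun_prop
    change ∫⁻ x, ‖G (x, y)‖ₑ ^ p * ENNReal.ofReal (y ^ (m + e * p)) = _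
    rw [lintegral_mul_const _ (mx.enorm.pow_const p), sl, eLp_rpow _ hp0]
  · refine (ae_restrict_mem hS).mono fun z hz => ?_
    have hz' : 0 < z.2 := hz
    simp only [Pi.zero_apply]; positivity

end

section
variable {N : ℕ} {p : ℝ}

lemma exists_src {κ : Type} [Fintype κ] [DecidableEq κ] (s : κ → Pt N) (w : Pt N) {φ : Pt N → ℝ} (sφ : ContDiff ℝ (⊤ : ℕ∞) φ)
    (cφ : HasCompactSupport φ) {δ : ℝ} (hδ : 0 < δ) (h0 : ∀ z : Pt N, 0 ≤ z.2 → z.2 ≤ δ → pd w φ z = 0) :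
    ∃ f, Eqn s w φ f := by
  set η : ℝ → ℝ := fun t => Real.smoothTransition ((t - δ / 2) / (δ / 2)) with hη
  have sη : ContDiff ℝ (⊤ : ℕ∞) η := by
    refine Real.smoothTransition.contDiff.comp ?_
    fun_prop
  have zη : ∀ t < δ / 2, η t = 0 := fun t ht => by
    apply Real.smoothTransition.zero_of_nonpos
    exact div_nonpos_of_nonpos_of_nonneg (by linarith) (by linarith)
  have sχ : ContDiff ℝ (⊤ : ℕ∞) fun t => η t * t⁻¹ := smooth_mul_half sη (by linarith) zη
    (contDiffOn_id.inv fun t ht => (Set.mem_Ioi.1 ht).ne')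
  have sw := pd_contDiff sφ w
  have cw : HasCompactSupport (pd w φ) := pd_hcs cφ w
  have so : ContDiff ℝ (⊤ : ℕ∞) (op s φ) := by
    unfold op
    exact ContDiff.sum fun k _ => pd_contDiff (pd_contDiff sφ _) _
  have hsupp : ∀ z ∉ tsupport φ, op s φ z = 0 := by
    intro z hz
    unfold op
    refine Finset.sum_eq_zero fun k _ => ?_
    have e1 : φ =ᶠ[nhds z] 0 := by
      exact notMem_tsupport_iff_eventuallyEq.1 hz
    have e2 : pd (s k) φ =ᶠ[nhds z] 0 := by
      filter_upwards [e1.fderiv (𝕜 := ℝ)] with y hy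
      rw [pd, hy]; simp
    rw [pd, e2.fderiv_eq]; simp
  have co : HasCompactSupport (op s φ) := HasCompactSupport.intro cφ hsupp
  refine ⟨fun z => op s φ z + (η z.2 * z.2⁻¹) * pd w φ z, sφ, cφ, ?_, ?_, ?_⟩
  · exact so.add ((sχ.comp contDiff_snd).mul sw)
  · exact co.add (cw.mul_left (f := fun z : Pt N => η z.2 * z.2⁻¹))
  · intro z hz
    by_cases h : z.2 ≤ δ
    · simp [h0 z hz.le h]
    · have : η z.2 = 1 := by
        apply Real.smoothTransition.one_of_one_le
        rw [le_div_iff₀ (by linarith)]; linarith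
      simp [this]

end

/-- Elliptic estimate `∑_{i,j} ‖y^α ∂²u/∂x_i∂x_j‖ ≤ C ‖ℒu‖` for
`ℒu = y^α Tr(A D²u) + y^{α-1} v·∇u − b y^{α-2} u` on functions of the form
`u = y^{−s₁} φ` with `φ ∈ 𝒞_w`, `w = v − 2 s₁ (q, γ)`. -/
theorem statement3 (N : ℕ) (hN : 1 ≤ N) (p m α : ℝ) (hp : 1 < p) (hα : α < 2)
    (Q : Matrix (Fin N) (Fin N) ℝ) (q : Fin N → ℝ) (γ : ℝ) (hγ : 0 < γ)
    (hsym : (blockA Q q γ).IsSymm) (hposdef : (blockA Q q γ).PosDef)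
    (d : Fin N → ℝ) (c b : ℝ)
    (D s₁ s₂ : ℝ) (hD : D = b / γ + ((c / γ - 1) / 2) ^ 2) (hDpos : 0 ≤ D)
    (hs₁ : s₁ = (c / γ - 1) / 2 - Real.sqrt D) (hs₂ : s₂ = (c / γ - 1) / 2 + Real.sqrt D)
    (h1 : s₁ + max (-α) 0 < (m + 1) / p) (h2 : (m + 1) / p < s₂ + 2 - α) :
    ∃ C > 0, ∀ φ : Pt N → ℝ, ContDiff ℝ (⊤ : ℕ∞) φ → HasCompactSupport φ →
      (∃ δ > 0, ∀ z : Pt N, 0 ≤ z.2 → z.2 ≤ δ →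
        (∑ i, (d i - 2 * s₁ * q i) * pd (ex i) φ z) + (c - 2 * s₁ * γ) * pd ey φ z = 0) →
      ∀ u : Pt N → ℝ, u = (fun z : Pt N => z.2 ^ (-s₁) * φ z) →
      (∑ i, ∑ j, LpmNorm N p m fun z => z.2 ^ α * pd (ex i) (pd (ex j) u) z)
      ≤ C * LpmNorm N p m fun z =>
          z.2 ^ α * trHess (blockA Q q γ) u z
            + z.2 ^ (α - 1) * ((∑ i, d i * pd (ex i) u z) + c * pd ey u z)
            - b * z.2 ^ (α - 2) * u z := by
  have hp0 : 0 < p := by linarith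
  obtain ⟨ρ, hρ, σ, hσ0, hσ, hop⟩ := decomp hposdef
  have ll : blockA Q q γ (Fin.last N) (Fin.last N) = γ := by simp [blockA]
  rw [ll] at hσ
  set w : Pt N := (fun i => d i - 2 * s₁ * q i, c - 2 * s₁ * γ) with hw
  have hS : Setup (Sum.elim (sx ρ) σ) ρ Sum.inl (Sum.inr none) := ⟨hρ, fun _ => rfl, hσ0⟩
  have sD0 := Real.sqrt_nonneg D
  have sD := Real.sq_sqrt hDpos
  set t := Real.sqrt D with ht
  have hr : 0 < 1 + 2 * t := by linarith
  have hv : w.2 = γ * (1 + 2 * t) := by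
    simp only [hw, hs₁]; field_simp; ring
  have hquad : s₁ * (s₁ + 1) * γ - c * s₁ - b = 0 := by
    have : b = γ * (t ^ 2 - ((c / γ - 1) / 2) ^ 2) := by rw [sD, hD]; field_simp; ring
    rw [this, hs₁]; field_simp; ring
  have hμe : (m + (α - s₁) * p + 1) / p = (m + 1) / p + α - s₁ := by field_simp; ring
  have hmax := le_max_left (-α) 0
  have hμ : 0 < m + (α - s₁) * p + 1 := by
    have : 0 < (m + (α - s₁) * p + 1) / p := by rw [hμe]; linarith
    exact (div_pos_iff_of_pos_right hp0).1 this
  have hθ : (m + (α - s₁) * p + 1) / p < 1 + 2 * t + 1 := by rw [hμe]; linarith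
  obtain ⟨C, hC, H⟩ := mainW hp ρ σ none hS w hγ hσ hr hv hμ hθ
  set μ := m + (α - s₁) * p with hμd
  set K := ENNReal.ofReal |(ρ ^ 2)⁻¹| ^ p * C with hK
  have hKt : K ≠ ⊤ := ENNReal.mul_ne_top (ENNReal.rpow_ne_top_of_nonneg hp0.le ENNReal.ofReal_ne_top) hC
  have K0 : 0 ≤ K.toReal ^ (1 / p) := by positivity
  refine ⟨N * N * K.toReal ^ (1 / p) + 1, by positivity, ?_⟩
  rintro φ sφ cφ ⟨δ, hδ, h0⟩ u rfl
  have h0' : ∀ z : Pt N, 0 ≤ z.2 → z.2 ≤ δ → pd w φ z = 0 := fun z a b => by rw [hw, vec_pd]; exact h0 z a b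
  obtain ⟨f, hf⟩ := exists_src (Sum.elim (sx ρ) σ) w sφ cφ hδ h0'
  have hR := LpmW (N := N) hp (m := m) (e := α - s₁) (F := fun z =>
          z.2 ^ α * trHess (blockA Q q γ) (fun z : Pt N => z.2 ^ (-s₁) * φ z) z
            + z.2 ^ (α - 1) * ((∑ i, d i * pd (ex i) (fun z : Pt N => z.2 ^ (-s₁) * φ z) z) + c * pd ey (fun z : Pt N => z.2 ^ (-s₁) * φ z) z)
            - b * z.2 ^ (α - 2) * (z.2 ^ (-s₁) * φ z)) hf.sf.continuous (fun z hz => by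
      rw [hf.eq z hz, hop φ sφ, hw, vec_pd (fun i => d i - 2 * s₁ * q i) (c - 2 * s₁ * γ)]
      exact Lu_eq hquad sφ hz)
  have fin := Wn_fin hp hμ hf.sf.continuous hf.cf
  rw [hR, ← hμd]
  set R := (Wn p μ f).toReal ^ (1 / p) with hRd
  have R0 : 0 ≤ R := by positivity
  have hL : ∀ i j : Fin N, LpmNorm N p m (fun z => z.2 ^ α * pd (ex i) (pd (ex j) fun z : Pt N => z.2 ^ (-s₁) * φ z) z)
      ≤ K.toReal ^ (1 / p) * R := by
    intro i j
    have sω : ContDiff ℝ (⊤ : ℕ∞) (pd (sx ρ i) (pd (sx ρ j) φ)) := pd_contDiff (pd_contDiff sφ _) _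
    have dj : Differentiable ℝ (pd (ex j) φ) := (pd_contDiff sφ _).differentiable (by simp)
    have hω : pd (sx ρ i) (pd (sx ρ j) φ) = fun z => ρ * (ρ * pd (ex i) (pd (ex j) φ) z) := by
      rw [sx, sx, pd_smul_dir, pd_smul_dir, pd_const_mul _ dj]
    rw [LpmW (N := N) hp (m := m) (e := α - s₁) (G := fun z => (ρ ^ 2)⁻¹ * pd (sx ρ i) (pd (sx ρ j) φ) z)
      (continuous_const.mul sω.continuous) ?_, ← hμd, Wn_const_mul hp _ _ sω.continuous, hRd,
      ← Real.mul_rpow ENNReal.toReal_nonneg ENNReal.toReal_nonneg, ← ENNReal.toReal_mul]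
    · refine Real.rpow_le_rpow ENNReal.toReal_nonneg (ENNReal.toReal_mono (ENNReal.mul_ne_top hKt fin) ?_) (by positivity)
      rw [hK, mul_assoc]
      gcongr
      exact H φ f δ hf hδ h0' i j
    · intro z hz
      rw [pd_pd_pow_mul sφ _ _ hz, hω, sub_eq_add_neg α s₁, Real.rpow_add hz]
      have x0 : ∀ i : Fin N, (ex i : Pt N).2 = 0 := fun _ => rfl
      have hX : ∀ X : ℝ, (ρ ^ 2)⁻¹ * (ρ * (ρ * X)) = X := fun X => by field_simp
      simp only [x0, hX]
      ring
  calc _ ≤ ∑ i : Fin N, ∑ j : Fin N, K.toReal ^ (1 / p) * R := Finset.sum_le_sum fun i _ => Finset.sum_le_sum fun j _ => hL i j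
    _ = N * N * K.toReal ^ (1 / p) * R := by simp; ring
    _ ≤ _ := by nlinarith
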